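/- Let A be a subset of the prime numbers whose lower density in the primes satisfies δ̲(A) > 5/8. Then there exists N₀ such that every odd positive integer N ≥ N₀ can be written as N = a₁ + a₂ + a₃ with a₁, a₂, a₃ ∈ A. -/

import Mathlib

/-- The lower density of a set `A` of natural numbers in the primes:
`liminf_{N → ∞} |A ∩ [1,N]| / |P ∩ [1,N]|`. -/
noncomputable def lowerDensityInPrimes (A : Set ℕ) : ℝ :=
  Filter.liminf
    (fun N : ℕ => ((A ∩ Set.Icc 1 N).ncard : ℝ) / (({p : ℕ | p.Prime} ∩ Set.Icc 1 N).ncard : ℝ))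
    Filter.atTop

section
lemma loc_pos {X Y Z : ℝ} (hX : X ≤ 11/5) (hX1 : -1 ≤ X) (hY1 : -1 ≤ Y) (hZ1 : -1 ≤ Z)
    (h : 3 < X*Y+Y*Z+Z*X) : 6/5 < Y + Z := by
  by_contra hc
  push Not at hc
  rcases le_or_gt 0 (Y+Z) with h0 | h0
  · nlinarith [sq_nonneg (Y-Z), mul_nonneg (sub_nonneg.2 hX) h0, mul_nonneg h0 (sub_nonneg.2 hc)]
  · nlinarith [mul_nonneg (by linarith : 0 ≤ X+1) (by linarith : 0 ≤ -(Y+Z)), mul_nonneg (by linarith : 0 ≤ 1+Y) (by linarith : 0 ≤ 1-Z)]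

lemma loc_final {G L q : ℝ} (hG : 0 ≤ G) (hL : 0 ≤ L) (hq : 0 ≤ q) (h1 : 3*G ≤ L+q)
    (h2 : 4*(G+3)*q ≤ L^2) (h3 : G+3+L+q ≤ 363/25) : 39*G-37*L+59*q ≤ 0 := by
  rcases le_or_gt (3*q) L with h | h
  · linarith
  · obtain ⟨V, hV, rfl⟩ : ∃ V : ℝ, 0 ≤ V ∧ G = V^2-3 := ⟨√(G+3), Real.sqrt_nonneg _, by rw [Real.sq_sqrt (by linarith)]; ring⟩
    obtain ⟨k, hk, rfl⟩ : ∃ k : ℝ, 0 ≤ k ∧ q = k^2 := ⟨√q, Real.sqrt_nonneg _, by rw [Real.sq_sqrt hq]⟩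
    have hL2 : 2*V*k ≤ L := by apply abs_le_of_sq_le_sq' _ hL |>.2; nlinarith
    have hk1 : 2*V < 3*k := by nlinarith
    have hs : V + k ≤ 3.811 := by nlinarith
    have hV1 : 1.732 ≤ V := by nlinarith
    have hV2 : V ≤ 2.287 := by linarith
    have : 39*(V^2-3)-74*V*k+59*k^2 ≤ 0 := by
      nlinarith [mul_nonneg (by linarith : 0 ≤ 3*k-2*V) (by linarith : 0 ≤ 3.811-V-k), mul_nonneg (by linarith : 0 ≤ V-1.732) (by linarith : 0 ≤ 2.287-V),mul_nonneg (by linarith : 0 ≤ V-1.732) (by linarith : 0 ≤ 3.811-V-k)]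
    linarith

lemma loc_cs {X Y Z h i j : ℝ} (hs : 0 < Y+Z) (hQ : 0 ≤ X*Y+Y*Z+Z*X) :
    4*(X*Y+Y*Z+Z*X)*(h*i+i*j+j*h) ≤ (h*(Y+Z)+i*(X+Z)+j*(X+Y))^2 := by
  have : 0 ≤ (Y+Z)^2*((h*(Y+Z)+i*(X+Z)+j*(X+Y))^2-4*(X*Y+Y*Z+Z*X)*(h*i+i*j+j*h)) := by
    have := add_nonneg (sq_nonneg ((Y+Z)*(h*(Y+Z)+i*(X+Z)+j*(X+Y))-2*(i+j)*(X*Y+Y*Z+Z*X)))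
      (mul_nonneg hQ (sq_nonneg (2*(j*Y-i*Z))))
    linarith
  linarith [nonneg_of_mul_nonneg_right this (by positivity)]

lemma loc_core {a p u b q v c r w : ℝ} (hu : -1 ≤ u) (hv : -1 ≤ v) (hw : -1 ≤ w)
    (hup : u ≤ p) (hvq : v ≤ q) (hwr : w ≤ r) (hpa : p ≤ a) (hqb : q ≤ b) (hrc : r ≤ c)
    (ha : a ≤ 11/5) (hb : b ≤ 11/5) (hc : c ≤ 11/5)
    (hG : 3 < (a+u)/2*((b+v)/2)+(b+v)/2*((c+w)/2)+(c+w)/2*((a+u)/2))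
    (h1 : a*q+q*r+r*a ≤ 3) (h2 : p*b+b*r+r*p ≤ 3) (h3 : p*q+q*c+c*p ≤ 3) :
    (a*b+b*r+r*a-3)+(a*q+q*c+c*a-3)+(p*b+b*c+c*p-3)+9*(u*v+v*w+w*u-3) ≤ 0 := by
  obtain ⟨X, hX⟩ : ∃ X, X = (a+u)/2 := ⟨_, rfl⟩
  obtain ⟨Y, hY⟩ : ∃ X, X = (b+v)/2 := ⟨_, rfl⟩
  obtain ⟨Z, hZ⟩ : ∃ X, X = (c+w)/2 := ⟨_, rfl⟩
  obtain ⟨h, hh⟩ : ∃ X, X = (a-u)/2 := ⟨_, rfl⟩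
  obtain ⟨i, hi⟩ : ∃ X, X = (b-v)/2 := ⟨_, rfl⟩
  obtain ⟨j, hj⟩ : ∃ X, X = (c-w)/2 := ⟨_, rfl⟩
  rw [← hX, ← hY, ← hZ] at hG
  have hYZ := loc_pos (by linarith : X ≤ 11/5) (by linarith) (by linarith : -1 ≤ Y) (by linarith : -1 ≤ Z) hG
  have hXZ := loc_pos (by linarith : Y ≤ 11/5) (by linarith) (by linarith : -1 ≤ X) (by linarith : -1 ≤ Z) (by linarith)
  have hXY := loc_pos (by linarith : Z ≤ 11/5) (by linarith) (by linarith : -1 ≤ X) (by linarith : -1 ≤ Y) (by linarith)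
  have h0 : 0 ≤ h := by linarith
  have i0 : 0 ≤ i := by linarith
  have j0 : 0 ≤ j := by linarith
  obtain rfl : a = X + h := by linarith
  obtain rfl : u = X - h := by linarith
  obtain rfl : b = Y + i := by linarith
  obtain rfl : v = Y - i := by linarith
  obtain rfl : c = Z + j := by linarith
  obtain rfl : w = Z - j := by linarith
  obtain ⟨e, rfl⟩ : ∃ e, p = X - h + e := ⟨p - (X-h), by ring⟩
  obtain ⟨f, rfl⟩ : ∃ e, q = Y - i + e := ⟨q - (Y-i), by ring⟩
  obtain ⟨g, rfl⟩ : ∃ e, r = Z - j + e := ⟨r - (Z-j), by ring⟩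
  have he : 0 ≤ e := by linarith
  have hf : 0 ≤ f := by linarith
  have hg : 0 ≤ g := by linarith
  have L0 : 0 ≤ h*(Y+Z)+i*(X+Z)+j*(X+Y) := by
    have := mul_nonneg h0 (by linarith : 0 ≤ Y+Z)
    have := mul_nonneg i0 (by linarith : 0 ≤ X+Z)
    have := mul_nonneg j0 (by linarith : 0 ≤ X+Y)
    linarith
  have q0 : 0 ≤ h*i+i*j+j*h := by positivity
  have key := loc_final (G := X*Y+Y*Z+Z*X-3) (L := h*(Y+Z)+i*(X+Z)+j*(X+Y)) (q := h*i+i*j+j*h)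
    (by linarith) L0 q0 (by linarith [mul_nonneg he hf, mul_nonneg hf hg, mul_nonneg hg he, mul_nonneg he (by linarith : 0 ≤ Y+Z), mul_nonneg hf (by linarith : 0 ≤ X+Z), mul_nonneg hg (by linarith : 0 ≤ X+Y)])
    (by have := @loc_cs X Y Z h i j (by linarith) (by linarith); linarith)
    (by linarith [mul_nonneg (sub_nonneg.2 ha) (by linarith : 0 ≤ Y+i+(Z+j)), mul_nonneg (sub_nonneg.2 hb) (by linarith : 0 ≤ 11/5+(Z+j))])
  linarith [mul_nonneg he hf, mul_nonneg hf hg, mul_nonneg hg he, mul_nonneg he (by linarith : 0 ≤ 11/3*(Y+Z)-(Y+i+(Z+j))), mul_nonneg hf (by linarith : 0 ≤ 11/3*(X+Z)-(X+h+(Z+j))), mul_nonneg hg (by linarith : 0 ≤ 11/3*(X+Y)-(X+h+(Y+i)))]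
end

section
open Finset

lemma zmod_sum_val (m : ℕ) [NeZero m] (f : ℕ → ℝ) : ∑ i : ZMod m, f i.val = ∑ i ∈ range m, f i := by
  obtain ⟨k, rfl⟩ := Nat.exists_eq_succ_of_ne_zero (NeZero.ne m)
  exact Fin.sum_univ_eq_sum_range f (k+1)

lemma loc_lat (m : ℕ) [NeZero m] (s t r : ZMod m → ℝ)
    (h : ∀ i j, ¬(i = 0 ∧ j = 0) → s i * t j + t j * r (-i-j) + r (-i-j) * s i ≤ 3) :
    (∑ i, s i)*(∑ i, t i)+(∑ i, t i)*(∑ i, r i)+(∑ i, r i)*(∑ i, s i) - 3*(m:ℝ)^2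
      ≤ s 0 * t 0 + t 0 * r 0 + r 0 * s 0 - 3 := by
  have e1 : ∀ i, ∑ j, r (-i-j) = ∑ j, r j := fun i =>
    Fintype.sum_equiv (Equiv.subLeft (-i)) _ _ (fun _ => rfl)
  have e2 : ∀ j, ∑ i, r (-i-j) = ∑ j, r j := fun j =>
    Fintype.sum_equiv ((Equiv.neg _).trans (Equiv.subRight j)) _ _ (fun _ => rfl)
  have e : ∑ i, ∑ j, (s i * t j + t j * r (-i-j) + r (-i-j) * s i - 3) =
      (∑ i, s i)*(∑ i, t i)+(∑ i, t i)*(∑ i, r i)+(∑ i, r i)*(∑ i, s i) - 3*(m:ℝ)^2 := by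
    simp only [sum_add_distrib, sum_sub_distrib]
    congr 1
    · congr 1
      · congr 1
        · rw [sum_mul_sum]
        · rw [sum_comm]; simp_rw [← mul_sum, e2, sum_mul]
      · simp_rw [← sum_mul, e1, mul_sum]
    · simp [ZMod.card]; ring
  rw [← e, ← Fintype.sum_prod_type', ← add_sum_erase _ _ (mem_univ ((0 : ZMod m), (0 : ZMod m)))]
  have : ∑ x ∈ univ.erase ((0 : ZMod m), (0 : ZMod m)),
      (s x.1 * t x.2 + t x.2 * r (-x.1-x.2) + r (-x.1-x.2) * s x.1 - 3) ≤ 0 := by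
    apply sum_nonpos
    intro x hx
    have := h x.1 x.2 (fun h => (mem_erase.1 hx).1 (Prod.ext h.1 h.2))
    linarith
  simp only [neg_zero, sub_zero]
  linarith

lemma loc_latN (m : ℕ) (hm : 0 < m) (s t r : ℕ → ℝ)
    (h : ∀ i j k, i < m → j < m → k < m → m ≤ i+j+k → s i * t j + t j * r k + r k * s i ≤ 3) :
    (∑ i ∈ range m, s i)*(∑ i ∈ range m, t i)+(∑ i ∈ range m, t i)*(∑ i ∈ range m, r i)
      +(∑ i ∈ range m, r i)*(∑ i ∈ range m, s i) - 3*(m:ℝ)^2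
      ≤ s 0 * t 0 + t 0 * r 0 + r 0 * s 0 - 3 := by
  haveI : NeZero m := ⟨hm.ne'⟩
  have := loc_lat m (fun i => s i.val) (fun i => t i.val) (fun i => r i.val) (fun i j hij => by
    apply h _ _ _ (ZMod.val_lt _) (ZMod.val_lt _) (ZMod.val_lt _)
    have hd : m ∣ i.val + j.val + (-i-j).val := by
      rw [← ZMod.natCast_eq_zero_iff]; push_cast; simp
    apply Nat.le_of_dvd _ hd
    by_contra hc
    apply hij
    constructor <;> rw [← ZMod.val_eq_zero] <;> omega)
  simpa [zmod_sum_val] using this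

lemma loc_closure (m : ℕ) (hm : 3 ≤ m) (x y z : ℕ → ℝ)
    (ax : ∀ i j, i ≤ j → j < 2*m → x j ≤ x i) (ay : ∀ i j, i ≤ j → j < 2*m → y j ≤ y i)
    (az : ∀ i j, i ≤ j → j < 2*m → z j ≤ z i)
    (bx : ∀ i < 2*m, -1 ≤ x i ∧ x i ≤ 11/5) (by' : ∀ i < 2*m, -1 ≤ y i ∧ y i ≤ 11/5)
    (bz : ∀ i < 2*m, -1 ≤ z i ∧ z i ≤ 11/5)
    (h : ∀ i j k, i < 2*m → j < 2*m → k < 2*m → 2*m ≤ i+j+k → x i * y j + y j * z k + z k * x i ≤ 3)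
    (X Y Z : ℝ) (hX : X = (∑ i ∈ range (2*m), x i)/(2*m)) (hY : Y = (∑ i ∈ range (2*m), y i)/(2*m))
    (hZ : Z = (∑ i ∈ range (2*m), z i)/(2*m)) : X*Y+Y*Z+Z*X ≤ 3 := by
  by_contra hc
  push Not at hc
  have M0 : (3:ℝ) ≤ m := by exact_mod_cast hm
  have MP : (0:ℝ) < m := by linarith
  have aux : ∀ (x : ℕ → ℝ), (∀ i j, i ≤ j → j < 2*m → x j ≤ x i) → (∀ i < 2*m, -1 ≤ x i ∧ x i ≤ 11/5) →
      ∀ X, X = (∑ i ∈ range (2*m), x i)/(2*m) → ∃ S U, X = (S+U)/2 ∧ ∑ i ∈ range m, x i = m*S ∧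
        ∑ i ∈ range m, x (m+i) = m*U ∧ S ≤ x 0 ∧ U ≤ x m ∧ x m ≤ x 0 ∧ -1 ≤ U ∧ -1 ≤ X ∧ x 0 ≤ 11/5 := by
    intro x ax bx X hX
    have hU1 : ∑ i ∈ range m, x (m+i) ≤ ∑ i ∈ range m, x m :=
      sum_le_sum fun i hi => ax _ _ (by omega) (by have := mem_range.1 hi; omega)
    have hS1 : ∑ i ∈ range m, x i ≤ ∑ i ∈ range m, x 0 :=
      sum_le_sum fun i hi => ax _ _ (by omega) (by have := mem_range.1 hi; omega)
    have hU2 : ∑ i ∈ range m, (-1:ℝ) ≤ ∑ i ∈ range m, x (m+i) :=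
      sum_le_sum fun i hi => (bx _ (by have := mem_range.1 hi; omega)).1
    have hS2 : ∑ i ∈ range m, (-1:ℝ) ≤ ∑ i ∈ range m, x i :=
      sum_le_sum fun i hi => (bx _ (by have := mem_range.1 hi; omega)).1
    rw [two_mul, sum_range_add] at hX
    simp only [sum_const, card_range, nsmul_eq_mul] at *
    obtain ⟨S, hS⟩ : ∃ S, ∑ i ∈ range m, x i = m*S := ⟨(∑ i ∈ range m, x i)/m, by field_simp⟩
    obtain ⟨U, hU⟩ : ∃ S, ∑ i ∈ range m, x (m+i) = m*S := ⟨(∑ i ∈ range m, x (m+i))/m, by field_simp⟩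
    have hXX : X = (S+U)/2 := by rw [hX, hS, hU]; field_simp
    rw [hS] at hS1 hS2
    rw [hU] at hU1 hU2
    have := le_of_mul_le_mul_left hS1 MP
    have := le_of_mul_le_mul_left hS2 MP
    have := le_of_mul_le_mul_left hU1 MP
    have := le_of_mul_le_mul_left hU2 MP
    exact ⟨S, U, hXX, hS, hU, by assumption, by assumption, ax _ _ (by omega) (by omega), by assumption, by linarith, (bx 0 (by omega)).2⟩
  obtain ⟨S, U, rfl, hS, hU, hS1, hU1, hm1, hU2, hX1, hx0⟩ := aux x ax bx X hX
  obtain ⟨T, V, rfl, hT, hV, hT1, hV1, hm2, hV2, hY1, hy0⟩ := aux y ay by' Y hY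
  obtain ⟨R, W, rfl, hR, hW, hR1, hW1, hm3, hW2, hZ1, hz0⟩ := aux z az bz Z hZ
  have l1 := loc_latN m (by omega) x y (fun i => z (m+i)) (fun i j k _ _ _ _ => h i j (m+k) (by omega) (by omega) (by omega) (by omega))
  have l2 := loc_latN m (by omega) x (fun i => y (m+i)) z (fun i j k _ _ _ _ => h i (m+j) k (by omega) (by omega) (by omega) (by omega))
  have l3 := loc_latN m (by omega) (fun i => x (m+i)) y z (fun i j k _ _ _ _ => h (m+i) j k (by omega) (by omega) (by omega) (by omega))
  have l4 := loc_latN m (by omega) (fun i => x (m+i)) (fun i => y (m+i)) (fun i => z (m+i)) (fun i j k _ _ _ _ => h (m+i) (m+j) (m+k) (by omega) (by omega) (by omega) (by omega))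
  have l5 := h m m m (by omega) (by omega) (by omega) (by omega)
  simp only [hS, hU, hT, hV, hR, hW, add_zero] at l1 l2 l3 l4
  have g4 : U*V+V*W+W*U-3 ≤ 0 := by
    have : (m:ℝ)^2*(U*V+V*W+W*U-3) ≤ 0 := by linarith
    by_contra hcc
    push Not at hcc
    have := mul_pos (by positivity : (0:ℝ) < (m:ℝ)^2) hcc
    linarith
  have p1 := loc_pos (by linarith : (S+U)/2 ≤ 11/5) hX1 hY1 hZ1 hc
  have p2 := loc_pos (by linarith : (T+V)/2 ≤ 11/5) hY1 hX1 hZ1 (by linarith)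
  have p3 := loc_pos (by linarith : (R+W)/2 ≤ 11/5) hZ1 hX1 hY1 (by linarith)
  have core := loc_core hU2 hV2 hW2 hU1 hV1 hW1 hm1 hm2 hm3 hx0 hy0 hz0
    (by
      have a1 := mul_nonneg (sub_nonneg.2 hS1) (by linarith : 0 ≤ (T+V)/2+(R+W)/2)
      have a2 := mul_nonneg (sub_nonneg.2 hT1) (by linarith : 0 ≤ (x 0+U)/2+(R+W)/2)
      have a3 := mul_nonneg (sub_nonneg.2 hR1) (by linarith : 0 ≤ (x 0+U)/2+(y 0+V)/2)
      linarith)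
    (h 0 m m (by omega) (by omega) (by omega) (by omega)) (h m 0 m (by omega) (by omega) (by omega) (by omega))
    (h m m 0 (by omega) (by omega) (by omega) (by omega))
  have m9 : (9:ℝ) ≤ (m:ℝ)^2 := by nlinarith
  have f1 := mul_nonneg (sub_nonneg.2 m9) (neg_nonneg.2 g4)
  have f2 := mul_pos (by positivity : (0:ℝ) < (m:ℝ)^2) (sub_pos.2 hc)
  linarith
end

section
lemma z5A (x y z : ℕ → ℝ) (s t u : ℕ) (hx : x 0 ≤ 1 ∧ x 1 ≤ x 0 ∧ x 2 ≤ x 1 ∧ x 3 ≤ x 2 ∧ 0 ≤ x 3)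
    (hy : y 0 ≤ 1 ∧ y 1 ≤ y 0 ∧ y 2 ≤ y 1 ∧ y 3 ≤ y 2 ∧ 0 ≤ y 3)
    (hz : z 0 ≤ 1 ∧ z 1 ≤ z 0 ∧ z 2 ≤ z 1 ∧ z 3 ≤ z 2 ∧ 0 ≤ z 3)
    (H : ∀ i j k, i < s → j < t → k < u → i + j + k = 4 → x i + y j + z k ≤ 3 / 2)
    (zx : ∀ i, s ≤ i → i < 4 → x i = 0) (zy : ∀ i, t ≤ i → i < 4 → y i = 0) (zz : ∀ i, u ≤ i → i < 4 → z i = 0)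
    (hs : s ≤ 4) (ht : t ≤ s) (hu : u ≤ t) (h1 : 1 ≤ u) :
    x 0 + x 1 + x 2 + x 3 + (y 0 + y 1 + y 2 + y 3) + (z 0 + z 1 + z 2 + z 3) ≤ 13 / 2 ∧
    (1 / 2 < x 0 + x 1 + x 2 + x 3 → 1 / 2 < y 0 + y 1 + y 2 + y 3 → 1 / 2 < z 0 + z 1 + z 2 + z 3 →
      x 0 + x 1 + x 2 + x 3 + (y 0 + y 1 + y 2 + y 3) + (z 0 + z 1 + z 2 + z 3) ≤ 6) := by
  obtain ⟨x0, x1, x2, x3, x4⟩ := hx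
  obtain ⟨y0, y1, y2, y3, y4⟩ := hy
  obtain ⟨z0, z1, z2, z3, z4⟩ := hz
  have hs1 : 1 ≤ s := by omega
  have ht1 : 1 ≤ t := by omega
  have h01 := H 0 1 3
  have h02 := H 0 2 2
  have h03 := H 0 3 1
  have h10 := H 1 0 3
  have h11 := H 1 1 2
  have h12 := H 1 2 1
  have h13 := H 1 3 0
  have h20 := H 2 0 2
  have h21 := H 2 1 1
  have h22 := H 2 2 0
  have h30 := H 3 0 1
  have h31 := H 3 1 0
  have xx1 := zx 1
  have xx2 := zx 2
  have xx3 := zx 3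
  have yy1 := zy 1
  have yy2 := zy 2
  have yy3 := zy 3
  have zz1 := zz 1
  have zz2 := zz 2
  have zz3 := zz 3
  clear H zx zy zz
  interval_cases s <;> interval_cases t <;> interval_cases u <;>
    simp only [Nat.reduceLT, Nat.reduceLeDiff, forall_const, Nat.reduceAdd, false_imp_iff, implies_true, le_refl, Nat.lt_irrefl] at h01 h02 h03 h10 h11 h12 h13 h20 h21 h22 h30 h31 xx1 xx2 xx3 yy1 yy2 yy3 zz1 zz2 zz3 <;>
    exact ⟨by linarith, fun _ _ _ => by linarith⟩

open Finset in
lemma sorted_seq {α : Type} [Fintype α] (f : α → ℝ) : ∃ x : ℕ → ℝ,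
    (∀ i j, i ≤ j → j < Fintype.card α → x j ≤ x i) ∧ ∑ i ∈ range (Fintype.card α), x i = ∑ a, f a ∧
    (∀ i < Fintype.card α, ∃ a, f a = x i) ∧ ∀ i < Fintype.card α, i + 1 ≤ #{a | x i ≤ f a} := by
  classical
  set n := Fintype.card α
  let e : Fin n ≃ α := (Fintype.equivFin α).symm
  let σ := Tuple.sort (fun k => - f (e k))
  have hm : Monotone (fun k => - f (e (σ k))) := Tuple.monotone_sort (fun k => - f (e k))
  refine ⟨fun i => if h : i < n then f (e (σ ⟨i, h⟩)) else 0, ?_, ?_, ?_, ?_⟩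
  · intro i j hij hj
    have := hm (show (⟨i, hij.trans_lt hj⟩ : Fin n) ≤ ⟨j, hj⟩ from hij)
    simp only [hj, hij.trans_lt hj, dif_pos]; linarith
  · rw [sum_range, ← (σ.trans e).sum_comp]; simp
  · intro i hi; exact ⟨e (σ ⟨i, hi⟩), by simp only [hi, dif_pos]⟩
  · intro i hi
    simp only [hi, dif_pos]
    calc i + 1 = #(Finset.Iic (⟨i, hi⟩ : Fin n)) := by simp
      _ = #((Finset.Iic (⟨i, hi⟩ : Fin n)).image (σ.trans e)) := (card_image_of_injective _ (σ.trans e).injective).symm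
      _ ≤ _ := card_le_card ?_
    intro a ha
    obtain ⟨k, hk, rfl⟩ := mem_image.1 ha
    have := hm (mem_Iic.1 hk)
    simp only [mem_filter, mem_univ, true_and, Equiv.trans_apply]; linarith

open Finset Pointwise in
lemma cd3 {p : ℕ} [Fact p.Prime] (A B C : Finset (ZMod p)) (hA : 1 ≤ #A) (hB : 1 ≤ #B) (hC : 1 ≤ #C)
    (h : p + 2 ≤ #A + #B + #C) (t : ZMod p) : ∃ a ∈ A, ∃ b ∈ B, ∃ c ∈ C, a + b + c = t := by
  have hA' := card_pos.1 hA
  have hB' := card_pos.1 hB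
  have hC' := card_pos.1 hC
  have h1 := ZMod.cauchy_davenport (Fact.out : p.Prime) hA' hB'
  have h2 := ZMod.cauchy_davenport (Fact.out : p.Prime) (hA'.add hB') hC'
  have h3 : #(A + B + C) ≤ p := by simpa using card_le_univ (A + B + C)
  have h4 : A + B + C = univ := by
    apply (card_eq_iff_eq_univ _).1; rw [ZMod.card]; omega
  have : t ∈ A + B + C := by rw [h4]; exact mem_univ _
  obtain ⟨s, hs, c, hc, rfl⟩ := mem_add.1 this
  obtain ⟨a, ha, b, hb, rfl⟩ := mem_add.1 hs
  exact ⟨a, ha, b, hb, c, hc, rfl⟩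

open Finset in
/-- sorted sequences on the units and realisation of index triples -/
lemma unit_seq {p : ℕ} [Fact p.Prime] (f : Fin 3 → (ZMod p)ˣ → ℝ) : ∃ x : Fin 3 → ℕ → ℝ,
    (∀ l i j, i ≤ j → j < p - 1 → x l j ≤ x l i) ∧ (∀ l, ∑ i ∈ range (p - 1), x l i = ∑ a, f l a) ∧
    (∀ l, ∀ i < p - 1, ∃ a, f l a = x l i) ∧ ∀ (t : ZMod p) (i j k : ℕ), i < p - 1 → j < p - 1 → k < p - 1 → 
    p - 1 ≤ i + j + k → ∃ a : Fin 3 → (ZMod p)ˣ, (a 0 : ZMod p) + a 1 + a 2 = t ∧ x 0 i ≤ f 0 (a 0) ∧ 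
      x 1 j ≤ f 1 (a 1) ∧ x 2 k ≤ f 2 (a 2) := by
  choose x hx using fun l => sorted_seq (f l)
  simp only [ZMod.card_units] at hx
  refine ⟨x, fun l => (hx l).1, fun l => (hx l).2.1, fun l => (hx l).2.2.1, fun t i j k hi hj hk h => ?_⟩
  let S : Fin 3 → ℕ → Finset (ZMod p) := fun l i => Finset.image (fun u : (ZMod p)ˣ => (u : ZMod p)) {a | x l i ≤ f l a}
  have hS : ∀ l i, i < p - 1 → i + 1 ≤ #(S l i) := fun l i hi => by
    rw [card_image_of_injective _ Units.val_injective]; exact (hx l).2.2.2 i hi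
  have hp := (Fact.out : p.Prime).two_le
  obtain ⟨a, ha, b, hb, c, hc, hs⟩ := cd3 (S 0 i) (S 1 j) (S 2 k) (by have := hS 0 i hi; omega) 
    (by have := hS 1 j hj; omega) (by have := hS 2 k hk; omega)
    (by have := hS 0 i hi; have := hS 1 j hj; have := hS 2 k hk; omega) t
  simp only [S, mem_image, mem_filter, mem_univ, true_and] at ha hb hc
  obtain ⟨a', ha, rfl⟩ := ha
  obtain ⟨b', hb, rfl⟩ := hb
  obtain ⟨c', hc, rfl⟩ := hc
  exact ⟨![a', b', c'], hs, ha, hb, hc⟩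

/-- the quadratic form -/
noncomputable def Phi (a : Fin 3 → ℝ) : ℝ := a 0 * a 1 + a 1 * a 2 + a 2 * a 0 - 5 / 8 * (a 0 + a 1 + a 2)

lemma Phi_mono1 {a b c a' : ℝ} (ha : 0 ≤ a) (hb : 0 ≤ b) (hc : 0 ≤ c)
    (h : 0 < Phi ![a, b, c]) (h' : a ≤ a') : 0 < Phi ![a', b, c] := by
  simp only [Phi, Matrix.cons_val] at h ⊢
  have : 5 / 8 ≤ b + c := by
    by_contra! hh
    nlinarith [mul_nonneg ha (by linarith : 0 ≤ 5 / 8 - b - c), mul_nonneg hb hb, mul_nonneg hc hc, mul_nonneg hb hc,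
      mul_nonneg hb (by linarith : 0 ≤ 5 / 8 - b - c), mul_nonneg hc (by linarith : 0 ≤ 5 / 8 - b - c)]
  nlinarith [mul_nonneg (sub_nonneg.2 h') (sub_nonneg.2 this)]

lemma Phi_mono {a b c a' b' c' : ℝ} (ha : 0 ≤ a) (hb : 0 ≤ b) (hc : 0 ≤ c) 
    (h : 0 < Phi ![a, b, c]) (h1' : a ≤ a') (h2' : b ≤ b') (h3' : c ≤ c') : 0 < Phi ![a', b', c'] := by
  have rot : ∀ a b c : ℝ, Phi ![a, b, c] = Phi ![b, c, a] := fun a b c => by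
    simp only [Phi, Matrix.cons_val]; ring
  have q1 := Phi_mono1 ha hb hc h h1'
  rw [rot] at q1
  have q2 := Phi_mono1 hb hc (ha.trans h1') q1 h2'
  rw [rot] at q2
  have q3 := Phi_mono1 hc (ha.trans h1') (hb.trans h2') q2 h3'
  rwa [rot] at q3
end

section
/-- mean over units -/
noncomputable def mu {R : ℕ} [NeZero R] (f : (ZMod R)ˣ → ℝ) : ℝ := (∑ a, f a) / Fintype.card (ZMod R)ˣ

open Finset in
lemma pstep {p : ℕ} [Fact p.Prime] (hp : 7 ≤ p) (f : Fin 3 → (ZMod p)ˣ → ℝ) (hf : ∀ l a, 0 ≤ f l a ∧ f l a ≤ 1)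
    (h : 0 < Phi fun l => mu (f l)) (t : ZMod p) : ∃ a : Fin 3 → (ZMod p)ˣ, (a 0 : ZMod p) + a 1 + a 2 = t ∧
      0 < Phi fun l => f l (a l) := by
  by_contra! hc
  obtain ⟨x, h1, h2, h3, h4⟩ := unit_seq f
  obtain ⟨m, hm⟩ : ∃ m, p - 1 = 2 * m := by
    rcases (Fact.out : p.Prime).eq_two_or_odd' with h | ⟨m, h⟩
    · omega
    · exact ⟨m, by omega⟩
  rw [hm] at h1 h2 h3 h4
  have b : ∀ l, ∀ i < 2 * m, 0 ≤ x l i ∧ x l i ≤ 1 := fun l i hi => by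
    obtain ⟨a, ha⟩ := h3 l i hi; rw [← ha]; exact hf l a
  have hv : ∀ (g : Fin 3 → ℝ), Phi g = Phi ![g 0, g 1, g 2] := fun g => by simp [Phi]
  have hM : (0 : ℝ) < 2 * m := by have : 0 < m := by omega
                                  positivity
  have hmu : ∀ l, 16 / 5 * mu (f l) - 1 = (∑ i ∈ range (2 * m), (16 / 5 * x l i - 1)) / (2 * m) := fun l => by
    rw [mu, ZMod.card_units, hm, ← h2 l, sum_sub_distrib, ← mul_sum]
    simp only [sum_const, card_range, nsmul_eq_mul, mul_one]; push_cast
    have : (m : ℝ) ≠ 0 := by linarith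
    field_simp
  have := loc_closure m (by omega) (fun i => 16 / 5 * x 0 i - 1) (fun i => 16 / 5 * x 1 i - 1) (fun i => 16 / 5 * x 2 i - 1)
    (fun i j hi hj => by linarith [h1 0 i j hi hj]) (fun i j hi hj => by linarith [h1 1 i j hi hj])
    (fun i j hi hj => by linarith [h1 2 i j hi hj])
    (fun i hi => by constructor <;> linarith [b 0 i hi]) (fun i hi => by constructor <;> linarith [b 1 i hi])
    (fun i hi => by constructor <;> linarith [b 2 i hi]) ?_ _ _ _ (hmu 0) (hmu 1) (hmu 2)
  · simp only [Phi] at h; nlinarith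
  · intro i j k hi hj hk hs
    obtain ⟨a, ha, q0, q1, q2⟩ := h4 t i j k hi hj hk hs
    have := hc a ha
    rw [hv] at this
    by_contra! hg
    refine absurd (Phi_mono (b 0 i hi).1 (b 1 j hj).1 (b 2 k hk).1 ?_ q0 q1 q2) (not_lt.2 this)
    simp only [Phi, Matrix.cons_val]; nlinarith

open Finset in
lemma z5B [Fact (Nat.Prime 5)] (f : Fin 3 → (ZMod 5)ˣ → ℝ) (hf : ∀ l a, 0 ≤ f l a ∧ f l a ≤ 1) (t : ZMod 5)
    (hb : ∀ a : Fin 3 → (ZMod 5)ˣ, (a 0 : ZMod 5) + a 1 + a 2 = t → (∀ l, 0 < f l (a l)) → ∑ l, f l (a l) ≤ 3 / 2)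
    (hpos : ∀ l, 0 < mu (f l)) : ∑ l, mu (f l) ≤ 13 / 8 ∧ ((∀ l, 1 / 8 < mu (f l)) → ∑ l, mu (f l) ≤ 3 / 2) := by
  obtain ⟨x, h1, h2, h3, h4⟩ := unit_seq f
  norm_num at h1 h2 h3 h4
  have b : ∀ l, ∀ i < 4, 0 ≤ x l i ∧ x l i ≤ 1 := fun l i hi => by
    obtain ⟨a, ha⟩ := h3 l i hi; rw [← ha]; exact hf l a
  have hmu : ∀ l, 4 * mu (f l) = x l 0 + x l 1 + x l 2 + x l 3 := fun l => by
    rw [mu, ZMod.card_units, ← h2 l]; simp [sum_range_succ]; ring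
  have hord : ∀ l, x l 0 ≤ 1 ∧ x l 1 ≤ x l 0 ∧ x l 2 ≤ x l 1 ∧ x l 3 ≤ x l 2 ∧ 0 ≤ x l 3 := fun l =>
    ⟨(b l 0 (by decide)).2, h1 l 0 1 (by decide) (by decide), h1 l 1 2 (by decide) (by decide), 
      h1 l 2 3 (by decide) (by decide), (b l 3 (by decide)).1⟩
  have hsup : ∀ l, ∃ s, 1 ≤ s ∧ s ≤ 4 ∧ (∀ i, i < s → 0 < x l i) ∧ ∀ i, s ≤ i → i < 4 → x l i = 0 := by
    intro l
    have hx : ∃ s, s = 4 ∨ x l s = 0 := ⟨4, Or.inl rfl⟩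
    classical
    have h4 : Nat.find hx ≤ 4 := Nat.find_min' hx (Or.inl rfl)
    refine ⟨Nat.find hx, ?_, h4, fun i hi => ?_, fun i hi hi4 => ?_⟩
    · by_contra! hlt
      have hz : Nat.find hx = 0 := by omega
      have := Nat.find_spec hx
      rw [hz] at this
      have := hpos l; have := hmu l; have := hord l
      rcases ‹0 = 4 ∨ x l 0 = 0› with h | h
      · omega
      · linarith
    · have := Nat.find_min hx hi; push Not at this
      exact lt_of_le_of_ne (b l i (by omega)).1 (Ne.symm this.2)
    · rcases Nat.find_spec hx with h | h
      · omega
      · exact le_antisymm (h ▸ h1 l _ i hi hi4) (b l i hi4).1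
  choose s s1 s4 sp sz using hsup
  have H : ∀ i j k, i < s 0 → j < s 1 → k < s 2 → i + j + k = 4 → x 0 i + x 1 j + x 2 k ≤ 3 / 2 := by
    intro i j k hi hj hk h
    obtain ⟨a, ha, q0, q1, q2⟩ := h4 t i j k (hi.trans_le (s4 0)) (hj.trans_le (s4 1)) (hk.trans_le (s4 2)) h.ge
    have := hb a ha (by 
      intro l; fin_cases l
      · exact (sp 0 i hi).trans_le q0
      · exact (sp 1 j hj).trans_le q1
      · exact (sp 2 k hk).trans_le q2)
    rw [Fin.sum_univ_three] at this; linarith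
  -- symmetry
  obtain ⟨σ, hσ1, hσ2⟩ : ∃ σ : Equiv.Perm (Fin 3), s (σ 1) ≤ s (σ 0) ∧ s (σ 2) ≤ s (σ 1) := by
    let σ := Tuple.sort s
    have := Tuple.monotone_sort s
    exact ⟨(Equiv.swap 0 2).trans σ, this (by decide : (1 : Fin 3) ≤ 2), this (by decide : (0 : Fin 3) ≤ 1)⟩
  have H' : ∀ n : Fin 3 → ℕ, (∀ l, n l < s l) → ∑ l, n l = 4 → ∑ l, x l (n l) ≤ 3 / 2 := fun n h1 h2 => by
    rw [Fin.sum_univ_three] at h2 ⊢; exact H _ _ _ (h1 0) (h1 1) (h1 2) h2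
  have key := z5A (x (σ 0)) (x (σ 1)) (x (σ 2)) _ _ _ (hord _) (hord _) (hord _) (fun i j k hi hj hk h => by
    have := H' (fun l => ![i, j, k] (σ.symm l)) ?_ ?_
    · rw [← Equiv.sum_comp σ, Fin.sum_univ_three] at this; simpa using this
    · intro l; obtain ⟨l, rfl⟩ := σ.surjective l; fin_cases l <;> simpa
    · rw [← Equiv.sum_comp σ, Fin.sum_univ_three]; simpa using h) (sz _) (sz _) (sz _) (s4 _) hσ1 hσ2 (s1 _)
  rw [← hmu, ← hmu, ← hmu] at key
  have e : ∑ l, mu (f l) = mu (f (σ 0)) + mu (f (σ 1)) + mu (f (σ 2)) := by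
    rw [← Equiv.sum_comp σ, Fin.sum_univ_three]
  rw [e]
  exact ⟨by linarith, fun h => by
    have := key.2 (by linarith [h (σ 0)]) (by linarith [h (σ 1)]) (by linarith [h (σ 2)]); linarith⟩

lemma PhiA {a b c : ℝ} (h0 : 0 ≤ a + b + c) (h : a + b + c ≤ 15 / 8) : Phi ![a, b, c] ≤ 0 := by
  simp only [Phi, Matrix.cons_val]
  nlinarith [sq_nonneg (a - b), sq_nonneg (b - c), sq_nonneg (c - a), mul_nonneg h0 (sub_nonneg.2 h)]

lemma PhiB {a b c : ℝ} (ha : 0 ≤ a) (hb : 0 ≤ b) (hc : 0 ≤ c) (ha1 : a ≤ 1 / 2) (hb1 : b ≤ 1 / 2) (hc1 : c ≤ 1) :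
    a * b + b * c + c * a - 5 / 8 * (a + b + c) ≤ 0 := by
  rcases le_total (5 / 8) (a + b) with h | h
  · nlinarith [mul_nonneg (sub_nonneg.2 h) (sub_nonneg.2 hc1), mul_nonneg (sub_nonneg.2 ha1) (sub_nonneg.2 hb1)]
  · nlinarith [mul_nonneg (sub_nonneg.2 h) hc, mul_nonneg ha (sub_nonneg.2 hb1)]

lemma PhiC {b c : ℝ} (hb : 0 ≤ b) (hc : 0 ≤ c) (hb1 : b ≤ 1) (hc1 : c ≤ 1) :
    b * c - 5 / 8 * (b + c) ≤ 0 := by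
  nlinarith [mul_nonneg hb (sub_nonneg.2 hc1), mul_nonneg hc (sub_nonneg.2 hb1)]

/-- bad triple of means -/
def Bd (a b c : ℝ) : Prop := (0 < a → 0 < b → 0 < c → a + b + c ≤ 13 / 8) ∧
  (1 / 8 < a → 1 / 8 < b → 1 / 8 < c → a + b + c ≤ 3 / 2)

lemma base_core1 {a b c d e f : ℝ} (ha : 0 < a) (hb : 0 < b) (hc : 0 < c) (hd : 0 < d) (he : 0 ≤ e) (hf : 0 ≤ f)
    (hef : 0 < e + f) (hb1 : b ≤ 1) (hd1 : d ≤ 1) (hf1 : f ≤ 1)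
    (h1 : Bd b c e) (h2 : Bd a d e) (h3 : Bd a c f) : a + b + c + d + e + f ≤ 15 / 4 := by
  rcases he.eq_or_lt with h | h
  · linarith [h3.1 ha hc (by linarith)]
  have q1 := h1.1 hb hc h
  have q2 := h2.1 ha hd h
  rcases hf.eq_or_lt with h' | h'
  · linarith
  have q3 := h3.1 ha hc h'
  by_contra! hh
  have := h1.2 (by linarith) (by linarith) (by linarith)
  have := h2.2 (by linarith) (by linarith) (by linarith)
  have := h3.2 (by linarith) (by linarith) (by linarith)
  linarith

lemma base_core0 {a b c d e f : ℝ} (ha : 0 < a) (hb : 0 < b) (hc : 0 < c) (hd : 0 < d) (he : 0 ≤ e) (hf : 0 ≤ f)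
    (hef : 0 < e + f) (ha1 : a ≤ 1) (hb1 : b ≤ 1) (hc1 : c ≤ 1) (hd1 : d ≤ 1)
    (h1 : Bd a c e) (h2 : Bd b d f) : a + b + c + d + e + f ≤ 15 / 4 := by
  rcases he.eq_or_lt with h | h
  · linarith [h2.1 hb hd (by linarith)]
  have q1 := h1.1 ha hc h
  rcases hf.eq_or_lt with h' | h'
  · linarith
  · linarith [h2.1 hb hd h']

lemma base_real (u v : Fin 3 → ℝ) (hu : ∀ l, 0 ≤ u l ∧ u l ≤ 1) (hv : ∀ l, 0 ≤ v l ∧ v l ≤ 1)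
    (L : (Bd (v 0) (u 1) (u 2) ∧ Bd (u 0) (v 1) (u 2) ∧ Bd (u 0) (u 1) (v 2)) ∨
      (Bd (u 0) (u 1) (u 2) ∧ Bd (v 0) (v 1) (v 2))) :
    Phi (fun l => (u l + v l) / 2) ≤ 0 := by
  by_contra! hc
  have e : Phi (fun l => (u l + v l) / 2) = Phi ![(u 0 + v 0) / 2, (u 1 + v 1) / 2, (u 2 + v 2) / 2] := by simp [Phi]
  have u0 := hu 0; have u1 := hu 1; have u2 := hu 2; have v0 := hv 0; have v1 := hv 1; have v2 := hv 2
  rw [e] at hc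
  have hS : 15 / 4 < u 0 + v 0 + u 1 + v 1 + u 2 + v 2 := by
    by_contra! hS
    exact absurd (PhiA (by linarith) (by linarith)) (not_le.2 hc)
  simp only [Phi, Matrix.cons_val] at hc
  have kB : ∀ i j k : Fin 3, ¬ (Phi ![(u i + v i) / 2, (u j + v j) / 2, (u k + v k) / 2] ≤ 0) → 
      1 < u i + v i ∨ 1 < u j + v j := fun i j k h => by
    by_contra! hh
    apply h
    simp only [Phi, Matrix.cons_val]
    have := hu i; have := hu j; have := hu k; have := hv i; have := hv j; have := hv k
    exact PhiB (by linarith) (by linarith) (by linarith) (by linarith) (by linarith) (by linarith)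
  have kC : ∀ i j k : Fin 3, ¬ (Phi ![(u i + v i) / 2, (u j + v j) / 2, (u k + v k) / 2] ≤ 0) → 
      0 < u i + v i := fun i j k h => by
    by_contra! hh
    apply h
    have := hu i; have := hu j; have := hu k; have := hv i; have := hv j; have := hv k
    have h0 : (u i + v i) / 2 = 0 := by linarith
    simp only [Phi, Matrix.cons_val, h0]
    have := PhiC (b := (u j + v j) / 2) (c := (u k + v k) / 2) (by linarith) (by linarith) (by linarith) (by linarith)
    linarith
  have z0 := kC 0 1 2 (by simp only [Phi, Matrix.cons_val]; linarith)
  have z1 := kC 1 2 0 (by simp only [Phi, Matrix.cons_val]; linarith)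
  have z2 := kC 2 0 1 (by simp only [Phi, Matrix.cons_val]; linarith)
  have n01 := kB 0 1 2 (by simp only [Phi, Matrix.cons_val]; linarith)
  have n12 := kB 1 2 0 (by simp only [Phi, Matrix.cons_val]; linarith)
  have n20 := kB 2 0 1 (by simp only [Phi, Matrix.cons_val]; linarith)
  have rt : ∀ {a b c : ℝ}, Bd a b c → Bd b c a := fun h =>
    ⟨fun h1 h2 h3 => by linarith [h.1 h3 h1 h2], fun h1 h2 h3 => by linarith [h.2 h3 h1 h2]⟩
  clear kB kC e hc
  have nn : (1 < u 0 + v 0 ∧ 1 < u 1 + v 1) ∨ (1 < u 1 + v 1 ∧ 1 < u 2 + v 2) ∨ (1 < u 2 + v 2 ∧ 1 < u 0 + v 0) := by tauto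
  clear n01 n12 n20
  rcases L with ⟨h0, h1, h2⟩ | ⟨h0, h1⟩
  · have c01 := fun ha hb hc hd => base_core1 (a := u 0) (b := v 0) (c := u 1) (d := v 1) ha hb hc hd u2.1 v2.1 z2 v0.2 v1.2 v2.2 h0 h1 h2
    have c12 := fun ha hb hc hd => base_core1 (a := u 1) (b := v 1) (c := u 2) (d := v 2) ha hb hc hd u0.1 v0.1 z0 v1.2 v2.2 v0.2 (rt h1) (rt h2) (rt h0)
    have c20 := fun ha hb hc hd => base_core1 (a := u 2) (b := v 2) (c := u 0) (d := v 0) ha hb hc hd u1.1 v1.1 z1 v2.2 v0.2 v1.2 (rt (rt h2)) (rt (rt h0)) (rt (rt h1))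
    rcases nn with ⟨n, n'⟩ | ⟨n, n'⟩ | ⟨n, n'⟩
    · linarith [c01 (by linarith) (by linarith) (by linarith) (by linarith)]
    · linarith [c12 (by linarith) (by linarith) (by linarith) (by linarith)]
    · linarith [c20 (by linarith) (by linarith) (by linarith) (by linarith)]
  · have c01 := fun ha hb hc hd => base_core0 (a := u 0) (b := v 0) (c := u 1) (d := v 1) ha hb hc hd u2.1 v2.1 z2 u0.2 v0.2 u1.2 v1.2 h0 h1
    have c12 := fun ha hb hc hd => base_core0 (a := u 1) (b := v 1) (c := u 2) (d := v 2) ha hb hc hd u0.1 v0.1 z0 u1.2 v1.2 u2.2 v2.2 (rt h0) (rt h1)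
    have c20 := fun ha hb hc hd => base_core0 (a := u 2) (b := v 2) (c := u 0) (d := v 0) ha hb hc hd u1.1 v1.1 z1 u2.2 v2.2 u0.2 v0.2 (rt (rt h0)) (rt (rt h1))
    rcases nn with ⟨n, n'⟩ | ⟨n, n'⟩ | ⟨n, n'⟩
    · linarith [c01 (by linarith) (by linarith) (by linarith) (by linarith)]
    · linarith [c12 (by linarith) (by linarith) (by linarith) (by linarith)]
    · linarith [c20 (by linarith) (by linarith) (by linarith) (by linarith)]
end

section
lemma crt_units {a b : ℕ} (h : Nat.Coprime a b) : ∃ E : (ZMod (a * b))ˣ ≃ (ZMod a)ˣ × (ZMod b)ˣ, ∀ (N : ℕ) (u : Fin 3 → (ZMod (a * b))ˣ),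
    ((E (u 0)).1 : ZMod a) + (E (u 1)).1 + (E (u 2)).1 = N → ((E (u 0)).2 : ZMod b) + (E (u 1)).2 + (E (u 2)).2 = N → 
    (u 0 : ZMod (a * b)) + u 1 + u 2 = N := by
  let e := ZMod.chineseRemainder h
  refine ⟨((Units.mapEquiv e.toMulEquiv).trans MulEquiv.prodUnits).toEquiv, fun N u h1 h2 => ?_⟩
  apply e.injective
  rw [map_add, map_add, map_natCast]
  ext
  · exact h1
  · exact h2

/-- local solvability -/
def QQ (R : ℕ) [NeZero R] : Prop := ∀ f : Fin 3 → (ZMod R)ˣ → ℝ, (∀ l a, 0 ≤ f l a ∧ f l a ≤ 1) → 0 < Phi (fun l => mu (f l)) →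
  ∀ N : ℕ, Odd N → ∃ a : Fin 3 → (ZMod R)ˣ, (a 0 : ZMod R) + a 1 + a 2 = N ∧ (∀ l, 0 < f l (a l)) ∧ 3 / 2 < ∑ l, f l (a l)

lemma mu_mem {R : ℕ} [NeZero R] {f : (ZMod R)ˣ → ℝ} (hf : ∀ a, 0 ≤ f a ∧ f a ≤ 1) : 0 ≤ mu f ∧ mu f ≤ 1 := by
  have hc : (0 : ℝ) < Fintype.card (ZMod R)ˣ := by exact_mod_cast Fintype.card_pos
  constructor
  · exact div_nonneg (Finset.sum_nonneg fun a _ => (hf a).1) hc.le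
  · rw [mu, div_le_one hc]
    refine (Finset.sum_le_sum fun a _ => (hf a).2).trans ?_
    simp

lemma mu_prod {a b : ℕ} [NeZero a] [NeZero b] (E : (ZMod (a * b))ˣ ≃ (ZMod a)ˣ × (ZMod b)ˣ) (f : (ZMod (a * b))ˣ → ℝ) :
    mu f = mu fun x => mu fun y => f (E.symm (x, y)) := by
  unfold mu
  rw [← E.symm.sum_comp, Fintype.sum_prod_type, Fintype.card_congr E, Fintype.card_prod, ← Finset.sum_div, div_div]
  push_cast; ring

lemma QQ_step {p R : ℕ} [Fact p.Prime] [NeZero R] (hp : 7 ≤ p) (hc : Nat.Coprime p R) (hR : QQ R) : QQ (p * R) := by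
  intro f hf hP N hN
  obtain ⟨E, hE⟩ := crt_units hc
  simp_rw [mu_prod E] at hP
  obtain ⟨b, hb, hb'⟩ := pstep hp (fun l x => mu fun y => f l (E.symm (x, y))) (fun l a => mu_mem fun _ => hf _ _) hP (N : ZMod p)
  obtain ⟨c, h1, h2, h3⟩ := hR (fun l y => f l (E.symm (b l, y))) (fun l a => hf _ _) hb' N hN
  refine ⟨fun l => E.symm (b l, c l), hE N (fun l => E.symm (b l, c l)) ?_ ?_, h2, h3⟩
  · simpa using hb
  · simpa using h1

open Finset in
lemma QQ_base : QQ 30 := by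
  have : Fact (Nat.Prime 5) := ⟨by norm_num⟩
  change QQ (6 * 5)
  intro f hf hP N hN
  obtain ⟨E, hE⟩ := crt_units (by norm_num : Nat.Coprime 6 5)
  by_contra! hc
  have m6 : ∀ g : (ZMod 6)ˣ → ℝ, mu g = (g 1 + g (-1)) / 2 := fun g => by
    have e : (univ : Finset (ZMod 6)ˣ) = {1, -1} := by decide
    have e2 : Fintype.card (ZMod 6)ˣ = 2 := by decide
    have e3 : (1 : (ZMod 6)ˣ) ≠ -1 := by decide
    rw [mu, e2, e, sum_pair e3]; norm_num
  simp_rw [mu_prod E, m6] at hP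
  have key : ∀ ε : Fin 3 → (ZMod 6)ˣ, (ε 0 : ZMod 6) + ε 1 + ε 2 = N → 
      Bd (mu fun y => f 0 (E.symm (ε 0, y))) (mu fun y => f 1 (E.symm (ε 1, y))) (mu fun y => f 2 (E.symm (ε 2, y))) := by
    intro ε hε
    have hb : ∀ a : Fin 3 → (ZMod 5)ˣ, (a 0 : ZMod 5) + a 1 + a 2 = N → (∀ l, 0 < f l (E.symm (ε l, a l))) → 
        ∑ l, f l (E.symm (ε l, a l)) ≤ 3 / 2 := fun a ha h =>
      hc (fun l => E.symm (ε l, a l)) (hE N (fun l => E.symm (ε l, a l)) (by simpa using hε) (by simpa using ha)) h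
    have := z5B (fun l y => f l (E.symm (ε l, y))) (fun l a => hf _ _) N hb
    simp only [Fin.forall_fin_succ, Fin.sum_univ_three] at this
    constructor
    · intro h1 h2 h3; exact (this ⟨h1, h2, h3, fun i => i.elim0⟩).1
    · intro h1 h2 h3
      exact (this ⟨lt_trans (by norm_num) h1, lt_trans (by norm_num) h2, lt_trans (by norm_num) h3, fun i => i.elim0⟩).2 ⟨h1, h2, h3, fun i => i.elim0⟩
  refine absurd hP (not_lt.2 ?_)
  have hmod : (N : ZMod 6) = 1 ∨ (N : ZMod 6) = 3 ∨ (N : ZMod 6) = -1 := by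
    have : N % 6 = 1 ∨ N % 6 = 3 ∨ N % 6 = 5 := by obtain ⟨k, hk⟩ := hN; omega
    rw [← ZMod.natCast_mod N 6]
    rcases this with h | h | h <;> rw [h] <;> decide
  have mm := fun (l : Fin 3) (e : (ZMod 6)ˣ) => mu_mem (f := fun y => f l (E.symm (e, y))) fun a => hf _ _
  rcases hmod with h | h | h <;> rw [h] at key
  · exact base_real (fun l => mu fun y => f l (E.symm (1, y))) (fun l => mu fun y => f l (E.symm (-1, y))) (fun l => mm l _) (fun l => mm l _)
      (Or.inl ⟨key ![-1, 1, 1] (by decide), key ![1, -1, 1] (by decide), key ![1, 1, -1] (by decide)⟩)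
  · exact base_real (fun l => mu fun y => f l (E.symm (1, y))) (fun l => mu fun y => f l (E.symm (-1, y))) (fun l => mm l _) (fun l => mm l _)
      (Or.inr ⟨key ![1, 1, 1] (by decide), key ![-1, -1, -1] (by decide)⟩)
  · have := base_real (fun l => mu fun y => f l (E.symm (-1, y))) (fun l => mu fun y => f l (E.symm (1, y))) (fun l => mm l _) (fun l => mm l _)
      (Or.inl ⟨key ![1, -1, -1] (by decide), key ![-1, 1, -1] (by decide), key ![-1, -1, 1] (by decide)⟩)
    simpa only [add_comm] using this

lemma QQ_primorial (w : ℕ) (hw : 5 ≤ w) (i : NeZero (primorial w)) : QQ (primorial w) := by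
  induction w, hw using Nat.le_induction with
  | base => exact QQ_base
  | succ n hn ih =>
    have : NeZero (primorial n) := ⟨(primorial_pos n).ne'⟩
    by_cases hp : (n + 1).Prime
    · have : Fact (n + 1).Prime := ⟨hp⟩
      have e : primorial (n + 1) = (n + 1) * primorial n := by
        unfold primorial
        rw [Finset.range_add_one, Finset.filter_insert, if_pos hp, Finset.prod_insert (by simp)]
      have h7 : 7 ≤ n + 1 := by
        rcases (by omega : n = 5 ∨ 6 ≤ n) with h | h
        · subst h; norm_num at hp
        · omega
      have hc : Nat.Coprime (n + 1) (primorial n) := by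
        unfold primorial
        refine Nat.Coprime.prod_right fun q hq => ?_
        simp only [Finset.mem_filter, Finset.mem_range] at hq
        exact (Nat.coprime_primes hp hq.2).2 (by omega)
      have := QQ_step h7 hc (ih _)
      revert i; rw [e]; intro i; exact this
    · have e : primorial (n + 1) = primorial n := by
        unfold primorial
        rw [Finset.range_add_one, Finset.filter_insert, if_neg hp]
      revert i; rw [e]; intro i; exact ih _

/-- the local theorem -/
lemma local_main (w : ℕ) (hw : 5 ≤ w) [NeZero (primorial w)] (f : (ZMod (primorial w))ˣ → ℝ) (hf : ∀ a, 0 ≤ f a ∧ f a ≤ 1)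
    (hm : 5 / 8 < mu f) (N : ℕ) (hN : Odd N) : ∃ a : Fin 3 → (ZMod (primorial w))ˣ,
      (a 0 : ZMod (primorial w)) + a 1 + a 2 = N ∧ (∀ l, 0 < f (a l)) ∧ 3 / 2 < ∑ l, f (a l) := 
  QQ_primorial w hw inferInstance (fun _ => f) (fun _ => hf) (by simp only [Phi]; nlinarith) N hN
end

section
open Finset in
/-- number of representations -/
def rep {p : ℕ} [NeZero p] (A B : Finset (ZMod p)) (x : ZMod p) : ℕ :=
  ∑ a : ZMod p, (if a ∈ A then 1 else 0) * (if x - a ∈ B then 1 else 0)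

open Finset in
lemma rep_split {p : ℕ} [NeZero p] (A B : Finset (ZMod p)) (x : ZMod p) :
    rep A B x = rep (A ∪ B) (A ∩ B) x + rep (A \ B) (B \ A) x := by
  have h : ∑ a : ZMod p, (if a ∈ B \ A then 1 else 0) * (if x - a ∈ A ∩ B then 1 else 0)
      = ∑ a : ZMod p, (if a ∈ A ∩ B then 1 else 0) * (if x - a ∈ B \ A then 1 else 0) := by
    rw [← Equiv.sum_comp (Equiv.subLeft x)]
    refine sum_congr rfl fun a _ => ?_
    simp only [Equiv.subLeft_apply, sub_sub_cancel]; ring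
  have e1 : rep (A ∪ B) (A ∩ B) x = (∑ a : ZMod p, (if a ∈ A then 1 else 0) * (if x - a ∈ A ∩ B then 1 else 0))
      + ∑ a : ZMod p, (if a ∈ B \ A then 1 else 0) * (if x - a ∈ A ∩ B then 1 else 0) := by
    rw [rep, ← sum_add_distrib]
    refine sum_congr rfl fun a _ => ?_
    rw [← add_mul]; congr 1
    by_cases h1 : a ∈ A <;> by_cases h2 : a ∈ B <;> simp [h1, h2]
  rw [e1, h, rep, rep, ← sum_add_distrib, ← sum_add_distrib]
  refine sum_congr rfl fun a _ => ?_
  by_cases h1 : a ∈ A <;> by_cases h2 : a ∈ B <;> by_cases h3 : x - a ∈ A <;>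
    by_cases h4 : x - a ∈ B <;> simp [h1, h2, h3, h4]

open Finset in
lemma rep_sum {p : ℕ} [NeZero p] (A B : Finset (ZMod p)) : ∑ x, rep A B x = #A * #B := by
  unfold rep
  rw [sum_comm]
  have : ∀ a : ZMod p, ∑ x : ZMod p, (if a ∈ A then 1 else 0) * (if x - a ∈ B then 1 else 0)
      = (if a ∈ A then 1 else 0) * #B := by
    intro a
    rw [← mul_sum]; congr 1
    rw [← Equiv.sum_comp (Equiv.addRight a)]; simp
  simp_rw [this, ← sum_mul]; simp

open Finset in
lemma rep_le {p : ℕ} [NeZero p] (A B : Finset (ZMod p)) (x : ZMod p) : rep A B x ≤ #B := by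
  unfold rep
  calc _ ≤ ∑ a : ZMod p, (if x - a ∈ B then 1 else 0) := by
        refine sum_le_sum fun a _ => ?_
        split_ifs <;> simp
    _ = #B := by rw [← Equiv.sum_comp (Equiv.subLeft x)]; simp

open Finset Pointwise in
lemma pollard {p : ℕ} [Fact p.Prime] : ∀ (n : ℕ) (A B : Finset (ZMod p)) (t : ℕ), #B = n → 
    t ≤ #A → t ≤ #B → t * min p (#A + #B - t) ≤ ∑ x, min t (rep A B x) := by
  intro n
  induction n using Nat.strong_induction_on with
  | _ n ih =>
  intro A B t hn hA hB
  rcases Nat.eq_zero_or_pos t with h0 | ht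
  · subst h0; simp
  rcases hB.eq_or_lt with h | hlt
  · have : ∀ x, min t (rep A B x) = rep A B x := fun x => min_eq_right (h ▸ rep_le A B x)
    simp_rw [this, rep_sum, ← h, Nat.add_sub_cancel, mul_comm #A]
    gcongr; exact min_le_right _ _
  by_cases hu : A = univ
  · subst hu
    have : ∀ x, rep univ B x = #B := by
      intro x; unfold rep
      rw [← Equiv.sum_comp (Equiv.subLeft x)]; simp
    simp_rw [this, min_eq_left hB]
    simp only [sum_const, card_univ, ZMod.card, smul_eq_mul]
    rw [mul_comm]; gcongr; exact min_le_left _ _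
  -- find shift
  obtain ⟨s, h1, h2⟩ : ∃ s : ZMod p, (A ∩ (B.image (· + s))).Nonempty ∧ ¬ (B.image (· + s)) ⊆ A := by
    by_contra! hc
    obtain ⟨b, hb, b', hb', hne⟩ := one_lt_card.1 (lt_of_le_of_lt ht hlt : 1 < #B)
    obtain ⟨a, ha⟩ : A.Nonempty := card_pos.1 (lt_of_lt_of_le ht hA)
    have key : ∀ k : ℕ, a + k * (b' - b) ∈ A := by
      intro k
      induction k with
      | zero => simpa using ha
      | succ k ihk =>
        have := hc (a + k * (b' - b) - b) ⟨_, mem_inter.2 ⟨ihk, mem_image.2 ⟨b, hb, by ring⟩⟩⟩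
        have := this (mem_image.2 ⟨b', hb', rfl⟩)
        convert this using 1; push_cast; ring
    apply hu
    ext y
    simp only [mem_univ, iff_true]
    have := key ((y - a) / (b' - b)).val
    rwa [ZMod.natCast_zmod_val, div_mul_cancel₀ _ (sub_ne_zero.2 hne.symm), add_sub_cancel] at this
  set B' := B.image (· + s) with hB'
  have hc : #B' = #B := card_image_of_injective _ (add_left_injective s)
  have hr : ∑ x, min t (rep A B x) = ∑ x, min t (rep A B' x) := by
    rw [← Equiv.sum_comp (Equiv.addRight s) (fun x => min t (rep A B' x))]
    refine sum_congr rfl fun x _ => ?_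
    congr 1; unfold rep; refine sum_congr rfl fun a _ => ?_
    congr 2
    simp only [hB', mem_image, Equiv.coe_addRight]
    refine propext ⟨fun h => ⟨_, h, by ring⟩, ?_⟩
    rintro ⟨b, hb, h⟩
    have : x - a = b := by linear_combination -h
    rwa [this]
  rw [hr, ← hc]
  have hI : #(A ∩ B') < #B' := card_lt_card ⟨inter_subset_right, fun h => h2 (fun y hy => (mem_inter.1 (h hy)).1)⟩
  have hI1 : 1 ≤ #(A ∩ B') := card_pos.2 h1
  have hU := card_union_add_card_inter A B'
  have hUp : #(A ∪ B') ≤ p := by simpa using card_le_univ (A ∪ B')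
  have hsp : ∀ t1 t2, t1 + t2 = t → ∑ x, min t1 (rep (A ∪ B') (A ∩ B') x) +
      ∑ x, min t2 (rep (A \ B') (B' \ A) x) ≤ ∑ x, min t (rep A B' x) := by
    intro t1 t2 h
    rw [← sum_add_distrib]
    refine sum_le_sum fun x _ => ?_
    rw [rep_split A B' x]; omega
  by_cases hi : t ≤ #(A ∩ B')
  · have := ih _ (by omega) (A ∪ B') (A ∩ B') t rfl (by omega) hi
    rw [hU] at this
    exact this.trans ((Nat.le_add_right _ _).trans (hsp t 0 rfl))
  · have ha := card_sdiff_add_card_inter A B'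
    have hb := card_sdiff_add_card_inter B' A
    rw [inter_comm B' A] at hb
    have := ih _ (by omega : #(B' \ A) < n) (A \ B') (B' \ A) (t - #(A ∩ B')) rfl (by omega) (by omega)
    have h3 := hsp #(A ∩ B') (t - #(A ∩ B')) (by omega)
    have h4 : ∀ x, min #(A ∩ B') (rep (A ∪ B') (A ∩ B') x) = rep (A ∪ B') (A ∩ B') x :=
      fun x => min_eq_right (rep_le _ _ x)
    simp_rw [h4, rep_sum] at h3
    refine le_trans ?_ (le_trans (Nat.add_le_add_left this _) h3)
    rw [min_eq_right (by omega : #(A \ B') + #(B' \ A) - (t - #(A ∩ B')) ≤ p)]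
    refine le_trans (Nat.mul_le_mul_left _ (min_le_right _ _)) (le_of_eq ?_)
    obtain ⟨j, hj⟩ : ∃ j, t = #(A ∩ B') + j := ⟨t - #(A ∩ B'), by omega⟩
    obtain ⟨u, hu⟩ : ∃ u, #(A ∪ B') = t + u := ⟨#(A ∪ B') - t, by omega⟩
    have e1 : #A + #B' - t = #(A ∩ B') + u := by omega
    have e2 : #(A \ B') + #(B' \ A) - (t - #(A ∩ B')) = u := by omega
    have e3 : t - #(A ∩ B') = j := by omega
    rw [e1, e2, e3, hu, hj]; ring

open Finset in
lemma three_count {p : ℕ} [Fact p.Prime] (g : Fin 3 → ZMod p → ℝ) (η : ℝ) (h0 : 0 < η) (h1 : η ≤ 1)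
    (hg : ∀ i a, 0 ≤ g i a) (hg1 : ∀ i a, g i a ≤ 1 + η) (hs : ∀ i, 3 * η * p ≤ ∑ a, g i a)
    (hS : (1 + 8 * η) * p ≤ ∑ i, ∑ a, g i a) (hp : 2 ≤ η * p) (x : ZMod p) :
    η ^ 5 / 2 * p ^ 2 ≤ ∑ a, ∑ b, g 0 a * g 1 b * g 2 (x - a - b) := by
  set A : Fin 3 → Finset (ZMod p) := fun i => univ.filter fun a => η ≤ g i a with hA
  have hp0 : (0 : ℝ) ≤ p := by positivity
  have hc : ∀ i, ∑ a, g i a ≤ η * p + #(A i) := by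
    intro i
    have : ∀ a, g i a ≤ η + if a ∈ A i then 1 else 0 := by
      intro a
      by_cases h : η ≤ g i a
      · simp only [hA, mem_filter, mem_univ, true_and, h, if_true]; linarith [hg1 i a]
      · simp only [hA, mem_filter, mem_univ, true_and, h, if_false]; linarith
    refine (sum_le_sum fun a _ => this a).trans ?_
    rw [sum_add_distrib]; simp [mul_comm]
  have hcA : ∀ i, #(A i) ≤ p := fun i => by simpa using card_le_univ (A i)
  obtain ⟨t, ht1, ht2⟩ : ∃ t : ℕ, (t : ℝ) ≤ η * p ∧ η * p / 2 ≤ t :=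
    ⟨⌊η * p⌋₊, Nat.floor_le (by linarith), by linarith [Nat.lt_floor_add_one (η * p)]⟩
  have htA : ∀ i, t ≤ #(A i) := fun i => by
    have : (t : ℝ) ≤ #(A i) := by nlinarith [hc i, hs i]
    exact_mod_cast this
  have hP := pollard _ (A 0) (A 1) t rfl (htA 0) (htA 1)
  rw [Fin.sum_univ_three] at hS
  have hP2 : ((t : ℝ)) * (η * p) ≤ ∑ c ∈ A 2, (rep (A 0) (A 1) (x - c) : ℝ) := by
    have e1 : ∑ y, (min t (rep (A 0) (A 1) y) : ℝ) ≤ ∑ c ∈ A 2, (rep (A 0) (A 1) (x - c) : ℝ) + t * (p - #(A 2)) := by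
      rw [← Equiv.sum_comp (Equiv.subLeft x), ← sum_add_sum_compl (A 2)]
      refine add_le_add (sum_le_sum fun c _ => min_le_right _ _) ?_
      refine (sum_le_sum fun c _ => min_le_left _ _).trans ?_
      rw [sum_const, card_compl, nsmul_eq_mul, ZMod.card, Nat.cast_sub (hcA 2), mul_comm]
    have e2 : (t : ℝ) * min (p : ℝ) (#(A 0) + #(A 1) - t) ≤ ∑ y, (min t (rep (A 0) (A 1) y) : ℝ) := by
      have := (Nat.cast_le (α := ℝ)).2 hP
      push_cast [Nat.cast_sub (le_trans (htA 0) (Nat.le_add_right _ #(A 1)))] at this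
      exact this
    have e3 : (p : ℝ) - #(A 2) + η * p ≤ min (p : ℝ) (#(A 0) + #(A 1) - t) := by
      refine le_min ?_ ?_ <;> nlinarith [hc 0, hc 1, hc 2, hs 2]
    nlinarith [mul_le_mul_of_nonneg_left e3 (Nat.cast_nonneg (α := ℝ) t)]
  have hm : ∑ c ∈ A 2, (rep (A 0) (A 1) (x - c) : ℝ) * η ^ 3 ≤ ∑ a, ∑ b, g 0 a * g 1 b * g 2 (x - a - b) := by
    have e1 : ∑ a, ∑ b, g 0 a * g 1 b * g 2 (x - a - b) = ∑ c, ∑ a, g 0 a * g 1 (x - c - a) * g 2 c := by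
      symm; rw [sum_comm]
      refine sum_congr rfl fun a _ => ?_
      rw [← Equiv.sum_comp (Equiv.subLeft (x - a))]
      refine sum_congr rfl fun c _ => ?_
      simp only [Equiv.subLeft_apply]
      rw [show x - (x - a - c) - a = c by ring]
    rw [e1]
    refine (sum_le_sum fun c hc => ?_).trans (sum_le_sum_of_subset_of_nonneg (subset_univ (A 2)) fun c _ _ =>
      sum_nonneg fun a _ => mul_nonneg (mul_nonneg (hg _ _) (hg _ _)) (hg _ _))
    unfold rep; push_cast; rw [sum_mul]
    refine sum_le_sum fun a _ => ?_
    have hη : ∀ i a, a ∈ A i → η ≤ g i a := fun i a h => by simpa [hA] using h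
    by_cases ha : a ∈ A 0
    · by_cases hb : x - c - a ∈ A 1
      · simp only [ha, hb, if_true]
        have := mul_le_mul (mul_le_mul (hη _ _ ha) (hη _ _ hb) h0.le (hg _ _)) (hη _ _ hc) h0.le (mul_nonneg (hg 0 a) (hg 1 (x-c-a)))
        linarith
      · simp only [hb, if_false]; simpa using mul_nonneg (mul_nonneg (hg 0 _) (hg 1 _)) (hg 2 _)
    · simp only [ha, if_false]; simpa using mul_nonneg (mul_nonneg (hg 0 _) (hg 1 _)) (hg 2 _)
  rw [← sum_mul] at hm
  refine le_trans ?_ hm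
  refine le_trans ?_ (mul_le_mul_of_nonneg_right hP2 (by positivity))
  have : η * p / 2 * (η * p) * η ^ 3 ≤ t * (η * p) * η ^ 3 := by gcongr
  linarith [this, show η * p / 2 * (η * p) * η ^ 3 = η ^ 5 / 2 * p ^ 2 by ring]
end

section
open MeasureTheory Filter Topology Set

noncomputable def fk (u : ℝ) : ℝ := ∫ t in (0:ℝ)..1, 2 * (1 - t) * Real.cos (t * u)

lemma fk_cont : Continuous fk := by
  unfold fk
  exact intervalIntegral.continuous_parametric_intervalIntegral_of_continuous' (by fun_prop) _ _

lemma fk_eq {u : ℝ} (hu : u ≠ 0) : fk u = 2 * (1 - Real.cos u) / u ^ 2 := by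
  unfold fk
  rw [intervalIntegral.integral_eq_sub_of_hasDerivAt
    (f := fun t => 2 * ((1 - t) * Real.sin (t * u) / u - Real.cos (t * u) / u ^ 2))]
  · simp; field_simp; ring
  · intro t _
    have h1 : HasDerivAt (fun t : ℝ => t * u) u t := by simpa using (hasDerivAt_id t).mul_const u
    have h2 : HasDerivAt (fun t : ℝ => 1 - t) (-1) t := by simpa using (hasDerivAt_id t).const_sub 1
    have := (((h2.mul h1.sin).div_const u).sub (h1.cos.div_const (u ^ 2))).const_mul 2
    refine this.congr_deriv ?_
    field_simp; ring
  · exact (by fun_prop : Continuous fun t : ℝ => 2 * (1 - t) * Real.cos (t * u)).intervalIntegrable _ _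

lemma fk_zero : fk 0 = 1 := by
  unfold fk
  simp only [mul_zero, Real.cos_zero, mul_one]
  rw [intervalIntegral.integral_eq_sub_of_hasDerivAt (f := fun t => 2 * t - t ^ 2)]
  · norm_num
  · intro t _
    have := ((hasDerivAt_id' t).const_mul 2).sub ((hasDerivAt_id' t).fun_pow 2)
    refine this.congr_deriv ?_
    norm_num; ring
  · exact (by fun_prop : Continuous fun t : ℝ => 2 * (1 - t)).intervalIntegrable _ _

lemma fk_nonneg (u : ℝ) : 0 ≤ fk u := by
  rcases eq_or_ne u 0 with rfl | h
  · simp [fk_zero]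
  · rw [fk_eq h]; have := Real.cos_le_one u
    exact div_nonneg (by linarith) (sq_nonneg _)

lemma fk_le (u : ℝ) : fk u ≤ 8 * (1 + u ^ 2)⁻¹ := by
  rcases eq_or_ne u 0 with rfl | h
  · simp [fk_zero]
  · rw [fk_eq h, ← div_eq_mul_inv, div_le_div_iff₀ (by positivity) (by positivity)]
    have h1 := Real.one_sub_sq_div_two_le_cos (x := u)
    have h2 := Real.neg_one_le_cos u
    nlinarith [sq_nonneg u, mul_nonneg (sq_nonneg u) (by linarith : (0:ℝ) ≤ 1 + Real.cos u)]

lemma fk_int : Integrable fk :=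
  (integrable_inv_one_add_sq.const_mul 8).mono' fk_cont.aestronglyMeasurable
    (ae_of_all _ fun u => by rw [Real.norm_of_nonneg (fk_nonneg u)]; exact fk_le u)

lemma fk_pos : 0 < ∫ u, fk u := by
  rw [integral_pos_iff_support_of_nonneg fk_nonneg fk_int]
  exact (fk_cont.isOpen_support).measure_pos volume ⟨0, by simp [fk_zero]⟩

lemma fk_int' {l : ℝ} (hl : 0 < l) (y : ℝ) : Integrable fun v => fk (l * (y - v)) :=
  ((integrable_comp_mul_left_iff fk hl.ne').2 fk_int).comp_sub_left y

lemma fk_re (u : ℝ) : fk u = (∫ t in Ioc (0:ℝ) 1, (2 * (1 - t) : ℂ) * Complex.exp (t * u * Complex.I)).re := by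
  have hi : Integrable (fun t : ℝ => (2 * (1 - t) : ℂ) * Complex.exp (t * u * Complex.I)) (volume.restrict (Ioc (0:ℝ) 1)) := by
    exact (Continuous.intervalIntegrable (by fun_prop) 0 1).1
  rw [fk, intervalIntegral.integral_of_le zero_le_one]
  have := integral_re hi
  simp only [RCLike.re_to_complex] at this
  rw [← this]
  congr 1; ext t
  have : (2 * (1 - t) : ℂ) = ((2 * (1 - t) : ℝ) : ℂ) := by push_cast; ring
  rw [this, Complex.re_ofReal_mul, ← Complex.ofReal_mul, Complex.exp_ofReal_mul_I_re]

lemma WI_eps (D : ℝ → ℝ) (hD : Measurable D) (C : ℝ) (hC : ∀ v, |D v| ≤ C) (H : ℂ → ℂ)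
    (hL : ∀ s : ℂ, 0 < s.re → ∫ v in Ioi (0:ℝ), (D v : ℂ) * Complex.exp (-s * v) = H s)
    (l y e : ℝ) (he : 0 < e) :
    ∫ v in Ioi (0:ℝ), D v * Real.exp (-e * v) * fk (l * (y - v)) =
    (∫ t in Ioc (0:ℝ) 1, (2 * (1 - t) : ℂ) * Complex.exp (t * (l * y) * Complex.I) * H (e + l * t * Complex.I)).re := by
  have hE : Integrable (fun v : ℝ => ((D v * Real.exp (-e * v) : ℝ) : ℂ)) (volume.restrict (Ioi 0)) := by
    refine Integrable.ofReal (f := fun v => D v * Real.exp (-e * v)) ?_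
    refine Integrable.mono' ((exp_neg_integrableOn_Ioi 0 he).const_mul C) (by fun_prop) (ae_of_all _ fun v => ?_)
    rw [norm_mul, Real.norm_eq_abs, Real.norm_of_nonneg (Real.exp_pos _).le]
    gcongr; exact hC v
  have hT : Integrable (fun t : ℝ => (2 * (1 - t) : ℂ)) (volume.restrict (Ioc (0:ℝ) 1)) :=
    (Continuous.intervalIntegrable (by fun_prop) 0 1).1
  have hP := hE.mul_prod hT
  have hP2 : Integrable (fun p : ℝ × ℝ => Complex.exp (p.2 * (l * (y - p.1) : ℝ) * Complex.I) * (((D p.1 * Real.exp (-e * p.1) : ℝ) : ℂ) * (2 * (1 - p.2))))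
      ((volume.restrict (Ioi 0)).prod (volume.restrict (Ioc (0:ℝ) 1))) := by
    refine hP.bdd_mul (c := 1) (by fun_prop) (ae_of_all _ fun p => ?_)
    rw [← Complex.ofReal_mul, Complex.norm_exp_ofReal_mul_I]
  have hsw := integral_integral_swap (f := fun v t : ℝ => Complex.exp (t * (l * (y - v) : ℝ) * Complex.I) * (((D v * Real.exp (-e * v) : ℝ) : ℂ) * (2 * (1 - t)))) hP2
  have e1 : ∀ v : ℝ, D v * Real.exp (-e * v) * fk (l * (y - v)) =
      (∫ t in Ioc (0:ℝ) 1, Complex.exp (t * (l * (y - v) : ℝ) * Complex.I) * (((D v * Real.exp (-e * v) : ℝ) : ℂ) * (2 * (1 - t)))).re := by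
    intro v
    rw [fk_re, ← Complex.re_ofReal_mul, ← integral_const_mul]
    congr 1; congr 1; ext t; ring
  simp_rw [e1]
  have := integral_re hP2.integral_prod_left
  simp only [RCLike.re_to_complex] at this
  rw [this, hsw]
  congr 1; congr 1; ext t
  rw [← hL _ (by simpa using he), ← integral_const_mul]
  congr 1; ext v
  push_cast
  have : Complex.exp (t * (l * (y - v)) * Complex.I) * Complex.exp (-e * v) =
     Complex.exp (t * (l * y) * Complex.I) * Complex.exp (-(e + l * t * Complex.I) * v) := by
    rw [← Complex.exp_add, ← Complex.exp_add]; congr 1; ring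
  linear_combination (D v : ℂ) * (2 * (1 - t)) * this

lemma WI_lim (D : ℝ → ℝ) (hD : Measurable D) (C : ℝ) (hC : ∀ v, |D v| ≤ C) (H : ℂ → ℂ)
    (hH : ContinuousOn H {s | 0 ≤ s.re})
    (hL : ∀ s : ℂ, 0 < s.re → ∫ v in Ioi (0:ℝ), (D v : ℂ) * Complex.exp (-s * v) = H s)
    (l y : ℝ) (hl : 0 < l) :
    ∫ v in Ioi (0:ℝ), D v * fk (l * (y - v)) =
    (∫ t in Ioc (0:ℝ) 1, (2 * (1 - t) : ℂ) * Complex.exp (t * (l * y) * Complex.I) * H (l * t * Complex.I)).re := by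
  have hlim1 : Tendsto (fun e : ℝ => ∫ v in Ioi (0:ℝ), D v * Real.exp (-e * v) * fk (l * (y - v))) (𝓝[>] 0)
      (𝓝 (∫ v in Ioi (0:ℝ), D v * fk (l * (y - v)))) := by
    refine tendsto_integral_filter_of_dominated_convergence (fun v => C * fk (l * (y - v))) ?_ ?_ ?_ ?_
    · refine Eventually.of_forall fun e => ?_
      have := fk_cont.measurable
      fun_prop
    · filter_upwards [self_mem_nhdsWithin] with e he
      filter_upwards [ae_restrict_mem measurableSet_Ioi] with v hv
      rw [norm_mul, norm_mul, Real.norm_eq_abs, Real.norm_of_nonneg (Real.exp_pos _).le,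
        Real.norm_of_nonneg (fk_nonneg _)]
      have : Real.exp (-e * v) ≤ 1 := by
        rw [Real.exp_le_one_iff]; nlinarith [mul_pos (mem_Ioi.1 he) (mem_Ioi.1 hv)]
      have h0 := fk_nonneg (l * (y - v))
      gcongr
      calc _ ≤ C * 1 := mul_le_mul (hC v) this (Real.exp_pos _).le ((abs_nonneg _).trans (hC v))
        _ = C := mul_one _
    · exact ((fk_int' hl y).const_mul C).restrict
    · refine ae_of_all _ fun v => ?_
      have : Tendsto (fun e : ℝ => D v * Real.exp (-e * v) * fk (l * (y - v))) (𝓝 0) (𝓝 (D v * Real.exp (-0 * v) * fk (l * (y - v)))) :=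
        Continuous.tendsto (by fun_prop) 0
      simpa using this.mono_left nhdsWithin_le_nhds
  have hK : IsCompact ((fun p : ℝ × ℝ => (p.1 + l * p.2 * Complex.I : ℂ)) '' (Icc 0 1 ×ˢ Icc 0 1)) :=
    (isCompact_Icc.prod isCompact_Icc).image (by fun_prop)
  obtain ⟨B, hB⟩ := hK.exists_bound_of_continuousOn (f := H) (hH.mono (by
    rintro _ ⟨p, hp, rfl⟩; simpa using hp.1.1))
  have hlim2 : Tendsto (fun e : ℝ => ∫ t in Ioc (0:ℝ) 1, (2 * (1 - t) : ℂ) * Complex.exp (t * (l * y) * Complex.I) * H (e + l * t * Complex.I)) (𝓝[>] 0)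
      (𝓝 (∫ t in Ioc (0:ℝ) 1, (2 * (1 - t) : ℂ) * Complex.exp (t * (l * y) * Complex.I) * H (l * t * Complex.I))) := by
    refine tendsto_integral_filter_of_dominated_convergence (fun v => 2 * B) ?_ ?_ ?_ ?_
    · filter_upwards [self_mem_nhdsWithin] with e he
      have h1 : Continuous fun t : ℝ => H (e + l * t * Complex.I) := by
        rw [continuous_iff_continuousAt]
        intro t
        have h1 : ContinuousAt H (e + l * t * Complex.I) := by
          refine hH.continuousAt ?_
          have : {s : ℂ | 0 < s.re} ∈ 𝓝 (e + l * t * Complex.I) :=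
            (isOpen_lt continuous_const Complex.continuous_re).mem_nhds (by simpa using he)
          exact mem_of_superset this fun s (hs : 0 < s.re) => hs.le
        exact ContinuousAt.comp' h1 (by fun_prop)
      exact (Continuous.mul (by fun_prop) h1).aestronglyMeasurable
    · have : Iio (1:ℝ) ∈ 𝓝[>] 0 := mem_nhdsWithin_of_mem_nhds (Iio_mem_nhds one_pos)
      filter_upwards [self_mem_nhdsWithin, this] with e he he1
      filter_upwards [ae_restrict_mem measurableSet_Ioc] with t ht
      have h2 := hB _ (mem_image_of_mem _ (show (e, t) ∈ Icc (0:ℝ) 1 ×ˢ Icc (0:ℝ) 1 from ⟨⟨(mem_Ioi.1 he).le, (mem_Iio.1 he1).le⟩, ht.1.le, ht.2⟩))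
      rw [norm_mul, norm_mul, ← Complex.ofReal_mul, ← Complex.ofReal_mul, Complex.norm_exp_ofReal_mul_I]
      have h3 : ‖(2 * (1 - t) : ℂ)‖ ≤ 2 := by
        have : (2 * (1 - t) : ℂ) = ((2 * (1 - t) : ℝ) : ℂ) := by push_cast; ring
        rw [this, Complex.norm_real, Real.norm_of_nonneg (by linarith [ht.2])]
        linarith [ht.1]
      rw [mul_one]
      exact mul_le_mul h3 h2 (norm_nonneg _) (by norm_num)
    · exact integrableOn_const (by simp)
    · filter_upwards [ae_restrict_mem measurableSet_Ioc] with t ht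
      refine Tendsto.const_mul _ ?_
      have h1 : Tendsto H (𝓝[{s | 0 ≤ s.re}] (l * t * Complex.I)) (𝓝 (H (l * t * Complex.I))) :=
        hH _ (by simp)
      refine h1.comp (tendsto_nhdsWithin_iff.2 ⟨?_, ?_⟩)
      · have : Tendsto (fun e : ℝ => (e + l * t * Complex.I : ℂ)) (𝓝 0) (𝓝 ((0:ℝ) + l * t * Complex.I : ℂ)) :=
          Continuous.tendsto (by fun_prop) 0
        simpa using this.mono_left nhdsWithin_le_nhds
      · filter_upwards [self_mem_nhdsWithin] with e he
        simpa using (mem_Ioi.1 he).le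
  refine tendsto_nhds_unique hlim1 (((Complex.continuous_re.tendsto _).comp hlim2).congr' ?_)
  filter_upwards [self_mem_nhdsWithin] with e he
  exact (WI_eps D hD C hC H hL l y e he).symm

lemma WI_core (D : ℝ → ℝ) (hD : Measurable D) (C : ℝ) (hC : ∀ v, |D v| ≤ C) (H : ℂ → ℂ)
    (hH : ContinuousOn H {s | 0 ≤ s.re})
    (hL : ∀ s : ℂ, 0 < s.re → ∫ v in Ioi (0:ℝ), (D v : ℂ) * Complex.exp (-s * v) = H s)
    (l : ℝ) (hl : 0 < l) :
    Tendsto (fun y => ∫ v in Ioi (0:ℝ), D v * fk (l * (y - v))) atTop (𝓝 0) := by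
  have h := Real.tendsto_integral_exp_smul_cocompact
    (indicator (Ioc (0:ℝ) 1) fun t : ℝ => (2 * (1 - t) : ℂ) * H (l * t * Complex.I))
  have h2 : Tendsto (fun y : ℝ => -(l * y / (2 * Real.pi))) atTop (cocompact ℝ) := by
    rw [cocompact_eq_atBot_atTop]
    refine Tendsto.mono_right ?_ le_sup_left
    refine tendsto_neg_atTop_atBot.comp ?_
    exact (tendsto_id.const_mul_atTop hl).atTop_div_const (by positivity)
  have h3 := (Complex.continuous_re.tendsto _).comp (h.comp h2)
  rw [Complex.zero_re] at h3
  refine h3.congr fun y => ?_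
  rw [WI_lim D hD C hC H hH hL l y hl, ← integral_indicator measurableSet_Ioc]
  simp only [Function.comp]
  congr 2; ext t
  by_cases ht : t ∈ Ioc (0:ℝ) 1
  · simp only [indicator_of_mem ht]
    rw [Circle.smul_def, Real.fourierChar_apply, smul_eq_mul]
    have : (2 * Real.pi * -(t * -(l * y / (2 * Real.pi))) : ℝ) = t * (l * y) := by
      field_simp
    rw [this]
    push_cast; ring
  · simp [indicator_of_notMem ht]
end

section
open MeasureTheory Filter Topology Set

lemma fk_J (l y h : ℝ) (hl : 0 < l) : l * ∫ v in y..(y+h), fk (l * (y + h/2 - v)) = ∫ u in (-(l*h/2))..(l*h/2), fk u := by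
  have := intervalIntegral.integral_comp_sub_left (a := y) (b := y + h) (fun v => fk (l * v)) (y + h/2)
  rw [this, intervalIntegral.integral_comp_mul_left _ hl.ne', smul_eq_mul, mul_inv_cancel_left₀ hl.ne']
  congr 1 <;> ring

lemma fk_I (l y : ℝ) (hl : 0 < l) : l * ∫ v, fk (l * (y - v)) = ∫ u, fk u := by
  have := integral_sub_left_eq_self (fun v => fk (l * v)) volume y
  rw [this, Measure.integral_comp_mul_left, smul_eq_mul, abs_of_pos (by positivity), mul_inv_cancel_left₀ hl.ne']

lemma taub1 (B : ℝ → ℝ) (hm : Measurable B) (C A : ℝ) (hA : 0 ≤ A) (hB : ∀ v, 0 ≤ B v ∧ B v ≤ C)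
    (hmono : ∀ v w, v ≤ w → Real.exp v * B v ≤ Real.exp w * B w) (l y h : ℝ) (hl : 0 < l) (hy : 0 < y) (hh : 0 < h) :
    B y * Real.exp (-h) * (∫ u in (-(l*h/2))..(l*h/2), fk u) - A * (∫ u, fk u) ≤
      l * ∫ v in Ioi (0:ℝ), (B v - A) * fk (l * (y + h/2 - v)) := by
  set Y := y + h/2
  have hi := fk_int' hl Y
  have hfm := fk_cont.measurable
  have hi2 : Integrable (fun v => (B v - A) * fk (l * (Y - v))) := by
    refine hi.bdd_mul (c := C + A) (by fun_prop) (ae_of_all _ fun v => ?_)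
    rw [Real.norm_eq_abs, abs_le]; constructor <;> linarith [hB v]
  have hi3 : Integrable (indicator (Ioc y (y+h)) fun v => fk (l * (Y - v))) := hi.indicator measurableSet_Ioc
  have h1 : ∫ v in Ioi (0:ℝ), (B y * Real.exp (-h) * (indicator (Ioc y (y+h)) (fun v => fk (l * (Y - v))) v) - A * fk (l * (Y - v))) ≤
      ∫ v in Ioi (0:ℝ), (B v - A) * fk (l * (Y - v)) := by
    refine integral_mono (((hi3.const_mul _).sub (hi.const_mul _)).restrict) hi2.restrict fun v => ?_
    have hk := fk_nonneg (l * (Y - v))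
    simp only [indicator]
    split_ifs with hv
    · have h2 := hmono y v hv.1.le
      have h3 : B y * Real.exp (-h) ≤ B v := by
        have : Real.exp (-v) * (Real.exp y * B y) ≤ B v := by
          calc _ ≤ Real.exp (-v) * (Real.exp v * B v) := by gcongr
            _ = B v := by rw [← mul_assoc, ← Real.exp_add]; simp
        refine le_trans ?_ this
        rw [← mul_assoc, ← Real.exp_add, mul_comm]
        have := (hB y).1
        gcongr; linarith [hv.2]
      linarith [mul_le_mul_of_nonneg_right h3 hk]
    · have := mul_nonneg (hB v).1 hk
      linarith
  rw [integral_sub ((hi3.const_mul _).restrict) (hi.const_mul _).restrict, integral_const_mul, integral_const_mul,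
    setIntegral_indicator measurableSet_Ioc, inter_eq_right.2 (show Ioc y (y+h) ⊆ Ioi 0 from fun v hv => lt_trans hy hv.1),
    ← intervalIntegral.integral_of_le (by linarith)] at h1
  have h4 : ∫ v in Ioi (0:ℝ), fk (l * (Y - v)) ≤ ∫ v, fk (l * (Y - v)) :=
    setIntegral_le_integral hi (ae_of_all _ fun v => fk_nonneg _)
  rw [← fk_J l y h hl, ← fk_I l Y hl]
  have := mul_le_mul_of_nonneg_left h1 hl.le
  have := mul_le_mul_of_nonneg_left h4 (mul_nonneg hl.le hA)
  linarith

lemma taub2 (B : ℝ → ℝ) (hm : Measurable B) (C A : ℝ) (hA : 0 ≤ A) (hB : ∀ v, 0 ≤ B v ∧ B v ≤ C)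
    (hmono : ∀ v w, v ≤ w → Real.exp v * B v ≤ Real.exp w * B w) (l y h : ℝ) (hl : 0 < l) (hy : 0 < y) (hh : 0 < h) :
      l * ∫ v in Ioi (0:ℝ), (B v - A) * fk (l * (y + h/2 - v)) ≤ 
    B (y + h) * Real.exp h * (∫ u, fk u) - A * (∫ u in (-(l*h/2))..(l*h/2), fk u) + C * ((∫ u, fk u) - ∫ u in (-(l*h/2))..(l*h/2), fk u):= by
  set Y := y + h/2
  have hi := fk_int' hl Y
  have hfm := fk_cont.measurable
  have hi2 : Integrable (fun v => (B v - A) * fk (l * (Y - v))) := by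
    refine hi.bdd_mul (c := C + A) (by fun_prop) (ae_of_all _ fun v => ?_)
    rw [Real.norm_eq_abs, abs_le]; constructor <;> linarith [hB v]
  have hi3 : Integrable (indicator (Ioc y (y+h)) fun v => fk (l * (Y - v))) := hi.indicator measurableSet_Ioc
  have hC := (hB 0).1.trans (hB 0).2
  have hp := mul_nonneg (hB (y + h)).1 (Real.exp_pos h).le
  have h1 : ∫ v in Ioi (0:ℝ), (B v - A) * fk (l * (Y - v)) ≤
      ∫ v in Ioi (0:ℝ), ((B (y+h) * Real.exp h + C) * fk (l * (Y - v)) - (A + C) * (indicator (Ioc y (y+h)) (fun v => fk (l * (Y - v))) v)) := by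
    refine integral_mono hi2.restrict (((hi.const_mul _).sub (hi3.const_mul _)).restrict) fun v => ?_
    have hk := fk_nonneg (l * (Y - v))
    simp only [indicator]
    split_ifs with hv
    · have h2 := hmono v (y + h) hv.2
      have h3 : B v ≤ B (y+h) * Real.exp h := by
        have : B v ≤ Real.exp (-v) * (Real.exp (y+h) * B (y+h)) := by
          calc B v = Real.exp (-v) * (Real.exp v * B v) := by rw [← mul_assoc, ← Real.exp_add]; simp
            _ ≤ _ := by gcongr
        refine this.trans ?_
        rw [← mul_assoc, ← Real.exp_add, mul_comm]
        have := (hB (y+h)).1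
        gcongr; linarith [hv.1]
      linarith [mul_le_mul_of_nonneg_right h3 hk]
    · have := mul_nonneg (sub_nonneg.2 (hB v).2) hk
      have := mul_nonneg hA hk
      have := mul_nonneg hp hk
      linarith
  rw [integral_sub (hi.const_mul _).restrict ((hi3.const_mul _).restrict), integral_const_mul, integral_const_mul,
    setIntegral_indicator measurableSet_Ioc, inter_eq_right.2 (show Ioc y (y+h) ⊆ Ioi 0 from fun v hv => lt_trans hy hv.1),
    ← intervalIntegral.integral_of_le (by linarith)] at h1
  have h4 : ∫ v in Ioi (0:ℝ), fk (l * (Y - v)) ≤ ∫ v, fk (l * (Y - v)) :=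
    setIntegral_le_integral hi (ae_of_all _ fun v => fk_nonneg _)
  rw [← fk_J l y h hl, ← fk_I l Y hl]
  have := mul_le_mul_of_nonneg_left h1 hl.le
  have := mul_le_mul_of_nonneg_left h4 (mul_nonneg hl.le (add_nonneg hp hC))
  linarith

lemma taub (B : ℝ → ℝ) (hm : Measurable B) (C A : ℝ) (hA : 0 ≤ A) (hB : ∀ v, 0 ≤ B v ∧ B v ≤ C)
    (hmono : ∀ v w, v ≤ w → Real.exp v * B v ≤ Real.exp w * B w)
    (hlim : ∀ l > 0, Tendsto (fun y => ∫ v in Ioi (0:ℝ), (B v - A) * fk (l * (y - v))) atTop (𝓝 0)) :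
    Tendsto B atTop (𝓝 A) := by
  have hI := fk_pos
  set I := ∫ u, fk u with hIdef
  have hC := (hB 0).1.trans (hB 0).2
  rw [Metric.tendsto_nhds]
  intro ε hε
  have c1 : Tendsto (fun x : ℝ => Real.exp x * (A * I + x) / (I - x)) (𝓝[>] 0) (𝓝 A) := by
    have : ContinuousAt (fun x : ℝ => Real.exp x * (A * I + x) / (I - x)) 0 := by
      refine ContinuousAt.div (by fun_prop) (by fun_prop) (by simpa using hI.ne')
    have h2 := this.tendsto.mono_left (nhdsWithin_le_nhds (s := Ioi 0))
    simpa [hI.ne'] using h2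
  have c2 : Tendsto (fun x : ℝ => Real.exp (-x) * (A * (I - x) - C * x - x) / I) (𝓝[>] 0) (𝓝 A) := by
    have : ContinuousAt (fun x : ℝ => Real.exp (-x) * (A * (I - x) - C * x - x) / I) 0 := by fun_prop
    have h2 := this.tendsto.mono_left (nhdsWithin_le_nhds (s := Ioi 0))
    simpa [hI.ne'] using h2
  have c3 : Iio I ∈ 𝓝[>] (0:ℝ) := mem_nhdsWithin_of_mem_nhds (Iio_mem_nhds hI)
  obtain ⟨x, ⟨⟨hx1, hx2⟩, hx3⟩, hx0⟩ := (((c1.eventually (Iio_mem_nhds (show A < A + ε by linarith))).and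
    (c2.eventually (Ioi_mem_nhds (show A - ε < A by linarith)))).and c3 |>.and self_mem_nhdsWithin).exists
  have c4 : Tendsto (fun l : ℝ => ∫ u in (-(l*x/2))..(l*x/2), fk u) atTop (𝓝 I) := by
    have : Tendsto (fun l : ℝ => l*x/2) atTop atTop := (tendsto_id.atTop_mul_const hx0).atTop_div_const two_pos
    exact intervalIntegral_tendsto_integral fk_int (tendsto_neg_atTop_atBot.comp this) this
  obtain ⟨l, hl, hJ⟩ := ((eventually_gt_atTop 0).and (c4.eventually (Ioi_mem_nhds (show I - x < I by linarith)))).exists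
  set J := ∫ u in (-(l*x/2))..(l*x/2), fk u with hJdef
  have hJI : J ≤ I := by
    rw [hJdef, intervalIntegral.integral_of_le (by nlinarith)]
    exact setIntegral_le_integral fk_int (ae_of_all _ fun v => fk_nonneg _)
  have h0 : Tendsto (fun y => l * ∫ v in Ioi (0:ℝ), (B v - A) * fk (l * (y + x/2 - v))) atTop (𝓝 0) := by
    have := ((hlim l hl).comp (tendsto_atTop_add_const_right atTop (x/2) tendsto_id)).const_mul l
    simpa using this
  have h0' := h0.comp (tendsto_atTop_add_const_right atTop (-x) tendsto_id)
  filter_upwards [eventually_gt_atTop x, h0.eventually (Iio_mem_nhds hx0), h0'.eventually (Ioi_mem_nhds (neg_lt_zero.2 hx0))] with y hy k1 k2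
  simp only [Function.comp, id, mem_Iio, mem_Ioi] at k1 k2
  have t1 := taub1 B hm C A hA hB hmono l y x hl (by linarith) hx0
  have t2 := taub2 B hm C A hA hB hmono l (y + -x) x hl (by linarith) hx0
  rw [← hJdef, ← hIdef] at t1 t2
  rw [neg_add_cancel_right] at t2
  have hb := (hB y).1
  rw [Real.dist_eq, abs_lt]
  constructor
  · have : A - ε < B y := by
      refine hx2.trans_le ?_
      rw [div_le_iff₀ hI, Real.exp_neg, inv_mul_le_iff₀ (Real.exp_pos _)]
      have : A * (I - x) ≤ A * J := by gcongr
      have : C * (I - J) ≤ C * x := by gcongr; linarith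
      linarith
    linarith
  · have : B y < A + ε := by
      refine lt_of_le_of_lt ?_ hx1
      rw [le_div_iff₀ (by linarith)]
      have h3 : B y * Real.exp (-x) * (I - x) ≤ A * I + x := by
        have : B y * Real.exp (-x) * (I - x) ≤ B y * Real.exp (-x) * J := by gcongr
        linarith
      calc B y * (I - x) = Real.exp x * (B y * Real.exp (-x) * (I - x)) := by
            rw [Real.exp_neg]; field_simp
        _ ≤ _ := by gcongr
    linarith
end

section
open MeasureTheory Filter Topology Set
open ArithmeticFunction.vonMangoldt (residueClass residueClass_nonneg residueClass_le LFunctionResidueClassAux)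

noncomputable def SB {q : ℕ} (a : ZMod q) (x : ℝ) : ℝ := ∑ k ∈ Finset.Icc 1 ⌊x⌋₊, residueClass a k

lemma SB_nonneg {q : ℕ} (a : ZMod q) (x : ℝ) : 0 ≤ SB a x :=
  Finset.sum_nonneg fun _ _ => residueClass_nonneg a _

lemma SB_mono {q : ℕ} (a : ZMod q) : Monotone (SB a) := fun _ _ h =>
  Finset.sum_le_sum_of_subset_of_nonneg (Finset.Icc_subset_Icc_right (Nat.floor_mono h))
    fun _ _ _ => residueClass_nonneg a _

lemma SB_le {q : ℕ} (a : ZMod q) {x : ℝ} (hx : 0 ≤ x) : SB a x ≤ (Real.log 4 + 4) * x := by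
  refine le_trans ?_ (Chebyshev.psi_le_const_mul_self hx)
  rw [Chebyshev.psi]
  exact Finset.sum_le_sum fun _ _ => residueClass_le a _

lemma exp_Ioi : Real.exp '' Ioi 0 = Ioi 1 := by
  ext x; constructor
  · rintro ⟨y, hy, rfl⟩; exact Real.one_lt_exp_iff.2 hy
  · intro hx; exact ⟨Real.log x, Real.log_pos hx, Real.exp_log (by linarith [mem_Ioi.1 hx])⟩

lemma SB_laplace {q : ℕ} [NeZero q] {a : ZMod q} (ha : IsUnit a) (s : ℂ) (hs : 0 < s.re) :
    ∫ v in Ioi (0:ℝ), ((Real.exp (-v) * SB a (Real.exp v) - (q.totient : ℝ)⁻¹ : ℝ) : ℂ) * Complex.exp (-s * v) =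
      (LFunctionResidueClassAux a (s + 1) - (q.totient : ℂ)⁻¹) / (s + 1) := by
  have hs1 : 1 < (s + 1).re := by simpa using hs
  rw [ArithmeticFunction.vonMangoldt.eqOn_LFunctionResidueClassAux ha hs1]
  have hO : (fun n : ℕ => ∑ k ∈ Finset.Icc 1 n, residueClass a k) =O[atTop] fun n : ℕ => (n : ℝ) ^ (1:ℝ) := by
    refine Asymptotics.IsBigO.of_bound (Real.log 4 + 4) (Eventually.of_forall fun n => ?_)
    have h1 := SB_le a (Nat.cast_nonneg (α := ℝ) n)
    have h2 := SB_nonneg a n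
    rw [SB, Nat.floor_natCast] at h1 h2
    rw [Real.norm_of_nonneg h2, Real.rpow_one, Real.norm_of_nonneg (Nat.cast_nonneg _)]
    exact h1
  have hl := LSeries_eq_mul_integral_of_nonneg (residueClass a) zero_le_one hs1 hO (residueClass_nonneg a)
  rw [← exp_Ioi, integral_image_eq_integral_abs_deriv_smul measurableSet_Ioi
    (fun x _ => (Real.hasDerivAt_exp x).hasDerivWithinAt) Real.exp_injective.injOn] at hl
  have e1 : ∀ v : ℝ, |Real.exp v| • ((∑ k ∈ Finset.Icc 1 ⌊Real.exp v⌋₊, (residueClass a k : ℂ)) *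
      (Real.exp v : ℂ) ^ (-(s + 1 + 1))) = ((Real.exp (-v) * SB a (Real.exp v) : ℝ) : ℂ) * Complex.exp (-s * v) := by
    intro v
    rw [abs_of_pos (Real.exp_pos v), Complex.real_smul, SB, Complex.ofReal_mul, Complex.ofReal_sum,
      Complex.cpow_def_of_ne_zero (by simp), ← Complex.ofReal_log (Real.exp_pos v).le, Real.log_exp]
    have : ((Real.exp v : ℝ) : ℂ) * Complex.exp (v * -(s + 1 + 1)) = ((Real.exp (-v) : ℝ) : ℂ) * Complex.exp (-s * v) := by
      push_cast; rw [← Complex.exp_add, ← Complex.exp_add]; congr 1; ring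
    linear_combination (∑ k ∈ Finset.Icc 1 ⌊Real.exp v⌋₊, (residueClass a k : ℂ)) * this
  simp only [e1] at hl
  have hn : ∀ v : ℝ, ‖Complex.exp (-s * v)‖ = Real.exp (-s.re * v) := by
    intro v; rw [Complex.norm_exp]; simp
  have hce : Integrable (fun v : ℝ => Complex.exp (-s * v)) (volume.restrict (Ioi 0)) := by
    refine Integrable.mono' (exp_neg_integrableOn_Ioi 0 hs) (Continuous.aestronglyMeasurable (by fun_prop)) (ae_of_all _ fun v => (hn v).le)
  have hB : Integrable (fun v : ℝ => ((Real.exp (-v) * SB a (Real.exp v) : ℝ) : ℂ) * Complex.exp (-s * v)) (volume.restrict (Ioi 0)) := by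
    refine hce.bdd_mul (c := Real.log 4 + 4) ?_ (ae_of_all _ fun v => ?_)
    · have := (SB_mono a).measurable
      exact Measurable.aestronglyMeasurable (by fun_prop)
    · rw [Complex.norm_real, Real.norm_of_nonneg (mul_nonneg (Real.exp_pos _).le (SB_nonneg _ _)), Real.exp_neg,
        inv_mul_le_iff₀ (Real.exp_pos _), mul_comm]
      exact SB_le a (Real.exp_pos v).le
  have h3 : ∫ v in Ioi (0:ℝ), Complex.exp (-s * v) = 1 / s := by
    have := integral_exp_mul_complex_Ioi (a := -s) (by simpa using hs) 0
    rw [this]; simp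
  have hs0 : s ≠ 0 := by rintro rfl; simp at hs
  have hs2 : s + 1 ≠ 0 := by intro h; rw [h] at hs1; simp at hs1; linarith
  simp only [Complex.ofReal_sub, sub_mul]
  rw [integral_sub hB (hce.const_mul _), integral_const_mul, h3, hl]
  rw [add_sub_cancel_right]
  generalize (∫ x in Ioi (0:ℝ), ((Real.exp (-x) * SB a (Real.exp x) : ℝ) : ℂ) * Complex.exp (-s * x)) = X
  push_cast
  generalize (q.totient : ℂ)⁻¹ = Y
  field_simp
  ring

lemma pnt_psi {q : ℕ} [NeZero q] {a : ZMod q} (ha : IsUnit a) :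
    Tendsto (fun n : ℕ => SB a n / n) atTop (𝓝 (q.totient : ℝ)⁻¹) := by
  have hm := (SB_mono a).measurable
  have hB : ∀ v : ℝ, 0 ≤ Real.exp (-v) * SB a (Real.exp v) ∧ Real.exp (-v) * SB a (Real.exp v) ≤ Real.log 4 + 4 := fun v =>
    ⟨mul_nonneg (Real.exp_pos _).le (SB_nonneg _ _), by
      rw [Real.exp_neg, inv_mul_le_iff₀ (Real.exp_pos _), mul_comm]; exact SB_le a (Real.exp_pos v).le⟩
  have hA : (0:ℝ) ≤ (q.totient : ℝ)⁻¹ := by positivity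
  have := taub (fun v => Real.exp (-v) * SB a (Real.exp v)) (by fun_prop) (Real.log 4 + 4) (q.totient : ℝ)⁻¹ hA hB
    (fun v w h => by
      simp only [← mul_assoc, ← Real.exp_add, add_neg_cancel, Real.exp_zero, one_mul]
      exact SB_mono a (Real.exp_le_exp.2 h))
    (fun l hl => by
      refine WI_core (fun v => Real.exp (-v) * SB a (Real.exp v) - (q.totient : ℝ)⁻¹) (by fun_prop)
        (Real.log 4 + 4 + (q.totient : ℝ)⁻¹) (fun v => by rw [abs_le]; constructor <;> linarith [hB v])
        (fun s => (LFunctionResidueClassAux a (s + 1) - (q.totient : ℂ)⁻¹) / (s + 1)) ?_ (SB_laplace ha) l hl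
      refine ContinuousOn.div (ContinuousOn.sub ?_ continuousOn_const) (by fun_prop) ?_
      · refine (ArithmeticFunction.vonMangoldt.continuousOn_LFunctionResidueClassAux a).comp (by fun_prop) fun s hs => ?_
        simpa using hs
      · intro s hs h
        have : (s + 1).re = 0 := by rw [h]; rfl
        simp at this hs; linarith)
  have h2 := this.comp (Real.tendsto_log_atTop.comp tendsto_natCast_atTop_atTop)
  refine h2.congr' ?_
  filter_upwards [eventually_gt_atTop 0] with n hn
  have hn' : (0:ℝ) < n := by exact_mod_cast hn
  simp only [Function.comp]
  rw [Real.exp_neg, Real.exp_log hn']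
  field_simp

noncomputable def thetaAP (q : ℕ) (a : ZMod q) (n : ℕ) : ℝ :=
  ∑ p ∈ (Finset.range (n + 1)).filter (fun p : ℕ => p.Prime ∧ (p : ZMod q) = a), Real.log p

lemma pnt_ap {q : ℕ} [NeZero q] {a : ZMod q} (ha : IsUnit a) :
    Tendsto (fun n : ℕ => thetaAP q a n / n) atTop (𝓝 (q.totient : ℝ)⁻¹) := by
  have h1 := pnt_psi ha
  obtain ⟨C, hC⟩ := Chebyshev.psi_sub_theta_le_mul_sqrt
  have hlow : ∀ n : ℕ, thetaAP q a n ≤ SB a n ∧ SB a n - thetaAP q a n ≤ Chebyshev.psi n - Chebyshev.theta n := by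
    intro n
    have hS : SB a n = ∑ k ∈ Finset.Icc 1 n, if (k : ZMod q) = a then ArithmeticFunction.vonMangoldt k else 0 := by
      rw [SB, Nat.floor_natCast]
      exact Finset.sum_congr rfl fun k _ => by simp [residueClass, indicator]
    have hT : thetaAP q a n = ∑ k ∈ Finset.Icc 1 n, if k.Prime ∧ (k : ZMod q) = a then ArithmeticFunction.vonMangoldt k else 0 := by
      rw [thetaAP, Finset.sum_filter, Finset.range_eq_Ico, Finset.sum_eq_sum_Ico_succ_bot (by omega)]
      simp only [Nat.not_prime_zero, false_and, if_false, zero_add]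
      refine Finset.sum_congr (by ext; simp) fun k _ => ?_
      split_ifs with h
      · rw [ArithmeticFunction.vonMangoldt_apply_prime h.1]
      · rfl
    have hp : Chebyshev.psi n = ∑ k ∈ Finset.Icc 1 n, ArithmeticFunction.vonMangoldt k := by
      rw [Chebyshev.psi, Nat.floor_natCast]; rfl
    have ht : Chebyshev.theta n = ∑ k ∈ Finset.Icc 1 n, if k.Prime then ArithmeticFunction.vonMangoldt k else 0 := by
      rw [Chebyshev.theta, Nat.floor_natCast, Finset.sum_filter]
      refine Finset.sum_congr rfl fun k _ => ?_
      split_ifs with h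
      · rw [ArithmeticFunction.vonMangoldt_apply_prime h]
      · rfl
    rw [hS, hT, hp, ht, ← Finset.sum_sub_distrib, ← Finset.sum_sub_distrib]
    constructor <;> refine Finset.sum_le_sum fun k _ => ?_ <;>
    · have := ArithmeticFunction.vonMangoldt_nonneg (n := k)
      by_cases h1 : k.Prime <;> by_cases h2 : (k : ZMod q) = a <;> simp [h1, h2, this]
  have h2 : Tendsto (fun n : ℕ => SB a n / n - C * (Real.sqrt n)⁻¹) atTop (𝓝 ((q.totient : ℝ)⁻¹ - C * 0)) :=
    h1.sub ((tendsto_inv_atTop_zero.comp (Real.tendsto_sqrt_atTop.comp tendsto_natCast_atTop_atTop)).const_mul C)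
  rw [mul_zero, sub_zero] at h2
  refine tendsto_of_tendsto_of_tendsto_of_le_of_le' h2 h1 ?_ ?_
  · filter_upwards [eventually_gt_atTop 0] with n hn
    have hn' : (0:ℝ) < n := by exact_mod_cast hn
    have h3 := (hlow n).2.trans (hC n)
    rw [le_div_iff₀ hn', sub_mul, div_mul_cancel₀ _ hn'.ne']
    have : (Real.sqrt n)⁻¹ * n = Real.sqrt n := by
      rw [inv_mul_eq_div, Real.div_sqrt]
    rw [mul_assoc, this]; linarith
  · exact Eventually.of_forall fun n => div_le_div_of_nonneg_right (hlow n).1 (Nat.cast_nonneg n)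
end

section
open Finset

noncomputable def EE (k : ℕ) (P : Finset ℕ) (x : ℕ → ℝ) : ℝ :=
  ∑ s ∈ P.powerset, (if #s < k then (-1 : ℝ) ^ #s else 0) * ∏ p ∈ s, x p

noncomputable def ee (k : ℕ) (P : Finset ℕ) (x : ℕ → ℝ) : ℝ :=
  ∑ s ∈ P.powerset, (if #s = k then (1 : ℝ) else 0) * ∏ p ∈ s, x p

lemma EE_zero (P x) : EE 0 P x = 0 := by simp [EE]

lemma EE_insert (k : ℕ) (P : Finset ℕ) (q : ℕ) (hq : q ∉ P) (x : ℕ → ℝ) :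
    EE (k + 1) (insert q P) x = EE (k + 1) P x - x q * EE k P x := by
  unfold EE
  rw [sum_powerset_insert hq, mul_sum, sub_eq_add_neg, ← sum_neg_distrib]
  congr 1
  refine sum_congr rfl fun s hs => ?_
  have h1 : q ∉ s := fun h => hq (mem_powerset.1 hs h)
  rw [card_insert_of_notMem h1, prod_insert h1]
  simp only [Nat.add_lt_add_iff_right]
  split_ifs
  · rw [pow_succ]; ring
  · ring

lemma ee_insert (k : ℕ) (P : Finset ℕ) (q : ℕ) (hq : q ∉ P) (x : ℕ → ℝ) :
    ee (k + 1) (insert q P) x = ee (k + 1) P x + x q * ee k P x := by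
  unfold ee
  rw [sum_powerset_insert hq, mul_sum]
  congr 1
  refine sum_congr rfl fun s hs => ?_
  have h1 : q ∉ s := fun h => hq (mem_powerset.1 hs h)
  rw [card_insert_of_notMem h1, prod_insert h1]
  simp only [Nat.add_right_cancel_iff]
  ring

lemma ee_zero (P x) : ee 0 P x = 1 := by
  unfold ee
  rw [sum_eq_single ∅] <;> simp
  intro s _ h1 h2; exact absurd h2 h1

lemma ee_empty (k x) : ee (k+1) ∅ x = 0 := by simp [ee]

lemma ee_nonneg (k P) (x : ℕ → ℝ) (hx : ∀ p, 0 ≤ x p) : 0 ≤ ee k P x :=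
  sum_nonneg fun s _ => mul_nonneg (by split_ifs <;> norm_num) (prod_nonneg fun p _ => hx p)

lemma bonf (P : Finset ℕ) (x : ℕ → ℝ) (hx : ∀ p, 0 ≤ x p ∧ x p ≤ 1) : ∀ k,
    0 ≤ (-1 : ℝ) ^ k * (∏ p ∈ P, (1 - x p) - EE k P x) ∧
    (-1 : ℝ) ^ k * (∏ p ∈ P, (1 - x p) - EE k P x) ≤ ee k P x := by
  induction P using Finset.induction_on with
  | empty =>
    intro k
    rcases k with _ | k
    · simp [EE, ee]
    · simp [EE, ee]
  | insert q P hq ih =>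
    intro k
    rcases k with _ | k
    · simp only [EE_zero, ee_zero, pow_zero, one_mul, sub_zero]
      exact ⟨prod_nonneg fun p _ => by linarith [hx p], prod_le_one (fun p _ => by linarith [hx p]) fun p _ => by linarith [hx p]⟩
    · rw [EE_insert k P q hq, ee_insert k P q hq, prod_insert hq]
      have h1 := ih (k+1)
      have h2 := ih k
      have e : (-1 : ℝ) ^ (k+1) * ((1 - x q) * ∏ p ∈ P, (1 - x p) - (EE (k+1) P x - x q * EE k P x)) =
        (-1 : ℝ) ^ (k+1) * (∏ p ∈ P, (1 - x p) - EE (k+1) P x) + x q * ((-1 : ℝ) ^ k * (∏ p ∈ P, (1 - x p) - EE k P x)) := by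
        rw [pow_succ]; ring
      rw [e]
      have h3 := mul_nonneg (hx q).1 h2.1
      have h4 := mul_le_mul_of_nonneg_left h2.2 (hx q).1
      exact ⟨by linarith, by linarith⟩

lemma ee_le (P : Finset ℕ) (x : ℕ → ℝ) (hx : ∀ p, 0 ≤ x p) : ∀ k, ee k P x ≤ (∑ p ∈ P, x p) ^ k / k.factorial := by
  induction P using Finset.induction_on with
  | empty => intro k; rcases k with _ | k <;> simp [ee]
  | insert q P hq ih =>
    intro k
    rcases k with _ | k
    · simp [ee_zero]
    · rw [ee_insert k P q hq, sum_insert hq]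
      set S := ∑ p ∈ P, x p
      have hS : 0 ≤ S := sum_nonneg fun p _ => hx p
      have h1 := ih (k+1)
      have h2 := mul_le_mul_of_nonneg_left (ih k) (hx q)
      refine (add_le_add h1 h2).trans ?_
      have h3 : S ^ (k+1) + (k+1) * (x q * S ^ k) ≤ (x q + S) ^ (k+1) := by
        have : ∀ m : ℕ, S ^ m * (S + (m+1) * x q) ≤ (x q + S) ^ (m + 1) := by
          intro m
          induction m with
          | zero => simp; linarith
          | succ m ihm =>
            rw [pow_succ (x q + S)]
            refine le_trans ?_ (mul_le_mul_of_nonneg_right ihm (add_nonneg (hx q) hS))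
            have hh : 0 ≤ S ^ m * (m+1) * (x q) ^ 2 := by positivity
            rw [pow_succ]; push_cast; nlinarith
        have := this k
        rw [pow_succ]; linarith
      have hk : (0:ℝ) < k.factorial := by positivity
      rw [Nat.factorial_succ, Nat.cast_mul, mul_div_assoc', div_add_div _ _ (by positivity) (by positivity),
        div_le_div_iff₀ (by positivity) (by positivity)]
      push_cast
      have := mul_le_mul_of_nonneg_right h3 (show (0:ℝ) ≤ k.factorial * ((k+1) * k.factorial) by positivity)
      nlinarith

/-- splitting sums over subsets of a disjoint union -/
lemma sum_pow_union (A B : Finset ℕ) (h : Disjoint A B) (f g : Finset ℕ → ℝ) :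
    ∑ D ∈ (A ∪ B).powerset, f (D ∩ A) * g (D ∩ B) = (∑ D ∈ A.powerset, f D) * ∑ D ∈ B.powerset, g D := by
  rw [sum_mul_sum, ← sum_product']
  refine sum_nbij' (fun D => (D ∩ A, D ∩ B)) (fun p => p.1 ∪ p.2) ?_ ?_ ?_ ?_ ?_
  · intro D _; simp
  · intro p hp; simp only [mem_product, mem_powerset] at hp ⊢; exact union_subset_union hp.1 hp.2
  · intro D hD; simp only; rw [← inter_union_distrib_left]; exact inter_eq_left.2 (mem_powerset.1 hD)
  · rintro ⟨s, t⟩ hp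
    simp only [mem_product, mem_powerset] at hp
    have h1 : t ∩ A = ∅ := disjoint_iff_inter_eq_empty.1 (h.symm.mono_left hp.2)
    have h2 : s ∩ B = ∅ := disjoint_iff_inter_eq_empty.1 (h.mono_left hp.1)
    simp only [union_inter_distrib_right, h1, h2, union_empty, empty_union, inter_eq_left.2 hp.1, inter_eq_left.2 hp.2]
  · intro D _; rfl

/-- factorisation over blocks -/
lemma sum_pow_blocks (P : ℕ → Finset ℕ) (hP : ∀ i j, i ≠ j → Disjoint (P i) (P j)) (f : ℕ → Finset ℕ → ℝ) (L : ℕ) :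
    ∑ D ∈ ((range L).biUnion P).powerset, ∏ i ∈ range L, f i (D ∩ P i) = ∏ i ∈ range L, ∑ s ∈ (P i).powerset, f i s := by
  induction L with
  | zero => simp
  | succ L ih =>
    rw [prod_range_succ, ← ih]
    have hd : Disjoint ((range L).biUnion P) (P L) := by
      rw [disjoint_biUnion_left]; intro i hi; exact hP i L (by have := mem_range.1 hi; omega)
    rw [← sum_pow_union _ _ hd]
    rw [range_add_one, biUnion_insert, union_comm]
    refine sum_congr rfl fun D _ => ?_
    rw [prod_insert (by simp), mul_comm]
    congr 1
    refine prod_congr rfl fun i hi => ?_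
    rw [inter_assoc, inter_eq_right.2 (subset_biUnion_of_mem P hi)]

lemma prod_blocks (P : ℕ → Finset ℕ) (hP : ∀ i j, i ≠ j → Disjoint (P i) (P j)) (L : ℕ) (D : Finset ℕ)
    (hD : D ⊆ (range L).biUnion P) (x : ℕ → ℝ) : ∏ i ∈ range L, ∏ p ∈ D ∩ P i, x p = ∏ p ∈ D, x p := by
  rw [← prod_biUnion]
  · congr 1
    ext p; simp only [mem_biUnion, mem_range, mem_inter]
    constructor
    · rintro ⟨i, _, h, _⟩; exact h
    · intro h
      have := hD h
      simp only [mem_biUnion, mem_range] at this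
      obtain ⟨i, hi, hp⟩ := this
      exact ⟨i, hi, h, hp⟩
  · intro i _ j _ hij
    exact (hP i j hij).mono inter_subset_right inter_subset_right
end

section
open Finset

def Blk (P : ℕ → Finset ℕ) : Prop := ∀ i, ∀ p ∈ P i, p.Prime ∧ 2 ^ 2 ^ i ≤ p ∧ p < 2 ^ 2 ^ (i + 1)

lemma Blk.disj {P} (h : Blk P) : ∀ i j, i ≠ j → Disjoint (P i) (P j) := by
  have : ∀ i j, i < j → Disjoint (P i) (P j) := by
    intro i j hij
    rw [Finset.disjoint_left]
    intro p h1 h2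
    have a := (h i p h1).2.2
    have b := (h j p h2).2.1
    have : 2 ^ 2 ^ (i + 1) ≤ 2 ^ 2 ^ j := Nat.pow_le_pow_right (by norm_num) (Nat.pow_le_pow_right (by norm_num) hij)
    omega
  intro i j hij
  rcases lt_or_gt_of_ne hij with h | h
  · exact this _ _ h
  · exact (this _ _ h).symm

lemma dyad (k : ℕ) (hk : 1 ≤ k) (S : Finset ℕ) (hS : ∀ p ∈ S, p.Prime ∧ 2 ^ k ≤ p ∧ p < 2 ^ (k+1)) :
    ∑ p ∈ S, (1 / p : ℝ) ≤ 4 / k := by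
  have hl2 : 0 < Real.log 2 := Real.log_pos one_lt_two
  have h1 : (#S : ℝ) * (k * Real.log 2) ≤ Real.log 4 * 2 ^ (k+1) := by
    have := Chebyshev.theta_le_log4_mul_x (x := 2 ^ (k+1)) (by positivity)
    refine le_trans ?_ this
    rw [← nsmul_eq_mul, ← sum_const, Chebyshev.theta]
    have hsub : S ⊆ {p ∈ Ioc 0 ⌊(2:ℝ)^(k+1)⌋₊ | p.Prime} := by
      intro p hp
      have := hS p hp
      rw [show ((2:ℝ)^(k+1)) = ((2^(k+1) : ℕ) : ℝ) by push_cast; rfl, Nat.floor_natCast]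
      simp only [mem_filter, mem_Ioc]
      exact ⟨⟨this.1.pos, this.2.2.le⟩, this.1⟩
    refine le_trans (sum_le_sum fun p hp => ?_) (sum_le_sum_of_subset_of_nonneg hsub fun p hp _ => Real.log_natCast_nonneg p)
    rw [← Real.log_pow]
    exact Real.log_le_log (by positivity) (by exact_mod_cast (hS p hp).2.1)
  have hk' : (0:ℝ) < k := by exact_mod_cast hk
  have h4 : Real.log 4 = 2 * Real.log 2 := by
    rw [show (4:ℝ) = 2 ^ 2 by norm_num, Real.log_pow]; norm_num
  have h2 : (#S : ℝ) * k ≤ 4 * 2 ^ k := by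
    rw [h4, pow_succ] at h1
    by_contra hc
    push Not at hc
    nlinarith
  have h3 : ∑ p ∈ S, (1 / p : ℝ) ≤ ∑ p ∈ S, (1 / 2 ^ k : ℝ) := sum_le_sum fun p hp => by
    have : ((2:ℝ) ^ k) ≤ p := by exact_mod_cast (hS p hp).2.1
    gcongr
  refine h3.trans ?_
  rw [sum_const, nsmul_eq_mul, mul_one_div, div_le_div_iff₀ (by positivity) hk']
  exact h2

lemma Blk.sum4 {P} (h : Blk P) (i : ℕ) : ∑ p ∈ P i, (1 / p : ℝ) ≤ 4 := by
  have hm : ∀ p ∈ P i, Nat.log 2 p ∈ Ico (2^i) (2^(i+1)) := by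
    intro p hp
    obtain ⟨h1, h2, h3⟩ := h i p hp
    rw [mem_Ico]
    exact ⟨Nat.le_log_of_pow_le (by norm_num) h2, Nat.log_lt_of_lt_pow h1.ne_zero h3⟩
  rw [← sum_fiberwise_of_maps_to hm]
  calc _ ≤ ∑ k ∈ Ico (2^i) (2^(i+1)), (4 / 2 ^ i : ℝ) := by
        refine sum_le_sum fun k hk => ?_
        rw [mem_Ico] at hk
        have h0 : 1 ≤ 2 ^ i := Nat.one_le_two_pow
        refine (dyad k (by omega) _ fun p hp => ?_).trans ?_
        · rw [mem_filter] at hp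
          obtain ⟨h1, h2, h3⟩ := h i p hp.1
          refine ⟨h1, ?_, ?_⟩
          · rw [← hp.2]; exact Nat.pow_log_le_self 2 h1.ne_zero
          · rw [← hp.2]; exact Nat.lt_pow_succ_log_self (by norm_num) p
        · have : ((2:ℝ) ^ i) ≤ k := by exact_mod_cast hk.1
          gcongr
    _ = 4 := by
        rw [sum_const, Nat.card_Ico, pow_succ, nsmul_eq_mul, mul_two, Nat.add_sub_cancel]
        push_cast; field_simp

lemma one_sub_ge {x : ℝ} (h0 : 0 ≤ x) (h : x ≤ 1/2) : Real.exp (-2 * x) ≤ 1 - x := by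
  have h1 := Real.add_one_le_exp (2 * x)
  have : (1 - x) * Real.exp (2 * x) ≥ 1 := by nlinarith
  rw [neg_mul, Real.exp_neg, inv_le_iff_one_le_mul₀ (Real.exp_pos _)]
  exact this

noncomputable def VV (S : Finset ℕ) : ℝ := ∏ p ∈ S, (1 - 1 / (p:ℝ))

lemma inv_le_half {p : ℕ} (h : p.Prime) : (1 / p : ℝ) ≤ 1 / 2 := by
  have : (2:ℝ) ≤ p := by exact_mod_cast h.two_le
  gcongr

lemma VV_ge (S : Finset ℕ) (hS : ∀ p ∈ S, p.Prime) : Real.exp (-2 * ∑ p ∈ S, (1 / p : ℝ)) ≤ VV S := by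
  rw [mul_sum, Real.exp_sum]
  exact prod_le_prod (fun _ _ => (Real.exp_pos _).le) fun p hp => one_sub_ge (by positivity) (inv_le_half (hS p hp))

lemma VV_pos (S : Finset ℕ) (hS : ∀ p ∈ S, p.Prime) : 0 < VV S := (Real.exp_pos _).trans_le (VV_ge S hS)

lemma Blk.V_ge {P} (h : Blk P) (i : ℕ) : Real.exp (-8) ≤ VV (P i) := by
  refine le_trans ?_ (VV_ge (P i) fun p hp => (h i p hp).1)
  have := h.sum4 i
  exact Real.exp_le_exp.2 (by linarith)

noncomputable def uu (k : ℕ) : ℝ := Real.exp 8 * (4 ^ k / k.factorial)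

lemma uu_nonneg (k) : 0 ≤ uu k := by unfold uu; positivity

noncomputable def rc (p : ℕ) : ℝ := 1 / p

lemma rc_mem (p : ℕ) : 0 ≤ rc p ∧ rc p ≤ 1 := by
  unfold rc
  refine ⟨by positivity, ?_⟩
  rcases Nat.eq_zero_or_pos p with rfl | h
  · simp
  · rw [div_le_one (by exact_mod_cast h)]; exact_mod_cast h

lemma Blk.ee_le {P} (h : Blk P) (i k : ℕ) : ee k (P i) rc ≤ uu k * VV (P i) := by
  have h1 := _root_.ee_le (P i) rc (fun p => (rc_mem p).1) k
  have h2 : (∑ p ∈ P i, rc p) ^ k / k.factorial ≤ 4 ^ k / k.factorial := by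
    have h0 : 0 ≤ ∑ p ∈ P i, rc p := sum_nonneg fun p _ => (rc_mem p).1
    have := h.sum4 i
    gcongr
    exact this
  refine (h1.trans h2).trans ?_
  have h3 := h.V_ge i
  rw [uu, mul_comm (Real.exp 8), mul_assoc]
  refine le_mul_of_one_le_right (by positivity) ?_
  calc (1:ℝ) = Real.exp 8 * Real.exp (-8) := by rw [← Real.exp_add]; simp
    _ ≤ _ := by gcongr

lemma EE_bounds (Q : Finset ℕ) (x : ℕ → ℝ) (hx : ∀ p, 0 ≤ x p ∧ x p ≤ 1) (k : ℕ) (hk : Odd k) :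
    ∏ p ∈ Q, (1 - x p) ≤ EE k Q x ∧ EE k Q x - ∏ p ∈ Q, (1 - x p) ≤ ee k Q x := by
  have := bonf Q x hx k
  rw [hk.neg_one_pow] at this
  constructor <;> linarith

lemma EE_nonneg (Q : Finset ℕ) (x : ℕ → ℝ) (hx : ∀ p, 0 ≤ x p ∧ x p ≤ 1) (k : ℕ) (hk : Odd k) : 0 ≤ EE k Q x :=
  le_trans (prod_nonneg fun p _ => by linarith [hx p]) (EE_bounds Q x hx k hk).1

lemma Blk.mean_le {P} (h : Blk P) (i k : ℕ) (hk : Odd k) : VV (P i) ≤ EE k (P i) rc ∧ EE k (P i) rc ≤ VV (P i) * (1 + uu k) := by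
  have h1 := EE_bounds (P i) rc rc_mem k hk
  have h2 := h.ee_le i k
  have : VV (P i) = ∏ p ∈ P i, (1 - rc p) := rfl
  rw [← this] at h1
  exact ⟨h1.1, by linarith⟩

lemma abs_EE_le (Q : Finset ℕ) (hQ : ∑ p ∈ Q, rc p ≤ 4) (k : ℕ) : |EE k Q rc| ≤ Real.exp 5 := by
  have h1 := bonf Q rc rc_mem k
  have h2 := _root_.ee_le Q rc (fun p => (rc_mem p).1) k
  have h0 : 0 ≤ ∑ p ∈ Q, rc p := sum_nonneg fun p _ => (rc_mem p).1
  have h3 : ee k Q rc ≤ Real.exp 4 := h2.trans ((Real.pow_div_factorial_le_exp _ h0 k).trans (Real.exp_le_exp.2 hQ))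
  have h4 : |∏ p ∈ Q, (1 - rc p) - EE k Q rc| ≤ Real.exp 4 := by
    rw [abs_le]
    rcases neg_one_pow_eq_or ℝ k with h | h <;> rw [h] at h1 <;> constructor <;> linarith
  have h5 : 0 ≤ ∏ p ∈ Q, (1 - rc p) ∧ ∏ p ∈ Q, (1 - rc p) ≤ 1 :=
    ⟨prod_nonneg fun p _ => by linarith [rc_mem p], prod_le_one (fun p _ => by linarith [rc_mem p]) fun p _ => by linarith [rc_mem p]⟩
  have h6 : 1 + Real.exp 4 ≤ Real.exp 5 := by
    have : Real.exp 5 = Real.exp 4 * Real.exp 1 := by rw [← Real.exp_add]; norm_num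
    have h7 := Real.add_one_le_exp (1:ℝ)
    have h8 := Real.add_one_le_exp (4:ℝ)
    rw [this]; nlinarith
  rw [abs_le] at h4 ⊢
  constructor <;> linarith

lemma EE_sub (k : ℕ) (P T : Finset ℕ) (hT : T ⊆ P) (x : ℕ → ℝ) :
    ∑ s ∈ P.powerset, (if T ⊆ s then (if #s < k then (-1 : ℝ) ^ #s else 0) * ∏ p ∈ s, x p else 0) =
      (-1) ^ #T * (∏ p ∈ T, x p) * EE (k - #T) (P \ T) x := by
  rw [← sum_filter, EE, mul_sum]
  refine sum_nbij' (fun s => s \ T) (fun s => s ∪ T) ?_ ?_ ?_ ?_ ?_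
  · intro s hs
    simp only [mem_filter, mem_powerset] at hs ⊢
    exact sdiff_subset_sdiff hs.1 le_rfl
  · intro s hs
    simp only [mem_filter, mem_powerset] at hs ⊢
    exact ⟨union_subset (hs.trans sdiff_subset) hT, subset_union_right⟩
  · intro s hs
    simp only [mem_filter, mem_powerset] at hs
    exact sdiff_union_of_subset hs.2
  · intro s hs
    simp only [mem_powerset] at hs
    exact union_sdiff_cancel_right (disjoint_of_subset_left hs sdiff_disjoint)
  · intro s hs
    simp only [mem_filter, mem_powerset] at hs
    have hc : #(s \ T) + #T = #s := card_sdiff_add_card_eq_card hs.2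
    have : #s < k ↔ #(s \ T) < k - #T := by omega
    simp only [this]
    rw [← prod_sdiff hs.2, ← hc]
    split_ifs
    · rw [pow_add]; ring
    · ring

lemma Blk.sub_le {P} (h : Blk P) (i k : ℕ) (hk : Odd k) (T : Finset ℕ) (hT : T ⊆ P i) :
    |∑ s ∈ (P i).powerset, (if T ⊆ s then (if #s < k then (-1 : ℝ) ^ #s else 0) * ∏ p ∈ s, rc p else 0)| ≤
      VV (P i) * (1 + uu k) * ∏ p ∈ T, (Real.exp 13 * rc p) := by
  have hV := VV_pos (P i) fun p hp => (h i p hp).1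
  have hu := uu_nonneg k
  rcases T.eq_empty_or_nonempty with rfl | hne
  · simp only [empty_subset, if_true, prod_empty, mul_one]
    have h1 := h.mean_le i k hk
    change |EE k (P i) rc| ≤ _
    rw [abs_of_nonneg (hV.le.trans h1.1)]
    exact h1.2
  · rw [EE_sub k (P i) T hT, abs_mul, abs_mul, abs_pow, abs_neg, abs_one, one_pow, one_mul,
      abs_of_nonneg (prod_nonneg fun p _ => (rc_mem p).1), prod_mul_distrib, prod_const]
    have h1 : |EE (k - #T) (P i \ T) rc| ≤ Real.exp 5 := by
      refine abs_EE_le _ (le_trans ?_ (h.sum4 i)) _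
      exact sum_le_sum_of_subset_of_nonneg sdiff_subset fun p _ _ => (rc_mem p).1
    have h2 := h.V_ge i
    have h3 : Real.exp 5 ≤ VV (P i) * (1 + uu k) * Real.exp 13 ^ #T := by
      have h4 : Real.exp 13 ≤ Real.exp 13 ^ #T := le_self_pow₀ (Real.one_le_exp (by norm_num)) hne.card_pos.ne'
      calc Real.exp 5 = Real.exp (-8) * Real.exp 13 := by rw [← Real.exp_add]; norm_num
        _ ≤ VV (P i) * (1 + uu k) * Real.exp 13 ^ #T := by
          gcongr
          nlinarith
    have h5 : 0 ≤ ∏ p ∈ T, rc p := prod_nonneg fun p _ => (rc_mem p).1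
    calc _ ≤ (∏ p ∈ T, rc p) * (VV (P i) * (1 + uu k) * Real.exp 13 ^ #T) := by gcongr; exact h1.trans h3
      _ = _ := by ring

lemma tau_small (ε : ℝ) (hε : 0 < ε) : ∃ b : ℕ, ∀ L, ∑ j ∈ range L, uu (2 * (b + j) + 1) ≤ ε := by
  have hs : Summable uu := (Real.summable_pow_div_factorial 4).mul_left _
  have := (hs.hasSum.tendsto_sum_nat).eventually (Metric.ball_mem_nhds _ hε)
  obtain ⟨b, hb⟩ := this.exists
  refine ⟨b, fun L => ?_⟩
  have h1 : ∑ i ∈ range b, uu i + ∑ j ∈ range L, uu (2 * (b + j) + 1) ≤ ∑' i, uu i := by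
    have h2 : Disjoint (range b) ((range L).image fun j => 2 * (b + j) + 1) := by
      rw [Finset.disjoint_left]; intro i hi hj
      simp only [mem_image, mem_range] at hi hj
      obtain ⟨j, _, rfl⟩ := hj; omega
    have h3 : ∑ j ∈ range L, uu (2 * (b + j) + 1) = ∑ i ∈ (range L).image fun j => 2 * (b + j) + 1, uu i := by
      rw [sum_image]; intro i _ j _ h; simp only at h; omega
    rw [h3, ← sum_union h2]
    exact hs.sum_le_tsum _ fun i _ => uu_nonneg i
  change dist _ _ < ε at hb
  rw [Real.dist_eq, abs_lt] at hb
  linarith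
end

section
open Finset

def PP (P : ℕ → Finset ℕ) (L : ℕ) : Finset ℕ := (range L).biUnion P

noncomputable def cg (P : ℕ → Finset ℕ) (L : ℕ) (c : ℕ → ℕ → ℝ) (D : Finset ℕ) : ℝ :=
  ∏ i ∈ range L, c i #(D ∩ P i)

noncomputable def Ug (P : ℕ → Finset ℕ) (L : ℕ) (c : ℕ → ℕ → ℝ) (x : ℕ → ℝ) : ℝ :=
  ∑ D ∈ (PP P L).powerset, cg P L c D * ∏ p ∈ D, x p

def kk (b L i : ℕ) : ℕ := 2 * (b + (L - 1 - i)) + 1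

noncomputable def cE (b L : ℕ) (i m : ℕ) : ℝ := if m < kk b L i then (-1) ^ m else 0

noncomputable def cT (b L j : ℕ) (i m : ℕ) : ℝ :=
  if i = j then (if m = kk b L i then 1 else 0) else cE b L i m

lemma kk_odd (b L i) : Odd (kk b L i) := ⟨_, rfl⟩

lemma Ug_eq {P} (h : Blk P) (L c x) :
    Ug P L c x = ∏ i ∈ range L, ∑ s ∈ (P i).powerset, c i #s * ∏ p ∈ s, x p := by
  rw [← sum_pow_blocks P h.disj]
  refine sum_congr rfl fun D hD => ?_
  rw [prod_mul_distrib, prod_blocks P h.disj L D (mem_powerset.1 hD)]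
  rfl

lemma Ug_E {P} (h : Blk P) (b L x) : Ug P L (cE b L) x = ∏ i ∈ range L, EE (kk b L i) (P i) x := by
  rw [Ug_eq h]; rfl

lemma Ug_T {P} (h : Blk P) (b L j x) : Ug P L (cT b L j) x =
    ∏ i ∈ range L, if i = j then ee (kk b L i) (P i) x else EE (kk b L i) (P i) x := by
  rw [Ug_eq h]
  refine prod_congr rfl fun i _ => ?_
  unfold cT
  split_ifs
  · simp [ee]
  · rfl

lemma PP_prod {P} (h : Blk P) (L) (x : ℕ → ℝ) : ∏ p ∈ PP P L, x p = ∏ i ∈ range L, ∏ p ∈ P i, x p := by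
  unfold PP
  rw [prod_biUnion]
  intro i _ j _ hij
  exact h.disj i j hij

lemma PP_prime {P} (h : Blk P) (L) : ∀ p ∈ PP P L, p.Prime := by
  intro p hp
  obtain ⟨i, _, hi⟩ := mem_biUnion.1 hp
  exact (h i p hi).1

lemma kk_sum (b L : ℕ) : ∑ i ∈ range L, 2 ^ (i + 1) * kk b L i ≤ 2 ^ L * (4 * b + 6) := by
  induction L generalizing b with
  | zero => simp
  | succ L ih =>
    rw [sum_range_succ]
    have e : ∑ i ∈ range L, 2 ^ (i + 1) * kk b (L + 1) i = ∑ i ∈ range L, 2 ^ (i + 1) * kk (b + 1) L i := by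
      refine sum_congr rfl fun i hi => ?_
      have := mem_range.1 hi
      congr 1; unfold kk; omega
    rw [e]
    have h1 := ih (b + 1)
    have h2 : kk b (L + 1) L = 2 * b + 1 := by unfold kk; omega
    rw [h2, pow_succ]
    nlinarith [pow_pos (two_pos (α := ℕ)) L]

def lev (b L : ℕ) : ℕ := 2 ^ (2 ^ L * (4 * b + 6))

lemma cg_level {P} (h : Blk P) (b L) (c) (hc : ∀ i m, c i m ≠ 0 → m ≤ kk b L i) (D) (hD : D ⊆ PP P L)
    (h0 : cg P L c D ≠ 0) : ∏ p ∈ D, p ≤ lev b L := by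
  have e := prod_blocks P h.disj L D hD (fun p => (p : ℝ))
  have h1 : (∏ p ∈ D, p) = ∏ i ∈ range L, ∏ p ∈ D ∩ P i, p := by
    apply Nat.cast_injective (R := ℝ); push_cast; exact e.symm
  rw [h1]
  calc _ ≤ ∏ i ∈ range L, 2 ^ (2 ^ (i + 1) * kk b L i) := by
        refine prod_le_prod' fun i hi => ?_
        have := hc i _ (prod_ne_zero_iff.1 h0 i hi)
        calc ∏ p ∈ D ∩ P i, p ≤ (2 ^ 2 ^ (i + 1)) ^ #(D ∩ P i) :=
              prod_le_pow_card _ _ _ fun p hp => (h i p (mem_inter.1 hp).2).2.2.le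
          _ ≤ (2 ^ 2 ^ (i + 1)) ^ kk b L i := Nat.pow_le_pow_right (by positivity) this
          _ = _ := by rw [← pow_mul]
    _ = 2 ^ ∑ i ∈ range L, 2 ^ (i + 1) * kk b L i := by rw [prod_pow_eq_pow_sum]
    _ ≤ _ := Nat.pow_le_pow_right (by norm_num) (kk_sum b L)

lemma cE_lv (b L i m) : cE b L i m ≠ 0 → m ≤ kk b L i := by
  unfold cE; split_ifs <;> simp; omega

lemma cT_lv (b L j i m) : cT b L j i m ≠ 0 → m ≤ kk b L i := by
  unfold cT; split_ifs
  · simp; omega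
  · simp
  · exact cE_lv b L i m

lemma cE_abs (b L i m) : |cE b L i m| ≤ 1 := by
  unfold cE; split_ifs <;> simp

lemma cT_abs (b L j i m) : |cT b L j i m| ≤ 1 := by
  unfold cT; split_ifs
  · simp
  · simp
  · exact cE_abs b L i m

lemma cg_abs (P L c D) (hc : ∀ i m, |c i m| ≤ 1) : |cg P L c D| ≤ 1 := by
  unfold cg; rw [abs_prod]; exact prod_le_one (fun _ _ => abs_nonneg _) fun i _ => hc _ _

lemma UE_ge {P} (h : Blk P) (b L x) (hx : ∀ p, 0 ≤ x p ∧ x p ≤ 1) :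
    ∏ p ∈ PP P L, (1 - x p) ≤ Ug P L (cE b L) x := by
  rw [Ug_E h, PP_prod h]
  exact prod_le_prod (fun i _ => prod_nonneg fun p _ => sub_nonneg.2 (hx p).2)
    fun i _ => (EE_bounds (P i) x hx _ (kk_odd _ _ _)).1

lemma tele (a c : ℕ → ℝ) (h : ∀ i, 0 ≤ c i ∧ c i ≤ a i) (L : ℕ) :
    ∏ i ∈ range L, a i - ∏ i ∈ range L, c i ≤
      ∑ j ∈ range L, ∏ i ∈ range L, if i = j then a i - c i else a i := by
  induction L with
  | zero => simp
  | succ L ih =>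
    rw [prod_range_succ, prod_range_succ, sum_range_succ]
    have e1 : ∑ j ∈ range L, ∏ i ∈ range (L + 1), (if i = j then a i - c i else a i) =
        (∑ j ∈ range L, ∏ i ∈ range L, if i = j then a i - c i else a i) * a L := by
      rw [sum_mul]
      refine sum_congr rfl fun j hj => ?_
      have := mem_range.1 hj
      rw [prod_range_succ, if_neg (by omega)]
    have e2 : ∏ i ∈ range (L + 1), (if i = L then a i - c i else a i) = (∏ i ∈ range L, a i) * (a L - c L) := by
      rw [prod_range_succ, if_pos rfl]
      congr 1
      refine prod_congr rfl fun i hi => ?_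
      have := mem_range.1 hi
      rw [if_neg (by omega)]
    rw [e1, e2]
    have h3 : ∏ i ∈ range L, c i ≤ ∏ i ∈ range L, a i := prod_le_prod (fun i _ => (h i).1) fun i _ => (h i).2
    have h4 : 0 ≤ ∏ i ∈ range L, c i := prod_nonneg fun i _ => (h i).1
    nlinarith [h L, mul_le_mul_of_nonneg_right ih ((h L).1.trans (h L).2)]

lemma UE_sub_le {P} (h : Blk P) (b L x) (hx : ∀ p, 0 ≤ x p ∧ x p ≤ 1) :
    Ug P L (cE b L) x - ∏ p ∈ PP P L, (1 - x p) ≤ ∑ j ∈ range L, Ug P L (cT b L j) x := by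
  rw [Ug_E h, PP_prod h]
  have hb := fun i => EE_bounds (P i) x hx (kk b L i) (kk_odd _ _ _)
  have h0 := fun i => prod_nonneg (s := P i) fun p _ => sub_nonneg.2 (hx p).2
  refine (tele _ _ (fun i => ⟨h0 i, (hb i).1⟩) L).trans ?_
  refine sum_le_sum fun j _ => ?_
  rw [Ug_T h]
  refine prod_le_prod (fun i _ => ?_) fun i _ => ?_
  · have := h0 i; have := hb i
    split_ifs <;> linarith
  · split_ifs
    · exact (hb i).2
    · exact le_rfl

noncomputable def tau (b L : ℕ) : ℝ := ∑ i ∈ range L, uu (kk b L i)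

lemma tau_eq (b L) : tau b L = ∑ j ∈ range L, uu (2 * (b + j) + 1) := by
  unfold tau kk
  exact sum_range_reflect (fun j => uu (2 * (b + j) + 1)) L

lemma tau_nonneg (b L) : 0 ≤ tau b L := sum_nonneg fun _ _ => uu_nonneg _

lemma prod_uu (b L) : ∏ i ∈ range L, (1 + uu (kk b L i)) ≤ Real.exp (tau b L) := by
  unfold tau
  rw [Real.exp_sum]
  exact prod_le_prod (fun i _ => by have := uu_nonneg (kk b L i); positivity) fun i _ => by
    rw [add_comm]; exact Real.add_one_le_exp _

lemma VV_PP {P} (h : Blk P) (L) : VV (PP P L) = ∏ i ∈ range L, VV (P i) := PP_prod h L _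

lemma UE_mean {P} (h : Blk P) (b L) : Ug P L (cE b L) rc ≤ VV (PP P L) * Real.exp (tau b L) := by
  rw [Ug_E h, VV_PP h]
  calc _ ≤ ∏ i ∈ range L, (VV (P i) * (1 + uu (kk b L i))) :=
        prod_le_prod (fun i _ => EE_nonneg _ _ rc_mem _ (kk_odd _ _ _)) fun i _ => (h.mean_le i _ (kk_odd _ _ _)).2
    _ ≤ _ := by
        rw [prod_mul_distrib]
        exact mul_le_mul_of_nonneg_left (prod_uu b L) (prod_nonneg fun i _ => (VV_pos _ fun p hp => (h i p hp).1).le)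

lemma UT_mean {P} (h : Blk P) (b L j) (hj : j ∈ range L) :
    Ug P L (cT b L j) rc ≤ VV (PP P L) * Real.exp (tau b L) * uu (kk b L j) := by
  have hV := fun i => (VV_pos (P i) fun p hp => (h i p hp).1)
  rw [Ug_T h, VV_PP h]
  calc _ ≤ ∏ i ∈ range L, (VV (P i) * (1 + uu (kk b L i)) * if i = j then uu (kk b L j) else 1) := by
        refine prod_le_prod (fun i _ => ?_) fun i _ => ?_
        · split_ifs
          · exact ee_nonneg _ _ _ fun p => (rc_mem p).1
          · exact EE_nonneg _ _ rc_mem _ (kk_odd _ _ _)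
        · have h1 := uu_nonneg (kk b L i)
          have h2 := hV i
          split_ifs with e
          · subst e
            refine (h.ee_le i _).trans ?_
            nlinarith [mul_nonneg (mul_nonneg h1 h1) h2.le]
          · rw [mul_one]; exact (h.mean_le i _ (kk_odd _ _ _)).2
    _ ≤ _ := by
        rw [prod_mul_distrib, prod_mul_distrib, prod_ite_eq' (range L) j, if_pos hj]
        exact mul_le_mul_of_nonneg_right (mul_le_mul_of_nonneg_left (prod_uu b L) (prod_nonneg fun i _ => (hV i).le)) (uu_nonneg _)

lemma UE_sub {P} (h : Blk P) (b L) (D0 : Finset ℕ) (hD0 : D0 ⊆ PP P L) :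
    |∑ D ∈ (PP P L).powerset, if D0 ⊆ D then cg P L (cE b L) D * ∏ p ∈ D, rc p else 0| ≤
      VV (PP P L) * Real.exp (tau b L) * ∏ p ∈ D0, (Real.exp 13 * rc p) := by
  have hV := fun i => (VV_pos (P i) fun p hp => (h i p hp).1)
  have e : ∑ D ∈ (PP P L).powerset, (if D0 ⊆ D then cg P L (cE b L) D * ∏ p ∈ D, rc p else 0) =
      ∏ i ∈ range L, ∑ s ∈ (P i).powerset, if D0 ∩ P i ⊆ s then cE b L i #s * ∏ p ∈ s, rc p else 0 := by
    rw [← sum_pow_blocks P h.disj]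
    refine sum_congr rfl fun D hD => ?_
    rw [mem_powerset] at hD
    by_cases hs : D0 ⊆ D
    · rw [if_pos hs, ← prod_blocks P h.disj L D hD, cg, ← prod_mul_distrib]
      refine prod_congr rfl fun i _ => ?_
      rw [if_pos (inter_subset_inter_right hs)]
    · rw [if_neg hs]
      obtain ⟨p, hp, hp'⟩ := not_subset.1 hs
      obtain ⟨i, hi, hpi⟩ := mem_biUnion.1 (hD0 hp)
      refine (prod_eq_zero hi ?_).symm
      rw [if_neg]
      intro hh
      exact hp' (mem_inter.1 (hh (mem_inter.2 ⟨hp, hpi⟩))).1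
  rw [e, abs_prod, VV_PP h, ← prod_blocks P h.disj L D0 hD0]
  calc _ ≤ ∏ i ∈ range L, (VV (P i) * (1 + uu (kk b L i)) * ∏ p ∈ D0 ∩ P i, (Real.exp 13 * rc p)) :=
        prod_le_prod (fun _ _ => abs_nonneg _) fun i _ => h.sub_le i _ (kk_odd _ _ _) _ inter_subset_right
    _ ≤ _ := by
        rw [prod_mul_distrib, prod_mul_distrib]
        refine mul_le_mul_of_nonneg_right (mul_le_mul_of_nonneg_left (prod_uu b L) (prod_nonneg fun i _ => (hV i).le)) ?_
        exact prod_nonneg fun i _ => prod_nonneg fun p _ => mul_nonneg (Real.exp_pos _).le (rc_mem p).1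
end

section
open Finset

noncomputable def ec (x : ℝ) : ℂ := Complex.exp ((2 * Real.pi * x : ℝ) * Complex.I)

lemma ec_add (x y) : ec (x + y) = ec x * ec y := by
  unfold ec; rw [← Complex.exp_add]; congr 1; push_cast; ring

lemma ec_zero : ec 0 = 1 := by simp [ec]

lemma ec_norm (x) : ‖ec x‖ = 1 := Complex.norm_exp_ofReal_mul_I _

lemma ec_int (n : ℤ) : ec n = 1 := by
  unfold ec; rw [Complex.exp_eq_one_iff]; exact ⟨n, by push_cast; ring⟩

lemma ec_add_int (x) (n : ℤ) : ec (x + n) = ec x := by rw [ec_add, ec_int, mul_one]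

lemma ec_nat_mul (n : ℕ) (x) : ec (n * x) = ec x ^ n := by
  unfold ec; rw [← Complex.exp_nat_mul]; congr 1; push_cast; ring

lemma ec_neg (x) : ec (-x) = (starRingEnd ℂ) (ec x) := by
  unfold ec; rw [← Complex.exp_conj]; congr 1; simp only [map_mul, Complex.conj_ofReal, Complex.conj_I]; push_cast; ring

lemma ec_sub_one (x) : ‖ec x - 1‖ = 2 * |Real.sin (Real.pi * x)| := by
  unfold ec
  rw [mul_comm, Complex.norm_exp_I_mul_ofReal_sub_one, norm_mul]
  simp only [Real.norm_eq_abs, abs_two]; congr 3; ring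

lemma ec_sub_le (x y) : ‖ec x - ec y‖ ≤ 2 * Real.pi * |x - y| := by
  have : ec x - ec y = ec y * (ec (x - y) - 1) := by
    rw [mul_sub, ← ec_add, mul_one]; congr 2; ring
  rw [this, norm_mul, ec_norm, one_mul, ec_sub_one]
  have := Real.abs_sin_le_abs (x := Real.pi * (x - y))
  rw [abs_mul, abs_of_pos Real.pi_pos] at this
  linarith

noncomputable def nn (x : ℝ) : ℝ := |x - round x|

lemma nn_nonneg (x) : 0 ≤ nn x := abs_nonneg _
lemma nn_le (x : ℝ) (m : ℤ) : nn x ≤ |x - m| := round_le x m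
lemma nn_half (x) : nn x ≤ 1 / 2 := abs_sub_round x

lemma ec_sub_one_ge (x) : 4 * nn x ≤ ‖ec x - 1‖ := by
  have e : ec x = ec (x - round x) := by
    rw [← ec_add_int (x - round x) (round x)]; congr 1; ring
  rw [e, ec_sub_one]
  have h1 := nn_half x
  have h2 := Real.mul_abs_le_abs_sin (x := Real.pi * (x - round x)) (by
    rw [abs_mul, abs_of_pos Real.pi_pos]; unfold nn at h1; nlinarith [Real.pi_pos])
  rw [abs_mul, abs_of_pos Real.pi_pos] at h2
  have : 2 / Real.pi * (Real.pi * |x - round x|) = 2 * nn x := by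
    unfold nn; field_simp
  linarith

noncomputable def SS (G : ℕ) (θ : ℝ) : ℂ := ∑ n ∈ range G, ec (n * θ)

lemma SS_le (G θ) : ‖SS G θ‖ ≤ G := by
  refine (norm_sum_le _ _).trans ?_
  simp [ec_norm]

lemma SS_nn (G θ) : 2 * nn θ * ‖SS G θ‖ ≤ 1 := by
  have e : SS G θ * (ec θ - 1) = ec θ ^ G - 1 := by
    unfold SS; simp_rw [ec_nat_mul]; exact geom_sum_mul _ _
  have h := congrArg norm e
  rw [norm_mul] at h
  have h2 : ‖ec θ ^ G - 1‖ ≤ 2 := by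
    refine (norm_sub_le _ _).trans ?_
    rw [norm_pow, ec_norm]; norm_num
  nlinarith [ec_sub_one_ge θ, norm_nonneg (SS G θ)]

lemma class_sum (d : ℕ) (n0 : ℕ) (h0 : n0 < d) (G : ℕ) (f : ℕ → ℂ) :
    ∑ n ∈ range G, (if n % d = n0 then f n else 0) = ∑ m ∈ range ((G + d - 1 - n0) / d), f (n0 + d * m) := by
  rw [← sum_filter]
  symm
  have hd : 0 < d := by omega
  have key : ∀ m, m < (G + d - 1 - n0) / d ↔ n0 + d * m < G := by
    intro m
    rw [Nat.lt_iff_add_one_le, Nat.le_div_iff_mul_le hd]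
    have : (m + 1) * d = d * m + d := by ring
    omega
  refine sum_nbij' (fun m => n0 + d * m) (fun n => n / d) ?_ ?_ ?_ ?_ ?_
  · intro m hm
    rw [mem_range] at hm
    rw [mem_filter, mem_range]
    exact ⟨(key m).1 hm, by rw [Nat.add_mul_mod_self_left, Nat.mod_eq_of_lt h0]⟩
  · intro n hn
    rw [mem_filter, mem_range] at hn
    rw [mem_range, key, ← hn.2, Nat.mod_add_div]; exact hn.1
  · intro m _
    simp [Nat.add_mul_div_left _ _ hd, Nat.div_eq_of_lt h0]
  · intro n hn
    rw [mem_filter] at hn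
    simp only [← hn.2, Nat.mod_add_div]
  · intro m _; rfl

lemma class_far (d n0 : ℕ) (h0 : n0 < d) (G : ℕ) (θ : ℝ) :
    2 * nn (d * θ) * ‖∑ n ∈ range G, (if n % d = n0 then ec (n * θ) else 0)‖ ≤ 1 := by
  rw [class_sum d n0 h0]
  have : ∑ m ∈ range ((G + d - 1 - n0) / d), ec (((n0 + d * m : ℕ) : ℝ) * θ) = ec (n0 * θ) * SS ((G + d - 1 - n0) / d) (d * θ) := by
    unfold SS
    rw [mul_sum]
    refine sum_congr rfl fun m _ => ?_
    rw [← ec_add]; congr 1; push_cast; ring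
  rw [this, norm_mul, ec_norm, one_mul]
  exact SS_nn _ _

lemma class_near (d n0 : ℕ) (h0 : n0 < d) (G : ℕ) (β : ℝ) :
    ‖∑ n ∈ range G, (if n % d = n0 then ec (n * β) else 0) - SS G β / d‖ ≤ 2 * Real.pi * |β| * G + 2 := by
  set A : ℕ → ℂ := fun j => ∑ n ∈ range G, (if n % d = j then ec (n * β) else 0) with hA
  have hd : 0 < d := by omega
  have hS : SS G β = ∑ j ∈ range d, A j := by
    rw [hA, sum_comm]
    refine sum_congr rfl fun n _ => ?_
    rw [sum_ite_eq, if_pos (mem_range.2 (Nat.mod_lt _ hd))]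
  have hq : ∀ j, j < d → ‖A j - ∑ m ∈ range (G / d), ec (((j + d * m : ℕ) : ℝ) * β)‖ ≤ 1 := by
    intro j hj
    simp only [hA]
    rw [class_sum d j hj]
    have h1 : G / d ≤ (G + d - 1 - j) / d := Nat.div_le_div_right (by omega)
    have h2 : (G + d - 1 - j) / d ≤ G / d + 1 := by
      rw [← Nat.add_div_right _ hd]; exact Nat.div_le_div_right (by omega)
    rcases (by omega : (G + d - 1 - j) / d = G / d ∨ (G + d - 1 - j) / d = G / d + 1) with e | e
    · rw [e]; simp
    · rw [e, sum_range_succ, add_sub_cancel_left, ec_norm]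
  have hdiff : ∀ j ∈ range d, ‖A n0 - A j‖ ≤ 2 * Real.pi * |β| * G + 2 := by
    intro j hj
    rw [mem_range] at hj
    have h3 : ‖∑ m ∈ range (G / d), ec (((n0 + d * m : ℕ) : ℝ) * β) - ∑ m ∈ range (G / d), ec (((j + d * m : ℕ) : ℝ) * β)‖ ≤ 2 * Real.pi * |β| * G := by
      rw [← sum_sub_distrib]
      calc _ ≤ ∑ m ∈ range (G / d), (2 * Real.pi * (d * |β|)) := by
            refine norm_sum_le_of_le _ fun m _ => (ec_sub_le _ _).trans ?_
            have : ((n0 + d * m : ℕ) : ℝ) * β - ((j + d * m : ℕ) : ℝ) * β = ((n0 : ℝ) - j) * β := by push_cast; ring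
            rw [this, abs_mul]
            have : |(n0 : ℝ) - j| ≤ d := by
              have a : (n0 : ℝ) < d := by exact_mod_cast h0
              have b : (j : ℝ) < d := by exact_mod_cast hj
              rw [abs_le]; constructor <;> linarith [Nat.cast_nonneg (α := ℝ) n0, Nat.cast_nonneg (α := ℝ) j]
            gcongr
        _ = 2 * Real.pi * |β| * ((G / d : ℕ) * d : ℝ) := by rw [sum_const, card_range, nsmul_eq_mul]; ring
        _ ≤ _ := by
            have : ((G / d : ℕ) * d : ℝ) ≤ G := by exact_mod_cast Nat.div_mul_le_self G d
            have := Real.pi_pos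
            gcongr
    have e : A n0 - A j = (A n0 - ∑ m ∈ range (G / d), ec (((n0 + d * m : ℕ) : ℝ) * β)) +
      (∑ m ∈ range (G / d), ec (((n0 + d * m : ℕ) : ℝ) * β) - ∑ m ∈ range (G / d), ec (((j + d * m : ℕ) : ℝ) * β)) -
      (A j - ∑ m ∈ range (G / d), ec (((j + d * m : ℕ) : ℝ) * β)) := by ring
    rw [e]
    refine (norm_sub_le _ _).trans ?_
    have := norm_add_le (A n0 - ∑ m ∈ range (G / d), ec (((n0 + d * m : ℕ) : ℝ) * β)) (∑ m ∈ range (G / d), ec (((n0 + d * m : ℕ) : ℝ) * β) - ∑ m ∈ range (G / d), ec (((j + d * m : ℕ) : ℝ) * β))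
    linarith [hq n0 h0, hq j hj]
  have e : A n0 - SS G β / d = (∑ j ∈ range d, (A n0 - A j)) / d := by
    have : (d : ℂ) ≠ 0 := by exact_mod_cast hd.ne'
    rw [sum_sub_distrib, ← hS, sum_const, card_range, nsmul_eq_mul]; field_simp
  change ‖A n0 - SS G β / d‖ ≤ _
  rw [e, norm_div, Complex.norm_natCast, div_le_iff₀ (by exact_mod_cast hd)]
  refine (norm_sum_le_of_le _ hdiff).trans ?_
  rw [sum_const, card_range, nsmul_eq_mul, mul_comm]

lemma class_ex (W b d : ℕ) (hd : 0 < d) (hW : Nat.Coprime d W) : ∃ n0 < d, ∀ n, d ∣ W * n + b ↔ n % d = n0 := by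
  obtain ⟨u, hu⟩ : ∃ u, W * u ≡ 1 [MOD d] := by
    rcases (by omega : d = 1 ∨ 1 < d) with rfl | h1
    · exact ⟨0, Nat.modEq_one⟩
    · obtain ⟨u, -, hu⟩ := Nat.exists_mul_mod_eq_one_of_coprime hW.symm h1
      exact ⟨u, by rw [Nat.ModEq, hu, Nat.mod_eq_of_lt h1]⟩
  have h0 : ∀ n, d ∣ W * n + b → ∀ m, (d ∣ W * m + b ↔ n ≡ m [MOD d]) := by
    intro n hn m
    constructor
    · intro hm
      have : W * n + b ≡ W * m + b [MOD d] := ((Nat.modEq_zero_iff_dvd).2 hn).trans ((Nat.modEq_zero_iff_dvd).2 hm).symm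
      exact Nat.ModEq.cancel_left_of_coprime hW (Nat.ModEq.add_right_cancel' b this)
    · intro h
      have : W * n + b ≡ W * m + b [MOD d] := (h.mul_left W).add_right b
      exact (Nat.modEq_zero_iff_dvd).1 (this.symm.trans ((Nat.modEq_zero_iff_dvd).2 hn))
  have h1 : d ∣ W * (u * (b * (d - 1))) + b := by
    rw [← Nat.modEq_zero_iff_dvd]
    have : W * (u * (b * (d - 1))) + b ≡ 1 * (b * (d - 1)) + b [MOD d] := by
      rw [← mul_assoc]; exact (hu.mul_right _).add_right _
    refine this.trans ?_
    rw [Nat.modEq_zero_iff_dvd]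
    refine ⟨b, ?_⟩
    obtain ⟨e, rfl⟩ : ∃ e, d = e + 1 := ⟨d - 1, by omega⟩
    simp; ring
  refine ⟨_, Nat.mod_lt (u * (b * (d - 1))) hd, fun n => ?_⟩
  rw [h0 _ h1 n]
  exact ⟨fun h => h.symm, fun h => Eq.symm h⟩
end

section
open Finset

noncomputable def xd (W b n p : ℕ) : ℝ := if p ∣ W * n + b then 1 else 0

lemma xd_mem (W b n p) : 0 ≤ xd W b n p ∧ xd W b n p ≤ 1 := by
  unfold xd; split_ifs <;> norm_num

lemma xd_prod (W b n) (D : Finset ℕ) (hD : ∀ p ∈ D, p.Prime) :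
    ∏ p ∈ D, xd W b n p = if (∏ p ∈ D, p) ∣ W * n + b then 1 else 0 := by
  unfold xd
  rw [prod_ite_zero]
  have : (∀ p ∈ D, p ∣ W * n + b) ↔ (∏ p ∈ D, p) ∣ W * n + b :=
    ⟨fun h => Finset.prod_primes_dvd _ (fun p hp => (hD p hp).prime) h, fun h p hp => (dvd_prod_of_mem _ hp).trans h⟩
  simp only [this, prod_const_one]

noncomputable def UF (P : ℕ → Finset ℕ) (L : ℕ) (c : ℕ → ℕ → ℝ) (W b n : ℕ) : ℝ := Ug P L c (xd W b n)

noncomputable def FU (P : ℕ → Finset ℕ) (L : ℕ) (c : ℕ → ℕ → ℝ) (W b G : ℕ) (θ : ℝ) : ℂ :=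
  ∑ n ∈ range G, (UF P L c W b n : ℂ) * ec (n * θ)

lemma FU_eq {P} (h : Blk P) (L c W b G θ) : FU P L c W b G θ =
    ∑ D ∈ (PP P L).powerset, (cg P L c D : ℂ) * ∑ n ∈ range G, if (∏ p ∈ D, p) ∣ W * n + b then ec (n * θ) else 0 := by
  unfold FU UF Ug
  simp_rw [mul_sum]
  rw [sum_comm]
  refine sum_congr rfl fun n _ => ?_
  rw [Complex.ofReal_sum, sum_mul]
  refine sum_congr rfl fun D hD => ?_
  rw [xd_prod W b n D fun p hp => PP_prime h L p (mem_powerset.1 hD hp)]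
  split_ifs <;> simp

lemma prod_primeFactors (D : Finset ℕ) (hD : ∀ p ∈ D, p.Prime) : (∏ p ∈ D, p).primeFactors = D := Nat.primeFactors_prod hD

lemma supp_card {P} (h : Blk P) (b L) (c) (hc : ∀ i m, c i m ≠ 0 → m ≤ kk b L i) :
    #((PP P L).powerset.filter fun D => cg P L c D ≠ 0) ≤ lev b L := by
  have : #(Icc 1 (lev b L)) = lev b L := by simp
  rw [← this]
  have hp : ∀ D ∈ (PP P L).powerset.filter fun D => cg P L c D ≠ 0, ∀ p ∈ D, p.Prime := fun D hD p hp =>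
    PP_prime h L p (mem_powerset.1 (mem_filter.1 hD).1 hp)
  refine card_le_card_of_injOn (fun D => ∏ p ∈ D, p) ?_ ?_
  · intro D hD
    have hD' := mem_filter.1 hD
    simp only [coe_Icc, Set.mem_Icc]
    exact ⟨prod_pos fun p hp' => (hp D hD p hp').pos, cg_level h b L c hc D (mem_powerset.1 hD'.1) hD'.2⟩
  · intro D hD D' hD' e
    rw [← prod_primeFactors D (hp D hD), ← prod_primeFactors D' (hp D' hD')]
    exact congrArg _ e

lemma rc_prod (D : Finset ℕ) : ∏ p ∈ D, rc p = 1 / (∏ p ∈ D, p : ℕ) := by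
  unfold rc; rw [prod_div_distrib]; simp

lemma S0 {P} (h : Blk P) (b L) (c) (hc : ∀ i m, c i m ≠ 0 → m ≤ kk b L i) (hc1 : ∀ i m, |c i m| ≤ 1)
    (W r : ℕ) (hW : ∀ p ∈ PP P L, Nat.Coprime p W) (G : ℕ) (θ : ℝ) (a : ℤ) (d0 Q : ℕ) (hd0 : 0 < d0) (hQ : d0 ≤ Q)
    (had : IsCoprime a (d0 : ℤ)) (hθ : |θ - a / d0| ≤ 1 / (d0 * Q)) (hlev : 2 * lev b L ≤ Q) :
    ‖FU P L c W r G θ‖ ≤ |∑ D ∈ (PP P L).powerset, if d0 ∣ ∏ p ∈ D, p then cg P L c D * ∏ p ∈ D, rc p else 0|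
      * ‖SS G (θ - a / d0)‖ + lev b L * (Q + 7 * G / Q + 2) := by
  classical
  set β := θ - a / d0 with hβ
  have hQ0 : (0 : ℝ) < Q := by exact_mod_cast (by omega : 0 < Q)
  have hd0' : (0 : ℝ) < d0 := by exact_mod_cast hd0
  obtain ⟨φ, hφ1, hφ⟩ : ∃ φ : ℂ, ‖φ‖ = 1 ∧ ∀ n : ℕ, ∀ d, Nat.Coprime d W → d0 ∣ d → d ∣ W * n + r → ec (n * θ) = φ * ec (n * β) := by
    by_cases hex : ∃ n, d0 ∣ W * n + r
    · obtain ⟨n1, h1⟩ := hex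
      refine ⟨ec (n1 * (a / d0)), ec_norm _, fun n d hd hdd hn => ?_⟩
      have : n1 ≡ n [MOD d0] := by
        have h2 := hdd.trans hn
        have : W * n1 + r ≡ W * n + r [MOD d0] := ((Nat.modEq_zero_iff_dvd).2 h1).trans ((Nat.modEq_zero_iff_dvd).2 h2).symm
        exact Nat.ModEq.cancel_left_of_coprime (Nat.Coprime.coprime_dvd_left hdd hd) (Nat.ModEq.add_right_cancel' r this)
      obtain ⟨t, ht⟩ := (Nat.modEq_iff_dvd.1 this)
      rw [← ec_add, ← ec_add_int (n1 * (a / d0) + n * β) (t * a)]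
      congr 1
      have ht' : (n : ℝ) - n1 = d0 * t := by exact_mod_cast ht
      have : (n : ℝ) = n1 + d0 * t := by linarith
      rw [hβ, this]; push_cast
      field_simp; ring
    · exact ⟨1, by simp, fun n d _ hdd hn => absurd ⟨n, hdd.trans hn⟩ hex⟩
  set E : ℝ := Q + 7 * G / Q + 2 with hE
  have hE0 : 0 ≤ E := by positivity
  have key : ∀ D ∈ (PP P L).powerset, ‖(cg P L c D : ℂ) * ((∑ n ∈ range G, if (∏ p ∈ D, p) ∣ W * n + r then ec (n * θ) else 0) -
      if d0 ∣ ∏ p ∈ D, p then φ * SS G β * (∏ p ∈ D, rc p : ℝ) else 0)‖ ≤ if cg P L c D ≠ 0 then E else 0 := by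
    intro D hD
    have hDs := mem_powerset.1 hD
    by_cases h0 : cg P L c D = 0
    · simp [h0]
    rw [if_pos h0]
    by_cases h1 : d0 ∣ ∏ p ∈ D, p
    all_goals
      have hl := cg_level h b L c hc D hDs h0
      have hdpos : 0 < ∏ p ∈ D, p := prod_pos fun p hp => (PP_prime h L p (hDs hp)).pos
      have hco : Nat.Coprime (∏ p ∈ D, p) W := Nat.Coprime.prod_left fun p hp => hW p (hDs hp)
      obtain ⟨n0, hn0, hcl⟩ := class_ex W r _ hdpos hco
      rw [norm_mul, Complex.norm_real, Real.norm_eq_abs]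
      refine (mul_le_mul_of_nonneg_right (cg_abs P L c D hc1) (norm_nonneg _)).trans ?_
      rw [one_mul]
    · rw [if_pos h1]
      have : ∑ n ∈ range G, (if (∏ p ∈ D, p) ∣ W * n + r then ec (n * θ) else 0) =
          φ * ∑ n ∈ range G, (if n % (∏ p ∈ D, p) = n0 then ec (n * β) else 0) := by
        rw [mul_sum]
        refine sum_congr rfl fun n _ => ?_
        by_cases hn : (∏ p ∈ D, p) ∣ W * n + r
        · rw [if_pos hn, if_pos ((hcl n).1 hn), hφ n _ hco h1 hn]
        · rw [if_neg hn, if_neg (fun hh => hn ((hcl n).2 hh)), mul_zero]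
      rw [this, mul_assoc, ← mul_sub, norm_mul, hφ1, one_mul, rc_prod]
      have h2 := class_near _ n0 hn0 G β
      have e : SS G β * ((1 / (∏ p ∈ D, p : ℕ) : ℝ) : ℂ) = SS G β / ((∏ p ∈ D, p : ℕ) : ℂ) := by push_cast; ring
      rw [e]
      refine h2.trans ?_
      have h3 : |β| ≤ 1 / Q := by
        refine hθ.trans ?_
        refine one_div_le_one_div_of_le hQ0 ?_
        have : (1 : ℝ) ≤ d0 := by exact_mod_cast hd0
        nlinarith
      have h4 : 2 * Real.pi ≤ 7 := by linarith [Real.pi_lt_d2]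
      have h5 : 2 * Real.pi * |β| * G ≤ 7 * (1 / Q) * G := by gcongr
      rw [hE]
      have : 7 * (1 / Q) * G = 7 * G / (Q : ℝ) := by ring
      linarith
    · rw [if_neg h1, sub_zero]
      have e : ∑ n ∈ range G, (if (∏ p ∈ D, p) ∣ W * n + r then ec (n * θ) else 0) =
          ∑ n ∈ range G, (if n % (∏ p ∈ D, p) = n0 then ec (n * θ) else 0) := by simp only [hcl]
      rw [e]
      have hf := class_far _ n0 hn0 G θ
      set d := ∏ p ∈ D, p
      have hnn : 1 / (2 * d0) ≤ nn (d * θ) := by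
        unfold nn
        set m := round ((d : ℝ) * θ)
        have hne : (d : ℤ) * a - m * d0 ≠ 0 := by
          intro hz
          apply h1
          have : (d0 : ℤ) ∣ d * a := ⟨m, by linarith⟩
          exact_mod_cast (had.symm.dvd_of_dvd_mul_right this)
        have h1' : (1 : ℝ) ≤ |(d : ℝ) * a - m * d0| := by exact_mod_cast Int.one_le_abs hne
        have e2 : (d : ℝ) * θ - m = ((d : ℝ) * a - m * d0) / d0 + d * β := by rw [hβ]; field_simp; ring
        rw [e2]
        have h6 : |((d : ℝ) * a - m * d0) / d0| ≥ 1 / d0 := by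
          rw [abs_div, abs_of_pos hd0']; gcongr
        have h7 : |d * β| ≤ 1 / (2 * d0) := by
          rw [abs_mul, Nat.abs_cast]
          calc (d : ℝ) * |β| ≤ d * (1 / (d0 * Q)) := by gcongr
            _ ≤ (Q / 2) * (1 / (d0 * Q)) := by
              gcongr
              have : (2 * d : ℝ) ≤ Q := by exact_mod_cast (by omega : 2 * d ≤ Q)
              linarith
            _ = _ := by field_simp
        have h8 := abs_sub_abs_le_abs_sub (((d : ℝ) * a - m * d0) / d0) (-(d * β))
        rw [abs_neg, sub_neg_eq_add] at h8
        have : 1 / (d0 : ℝ) = 1 / (2 * d0) + 1 / (2 * d0) := by field_simp; norm_num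
        linarith
      set X := ‖∑ n ∈ range G, (if n % d = n0 then ec (n * θ) else 0)‖
      have hX : 0 ≤ X := norm_nonneg _
      have : X ≤ d0 := by
        have h9 : 2 * (1 / (2 * d0)) * X ≤ 1 := by
          refine le_trans ?_ hf
          gcongr
        have : 2 * (1 / (2 * d0)) * X = X / d0 := by field_simp
        rw [this, div_le_one hd0'] at h9
        exact h9
      have hq : (d0 : ℝ) ≤ Q := by exact_mod_cast hQ
      have : 0 ≤ 7 * G / (Q : ℝ) := by positivity
      linarith
  have hsum := norm_sum_le_of_le _ key
  rw [← sum_filter, sum_const, nsmul_eq_mul] at hsum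
  have hcard : ((#((PP P L).powerset.filter fun D => cg P L c D ≠ 0) : ℕ) : ℝ) * E ≤ lev b L * E := by
    have := supp_card h b L c hc
    gcongr
  have hmain : FU P L c W r G θ = (∑ D ∈ (PP P L).powerset, (cg P L c D : ℂ) * ((∑ n ∈ range G, if (∏ p ∈ D, p) ∣ W * n + r then ec (n * θ) else 0) -
      if d0 ∣ ∏ p ∈ D, p then φ * SS G β * (∏ p ∈ D, rc p : ℝ) else 0)) +
      φ * SS G β * ((∑ D ∈ (PP P L).powerset, if d0 ∣ ∏ p ∈ D, p then cg P L c D * ∏ p ∈ D, rc p else 0 : ℝ) : ℂ) := by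
    rw [FU_eq h, Complex.ofReal_sum, mul_sum, ← sum_add_distrib]
    refine sum_congr rfl fun D _ => ?_
    split_ifs
    · push_cast; ring
    · push_cast; ring
  rw [hmain]
  refine (norm_add_le _ _).trans ?_
  rw [norm_mul, norm_mul, hφ1, one_mul, Complex.norm_real, Real.norm_eq_abs]
  linarith [mul_comm ‖SS G β‖ |∑ D ∈ (PP P L).powerset, if d0 ∣ ∏ p ∈ D, p then cg P L c D * ∏ p ∈ D, rc p else 0|]

lemma UF_count {P} (h : Blk P) (b L) (c) (hc : ∀ i m, c i m ≠ 0 → m ≤ kk b L i) (hc1 : ∀ i m, |c i m| ≤ 1)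
    (W r : ℕ) (hW : ∀ p ∈ PP P L, Nat.Coprime p W) (G : ℕ) :
    ∑ n ∈ range G, UF P L c W r n ≤ G * Ug P L c rc + lev b L * 2 := by
  have e : ∑ n ∈ range G, UF P L c W r n = ∑ D ∈ (PP P L).powerset, cg P L c D * ∑ n ∈ range G, if (∏ p ∈ D, p) ∣ W * n + r then 1 else 0 := by
    have := FU_eq h L c W r G 0
    simp only [FU, mul_zero, ec_zero, mul_one] at this
    apply Complex.ofReal_injective
    push_cast [apply_ite Complex.ofReal]; exact this
  have key : ∀ D ∈ (PP P L).powerset, |cg P L c D * ((∑ n ∈ range G, if (∏ p ∈ D, p) ∣ W * n + r then 1 else 0) - G * ∏ p ∈ D, rc p)|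
      ≤ if cg P L c D ≠ 0 then 2 else 0 := by
    intro D hD
    have hDs := mem_powerset.1 hD
    split_ifs with h0
    · have hdpos : 0 < ∏ p ∈ D, p := prod_pos fun p hp => (PP_prime h L p (hDs hp)).pos
      have hco : Nat.Coprime (∏ p ∈ D, p) W := Nat.Coprime.prod_left fun p hp => hW p (hDs hp)
      obtain ⟨n0, hn0, hcl⟩ := class_ex W r _ hdpos hco
      rw [abs_mul]
      refine (mul_le_mul_of_nonneg_right (cg_abs P L c D hc1) (abs_nonneg _)).trans ?_
      rw [one_mul]
      have h2 := class_near _ n0 hn0 G 0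
      simp only [SS, mul_zero, ec_zero, sum_const, card_range, nsmul_eq_mul, mul_one, abs_zero, zero_mul, zero_add, ← hcl] at h2
      rw [← Real.norm_eq_abs, ← Complex.norm_real, rc_prod]
      have e : (((∑ n ∈ range G, if (∏ p ∈ D, p) ∣ W * n + r then (1:ℝ) else 0) - G * (1 / (∏ p ∈ D, p : ℕ)) : ℝ) : ℂ) =
          (∑ x ∈ range G, if ∏ p ∈ D, p ∣ W * x + r then 1 else 0) - (G : ℂ) / (∏ p ∈ D, p : ℕ) := by
        push_cast [apply_ite Complex.ofReal]; rw [mul_one_div]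
      rw [e]; exact h2
    · simp only [ne_eq, not_not] at h0; simp [h0]
  have hsum := (le_abs_self _).trans ((abs_sum_le_sum_abs _ _).trans (sum_le_sum key))
  rw [← sum_filter, sum_const, nsmul_eq_mul] at hsum
  have hcard : ((#((PP P L).powerset.filter fun D => cg P L c D ≠ 0) : ℕ) : ℝ) * 2 ≤ lev b L * 2 := by
    have := supp_card h b L c hc
    gcongr
  simp_rw [mul_sub] at hsum
  rw [sum_sub_distrib, ← e] at hsum
  have : ∑ D ∈ (PP P L).powerset, cg P L c D * (G * ∏ p ∈ D, rc p) = G * Ug P L c rc := by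
    unfold Ug; rw [mul_sum]; exact sum_congr rfl fun _ _ => by ring
  linarith
end

section
open Finset

noncomputable def C1 : ℝ := Real.exp 13 ^ ⌈Real.exp 13 ^ 2⌉₊

lemma C1_pos : 0 < C1 := by unfold C1; positivity

lemma C1_ge : 1 ≤ C1 := one_le_pow₀ (Real.one_le_exp (by norm_num))

lemma kap_factor (p : ℕ) (hp : p.Prime) (h : Real.exp 13 ^ 2 ≤ p) : Real.exp 13 * rc p ≤ 1 / √p := by
  have hp0 : (0 : ℝ) < p := by exact_mod_cast hp.pos
  unfold rc
  have h1 : Real.exp 13 ≤ √p := Real.le_sqrt_of_sq_le h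
  have h2 : 0 < √(p : ℝ) := Real.sqrt_pos.2 hp0
  rw [mul_one_div, div_le_div_iff₀ hp0 h2]
  nlinarith [Real.mul_self_sqrt hp0.le]

lemma sqrt_prod' (D : Finset ℕ) : √((∏ p ∈ D, p : ℕ) : ℝ) = ∏ p ∈ D, √(p : ℝ) := by
  push_cast
  induction D using Finset.induction_on with
  | empty => simp
  | insert a s ha ih => rw [prod_insert ha, prod_insert ha, Real.sqrt_mul (by positivity), ih]

lemma kap_le (D : Finset ℕ) (hD : ∀ p ∈ D, p.Prime) :
    ∏ p ∈ D, (Real.exp 13 * rc p) ≤ C1 / √((∏ p ∈ D, p : ℕ) : ℝ) := by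
  rw [sqrt_prod']
  have h1 : ∀ p ∈ D, Real.exp 13 * rc p ≤ (if (p : ℝ) < Real.exp 13 ^ 2 then Real.exp 13 else 1) * (1 / √p) := by
    intro p hp
    have h0 : (1 : ℝ) ≤ p := by exact_mod_cast (hD p hp).one_le
    split_ifs with h
    · unfold rc
      gcongr
      rw [Real.sqrt_le_left (by linarith)]; nlinarith
    · rw [one_mul]; exact kap_factor p (hD p hp) (not_lt.1 h)
  refine (prod_le_prod (fun p _ => mul_nonneg (Real.exp_pos _).le (rc_mem p).1) h1).trans ?_
  rw [prod_mul_distrib, prod_div_distrib, prod_const_one, mul_one_div]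
  have : ∏ p ∈ D, (if (p : ℝ) < Real.exp 13 ^ 2 then Real.exp 13 else 1) ≤ C1 := by
    rw [← prod_filter, prod_const]
    refine pow_le_pow_right₀ (Real.one_le_exp (by norm_num)) ?_
    refine (card_le_card (t := range ⌈Real.exp 13 ^ 2⌉₊) ?_).trans (by simp)
    intro p hp
    rw [mem_range, Nat.lt_ceil]; exact (mem_filter.1 hp).2
  gcongr

lemma kap_le' (D : Finset ℕ) (hD : ∀ p ∈ D, p.Prime) (h : ∀ p ∈ D, Real.exp 13 ^ 2 ≤ p) :
    ∏ p ∈ D, (Real.exp 13 * rc p) ≤ 1 / √((∏ p ∈ D, p : ℕ) : ℝ) := by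
  rw [sqrt_prod', ← prod_const_one (s := D), ← prod_div_distrib]
  exact prod_le_prod (fun p _ => mul_nonneg (Real.exp_pos _).le (rc_mem p).1) fun p hp => kap_factor p (hD p hp) (h p hp)

lemma main_ex {P} (h : Blk P) (b L) (d0 : ℕ) (hd0 : 0 < d0) : ∃ κ : ℝ, 0 ≤ κ ∧ κ ≤ C1 / √(d0 : ℝ) ∧
    (∀ Y : ℝ, Real.exp 13 ^ 2 ≤ Y → (∀ p ∈ PP P L, Y ≤ p) → d0 ≠ 1 → κ ≤ 1 / √Y) ∧
    |∑ D ∈ (PP P L).powerset, if d0 ∣ ∏ p ∈ D, p then cg P L (cE b L) D * ∏ p ∈ D, rc p else 0| ≤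
      VV (PP P L) * Real.exp (tau b L) * κ := by
  by_cases hex : ∃ D0 ⊆ PP P L, d0 = ∏ p ∈ D0, p
  · obtain ⟨D0, hs, rfl⟩ := hex
    have hp : ∀ p ∈ D0, p.Prime := fun p hp => PP_prime h L p (hs hp)
    refine ⟨_, prod_nonneg fun p _ => mul_nonneg (Real.exp_pos _).le (rc_mem p).1, kap_le D0 hp, ?_, ?_⟩
    · intro Y hY hY' hne
      refine (kap_le' D0 hp fun p hp' => hY.trans (hY' p (hs hp'))).trans ?_
      have hY0 : 0 < Y := lt_of_lt_of_le (by positivity) hY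
      have : Y ≤ (∏ p ∈ D0, p : ℕ) := by
        obtain ⟨p, hpD⟩ : D0.Nonempty := by
          rw [nonempty_iff_ne_empty]; rintro rfl; simp at hne
        refine (hY' p (hs hpD)).trans ?_
        exact_mod_cast Nat.le_of_dvd hd0 (dvd_prod_of_mem _ hpD)
      gcongr
    · refine le_of_eq_of_le ?_ (UE_sub h b L D0 hs)
      congr 1
      refine sum_congr rfl fun D hD => ?_
      have hD' := mem_powerset.1 hD
      have : (∏ p ∈ D0, p) ∣ (∏ p ∈ D, p) ↔ D0 ⊆ D := by
        refine ⟨fun hd => ?_, fun hd => prod_dvd_prod_of_subset _ _ _ hd⟩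
        have hpD : ∀ p ∈ D, p.Prime := fun p hp => PP_prime h L p (hD' hp)
        have := Nat.primeFactors_mono hd (prod_pos fun p hp => (hpD p hp).pos).ne'
        rwa [prod_primeFactors _ hp, prod_primeFactors _ hpD] at this
      simp only [this]
  · refine ⟨0, le_rfl, div_nonneg C1_pos.le (Real.sqrt_nonneg _), fun Y _ _ _ => by positivity, ?_⟩
    rw [sum_eq_zero]
    · simp
    · intro D hD
      have hD' := mem_powerset.1 hD
      have hpD : ∀ p ∈ D, p.Prime := fun p hp => PP_prime h L p (hD' hp)
      rw [if_neg]
      intro hd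
      have hne := (prod_pos fun p hp => (hpD p hp).pos).ne'
      refine hex ⟨d0.primeFactors, ?_, ?_⟩
      · refine ((Nat.primeFactors_mono hd hne).trans ?_)
        rw [prod_primeFactors _ hpD]; exact hD'
      · have : Squarefree (∏ p ∈ D, p) := by
          refine Finset.squarefree_prod_of_pairwise_isCoprime ?_ fun p hp => (hpD p hp).squarefree
          intro p hp q hq hpq
          exact Nat.coprime_iff_isRelPrime.1 ((Nat.coprime_primes (hpD p hp) (hpD q hq)).2 hpq)
        exact (Nat.prod_primeFactors_of_squarefree (this.squarefree_of_dvd hd)).symm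

/-- full prime blocks -/
def Pf (i : ℕ) : Finset ℕ := (range (2 ^ 2 ^ (i + 1))).filter fun p => p.Prime ∧ 2 ^ 2 ^ i ≤ p

lemma Pf_blk : Blk Pf := by
  intro i p hp
  simp only [Pf, mem_filter, mem_range] at hp
  exact ⟨hp.2.1, hp.2.2, hp.1⟩

lemma PP_Pf (L) : PP Pf L = (2 ^ 2 ^ L).primesBelow := by
  ext p
  simp only [PP, Pf, mem_biUnion, mem_range, mem_filter, Nat.mem_primesBelow]
  constructor
  · rintro ⟨i, hi, h1, h2, h3⟩
    refine ⟨h1.trans_le ?_, h2⟩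
    exact Nat.pow_le_pow_right (by norm_num) (Nat.pow_le_pow_right (by norm_num) hi)
  · rintro ⟨h1, h2⟩
    induction L with
    | zero => simp at h1; have := h2.two_le; omega
    | succ L ih =>
      by_cases h : p < 2 ^ 2 ^ L
      · obtain ⟨i, hi, h'⟩ := ih h
        exact ⟨i, by omega, h'⟩
      · exact ⟨L, by omega, h1, h2, not_lt.1 h⟩

lemma VV_primes_le (N : ℕ) : VV N.primesBelow * Real.log N ≤ 1 := by
  let f : ℕ →* ℝ := { toFun := fun n => (n : ℝ)⁻¹, map_one' := by simp, map_mul' := fun a b => by push_cast; rw [mul_inv] }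
  have hf : ∀ n, f n = (n : ℝ)⁻¹ := fun _ => rfl
  have h1 := EulerProduct.summable_and_hasSum_smoothNumbers_prod_primesBelow_geometric (f := f) (by
    intro p hp
    rw [hf, norm_inv, Real.norm_natCast]
    exact inv_lt_one_of_one_lt₀ (by exact_mod_cast hp.one_lt)) N
  have hpos : 0 < VV N.primesBelow := VV_pos _ fun p hp => Nat.prime_of_mem_primesBelow hp
  have e : ∏ p ∈ N.primesBelow, (1 - f p)⁻¹ = (VV N.primesBelow)⁻¹ := by
    unfold VV; rw [prod_inv_distrib]; simp [hf]
  have h2 : Real.log N ≤ (VV N.primesBelow)⁻¹ := by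
    rw [← e, ← h1.2.tsum_eq]
    rcases Nat.eq_zero_or_pos N with rfl | hN
    · simpa using tsum_nonneg fun m => by rw [hf]; positivity
    obtain ⟨k, rfl⟩ : ∃ k, N = k + 1 := ⟨N - 1, by omega⟩
    have h3 := log_add_one_le_harmonic k
    refine le_trans (by exact_mod_cast h3) ?_
    rw [harmonic]
    have hmem : ∀ i, i < k → i + 1 ∈ Nat.smoothNumbers (k + 1) := fun i hi =>
      Nat.mem_smoothNumbers_of_lt (by omega) (by omega)
    let g : range k → Nat.smoothNumbers (k + 1) := fun i => ⟨i.1 + 1, hmem _ (mem_range.1 i.2)⟩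
    have hg : Function.Injective g := by
      intro i j hij
      have := congrArg Subtype.val hij
      simp only [g] at this
      exact Subtype.ext (by omega)
    have h4 := h1.2.summable.sum_le_tsum (univ.map ⟨g, hg⟩) (fun m _ => by rw [hf]; positivity)
    refine le_trans (le_of_eq ?_) h4
    rw [sum_map, ← sum_coe_sort]
    push_cast
    refine sum_congr rfl fun i _ => ?_
    simp [hf, g]
  calc _ ≤ VV N.primesBelow * (VV N.primesBelow)⁻¹ := by gcongr
    _ = 1 := mul_inv_cancel₀ hpos.ne'

noncomputable def lz (L : ℕ) : ℝ := Real.log ((2 ^ 2 ^ L : ℕ) : ℝ)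

lemma lz_pos (L) : 0 < lz L := Real.log_pos (by exact_mod_cast Nat.one_lt_pow (by positivity) (by norm_num))

lemma lz_eq (L) : lz L = 2 ^ L * Real.log 2 := by
  unfold lz; push_cast; rw [Real.log_pow]; push_cast; ring

lemma VV_Pf (L) : VV (PP Pf L) ≤ 1 / lz L := by
  rw [PP_Pf, le_div_iff₀ (lz_pos L)]; exact VV_primes_le _

lemma VVPP_pos {P} (h : Blk P) (L) : 0 < VV (PP P L) := VV_pos _ (PP_prime h L)

lemma FU_bd {P} (h : Blk P) (b L) (W r : ℕ) (hW : ∀ p ∈ PP P L, Nat.Coprime p W) (G Q : ℕ) (θ : ℝ)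
    (hlev : 2 * lev b L ≤ Q) : ∃ (a : ℤ) (d0 : ℕ) (κ : ℝ), 0 < d0 ∧ d0 ≤ Q ∧ |θ - a / d0| ≤ 1 / (d0 * Q) ∧
    0 ≤ κ ∧ κ ≤ C1 / √(d0 : ℝ) ∧
    (∀ Y : ℝ, Real.exp 13 ^ 2 ≤ Y → (∀ p ∈ PP P L, Y ≤ p) → d0 ≠ 1 → κ ≤ 1 / √Y) ∧
    ‖FU P L (cE b L) W r G θ‖ ≤ VV (PP P L) * Real.exp (tau b L) * κ * ‖SS G (θ - a / d0)‖ + lev b L * (Q + 7 * G / Q + 2) := by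
  have hl : 0 < lev b L := by unfold lev; positivity
  have hQ : 0 < Q := by omega
  obtain ⟨q, hq1, hq2⟩ := Real.exists_rat_abs_sub_le_and_den_le θ hQ
  obtain ⟨κ, k1, k2, k3, k4⟩ := main_ex h b L q.den q.pos
  have hqe : (q : ℝ) = q.num / q.den := by exact_mod_cast (Rat.num_div_den q).symm
  have hQ' : (0 : ℝ) < Q := by exact_mod_cast hQ
  have hd' : (0 : ℝ) < q.den := by exact_mod_cast q.pos
  have hb : |θ - q.num / q.den| ≤ 1 / (q.den * Q) := by
    rw [← hqe]; refine hq1.trans ?_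
    refine one_div_le_one_div_of_le (by positivity) ?_
    nlinarith
  refine ⟨q.num, q.den, κ, q.pos, hq2, hb, k1, k2, k3, ?_⟩
  refine (S0 h b L (cE b L) (cE_lv b L) (cE_abs b L) W r hW G θ q.num q.den Q q.pos hq2 ?_ hb hlev).trans ?_
  · rw [Int.isCoprime_iff_gcd_eq_one]; exact q.reduced
  · gcongr

lemma nn_mul (k : ℕ) (x : ℝ) : nn (k * x) ≤ k * nn x := by
  refine (nn_le _ (k * round x)).trans ?_
  unfold nn
  push_cast
  rw [← mul_sub, abs_mul, Nat.abs_cast]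

lemma nn_add_int (x : ℝ) (m : ℤ) : nn (x + m) = nn x := by
  unfold nn; rw [round_add_intCast]; push_cast; congr 1; ring

lemma nn_neg (x : ℝ) : nn (-x) = nn x := by
  apply le_antisymm
  · refine (nn_le _ (-round x)).trans (le_of_eq ?_)
    unfold nn; push_cast; rw [← abs_neg]; congr 1; ring
  · refine (nn_le _ (-round (-x))).trans (le_of_eq ?_)
    unfold nn; push_cast; rw [← abs_neg]; congr 1; ring

lemma nn_add (x y : ℝ) : nn (x + y) ≤ nn x + nn y := by
  refine (nn_le _ (round x + round y)).trans ?_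
  unfold nn; push_cast
  have : x + y - (round x + round y) = (x - round x) + (y - round y) := by ring
  rw [this]; exact abs_add_le _ _

lemma one_le_lev (b L) : 1 ≤ lev b L := by unfold lev; exact Nat.one_le_two_pow

lemma lz_le_lev (b L) : lz L ≤ lev b L := by
  rw [lz_eq]
  have h1 : (2:ℝ) ^ L ≤ lev b L := by
    unfold lev
    have : 2 ^ L ≤ 2 ^ (2 ^ L * (4 * b + 6)) := by
      refine Nat.pow_le_pow_right (by norm_num) ?_
      have := (Nat.lt_two_pow_self (n := L)).le
      nlinarith
    exact_mod_cast this
  have h2 : Real.log 2 ≤ 1 := by linarith [Real.log_two_lt_d9]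
  have : (0:ℝ) < 2 ^ L := by positivity
  nlinarith

/-- large Fourier coefficients of the full sieve weight -/
lemma big_FU (b L G G1 : ℕ) (c θ : ℝ) (hc : 0 < c) (hc1 : c ≤ 1) (hτ : tau b L ≤ 1) (hG : G ≤ G1)
    (hG1 : 22 * (lev b L : ℝ) ^ 2 ≤ c * √G1) (hF : c * G1 / lz L ≤ ‖FU Pf L (cE b L) 1 0 G θ‖) :
    ∃ d : ℕ, 0 < d ∧ (d : ℝ) ≤ (6 * C1 / c) ^ 3 ∧ nn (d * θ) ≤ (6 * C1 / c) ^ 3 / G1 := by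
  set l : ℝ := (lev b L : ℝ) with hl
  have hl1 : 1 ≤ l := by rw [hl]; exact_mod_cast one_le_lev b L
  have hs : 22 ≤ √(G1 : ℝ) := by nlinarith [Real.sqrt_nonneg (G1 : ℝ)]
  have hG1p : (0 : ℝ) < G1 := by
    by_contra hh
    have : √(G1 : ℝ) = 0 := Real.sqrt_eq_zero_of_nonpos (not_lt.1 hh)
    linarith
  have hss := Real.mul_self_sqrt hG1p.le
  set Q := ⌈√(G1 : ℝ)⌉₊ with hQ
  have hQ1 : √(G1 : ℝ) ≤ Q := Nat.le_ceil _
  have hQ2 : (Q : ℝ) ≤ √(G1 : ℝ) + 1 := (Nat.ceil_lt_add_one (Real.sqrt_nonneg _)).le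
  have hlev : 2 * lev b L ≤ Q := by
    have : 2 * l ≤ Q := by nlinarith
    rw [hl] at this; exact_mod_cast this
  obtain ⟨a, d0, κ, h1, h2, h3, h4, h5, -, h7⟩ := FU_bd Pf_blk b L 1 0 (fun p _ => Nat.coprime_one_right p) G Q θ hlev
  have hd0 : (0 : ℝ) < d0 := by exact_mod_cast h1
  set S := ‖SS G (θ - a / d0)‖
  have hS0 : 0 ≤ S := norm_nonneg _
  have hS1 : S ≤ G1 := (SS_le _ _).trans (by exact_mod_cast hG)
  have hlz := lz_pos L
  have herr : l * (Q + 7 * G / Q + 2) ≤ c / 2 * G1 / lz L := by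
    have hGQ : 7 * (G : ℝ) / Q ≤ 7 * √(G1 : ℝ) := by
      rw [div_le_iff₀ (by linarith)]
      have : (G : ℝ) ≤ G1 := by exact_mod_cast hG
      nlinarith
    rw [le_div_iff₀ hlz]
    have hll : lz L ≤ l := lz_le_lev b L
    have : l * (Q + 7 * G / Q + 2) ≤ l * (11 * √(G1 : ℝ)) := by gcongr; linarith
    have h9 : l * (11 * √(G1 : ℝ)) * lz L ≤ l * (11 * √(G1 : ℝ)) * l := by gcongr
    nlinarith
  have hm : VV (PP Pf L) * Real.exp (tau b L) * κ * S ≤ (1 / lz L) * 3 * (C1 / √(d0 : ℝ)) * S := by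
    have := VV_Pf L
    have h0 := (VVPP_pos Pf_blk L).le
    have he : Real.exp (tau b L) ≤ 3 := (Real.exp_le_exp.2 hτ).trans (by linarith [Real.exp_one_lt_d9])
    gcongr
  have hkey : c * G1 * √(d0 : ℝ) ≤ 6 * C1 * S := by
    have h8 : c / 2 * G1 / lz L ≤ (1 / lz L) * 3 * (C1 / √(d0 : ℝ)) * S := by
      have : c * G1 / lz L = c / 2 * G1 / lz L + c / 2 * G1 / lz L := by ring
      linarith
    have hsd : 0 < √(d0 : ℝ) := Real.sqrt_pos.2 hd0
    have e : (1 / lz L) * 3 * (C1 / √(d0 : ℝ)) * S = (3 * C1 * S / √(d0 : ℝ)) / lz L := by ring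
    rw [e, div_le_div_iff_of_pos_right hlz, le_div_iff₀ hsd] at h8
    linarith
  have hsd1 : 1 ≤ √(d0 : ℝ) := by rw [Real.one_le_sqrt]; exact_mod_cast h1
  have hC := C1_ge
  set X := 6 * C1 / c with hX
  have hX1 : 1 ≤ X := by rw [hX, le_div_iff₀ hc]; linarith
  have hXc : X * c = 6 * C1 := by rw [hX]; field_simp
  have hd : √(d0 : ℝ) ≤ X := by
    have : c * G1 * √(d0 : ℝ) ≤ X * c * G1 := by rw [hXc]; exact hkey.trans (by gcongr)
    have hcg : 0 < c * G1 := by positivity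
    nlinarith
  have hd2 : (d0 : ℝ) ≤ X ^ 2 := by
    rw [← Real.sq_sqrt hd0.le]; gcongr
  refine ⟨d0, h1, hd2.trans (pow_le_pow_right₀ hX1 (by norm_num)), ?_⟩
  have hn := SS_nn G (θ - a / d0)
  have e : nn (d0 * θ) = nn (d0 * (θ - a / d0)) := by
    rw [← nn_add_int (d0 * (θ - a / d0)) a]; congr 1; field_simp; ring
  rw [e]
  refine (nn_mul _ _).trans ?_
  have hnn0 := nn_nonneg (θ - a / d0)
  generalize nn (θ - a / d0) = ν at hn hnn0 ⊢
  have h10 : ν * (c * G1) ≤ X * c := by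
    rw [hXc]
    have h12 : c * G1 ≤ 6 * C1 * S := le_trans (le_mul_of_one_le_right (by positivity) hsd1) hkey
    have h13 := mul_le_mul_of_nonneg_left h12 hnn0
    have h14 : ν * (6 * C1 * S) = 3 * C1 * (2 * ν * S) := by ring
    have h15 := mul_le_mul_of_nonneg_left hn (by linarith : 0 ≤ 3 * C1)
    linarith
  have h11 : ν ≤ X / G1 := by
    rw [le_div_iff₀ hG1p]
    have : (ν * G1) * c ≤ X * c := by linarith
    exact le_of_mul_le_mul_right this hc
  calc (d0 : ℝ) * ν ≤ X ^ 2 * (X / G1) := by gcongr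
    _ = _ := by ring
end

section
open Finset

lemma nn_abs (x : ℝ) (h : |x| ≤ 1 / 2) : |x| ≤ nn x := by
  unfold nn
  by_cases h0 : round x = 0
  · rw [h0]; simp
  · have : (1 : ℝ) ≤ |(round x : ℝ)| := by exact_mod_cast Int.one_le_abs h0
    have h2 := abs_sub_abs_le_abs_sub (round x : ℝ) x
    rw [abs_sub_comm (round x : ℝ) x] at h2
    linarith

lemma ec_re (x : ℝ) (h : nn x ≤ 1 / 8) : 1 / 2 ≤ (ec x).re := by
  have e : ec x = ec (x - round x) := by
    rw [← ec_add_int (x - round x) (round x)]; congr 1; ring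
  have h1 : ‖ec (x - round x) - 1‖ ≤ 1 := by
    have := ec_sub_le (x - round x) 0
    rw [ec_zero, sub_zero] at this
    unfold nn at h
    nlinarith [Real.pi_lt_d2, Real.pi_pos, abs_nonneg (x - round x)]
  -- sharper via sine bound
  have h3 : ‖ec x - 1‖ ^ 2 ≤ 1 := by rw [e]; nlinarith [norm_nonneg (ec (x - round x) - 1)]
  have h4 : ‖ec x‖ ^ 2 = 1 := by rw [ec_norm]; norm_num
  rw [← Complex.normSq_eq_norm_sq, Complex.normSq_apply] at h3 h4
  simp at h3
  nlinarith

lemma sq_expand (K : ℕ) (x : ℝ) : ((‖∑ k ∈ range K, ec (k * x)‖ ^ 2 : ℝ) : ℂ) =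
    ∑ k ∈ range K, ∑ k' ∈ range K, ec (((k : ℝ) - k') * x) := by
  rw [Complex.ofReal_pow, ← Complex.mul_conj', map_sum, sum_mul_sum]
  refine sum_congr rfl fun k _ => sum_congr rfl fun k' _ => ?_
  rw [← ec_neg, ← ec_add]; congr 1; ring

lemma fej (w : ℕ → ℝ) (hw : ∀ n, 0 ≤ w n) (G K : ℕ) (S : Finset ℕ) (hS : S ⊆ range G) (n0 γ : ℝ)
    (h : ∀ n ∈ S, 8 * K * nn ((n - n0) * γ) ≤ 1) :
    (K : ℝ) ^ 2 / 4 * ∑ n ∈ S, w n ≤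
      ∑ k ∈ range K, ∑ k' ∈ range K, ‖∑ n ∈ range G, (w n : ℂ) * ec (n * (((k : ℝ) - k') * γ))‖ := by
  have h1 : (K : ℝ) ^ 2 / 4 * ∑ n ∈ S, w n ≤ ∑ n ∈ range G, w n * ‖∑ k ∈ range K, ec (k * ((n - n0) * γ))‖ ^ 2 := by
    rw [mul_sum]
    refine le_trans (sum_le_sum fun n hn => ?_) (sum_le_sum_of_subset_of_nonneg hS fun n _ _ => mul_nonneg (hw n) (sq_nonneg _))
    rw [mul_comm]
    refine mul_le_mul_of_nonneg_left ?_ (hw n)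
    have h2 : (K : ℝ) / 2 ≤ ‖∑ k ∈ range K, ec (k * ((n - n0) * γ))‖ := by
      refine le_trans ?_ (Complex.re_le_norm _)
      rw [Complex.re_sum]
      have : (K : ℝ) / 2 = ∑ k ∈ range K, (1 / 2 : ℝ) := by simp; ring
      rw [this]
      refine sum_le_sum fun k hk => ec_re _ ?_
      have := nn_mul k ((n - n0) * γ)
      have hk' : (k : ℝ) ≤ K := by exact_mod_cast (mem_range.1 hk).le
      have h3 := h n hn
      nlinarith [nn_nonneg ((n - n0) * γ)]
    have : (0:ℝ) ≤ K / 2 := by positivity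
    calc (K : ℝ) ^ 2 / 4 = (K / 2) ^ 2 := by ring
      _ ≤ _ := by gcongr
  refine h1.trans ?_
  have e : ((∑ n ∈ range G, w n * ‖∑ k ∈ range K, ec (k * ((n - n0) * γ))‖ ^ 2 : ℝ) : ℂ) =
      ∑ k ∈ range K, ∑ k' ∈ range K, ec (-(((k : ℝ) - k') * (n0 * γ))) * ∑ n ∈ range G, (w n : ℂ) * ec (n * (((k : ℝ) - k') * γ)) := by
    rw [Complex.ofReal_sum]
    simp_rw [Complex.ofReal_mul, sq_expand, mul_sum]
    rw [sum_comm]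
    refine sum_congr rfl fun k _ => ?_
    rw [sum_comm]
    refine sum_congr rfl fun k' _ => sum_congr rfl fun n _ => ?_
    rw [mul_left_comm (ec _), ← ec_add]; congr 2; ring
  have h2 := congrArg norm e
  rw [Complex.norm_real] at h2
  refine ((le_abs_self _).trans (le_of_eq h2)).trans ?_
  refine norm_sum_le_of_le _ fun k _ => norm_sum_le_of_le _ fun k' _ => ?_
  rw [norm_mul, ec_norm, one_mul]

lemma vin1 (H : ℕ) (S : Finset ℕ) (hS : S ⊆ range H) (c δ n0 γ : ℝ) (hc : 0 < c) (hc1 : c ≤ 1) (hH : 0 < H)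
    (hcard : c * H ≤ #S) (hδ : 72 * δ ≤ c) (h : ∀ n ∈ S, nn ((n - n0) * γ) ≤ δ) :
    ∃ q : ℕ, 0 < q ∧ (q : ℝ) ≤ 9 / c ∧ nn (q * γ) ≤ 4 / (c * H) := by
  have hH' : (0:ℝ) < H := by exact_mod_cast hH
  set K := ⌊8 / c⌋₊ + 1 with hK
  have hK1 : 8 / c < K := by rw [hK]; push_cast; exact Nat.lt_floor_add_one _
  have hK2 : (K : ℝ) ≤ 9 / c := by
    rw [hK]; push_cast
    have := Nat.floor_le (by positivity : 0 ≤ 8 / c)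
    have h1 : 1 ≤ 1 / c := by rw [le_div_iff₀ hc]; linarith
    have : 9 / c = 8 / c + 1 / c := by ring
    linarith
  have hδ0 : 8 * K * δ ≤ 1 := by
    by_cases hd : δ ≤ 0
    · have : (0:ℝ) ≤ 8 * K := by positivity
      nlinarith
    · have h2 : 8 * K * δ ≤ 8 * (9 / c) * δ := by push Not at hd; gcongr
      have : 8 * (9 / c) * δ = 72 * δ / c := by ring
      have h3 : 72 * δ / c ≤ 1 := by rw [div_le_one hc]; exact hδ
      linarith
  have hf := fej (fun _ => 1) (fun _ => zero_le_one) H K S hS n0 γ (fun n hn => by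
    have := h n hn
    have h0 : (0:ℝ) ≤ 8 * K := by positivity
    nlinarith)
  simp only [sum_const, nsmul_eq_mul, mul_one, Complex.ofReal_one, one_mul] at hf
  have hex : ∃ k ∈ range K, ∃ k' ∈ range K, k ≠ k' ∧ c * H / 8 ≤ ‖SS H (((k : ℝ) - k') * γ)‖ := by
    by_contra hcon
    push Not at hcon
    have : ∑ k ∈ range K, ∑ k' ∈ range K, ‖∑ n ∈ range H, ec (n * (((k : ℝ) - k') * γ))‖ ≤
        ∑ k ∈ range K, ∑ k' ∈ range K, ((if k = k' then (H : ℝ) else 0) + c * H / 8) := by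
      refine sum_le_sum fun k hk => sum_le_sum fun k' hk' => ?_
      have hp : 0 ≤ c * H / 8 := by positivity
      split_ifs with hkk
      · have := SS_le H (((k : ℝ) - k') * γ)
        unfold SS at this; linarith
      · have := hcon k hk k' hk' hkk
        unfold SS at this; linarith
    have h2 : ∑ k ∈ range K, ∑ k' ∈ range K, ((if k = k' then (H : ℝ) else 0) + c * H / 8) = K * H + K * K * (c * H / 8) := by
      simp only [sum_add_distrib, sum_ite_eq, sum_const, card_range, nsmul_eq_mul]
      rw [sum_congr rfl fun x hx => if_pos hx]
      simp; ring
    have h3 : (K : ℝ) ^ 2 / 4 * (c * H) ≤ K * H + K * K * (c * H / 8) := by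
      have : (K : ℝ) ^ 2 / 4 * (c * H) ≤ (K : ℝ) ^ 2 / 4 * #S := by gcongr
      linarith
    have hKp : (0:ℝ) < K * H := by positivity
    have h4 : (K * H : ℝ) * (K * c) ≤ K * H * 8 := by nlinarith
    have h5 := le_of_mul_le_mul_left h4 hKp
    rw [div_lt_iff₀ hc] at hK1
    linarith
  obtain ⟨k, hk, k', hk', hne, hbig⟩ := hex
  rw [mem_range] at hk hk'
  have hq : (( ((k : ℤ) - k').natAbs : ℕ) : ℝ) = |(k : ℝ) - k'| := by
    rw [Nat.cast_natAbs]; push_cast; rfl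
  refine ⟨((k : ℤ) - k').natAbs, by omega, ?_, ?_⟩
  · refine le_trans ?_ hK2
    exact_mod_cast (by omega : ((k : ℤ) - k').natAbs ≤ K)
  · have e : nn ((((k : ℤ) - k').natAbs : ℕ) * γ) = nn (((k : ℝ) - k') * γ) := by
      rw [hq]
      rcases abs_choice ((k : ℝ) - k') with e | e
      · rw [e]
      · rw [e, neg_mul, nn_neg]
    rw [e]
    have h1 := SS_nn H (((k : ℝ) - k') * γ)
    have h0 := nn_nonneg (((k : ℝ) - k') * γ)
    rw [le_div_iff₀ (by positivity)]
    nlinarith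

lemma vin (H : ℕ) (S : Finset ℕ) (hS : S ⊆ range H) (c δ n0 γ : ℝ) (hc : 0 < c) (hc1 : c ≤ 1) (hH : 306 / c ^ 3 ≤ H)
    (hcard : c * H ≤ #S) (hδ : 72 * δ ≤ c) (h : ∀ n ∈ S, nn ((n - n0) * γ) ≤ δ) :
    ∃ q : ℕ, 0 < q ∧ (q : ℝ) ≤ 9 / c ∧ nn (q * γ) ≤ 6000 * δ / (c ^ 4 * H) := by
  have hHr : (0:ℝ) < H := lt_of_lt_of_le (by positivity) hH
  have hH0 : 0 < H := by exact_mod_cast hHr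
  obtain ⟨q, hq0, hq1, hq2⟩ := vin1 H S hS c δ n0 γ hc hc1 hH0 hcard hδ h
  refine ⟨q, hq0, hq1, ?_⟩
  have hq0' : (0:ℝ) < q := by exact_mod_cast hq0
  have hc3 : 306 ≤ c ^ 3 * H := by rw [div_le_iff₀ (by positivity)] at hH; linarith
  have hcH : 306 ≤ c * H := by
    have : c ^ 3 * H ≤ c * H := by gcongr; nlinarith [sq_nonneg c]
    linarith
  set l := ⌊c * H / 8⌋₊ with hl
  have hl1 : (l : ℝ) ≤ c * H / 8 := Nat.floor_le (by positivity)
  have hl2 : c * H / 16 ≤ l := by have := Nat.lt_floor_add_one (c * H / 8); rw [← hl] at this; linarith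
  have hl0 : 0 < l := by
    have : (0:ℝ) < l := by linarith
    exact_mod_cast this
  have hmaps : ∀ n ∈ S, (n % q, n / l) ∈ range q ×ˢ range (H / l + 1) := by
    intro n hn
    have := mem_range.1 (hS hn)
    rw [mem_product, mem_range, mem_range]
    exact ⟨Nat.mod_lt _ hq0, Nat.lt_succ_of_le (Nat.div_le_div_right this.le)⟩
  have hcells : ((#(range q ×ˢ range (H / l + 1)) : ℕ) : ℝ) ≤ 153 / c ^ 2 := by
    rw [card_product, card_range, card_range]
    push_cast
    have : ((H / l : ℕ) : ℝ) + 1 ≤ 17 / c := by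
      have h1 : ((H / l : ℕ) : ℝ) ≤ H / l := Nat.cast_div_le
      have h2 : (H : ℝ) / l ≤ 16 / c := by
        rw [div_le_div_iff₀ (by exact_mod_cast hl0) hc]; linarith
      have h3 : 1 ≤ 1 / c := by rw [le_div_iff₀ hc]; linarith
      have : 17 / c = 16 / c + 1 / c := by ring
      linarith
    calc (q : ℝ) * ((H / l : ℕ) + 1) ≤ 9 / c * (17 / c) := by gcongr
      _ = _ := by ring
  obtain ⟨y, -, hy⟩ := exists_le_card_fiber_of_nsmul_le_card_of_maps_to (b := c ^ 3 * H / 153) hmaps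
    ⟨(0, 0), by simp [hq0]⟩ (by
      rw [nsmul_eq_mul]
      refine le_trans (mul_le_mul_of_nonneg_right hcells (by positivity)) (le_trans (le_of_eq ?_) hcard)
      field_simp)
  set T := S.filter fun n => (n % q, n / l) = y
  have hTne : T.Nonempty := by
    rw [← card_pos]; have : (0:ℝ) < #T := by linarith
    exact_mod_cast this
  set h1 := T.min' hTne
  set h2 := T.max' hTne
  have hm1 : h1 ∈ T := T.min'_mem hTne
  have hm2 : h2 ∈ T := T.max'_mem hTne
  have hle : h1 ≤ h2 := T.min'_le _ hm2
  have hcT : #T ≤ h2 - h1 + 1 := by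
    have : T ⊆ Icc h1 h2 := fun n hn => mem_Icc.2 ⟨T.min'_le _ hn, T.le_max' _ hn⟩
    have := card_le_card this
    rw [Nat.card_Icc] at this; omega
  have hf1 := (mem_filter.1 hm1)
  have hf2 := (mem_filter.1 hm2)
  have hfe := hf1.2.trans hf2.2.symm
  rw [Prod.mk.injEq] at hfe
  obtain ⟨k, hk⟩ : q ∣ h2 - h1 := (Nat.modEq_iff_dvd' hle).1 hfe.1
  have hlt : h2 - h1 < l := by
    have a1 := Nat.div_add_mod h1 l
    have a2 := Nat.div_add_mod h2 l
    have a3 := Nat.mod_lt h2 hl0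
    rw [hfe.2] at a1
    omega
  have hkq : ((h2 : ℝ) - h1) = q * k := by
    rw [← Nat.cast_sub hle, hk]; push_cast; ring
  have hdiff : c ^ 3 * H / 306 ≤ (q : ℝ) * k := by
    rw [← hkq, ← Nat.cast_sub hle]
    have : (#T : ℝ) ≤ ((h2 - h1 : ℕ) : ℝ) + 1 := by exact_mod_cast hcT
    linarith
  have hup : (q : ℝ) * k ≤ c * H / 8 := by
    refine le_trans ?_ hl1
    rw [← hkq, ← Nat.cast_sub hle]; exact_mod_cast hlt.le
  set s := q * γ - round (q * γ) with hs
  have hρ : nn (q * γ) = |s| := rfl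
  rw [hρ] at hq2 ⊢
  have hq1' : (1:ℝ) ≤ q := by exact_mod_cast hq0
  have hks : |k * s| ≤ 1 / 2 := by
    rw [abs_mul, Nat.abs_cast]
    have hk8 : (k : ℝ) ≤ c * H / 8 := by
      refine le_trans ?_ hup
      exact le_mul_of_one_le_left (by positivity) hq1'
    calc (k : ℝ) * |s| ≤ c * H / 8 * (4 / (c * H)) := by gcongr
      _ = 1 / 2 := by field_simp; norm_num
  have hnn : k * |s| ≤ 2 * δ := by
    have e1 := nn_abs _ hks
    rw [abs_mul, Nat.abs_cast] at e1
    refine e1.trans ?_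
    have e2 : nn (k * s) = nn ((h2 - n0) * γ + -((h1 - n0) * γ)) := by
      rw [← nn_add_int (k * s) (k * round (q * γ))]; congr 1
      rw [hs]; push_cast
      have : (h2 : ℝ) = h1 + q * k := by linarith
      rw [this]; ring
    rw [e2]
    refine (nn_add _ _).trans ?_
    rw [nn_neg]
    linarith [h h1 hf1.1, h h2 hf2.1]
  have hs0 := abs_nonneg s
  rw [le_div_iff₀ (by positivity)]
  have h5 : c ^ 3 * H / 306 * |s| ≤ q * (2 * δ) := by
    calc c ^ 3 * H / 306 * |s| ≤ q * k * |s| := by gcongr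
      _ = q * (k * |s|) := by ring
      _ ≤ _ := by gcongr
  have hδ0 : 0 ≤ δ := (nn_nonneg _).trans (h h1 hf1.1)
  have h6 : (q : ℝ) * (2 * δ) * c ≤ 9 * (2 * δ) := by
    rw [le_div_iff₀ hc] at hq1; nlinarith
  have h7 := mul_le_mul_of_nonneg_right h5 hc.le
  have h8 : c ^ 3 * H / 306 * |s| * c = |s| * (c ^ 4 * H) / 306 := by ring
  rw [h8] at h7
  linarith
end

section
open Finset

lemma avg (s : Finset ℕ) (w x : ℕ → ℝ) (hw : ∀ i ∈ s, 0 ≤ w i) (A S : ℝ) (hA : 0 < A) (hS : 0 < S)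
    (h1 : ∑ i ∈ s, w i ≤ S) (h2 : A ≤ ∑ i ∈ s, w i * x i) : ∃ i ∈ s, A / (2 * S) ≤ x i := by
  have : ∑ i ∈ s, w i * (A / (2 * S)) < ∑ i ∈ s, w i * x i := by
    rw [← sum_mul]
    have : (∑ i ∈ s, w i) * (A / (2 * S)) ≤ S * (A / (2 * S)) := by gcongr
    have e : S * (A / (2 * S)) = A / 2 := by field_simp
    linarith
  obtain ⟨i, hi, h⟩ := exists_lt_of_sum_lt this
  exact ⟨i, hi, (lt_of_mul_lt_mul_left h (hw i hi)).le⟩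

open Classical in
lemma PGE (s : Finset ℕ) (w v : ℕ → ℝ) (hw : ∀ i ∈ s, 0 ≤ w i) (P : ℕ → ℕ → Prop) (A S V D0 : ℝ) (hA : 0 < A)
    (hS : 0 < S) (hV : 0 < V) (h1 : ∑ i ∈ s, w i ≤ S) (h2 : A ≤ ∑ i ∈ s, w i * v i) (hv : ∀ i ∈ s, v i ≤ V)
    (hP : ∀ i ∈ s, A / (2 * S) ≤ v i → ∃ e : ℕ, 0 < e ∧ (e : ℝ) ≤ D0 ∧ P e i) :
    ∃ e : ℕ, 0 < e ∧ (e : ℝ) ≤ D0 ∧ A ≤ 2 * V * D0 * ∑ i ∈ s with P e i, w i := by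
  by_contra hcon
  push Not at hcon
  have ha : ∑ i ∈ s, w i * v i ≤ A / 2 + V * ∑ i ∈ s with A / (2 * S) ≤ v i, w i := by
    have : ∑ i ∈ s, w i * v i ≤ ∑ i ∈ s, (w i * (A / (2 * S)) + V * if A / (2 * S) ≤ v i then w i else 0) := by
      refine sum_le_sum fun i hi => ?_
      have h0 := hw i hi
      have hp : 0 ≤ A / (2 * S) := by positivity
      split_ifs with h
      · nlinarith [hv i hi, mul_nonneg h0 hp]
      · push Not at h; nlinarith
    rw [sum_add_distrib, ← sum_mul, ← mul_sum, ← sum_filter] at this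
    have h3 : (∑ i ∈ s, w i) * (A / (2 * S)) ≤ S * (A / (2 * S)) := by gcongr
    have e : S * (A / (2 * S)) = A / 2 := by field_simp
    linarith
  have hb : ∑ i ∈ s with A / (2 * S) ≤ v i, w i ≤ ∑ e ∈ Icc 1 ⌊D0⌋₊, ∑ i ∈ s with P e i, w i := by
    calc _ ≤ ∑ i ∈ s with A / (2 * S) ≤ v i, ∑ e ∈ Icc 1 ⌊D0⌋₊, if P e i then w i else 0 := by
          refine sum_le_sum fun i hi => ?_
          rw [mem_filter] at hi
          obtain ⟨e, he0, he1, heP⟩ := hP i hi.1 hi.2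
          refine le_trans (le_of_eq (if_pos heP).symm) (single_le_sum (f := fun e => if P e i then w i else 0)
            (fun e _ => ?_) (mem_Icc.2 ⟨he0, Nat.le_floor he1⟩))
          split_ifs <;> simp [hw i hi.1]
      _ ≤ ∑ i ∈ s, ∑ e ∈ Icc 1 ⌊D0⌋₊, if P e i then w i else 0 := by
          refine sum_le_sum_of_subset_of_nonneg (filter_subset _ _) fun i hi _ => sum_nonneg fun e _ => ?_
          split_ifs <;> simp [hw i hi]
      _ = _ := by rw [sum_comm]; simp_rw [sum_filter]
  by_cases hD : (Icc 1 ⌊D0⌋₊).Nonempty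
  · have hc : ∑ e ∈ Icc 1 ⌊D0⌋₊, (2 * V * D0 * ∑ i ∈ s with P e i, w i) < ∑ e ∈ Icc 1 ⌊D0⌋₊, A := by
      refine sum_lt_sum_of_nonempty hD fun e he => ?_
      rw [mem_Icc] at he
      exact hcon e he.1 ((Nat.le_floor_iff' (by omega)).1 he.2)
    rw [← mul_sum, sum_const, nsmul_eq_mul, Nat.card_Icc, Nat.add_sub_cancel] at hc
    obtain ⟨e, he⟩ := hD
    rw [mem_Icc] at he
    have hD1 : (0:ℝ) < D0 := Nat.pos_of_floor_pos (by omega)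
    have h4 : (⌊D0⌋₊ : ℝ) ≤ D0 := Nat.floor_le hD1.le
    have h5 : (⌊D0⌋₊ : ℝ) * A ≤ D0 * A := by gcongr
    have h6 : D0 * (2 * (V * ∑ e ∈ Icc 1 ⌊D0⌋₊, ∑ i ∈ s with P e i, w i)) < D0 * A := by linarith
    have h7 := lt_of_mul_lt_mul_left h6 hD1.le
    nlinarith
  · rw [not_nonempty_iff_eq_empty] at hD
    rw [hD, sum_empty] at hb
    nlinarith

noncomputable abbrev UU (b L n : ℕ) : ℝ := UF Pf L (cE b L) 1 0 n

lemma UU_nonneg (b L n) : 0 ≤ UU b L n :=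
  (prod_nonneg fun p _ => by linarith [(xd_mem 1 0 n p).2]).trans (UE_ge Pf_blk b L _ (xd_mem 1 0 n))

lemma U_sum (b L G : ℕ) (hτ : tau b L ≤ 1) (hG : (lev b L : ℝ) ^ 2 ≤ G) : ∑ n ∈ range G, UU b L n ≤ 5 * G / lz L := by
  have h := UF_count Pf_blk b L (cE b L) (cE_lv b L) (cE_abs b L) 1 0 (fun p _ => Nat.coprime_one_right p) G
  refine h.trans ?_
  have h1 : Ug Pf L (cE b L) rc ≤ 3 / lz L := by
    refine (UE_mean Pf_blk b L).trans ?_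
    have : Real.exp (tau b L) ≤ 3 := (Real.exp_le_exp.2 hτ).trans (by linarith [Real.exp_one_lt_d9])
    calc _ ≤ 1 / lz L * 3 := by
          gcongr
          · have := lz_pos L; positivity
          · exact VV_Pf L
      _ = _ := by ring
  have h2 : (lev b L : ℝ) ≤ G / lz L := by
    rw [le_div_iff₀ (lz_pos L)]
    nlinarith [lz_le_lev b L, lz_pos L, one_le_lev b L]
  calc _ ≤ (G : ℝ) * (3 / lz L) + G / lz L * 2 := by gcongr
    _ = _ := by ring

lemma norm_sum_UU (b L : ℕ) (s : Finset ℕ) (x : ℕ → ℝ) : ‖∑ m ∈ s, (UU b L m : ℂ) * ec (x m)‖ ≤ ∑ m ∈ s, UU b L m := by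
  refine norm_sum_le_of_le _ fun m _ => ?_
  rw [norm_mul, ec_norm, mul_one, Complex.norm_real, Real.norm_of_nonneg (UU_nonneg _ _ _)]

/-- Cauchy–Schwarz -/
lemma cs_step (s t : Finset ℕ) (β U : ℕ → ℝ) (a : ℕ → ℝ) (ha : ∀ n, 0 ≤ a n) (hβ : ∀ n, 0 ≤ β n ∧ β n ≤ U n)
    (R : ℕ → ℕ → Prop) [∀ m d, Decidable (R m d)] (α : ℝ) :
    ‖∑ m ∈ s, (β m : ℂ) * ∑ d ∈ t with R m d, (a d : ℂ) * ec (d * m * α)‖ ^ 2 ≤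
      (∑ m ∈ s, U m) * ∑ d' ∈ t, a d' * ∑ d ∈ t, a d * ‖∑ m ∈ s with R m d ∧ R m d', (U m : ℂ) * ec (m * ((d - d') * α))‖ := by
  set X : ℕ → ℂ := fun m => ∑ d ∈ t with R m d, (a d : ℂ) * ec (d * m * α)
  have hU : ∀ m, 0 ≤ U m := fun m => (hβ m).1.trans (hβ m).2
  have h1 : ‖∑ m ∈ s, (β m : ℂ) * X m‖ ≤ ∑ m ∈ s, √(U m) * (√(U m) * ‖X m‖) := by
    refine norm_sum_le_of_le _ fun m _ => ?_
    rw [norm_mul, Complex.norm_real, Real.norm_of_nonneg (hβ m).1, ← mul_assoc, Real.mul_self_sqrt (hU m)]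
    exact mul_le_mul_of_nonneg_right (hβ m).2 (norm_nonneg _)
  have h2 := sum_mul_sq_le_sq_mul_sq s (fun m => √(U m)) (fun m => √(U m) * ‖X m‖)
  simp_rw [mul_pow, Real.sq_sqrt (hU _)] at h2
  refine (pow_le_pow_left₀ (norm_nonneg _) h1 2).trans (h2.trans ?_)
  refine mul_le_mul_of_nonneg_left ?_ (sum_nonneg fun m _ => hU m)
  have e : ((∑ m ∈ s, U m * ‖X m‖ ^ 2 : ℝ) : ℂ) = ∑ d' ∈ t, ∑ d ∈ t, (a d' * a d : ℝ) *
      ∑ m ∈ s with R m d ∧ R m d', (U m : ℂ) * ec (m * ((d - d') * α)) := by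
    simp_rw [sum_filter, mul_sum]
    rw [Complex.ofReal_sum, sum_comm' (t' := t) (s' := fun _ => t) (by tauto)]
    have : ∀ m : ℕ, ((U m * ‖X m‖ ^ 2 : ℝ) : ℂ) = ∑ d ∈ t, ∑ d' ∈ t, ((a d' * a d : ℝ) : ℂ) *
        (if R m d ∧ R m d' then (U m : ℂ) * ec (m * ((d - d') * α)) else 0) := by
      intro m
      rw [Complex.ofReal_mul, Complex.ofReal_pow, ← Complex.mul_conj', map_sum, sum_mul_sum, sum_filter, mul_sum]
      refine sum_congr rfl fun d _ => ?_
      split_ifs with hd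
      · rw [sum_filter, mul_sum]
        refine sum_congr rfl fun d' _ => ?_
        by_cases hd' : R m d'
        · simp only [hd, hd', and_self, if_true]
          rw [map_mul, Complex.conj_ofReal, ← ec_neg]
          have : ec ((m:ℝ) * ((d - d') * α)) = ec (d * m * α) * ec (-(d' * m * α)) := by
            rw [← ec_add]; congr 1; ring
          rw [this]; push_cast; ring
        · simp [hd']
      · simp [hd]
    rw [sum_congr rfl fun m _ => this m, sum_comm]
    refine sum_congr rfl fun d _ => ?_
    rw [sum_comm]
  have h3 := congrArg norm e
  rw [Complex.norm_real] at h3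
  refine ((le_abs_self _).trans (le_of_eq h3)).trans ?_
  refine norm_sum_le_of_le _ fun d' _ => ?_
  rw [mul_sum]
  refine norm_sum_le_of_le _ fun d _ => ?_
  rw [norm_mul, Complex.norm_real, Real.norm_of_nonneg (mul_nonneg (ha _) (ha _)), mul_assoc]

/-- interval sums of `UU` in terms of `FU` -/
lemma E_big (b L M X : ℕ) (θ c : ℝ) (hc : 0 < c)
    (h : c ≤ ‖∑ m ∈ (Ioc M (2 * M)).filter (fun m => m ≤ X), (UU b L m : ℂ) * ec (m * θ)‖) :
    ∃ G ≤ 2 * M + 1, c / 2 ≤ ‖FU Pf L (cE b L) 1 0 G θ‖ := by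
  have e : (Ioc M (2 * M)).filter (fun m => m ≤ X) = Ico (M + 1) (min (2 * M) X + 1) := by
    ext m; simp only [mem_filter, mem_Ioc, mem_Ico]; omega
  rw [e] at h
  by_cases hM : M + 1 ≤ min (2 * M) X + 1
  · rw [sum_Ico_eq_sub _ hM] at h
    have h2 := h.trans (norm_sub_le _ _)
    by_cases h3 : c / 2 ≤ ‖FU Pf L (cE b L) 1 0 (M + 1) θ‖
    · exact ⟨M + 1, by omega, h3⟩
    · refine ⟨min (2 * M) X + 1, by omega, ?_⟩
      unfold FU at h3 ⊢
      push Not at h3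
      linarith
  · rw [Ico_eq_empty_of_le (by omega)] at h
    simp at h; linarith
end

section
open Finset

lemma sq_aux (K l Y : ℝ) (hK : 1 ≤ K) (hl : 1 ≤ l) (hY : 0 ≤ Y) (h : K * l ^ 2 ≤ √Y) : l ^ 2 ≤ Y ∧ K ≤ Y := by
  have h2 : 1 ≤ l ^ 2 := one_le_pow₀ hl
  have h3 : l ^ 2 ≤ √Y := le_trans (le_mul_of_one_le_left (by positivity) hK) h
  have h4 : K ≤ √Y := le_trans (le_mul_of_one_le_right (by positivity) h2) h
  have h5 : √Y ≤ Y := by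
    have h1 : √Y * √Y = Y := Real.mul_self_sqrt hY
    calc √Y ≤ √Y * √Y := le_mul_of_one_le_left (by positivity) (hK.trans h4)
      _ = Y := h1
  exact ⟨h3.trans h5, h4.trans h5⟩

set_option maxHeartbeats 1000000 in
lemma typeII (c0 B : ℝ) (hc0 : 0 < c0) (hc01 : c0 ≤ 1) (hB : 1 ≤ B) : ∃ K : ℝ, 1 ≤ K ∧ ∀ (b L N M : ℕ) (α : ℝ) (a β : ℕ → ℝ),
    tau b L ≤ 1 → 0 < M → K * (lev b L : ℝ) ^ 2 ≤ √(M : ℝ) → K * (lev b L : ℝ) ^ 2 ≤ √((N : ℝ) / M) →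
    (∀ n, 0 ≤ a n) → (∀ n ∈ range (N / M + 1), a n ≤ B * lz L * UU b L n) → ∑ n ∈ range (N / M + 1), a n ≤ B * ((N : ℝ) / M) →
    (∀ n, 0 ≤ β n ∧ β n ≤ UU b L n) →
    c0 * N / lz L ≤ ‖∑ m ∈ Ioc M (2 * M), (β m : ℂ) * ∑ d ∈ range (N / M + 1) with d * m ≤ N, (a d : ℂ) * ec (d * m * α)‖ →
    ∃ q : ℕ, 0 < q ∧ (q : ℝ) ≤ K ∧ nn (q * α) ≤ K / N := by
  classical
  set c3 := c0 ^ 2 / (60 * B ^ 2) with hc3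
  have hc3p : 0 < c3 := by positivity
  have hc2 : c0 ^ 2 ≤ 1 := pow_le_one₀ hc0.le hc01
  have hB2 : 1 ≤ B ^ 2 := one_le_pow₀ hB
  have hc31 : c3 ≤ 1 := by rw [hc3, div_le_one (by positivity)]; linarith
  set D0 := (6 * C1 / (c3 / 6)) ^ 3 with hD0
  have hD0p : 1 ≤ D0 := by
    refine one_le_pow₀ ?_
    rw [le_div_iff₀ (by positivity)]; linarith [C1_ge]
  set c5 := c0 ^ 2 / (7200 * B ^ 2 * D0) with hc5
  have hc5p : 0 < c5 := by positivity
  have hc51 : c5 ≤ 1 := by rw [hc5, div_le_one (by positivity)]; linarith [one_le_mul_of_one_le_of_one_le hB2 hD0p]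
  set D1 := (6 * C1 / (c5 / 4)) ^ 3 with hD1
  have hD1p : 1 ≤ D1 := by
    refine one_le_pow₀ ?_
    rw [le_div_iff₀ (by positivity)]; linarith [C1_ge]
  set c6 := c5 / (20 * D1) with hc6
  have hc6p : 0 < c6 := by positivity
  have hc61 : c6 ≤ 1 := by rw [hc6, div_le_one (by positivity)]; linarith
  set K := 96000 * D0 * D1 / c6 ^ 4 + 132 / c3 + 88 / c5 with hK
  have hi : 1 ≤ 1 / c6 ^ 4 := by rw [le_div_iff₀ (by positivity), one_mul]; exact pow_le_one₀ hc6p.le hc61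
  have hK0 : 96000 * D0 * D1 / c6 ^ 4 ≤ K := by
    have : 0 < 132 / c3 + 88 / c5 := by positivity
    linarith
  have hKm : ∀ (x : ℝ) (k : ℕ), k ≤ 4 → x ≤ 96000 * (D0 * D1) → x / c6 ^ k ≤ K := by
    intro x k hk hx
    rw [← mul_assoc] at hx
    refine le_trans ?_ hK0
    have : c6 ^ 4 ≤ c6 ^ k := pow_le_pow_of_le_one hc6p.le hc61 hk
    gcongr
  have hDD : 1 ≤ D0 * D1 := one_le_mul_of_one_le_of_one_le hD0p hD1p
  have hDD0 : D0 ≤ D0 * D1 := le_mul_of_one_le_right (by linarith) hD1p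
  have hDD1 : D1 ≤ D0 * D1 := le_mul_of_one_le_left (by linarith) hD0p
  have hK1 : 1 ≤ K := by have := hKm 1 0 (by norm_num) (by linarith); simpa using this
  have hK3 : 132 / c3 ≤ K := by
    have : 0 < 96000 * D0 * D1 / c6 ^ 4 + 88 / c5 := by positivity
    linarith
  have hK5 : 88 / c5 ≤ K := by
    have : 0 < 96000 * D0 * D1 / c6 ^ 4 + 132 / c3 := by positivity
    linarith
  clear_value K
  refine ⟨K, hK1, ?_⟩
  intro b L N M α a β hτ hM hKM hKX ha ha2 haS hβ hT
  set l := lz L with hl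
  have hlp : 0 < l := lz_pos L
  set X : ℝ := (N : ℝ) / M with hX
  have hMr : (0:ℝ) < M := by exact_mod_cast hM
  have hNX : (N : ℝ) = X * M := by rw [hX]; field_simp
  have hlev : (1:ℝ) ≤ lev b L := by exact_mod_cast one_le_lev b L
  obtain ⟨hM2, hMK⟩ := sq_aux K _ M hK1 hlev hMr.le hKM
  have hX0 : 0 ≤ X := by positivity
  obtain ⟨hX2, hXK⟩ := sq_aux K _ X hK1 hlev hX0 hKX
  have hXp : 0 < X := by linarith
  set D := N / M + 1 with hD
  have hDu : (D : ℝ) ≤ 2 * X := by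
    rw [hD]; push_cast
    have : ((N / M : ℕ) : ℝ) ≤ X := Nat.cast_div_le
    linarith
  have hDl : X ≤ D := by
    rw [hD, hX, div_le_iff₀ hMr]
    rw [mul_comm]
    exact_mod_cast (Nat.lt_mul_div_succ N hM).le
  have hM1 : (1:ℝ) ≤ M := by exact_mod_cast hM
  have hUM : ∑ m ∈ range (2 * M + 1), UU b L m ≤ 15 * M / l := by
    refine (U_sum b L (2 * M + 1) hτ (by push_cast; linarith)).trans ?_
    refine div_le_div_of_nonneg_right ?_ hlp.le
    push_cast; linarith
  have hUI : ∀ s ⊆ Ioc M (2 * M), ∑ m ∈ s, UU b L m ≤ 15 * M / l := fun s hs => le_trans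
    (sum_le_sum_of_subset_of_nonneg (fun m hm => by have := mem_Ioc.1 (hs hm); rw [mem_range]; omega) fun m _ _ => UU_nonneg _ _ _) hUM
  have hUD : ∑ m ∈ range D, UU b L m ≤ 10 * X / l := by
    refine (U_sum b L D hτ (by linarith)).trans ?_
    refine div_le_div_of_nonneg_right ?_ hlp.le
    linarith
  -- step 1, 2
  have hcs := cs_step (Ioc M (2 * M)) (range D) β (UU b L) a ha hβ (fun m d => d * m ≤ N) α
  set E : ℕ → ℕ → ℝ := fun d' d => ‖∑ m ∈ (Ioc M (2 * M)).filter (fun m => d * m ≤ N ∧ d' * m ≤ N), (UU b L m : ℂ) * ec (m * ((d - d') * α))‖ with hE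
  have h2 : c0 ^ 2 * X ^ 2 * M / (15 * l) ≤ ∑ d' ∈ range D, a d' * ∑ d ∈ range D, a d * E d' d := by
    have h1 : (c0 * N / l) ^ 2 ≤ 15 * M / l * ∑ d' ∈ range D, a d' * ∑ d ∈ range D, a d * E d' d := by
      refine (pow_le_pow_left₀ (by positivity) hT 2).trans (hcs.trans ?_)
      refine mul_le_mul_of_nonneg_right (hUI _ (Subset.refl _)) (sum_nonneg fun d' _ => mul_nonneg (ha _) (sum_nonneg fun d _ => mul_nonneg (ha _) (norm_nonneg _)))
    rw [hNX] at h1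
    have h0 : (0:ℝ) < 15 * M / l := by positivity
    refine le_of_mul_le_mul_left (le_trans (le_of_eq ?_) h1) h0
    field_simp
  have hBX : 0 < B * X := by positivity
  obtain ⟨d', -, hd'⟩ := avg (range D) a _ (fun i _ => ha i) _ (B * X) (by positivity) hBX haS h2
  obtain ⟨e, he0, heD, he⟩ := PGE (range D) a (E d') (fun i _ => ha i) (fun e d => nn (e * ((d - d') * α)) ≤ D0 / M) _ (B * X) (15 * M / l) D0
    (by positivity) hBX (by positivity) haS hd' (fun d _ => (norm_sum_UU b L _ _).trans (hUI _ (filter_subset _ _))) (by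
      intro d _ hd
      have hX3 : ∃ X', (Ioc M (2 * M)).filter (fun m => d * m ≤ N ∧ d' * m ≤ N) = (Ioc M (2 * M)).filter (fun m => m ≤ X') := by
        refine ⟨min (if d = 0 then 2 * M else N / d) (if d' = 0 then 2 * M else N / d'), filter_congr fun m hm => ?_⟩
        rw [mem_Ioc] at hm
        rw [le_min_iff]
        refine and_congr ?_ ?_
        · split_ifs with h
          · simp [h]; omega
          · rw [Nat.le_div_iff_mul_le (by omega), mul_comm]
        · split_ifs with h
          · simp [h]; omega
          · rw [Nat.le_div_iff_mul_le (by omega), mul_comm]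
      obtain ⟨X', hX'⟩ := hX3
      simp only [hE] at hd
      rw [hX'] at hd
      obtain ⟨G, hG, hF⟩ := E_big b L M X' _ _ (by positivity) hd
      obtain ⟨e, h1, h2, h3⟩ := big_FU b L G (2 * M + 1) (c3 / 6) ((d - d') * α) (by positivity) (by linarith) hτ hG (by
        have : √(M : ℝ) ≤ √((2 * M + 1 : ℕ) : ℝ) := Real.sqrt_le_sqrt (by push_cast; linarith)
        have h4 : 132 / c3 * (lev b L : ℝ) ^ 2 ≤ √((2 * M + 1 : ℕ) : ℝ) := le_trans (by gcongr) (hKM.trans this)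
        have h5 : c3 / 6 * (132 / c3 * (lev b L : ℝ) ^ 2) ≤ c3 / 6 * √((2 * M + 1 : ℕ) : ℝ) := by gcongr
        refine le_trans (le_of_eq ?_) h5
        field_simp; ring) (by
        refine le_trans ?_ hF
        have : c3 / 6 * ((2 * M + 1 : ℕ) : ℝ) / l ≤ c3 / 6 * (3 * M) / l := by push_cast; gcongr; linarith
        refine this.trans (le_of_eq ?_)
        rw [hc3]; field_simp; norm_num)
      refine ⟨e, h1, h2, h3.trans ?_⟩
      gcongr
      push_cast; linarith)
  set DE := (range D).filter fun d => nn (e * (((d:ℕ) - d') * α)) ≤ D0 / M with hDE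
  have hUE : c0 ^ 2 * X / (900 * B ^ 2 * D0 * l) ≤ ∑ d ∈ DE, UU b L d := by
    have h1 : ∑ d ∈ DE, a d ≤ B * l * ∑ d ∈ DE, UU b L d := by
      rw [mul_sum]; exact sum_le_sum fun d hd => ha2 d (mem_filter.1 hd).1
    have h3 : c0 ^ 2 * X ^ 2 * M / (15 * l) / (2 * (B * X)) ≤ 2 * (15 * M / l) * D0 * (B * l * ∑ d ∈ DE, UU b L d) :=
      he.trans (by gcongr)
    have h0 : 0 < 2 * (15 * M / l) * D0 * (B * l) := by positivity
    refine le_of_mul_le_mul_left (le_trans (le_of_eq ?_) (h3.trans_eq (mul_assoc _ _ _).symm)) h0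
    field_simp; norm_num
  -- step 4
  set H := ⌊M / (8 * D0)⌋₊ with hH
  have hHu : (H : ℝ) ≤ M / (8 * D0) := Nat.floor_le (by positivity)
  have hMbig : 306 * 16 * D0 / c6 ^ 3 ≤ M := (hKm _ 3 (by norm_num) (by linarith)).trans hMK
  have hc63 : 1 ≤ 1 / c6 ^ 3 := by rw [le_div_iff₀ (by positivity), one_mul]; exact pow_le_one₀ hc6p.le hc61
  have hMD : 306 / c6 ^ 3 ≤ M / (16 * D0) := by
    rw [le_div_iff₀ (by positivity)]; refine le_trans (le_of_eq ?_) hMbig; ring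
  have hHl : (M : ℝ) / (16 * D0) ≤ H := by
    have h1 := Nat.lt_floor_add_one ((M : ℝ) / (8 * D0))
    rw [← hH] at h1
    have h2 : (M : ℝ) / (8 * D0) = 2 * (M / (16 * D0)) := by field_simp; norm_num
    have h3 : 306 / c6 ^ 3 = 306 * (1 / c6 ^ 3) := by ring
    linarith
  have hHc : 306 / c6 ^ 3 ≤ H := hMD.trans hHl
  have hHp : (0:ℝ) < H := lt_of_lt_of_le (by positivity) hHc
  have hfej := fej (UU b L) (UU_nonneg b L) D H DE (filter_subset _ _) d' (e * α) (by
    intro d hd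
    have h1 := (mem_filter.1 hd).2
    have h2 : ((d : ℝ) - d') * (e * α) = e * ((d - d') * α) := by ring
    rw [h2]
    calc 8 * (H : ℝ) * nn (e * ((d - d') * α)) ≤ 8 * (M / (8 * D0)) * (D0 / M) := by
          gcongr
          exact nn_nonneg _
      _ = 1 := by field_simp)
  have hf2 : (H : ℝ) ^ 2 / 4 * (c0 ^ 2 * X / (900 * B ^ 2 * D0 * l)) ≤ ∑ k ∈ range H, 1 * ∑ k' ∈ range H,
      1 * ‖FU Pf L (cE b L) 1 0 D (((k' : ℝ) - k) * (e * α))‖ := by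
    refine le_trans (by gcongr) (hfej.trans (le_of_eq ?_))
    rw [sum_comm]
    simp only [one_mul]
    rfl
  obtain ⟨h', -, hh'⟩ := avg (range H) (fun _ => 1) _ (fun i _ => zero_le_one) _ H (by positivity) hHp (by simp) hf2
  obtain ⟨e', he0', heD', he'⟩ := PGE (range H) (fun _ => 1) _ (fun i _ => zero_le_one)
    (fun e' h => nn (e' * (((h : ℝ) - h') * (e * α))) ≤ D1 / X) _ H (10 * X / l) D1 (by positivity) hHp (by positivity) (by simp) hh'
    (fun h _ => (norm_sum_UU b L _ _).trans hUD) (by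
      intro h _ hh
      obtain ⟨e', h1, h2, h3⟩ := big_FU b L D D (c5 / 4) _ (by positivity) (by linarith) hτ le_rfl (by
        have : √X ≤ √(D : ℝ) := Real.sqrt_le_sqrt hDl
        have h4 : 88 / c5 * (lev b L : ℝ) ^ 2 ≤ √(D : ℝ) := le_trans (by gcongr) (hKX.trans this)
        have h5 : c5 / 4 * (88 / c5 * (lev b L : ℝ) ^ 2) ≤ c5 / 4 * √(D : ℝ) := by gcongr
        refine le_trans (le_of_eq ?_) h5
        field_simp; ring) (by
        refine le_trans ?_ hh
        have : c5 / 4 * (D : ℝ) / l ≤ c5 / 4 * (2 * X) / l := by gcongr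
        refine this.trans (le_of_eq ?_)
        rw [hc5]; field_simp; norm_num)
      refine ⟨e', h1, h2, h3.trans ?_⟩
      gcongr)
  set S := (range H).filter fun h : ℕ => nn (e' * (((h : ℝ) - h') * (e * α))) ≤ D1 / X with hS
  rw [sum_const, nsmul_eq_mul, mul_one] at he'
  obtain ⟨q, hq0, hq1, hq2⟩ := vin H S (filter_subset _ _) c6 (D1 / X) h' (e' * (e * α)) hc6p hc61 hHc (by
      have h0 : 0 < 2 * (10 * X / l) * D1 := by positivity
      refine le_of_mul_le_mul_left (le_trans (le_of_eq ?_) he') h0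
      rw [hc6, hc5]; field_simp; norm_num) (by
      have h1 : 72 * D1 / c6 ^ 1 ≤ X := (hKm _ 1 (by norm_num) (by linarith)).trans hXK
      rw [pow_one, div_le_iff₀ hc6p] at h1
      rw [mul_div_assoc', div_le_iff₀ hXp]; linarith) (by
      intro h hh
      have h1 := (mem_filter.1 hh).2
      have h2 : ((h : ℝ) - h') * (e' * (e * α)) = e' * ((h - h') * (e * α)) := by ring
      rw [h2]; exact h1)
  refine ⟨q * e' * e, by positivity, ?_, ?_⟩
  · push_cast
    have := hKm (9 * D1 * D0) 1 (by norm_num) (by linarith)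
    refine le_trans ?_ this
    rw [pow_one]
    calc (q : ℝ) * e' * e ≤ 9 / c6 * D1 * D0 := by gcongr
      _ = _ := by ring
  · have e1 : (((q * e' * e : ℕ) : ℝ)) * α = q * (e' * (e * α)) := by push_cast; ring
    rw [e1]
    refine hq2.trans ?_
    calc 6000 * (D1 / X) / (c6 ^ 4 * H) ≤ 6000 * (D1 / X) / (c6 ^ 4 * (M / (16 * D0))) := by gcongr
      _ = (96000 * D0 * D1 / c6 ^ 4) / N := by rw [hNX]; field_simp; norm_num
      _ ≤ _ := by gcongr
end

section
open Finset
open scoped ArithmeticFunction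

lemma tau_small' (ε : ℝ) (hε : 0 < ε) : ∃ b : ℕ, ∀ L, (4 * b + 6) * tau b L ≤ ε := by
  obtain ⟨b, hb⟩ := tau_small (ε / 48) (by positivity)
  refine ⟨b + 1, fun L => ?_⟩
  have h := hb L
  rw [tau_eq, mul_sum]
  have : ∀ j ∈ range L, (4 * ((b + 1 : ℕ) : ℝ) + 6) * uu (2 * (b + 1 + j) + 1) ≤ 48 * uu (2 * (b + j) + 1) := by
    intro j _
    have e : 2 * (b + 1 + j) + 1 = (2 * (b + j) + 1) + 1 + 1 := by ring
    rw [e]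
    unfold uu
    rw [Nat.factorial_succ, Nat.factorial_succ, pow_succ, pow_succ]
    have hF : (0:ℝ) < (2 * (b + j) + 1).factorial := by positivity
    push_cast
    generalize ((2 * (b + j) + 1).factorial : ℝ) = F at hF ⊢
    have h1 : (4 * ((b : ℝ) + 1) + 6) * (Real.exp 8 * (4 ^ (2 * (b + j) + 1) * 4 * 4 / ((2 * (b + j) + 2 + 1) * ((2 * (b + j) + 1 + 1) * F))))
      = (4 * ((b : ℝ) + 1) + 6) * 16 / ((2 * (b + j) + 2 + 1) * (2 * (b + j) + 1 + 1)) * (Real.exp 8 * (4 ^ (2 * (b + j) + 1) / F)) := by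
      field_simp; norm_num
    rw [h1]
    refine mul_le_mul_of_nonneg_right ?_ (by positivity)
    rw [div_le_iff₀ (by positivity)]
    have : (0:ℝ) ≤ b := by positivity
    have : (0:ℝ) ≤ j := by positivity
    nlinarith [mul_nonneg (Nat.cast_nonneg (α := ℝ) b) (Nat.cast_nonneg (α := ℝ) j), sq_nonneg (b:ℝ), sq_nonneg (j:ℝ)]
  refine (sum_le_sum this).trans ?_
  rw [← mul_sum]; linarith

noncomputable def rr (L n : ℕ) : ℝ := ∏ p ∈ PP Pf L, (1 - xd 1 0 n p)

lemma rr_nonneg (L n) : 0 ≤ rr L n := prod_nonneg fun p _ => by linarith [(xd_mem 1 0 n p).2]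

lemma rr_le_one (L n) : rr L n ≤ 1 := prod_le_one (fun p _ => by linarith [(xd_mem 1 0 n p).2]) fun p _ => by linarith [(xd_mem 1 0 n p).1]

lemma rr_le_UU (b L n) : rr L n ≤ UU b L n := UE_ge Pf_blk b L _ (xd_mem 1 0 n)

lemma rr_anti {L L' : ℕ} (h : L' ≤ L) (n) : rr L n ≤ rr L' n := by
  unfold rr
  rw [← prod_sdiff (s₁ := PP Pf L') (s₂ := PP Pf L) (biUnion_subset_biUnion_of_subset_left _ (range_mono h))]
  refine mul_le_of_le_one_left (rr_nonneg L' n) ?_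
  exact prod_le_one (fun p _ => by linarith [(xd_mem 1 0 n p).2]) fun p _ => by linarith [(xd_mem 1 0 n p).1]

lemma mem_PPf (L p : ℕ) : p ∈ PP Pf L ↔ p < 2 ^ 2 ^ L ∧ p.Prime := by
  rw [PP_Pf, Nat.mem_primesBelow]

lemma rr_mul (L d m) : rr L (d * m) = rr L d * rr L m := by
  unfold rr
  rw [← prod_mul_distrib]
  refine prod_congr rfl fun p hp => ?_
  have hp := ((mem_PPf L p).1 hp).2
  unfold xd
  simp only [one_mul, add_zero, hp.dvd_mul]
  split_ifs <;> simp_all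

lemma rr_eq_zero (L n p) (hp : p.Prime) (h : p < 2 ^ 2 ^ L) (hd : p ∣ n) : rr L n = 0 :=
  prod_eq_zero ((mem_PPf L p).2 ⟨h, hp⟩) (by simp [xd, hd])

lemma rr_small (L n) (h : n < 2 ^ 2 ^ L) (hn : n ≠ 1) (hL : 1 ≤ L) : rr L n = 0 := by
  rcases Nat.eq_zero_or_pos n with rfl | h0
  · refine rr_eq_zero L 0 2 Nat.prime_two ?_ (by simp)
    calc 2 < 2 ^ 2 ^ 1 := by norm_num
      _ ≤ _ := Nat.pow_le_pow_right (by norm_num) (Nat.pow_le_pow_right (by norm_num) hL)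
  · exact rr_eq_zero L n n.minFac (Nat.minFac_prime hn) ((Nat.minFac_le h0).trans_lt h) (Nat.minFac_dvd n)

lemma rr_prime (L p) (hp : p.Prime) (h : 2 ^ 2 ^ L ≤ p) : rr L p = 1 := by
  refine prod_eq_one fun q hq => ?_
  have hq := (mem_PPf L q).1 hq
  have : ¬ q ∣ p := fun hd => by have := (Nat.prime_dvd_prime_iff_eq hq.2 hp).1 hd; omega
  simp [xd, this]

lemma rr_one (L) : rr L 1 = 1 := by
  refine prod_eq_one fun q hq => ?_
  have hq := (mem_PPf L q).1 hq
  simp [xd, hq.2.one_lt.ne']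

lemma abel_log (f : ℕ → ℂ) (N : ℕ) : ‖∑ n ∈ range (N + 1), (Real.log n : ℂ) * f n - Real.log N * ∑ n ∈ range (N + 1), f n‖ ≤
    ∑ k ∈ range N, (1 / k : ℝ) * ‖∑ n ∈ range (k + 1), f n‖ := by
  induction N with
  | zero => simp
  | succ N ih =>
    rw [sum_range_succ _ (N + 1), sum_range_succ f (N + 1), sum_range_succ (fun k : ℕ => (1 / (k:ℝ)) * _) N]
    have e : ∑ n ∈ range (N + 1), (Real.log n : ℂ) * f n + (Real.log ((N + 1 : ℕ)) : ℂ) * f (N + 1) - Real.log ((N + 1 : ℕ)) * (∑ n ∈ range (N + 1), f n + f (N + 1))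
       = (∑ n ∈ range (N + 1), (Real.log n : ℂ) * f n - Real.log N * ∑ n ∈ range (N + 1), f n) + ((Real.log N - Real.log (N + 1 : ℕ) : ℝ) : ℂ) * ∑ n ∈ range (N + 1), f n := by
      push_cast; ring
    rw [e]
    refine (norm_add_le _ _).trans (add_le_add ih ?_)
    rw [norm_mul, Complex.norm_real]
    refine mul_le_mul_of_nonneg_right ?_ (norm_nonneg _)
    rcases Nat.eq_zero_or_pos N with rfl | hN
    · simp
    · have hN' : (0:ℝ) < N := by exact_mod_cast hN
      rw [Real.norm_eq_abs, abs_sub_comm, ← Real.log_div (by positivity) (by positivity), abs_of_nonneg]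
      · refine (Real.log_le_sub_one_of_pos (by positivity)).trans (le_of_eq ?_)
        push_cast; field_simp; ring
      · refine Real.log_nonneg ?_
        rw [le_div_iff₀ hN']; push_cast; linarith

lemma UU_count (b L G : ℕ) (hτ : tau b L ≤ 1) : ∑ n ∈ range G, UU b L n ≤ G * (3 / lz L) + lev b L * 2 := by
  have h := UF_count Pf_blk b L (cE b L) (cE_lv b L) (cE_abs b L) 1 0 (fun p _ => Nat.coprime_one_right p) G
  refine h.trans ?_
  have h1 : Ug Pf L (cE b L) rc ≤ 3 / lz L := by
    refine (UE_mean Pf_blk b L).trans ?_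
    have : Real.exp (tau b L) ≤ 3 := (Real.exp_le_exp.2 hτ).trans (by linarith [Real.exp_one_lt_d9])
    calc _ ≤ 1 / lz L * 3 := by
          gcongr
          · have := lz_pos L; positivity
          · exact VV_Pf L
      _ = _ := by ring
  gcongr

lemma UU_sub_count (b L G : ℕ) (hτ : tau b L ≤ 1) : ∑ n ∈ range G, (UU b L n - rr L n) ≤ G * (3 * tau b L / lz L) + L * (lev b L * 2) := by
  calc _ ≤ ∑ n ∈ range G, ∑ j ∈ range L, UF Pf L (cT b L j) 1 0 n := sum_le_sum fun n _ => UE_sub_le Pf_blk b L _ (xd_mem 1 0 n)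
    _ = ∑ j ∈ range L, ∑ n ∈ range G, UF Pf L (cT b L j) 1 0 n := sum_comm
    _ ≤ ∑ j ∈ range L, (G * (3 / lz L * uu (kk b L j)) + lev b L * 2) := by
        refine sum_le_sum fun j hj => ?_
        refine (UF_count Pf_blk b L (cT b L j) (cT_lv b L j) (cT_abs b L j) 1 0 (fun p _ => Nat.coprime_one_right p) G).trans ?_
        gcongr
        refine (UT_mean Pf_blk b L j hj).trans ?_
        have : Real.exp (tau b L) ≤ 3 := (Real.exp_le_exp.2 hτ).trans (by linarith [Real.exp_one_lt_d9])
        refine mul_le_mul_of_nonneg_right ?_ (uu_nonneg _)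
        calc _ ≤ 1 / lz L * 3 := by
              gcongr
              · have := lz_pos L; positivity
              · exact VV_Pf L
          _ = _ := by ring
    _ = _ := by
        rw [sum_add_distrib, ← mul_sum, ← mul_sum, sum_const, card_range, nsmul_eq_mul]
        unfold tau; ring
end

section
open Finset
open scoped ArithmeticFunction

lemma L_le_lev (b L : ℕ) : (L : ℝ) ≤ lev b L := by
  have h1 : L < 2 ^ L := Nat.lt_two_pow_self
  have h2 : 2 ^ L < 2 ^ 2 ^ L := Nat.lt_two_pow_self
  have h3 : 2 ^ 2 ^ L ≤ lev b L := Nat.pow_le_pow_right (by norm_num) (Nat.le_mul_of_pos_right _ (by omega))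
  exact_mod_cast (by omega : L ≤ lev b L)

lemma sum_inv_le (N : ℕ) : ∑ k ∈ range N, (1 / k : ℝ) ≤ 1 + Real.log N := by
  rcases N with _ | N
  · simp
  · rw [sum_range_succ']
    have h := harmonic_le_one_add_log N
    unfold harmonic at h
    push_cast at h ⊢
    have h2 : Real.log N ≤ Real.log (N + 1) := by
      rcases Nat.eq_zero_or_pos N with rfl | hN
      · simp
      · exact Real.log_le_log (by exact_mod_cast hN) (by linarith)
    simp only [one_div] at *
    simp only [inv_zero, add_zero]
    linarith

lemma typeI (b L N : ℕ) (c α E : ℝ) (hc : 0 ≤ c) (hE : 1 ≤ E) (hτ : tau b L ≤ 1) (hlog : Real.log N ≤ 2 * E * lz L)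
    (hlev : (lev b L : ℝ) ^ 20 ≤ N) (hF : ‖FU Pf L (cE b L) 1 0 (N + 1) α‖ ≤ c * ((N + 1 : ℕ) : ℝ) / lz L) :
    ‖∑ n ∈ range (N + 1), (Real.log n : ℂ) * ((rr L n : ℂ) * ec (n * α))‖ ≤ N * (4 * E * (c + 3 * tau b L) + 16 * E / lz L) := by
  set l := lz L with hl
  have hlp : 0 < l := lz_pos L
  set v : ℝ := (lev b L : ℝ) with hv
  have hv1 : 1 ≤ v := by rw [hv]; exact_mod_cast one_le_lev b L
  have hlv : l ≤ v := lz_le_lev b L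
  have hLv : (L : ℝ) ≤ v := L_le_lev b L
  have hN1 : (1:ℝ) ≤ N := (one_le_pow₀ hv1).trans hlev
  have hτ0 := tau_nonneg b L
  have hlog0 : 0 ≤ Real.log N := Real.log_nonneg hN1
  set f : ℕ → ℂ := fun n => (rr L n : ℂ) * ec (n * α)
  have hS : ∀ k, ‖∑ n ∈ range (k + 1), f n‖ ≤ ((k + 1 : ℕ) : ℝ) * (3 / l) + v * 2 := by
    intro k
    refine le_trans (norm_sum_le_of_le _ fun n _ => ?_) (UU_count b L (k + 1) hτ)
    rw [norm_mul, ec_norm, mul_one, Complex.norm_real, Real.norm_of_nonneg (rr_nonneg _ _)]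
    exact rr_le_UU b L n
  have hSN : ‖∑ n ∈ range (N + 1), f n‖ ≤ (2 * N) / l * (c + 3 * tau b L) + 2 * v ^ 2 := by
    have e : ∑ n ∈ range (N + 1), f n = FU Pf L (cE b L) 1 0 (N + 1) α - ∑ n ∈ range (N + 1), ((UU b L n - rr L n : ℝ) : ℂ) * ec (n * α) := by
      unfold FU
      rw [← sum_sub_distrib]
      refine sum_congr rfl fun n _ => ?_
      push_cast; ring
    rw [e]
    refine (norm_sub_le _ _).trans ?_
    have h1 : ‖∑ n ∈ range (N + 1), ((UU b L n - rr L n : ℝ) : ℂ) * ec (n * α)‖ ≤ ((N + 1 : ℕ) : ℝ) * (3 * tau b L / l) + L * (v * 2) := by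
      refine le_trans (norm_sum_le_of_le _ fun n _ => ?_) (UU_sub_count b L (N + 1) hτ)
      rw [norm_mul, ec_norm, mul_one, Complex.norm_real, Real.norm_of_nonneg (sub_nonneg.2 (rr_le_UU b L n))]
    have h2 : (L : ℝ) * (v * 2) ≤ v * (v * 2) := by gcongr
    have h3 : ((N + 1 : ℕ) : ℝ) ≤ 2 * N := by push_cast; linarith
    have h4 : c * ((N + 1 : ℕ) : ℝ) / l ≤ c * (2 * N) / l := by gcongr
    have h5 : ((N + 1 : ℕ) : ℝ) * (3 * tau b L / l) ≤ 2 * N * (3 * tau b L / l) := by gcongr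
    have e2 : (2 * N) / l * (c + 3 * tau b L) + 2 * v ^ 2 = c * (2 * N) / l + (2 * N * (3 * tau b L / l) + v * (v * 2)) := by ring
    rw [e2]
    linarith
  have hsum : ∑ k ∈ range N, (1 / k : ℝ) * ‖∑ n ∈ range (k + 1), f n‖ ≤ 6 * N / l + 2 * v * (1 + Real.log N) := by
    have : ∀ k ∈ range N, (1 / k : ℝ) * ‖∑ n ∈ range (k + 1), f n‖ ≤ 6 / l + 2 * v * (1 / k) := by
      intro k _
      rcases Nat.eq_zero_or_pos k with rfl | hk
      · simp; positivity
      · have hk' : (1:ℝ) ≤ k := by exact_mod_cast hk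
        calc _ ≤ (1 / k : ℝ) * (((k + 1 : ℕ) : ℝ) * (3 / l) + v * 2) := by gcongr; exact hS k
          _ ≤ (1 / k : ℝ) * ((2 * k) * (3 / l) + v * 2) := by gcongr; push_cast; linarith
          _ = _ := by field_simp; ring
    refine (sum_le_sum this).trans ?_
    rw [sum_add_distrib, ← mul_sum, sum_const, card_range, nsmul_eq_mul]
    have := sum_inv_le N
    have h2 : 2 * v * ∑ k ∈ range N, (1 / k : ℝ) ≤ 2 * v * (1 + Real.log N) := by gcongr
    have h3 : (N : ℝ) * (6 / l) = 6 * N / l := by ring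
    linarith
  have hA := abel_log f N
  have h6 : ‖∑ n ∈ range (N + 1), (Real.log n : ℂ) * f n‖ ≤ Real.log N * ‖∑ n ∈ range (N + 1), f n‖ + (6 * N / l + 2 * v * (1 + Real.log N)) := by
    have := norm_sub_norm_le (∑ n ∈ range (N + 1), (Real.log n : ℂ) * f n) ((Real.log N : ℂ) * ∑ n ∈ range (N + 1), f n)
    rw [norm_mul, Complex.norm_real, Real.norm_of_nonneg hlog0] at this
    linarith
  refine h6.trans ?_
  have hv4 : v ^ 3 ≤ N / l := by
    rw [le_div_iff₀ hlp]
    calc v ^ 3 * l ≤ v ^ 3 * v := by gcongr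
      _ = v ^ 4 := by ring
      _ ≤ v ^ 20 := pow_le_pow_right₀ hv1 (by norm_num)
      _ ≤ N := hlev
  have h7 : Real.log N * ‖∑ n ∈ range (N + 1), f n‖ ≤ 2 * E * l * ((2 * N) / l * (c + 3 * tau b L) + 2 * v ^ 2) := by gcongr
  have h8 : 2 * E * l * ((2 * N) / l * (c + 3 * tau b L) + 2 * v ^ 2) = N * (4 * E * (c + 3 * tau b L)) + 4 * E * (l * v ^ 2) := by
    field_simp; ring
  have h9 : l * v ^ 2 ≤ v ^ 3 := by
    calc l * v ^ 2 ≤ v * v ^ 2 := by gcongr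
      _ = _ := by ring
  have hv23 : v ≤ v ^ 3 := le_self_pow₀ hv1 (by norm_num)
  have h10 : v * Real.log N ≤ 2 * E * v ^ 3 := by
    calc v * Real.log N ≤ v * (2 * E * v) := by
          gcongr
          exact hlog.trans (by gcongr)
      _ = 2 * E * v ^ 2 := by ring
      _ ≤ _ := by gcongr <;> norm_num
  have h11 : v ≤ E * v ^ 3 := hv23.trans (le_mul_of_one_le_left (by positivity) hE)
  have h12 : 4 * E * (l * v ^ 2) ≤ 4 * E * v ^ 3 := by gcongr
  have h13 : E * v ^ 3 ≤ E * (N / l) := by gcongr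
  have h14 : (N:ℝ) / l ≤ E * (N / l) := le_mul_of_one_le_left (by positivity) hE
  have e3 : (N:ℝ) * (4 * E * (c + 3 * tau b L) + 16 * E / l) = N * (4 * E * (c + 3 * tau b L)) + 16 * (E * (N / l)) := by ring
  have e4 : 6 * (N:ℝ) / l = 6 * (N / l) := by ring
  rw [e3, e4]
  linarith

lemma dyadic_sum (f : ℕ → ℂ) (J : ℕ) : ∑ m ∈ Ioc 0 (2 ^ J), f m = f 1 + ∑ j ∈ range J, ∑ m ∈ Ioc (2 ^ j) (2 * 2 ^ j), f m := by
  induction J with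
  | zero => rw [pow_zero, show Ioc 0 1 = {1} by rfl]; simp
  | succ J ih => rw [sum_range_succ, ← add_assoc, ← ih, pow_succ, mul_comm, sum_Ioc_consecutive _ (by simp) (by omega)]

lemma decomp (L N J : ℕ) (hL : 1 ≤ L) (hJ : N < 2 ^ J) (α : ℝ) :
    ∑ n ∈ range (N + 1), (Real.log n : ℂ) * ((rr L n : ℂ) * ec (n * α)) =
    ∑ d ∈ range (N + 1), ((Λ d * rr L d : ℝ) : ℂ) * ec (d * α) +
    ∑ j ∈ range J, ∑ m ∈ Ioc (2 ^ j) (2 * 2 ^ j), (rr L m : ℂ) *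
      ∑ d ∈ range (N / 2 ^ j + 1) with d * m ≤ N, ((Λ d * rr L d : ℝ) : ℂ) * ec (d * m * α) := by
  set g : ℕ → ℂ := fun m => (rr L m : ℂ) * ∑ d ∈ range (N + 1) with d * m ≤ N, ((Λ d * rr L d : ℝ) : ℂ) * ec (d * m * α) with hg
  have h1 : ∑ d ∈ range (N + 1), ((Λ d * rr L d : ℝ) : ℂ) * ec (d * α) = g 1 := by
    simp only [hg, rr_one, Complex.ofReal_one, one_mul, mul_one, Nat.cast_one]
    rw [filter_true_of_mem]
    intro d hd; rw [mem_range] at hd; omega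
  have h2 : ∀ j ∈ range J, ∑ m ∈ Ioc (2 ^ j) (2 * 2 ^ j), (rr L m : ℂ) *
      ∑ d ∈ range (N / 2 ^ j + 1) with d * m ≤ N, ((Λ d * rr L d : ℝ) : ℂ) * ec (d * m * α) = ∑ m ∈ Ioc (2 ^ j) (2 * 2 ^ j), g m := by
    intro j _
    refine sum_congr rfl fun m hm => ?_
    simp only [hg]
    congr 1
    refine sum_congr ?_ fun _ _ => rfl
    ext d
    simp only [mem_filter, mem_range, Nat.lt_succ_iff]
    refine and_congr_left fun h => ?_
    have h3 : d * 2 ^ j ≤ N := le_trans (Nat.mul_le_mul_left _ (mem_Ioc.1 hm).1.le) h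
    have h4 : d ≤ N / 2 ^ j := (Nat.le_div_iff_mul_le (by positivity)).2 h3
    exact ⟨fun _ => h4.trans (Nat.div_le_self _ _), fun _ => h4⟩
  rw [sum_congr rfl h2, h1, ← dyadic_sum]
  have h3 : ∀ n ∈ range (N + 1), (Real.log n : ℂ) * ((rr L n : ℂ) * ec (n * α)) =
      ∑ m ∈ Ioc 0 (2 ^ J), ∑ d ∈ range (N + 1), if d * m = n then ((Λ d : ℝ) : ℂ) * ((rr L n : ℂ) * ec (n * α)) else 0 := by
    intro n hn
    rcases Nat.eq_zero_or_pos n with rfl | hn0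
    · rw [rr_small L 0 (by positivity) (by norm_num) hL]; simp
    · rw [← ArithmeticFunction.vonMangoldt_sum, Complex.ofReal_sum, sum_mul, sum_comm]
      have : n.divisors = (range (N + 1)).filter fun d => d ∣ n := by
        ext d
        simp only [Nat.mem_divisors, mem_filter, mem_range]
        rw [mem_range] at hn
        constructor
        · rintro ⟨h, -⟩; exact ⟨by have := Nat.le_of_dvd hn0 h; omega, h⟩
        · rintro ⟨-, h⟩; exact ⟨h, by omega⟩
      rw [this, sum_filter]
      refine sum_congr rfl fun d _ => ?_
      split_ifs with hd
      · obtain ⟨k, rfl⟩ := hd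
        have hd0 : 0 < d := Nat.pos_of_mul_pos_right hn0
        have hk0 : 0 < k := Nat.pos_of_mul_pos_left hn0
        rw [sum_eq_single k]
        · simp
        · intro m _ hmk
          rw [if_neg]
          intro h; exact hmk (Nat.eq_of_mul_eq_mul_left hd0 h)
        · intro h
          exfalso; apply h
          rw [mem_range] at hn
          rw [mem_Ioc]
          exact ⟨hk0, by nlinarith⟩
      · symm; apply sum_eq_zero
        intro m _
        rw [if_neg]
        rintro rfl; exact hd (dvd_mul_right _ _)
  rw [sum_congr rfl h3, sum_comm]
  refine sum_congr rfl fun m _ => ?_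
  rw [sum_comm]
  simp only [hg]
  rw [mul_sum, sum_filter]
  refine sum_congr rfl fun d _ => ?_
  rw [sum_ite_eq]
  simp only [mem_range, Nat.lt_succ_iff]
  split_ifs
  · rw [rr_mul]; push_cast; ring
  · rfl

lemma prime_approx (L N : ℕ) (hL : 1 ≤ L) (α : ℝ) :
    ‖∑ p ∈ range (N + 1) with p.Prime, (Real.log p : ℂ) * ec (p * α) - ∑ d ∈ range (N + 1), ((Λ d * rr L d : ℝ) : ℂ) * ec (d * α)‖ ≤
      Chebyshev.psi N - Chebyshev.theta N + Chebyshev.theta ((2 ^ 2 ^ L : ℕ) : ℝ) := by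
  rw [sum_filter, ← sum_sub_distrib]
  have h1 : ∀ d ∈ range (N + 1), ‖(if d.Prime then (Real.log d : ℂ) * ec (d * α) else 0) - ((Λ d * rr L d : ℝ) : ℂ) * ec (d * α)‖ ≤
      Λ d - (if d.Prime then Real.log d else 0) + if d.Prime ∧ d ≤ 2 ^ 2 ^ L then Real.log d else 0 := by
    intro d _
    by_cases hd : d.Prime
    · simp only [hd, if_true, true_and, ArithmeticFunction.vonMangoldt_apply_prime hd, sub_self, zero_add]
      have h0 : 0 ≤ Real.log d := Real.log_natCast_nonneg d
      rcases lt_or_ge d (2 ^ 2 ^ L) with h | h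
      · rw [rr_small L d h hd.one_lt.ne' hL, if_pos h.le]
        rw [mul_zero, Complex.ofReal_zero, zero_mul, sub_zero, norm_mul, ec_norm, mul_one, Complex.norm_real, Real.norm_of_nonneg h0]
      · rw [rr_prime L d hd h]; simp; split_ifs <;> simp [h0]
    · simp only [hd, if_false, false_and, zero_sub, norm_neg, sub_zero, add_zero]
      rw [norm_mul, ec_norm, mul_one, Complex.norm_real, Real.norm_of_nonneg (mul_nonneg ArithmeticFunction.vonMangoldt_nonneg (rr_nonneg _ _))]
      exact mul_le_of_le_one_right ArithmeticFunction.vonMangoldt_nonneg (rr_le_one _ _)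
  refine (norm_sum_le_of_le _ h1).trans ?_
  rw [sum_add_distrib, sum_sub_distrib, Chebyshev.psi_eq_sum_Icc, Chebyshev.theta_eq_sum_Icc, Chebyshev.theta_eq_sum_Icc, Nat.floor_natCast, Nat.floor_natCast,
    ← Nat.range_succ_eq_Icc_zero, ← sum_filter, ← sum_filter]
  gcongr ?_ + ?_
  · exact le_rfl
  · refine sum_le_sum_of_subset_of_nonneg ?_ fun p _ _ => Real.log_natCast_nonneg p
    intro p hp
    simp only [mem_filter, mem_Icc] at hp ⊢
    exact ⟨⟨by omega, hp.2.2⟩, hp.2.1⟩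
end

section
open Finset
open scoped ArithmeticFunction

lemma params (E L0 : ℕ) (hE : 1 ≤ E) : ∃ N0, 1 ≤ N0 ∧ ∀ N ≥ N0, ∃ L ≥ L0, E * 2 ^ L ≤ Nat.log 2 N ∧ Nat.log 2 N < 2 * E * 2 ^ L := by
  refine ⟨2 ^ (E * 2 ^ L0), Nat.one_le_two_pow, fun N hN => ?_⟩
  have h1 : E * 2 ^ L0 ≤ Nat.log 2 N := by
    have := Nat.log_mono_right (b := 2) hN
    rwa [Nat.log_pow (by norm_num)] at this
  set q := Nat.log 2 N / E
  have hq : 2 ^ L0 ≤ q := (Nat.le_div_iff_mul_le hE).2 (by rwa [mul_comm])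
  have hq0 : q ≠ 0 := (lt_of_lt_of_le (by positivity) hq).ne'
  refine ⟨Nat.log 2 q, Nat.le_log_of_pow_le (by norm_num) hq, ?_, ?_⟩
  · calc _ ≤ E * q := Nat.mul_le_mul_left _ (Nat.pow_log_le_self 2 hq0)
      _ ≤ _ := Nat.mul_div_le _ _
  · have h2 : q + 1 ≤ 2 ^ (Nat.log 2 q + 1) := Nat.lt_pow_succ_log_self (by norm_num) q
    calc _ < E * (q + 1) := Nat.lt_mul_div_succ _ hE
      _ ≤ E * 2 ^ (Nat.log 2 q + 1) := Nat.mul_le_mul_left _ h2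
      _ = _ := by ring

lemma scale (c0 B : ℝ) (h0 : 0 < c0) (h1 : c0 ≤ 1) (hB : 1 ≤ B) : ∃ K : ℝ, 1 ≤ K ∧ ∀ (b L' s N M : ℕ) (α F : ℝ), 1 ≤ L' → 0 < M → tau b L' ≤ 1 →
    0 ≤ F → Real.log N ≤ F * lz L' → F + 6 ≤ B → (lev b L') ^ 16 ≤ 2 ^ 2 ^ (L' + s) → 2 * K ≤ lev b L' →
    ‖∑ m ∈ Ioc M (2 * M), (rr (L' + s) m : ℂ) * ∑ d ∈ range (N / M + 1) with d * m ≤ N, ((Λ d * rr (L' + s) d : ℝ) : ℂ) * ec (d * m * α)‖ ≤ c0 * N / lz L' ∨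
    ∃ q : ℕ, 0 < q ∧ (q : ℝ) ≤ K ∧ nn (q * α) ≤ K / N := by
  obtain ⟨K, hK, H⟩ := typeII c0 B h0 h1 hB
  refine ⟨K, hK, fun b L' s N M α F hL hM hτ hF hlog hFB hlev hKl => ?_⟩
  have hlp := lz_pos L'
  set L := L' + s with hLs
  rw [or_iff_not_imp_left, not_le]
  intro hbig
  have hLL : L' ≤ L := Nat.le_add_right _ _
  have hT0 : ∀ x : ℂ, c0 * N / lz L' < ‖x‖ → x = 0 → False := by
    rintro x h rfl
    rw [norm_zero] at h
    have : 0 ≤ c0 * N / lz L' := by positivity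
    linarith
  have hz1 : 2 ^ 2 ^ L ≤ 2 * M := by
    by_contra! hc
    refine hT0 _ hbig (sum_eq_zero fun m hm => ?_)
    rw [mem_Ioc] at hm
    rw [rr_small L m (by omega) (by omega) (by omega)]; simp
  have hz2 : 2 ^ 2 ^ L ≤ N / M := by
    by_contra! hc
    refine hT0 _ hbig (sum_eq_zero fun m hm => ?_)
    rw [sum_eq_zero, mul_zero]
    intro d hd
    rw [mem_filter, mem_range] at hd
    rcases eq_or_ne d 1 with rfl | hd1
    · simp
    · rw [rr_small L d (by omega) hd1 (by omega)]; simp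
  set v : ℝ := (lev b L' : ℝ) with hv
  have hv1 : 1 ≤ v := by rw [hv]; exact_mod_cast one_le_lev b L'
  have hz3 : ((2 ^ 2 ^ L : ℕ) : ℝ) ≤ 2 * M := by exact_mod_cast hz1
  have hz4 : ((2 ^ 2 ^ L : ℕ) : ℝ) ≤ (N : ℝ) / M := le_trans (by exact_mod_cast hz2) Nat.cast_div_le
  have hv16 : v ^ 16 ≤ ((2 ^ 2 ^ L : ℕ) : ℝ) := by rw [hv]; exact_mod_cast hlev
  have hKv : (K * v ^ 2) ^ 2 ≤ ((2 ^ 2 ^ L : ℕ) : ℝ) / 2 := by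
    have a1 : K ^ 2 ≤ (v / 2) ^ 2 := by gcongr; linarith
    have a2 : v ^ 6 ≤ v ^ 16 := pow_le_pow_right₀ hv1 (by norm_num)
    calc (K * v ^ 2) ^ 2 = K ^ 2 * v ^ 4 := by ring
      _ ≤ (v / 2) ^ 2 * v ^ 4 := by gcongr
      _ = v ^ 6 / 4 := by ring
      _ ≤ _ := by linarith [pow_pos (by linarith : 0 < v) 16]
  have hz0 : (0:ℝ) < ((2 ^ 2 ^ L : ℕ) : ℝ) := by positivity
  have hNpos : ∀ n ∈ range (N / M + 1), Λ n ≤ F * lz L' := by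
    intro n hn
    rw [mem_range] at hn
    rcases Nat.eq_zero_or_pos n with rfl | hn0
    · simp; positivity
    · refine ArithmeticFunction.vonMangoldt_le_log.trans (le_trans (Real.log_le_log (by exact_mod_cast hn0) ?_) hlog)
      exact_mod_cast (by omega : n ≤ N / M).trans (Nat.div_le_self N M)
  have hl0 : ∀ n, 0 ≤ Λ n := fun n => ArithmeticFunction.vonMangoldt_nonneg
  refine H b L' N M α (fun n => Λ n * rr L n) (fun m => rr L m) hτ hM (Real.le_sqrt_of_sq_le (by linarith))
    (Real.le_sqrt_of_sq_le (by linarith)) (fun n => mul_nonneg (hl0 n) (rr_nonneg L n)) (fun n hn => ?_) ?_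
    (fun n => ⟨rr_nonneg _ _, (rr_anti hLL n).trans (rr_le_UU b L' n)⟩) hbig.le
  · have a1 := hNpos n hn
    have a2 : rr L n ≤ UU b L' n := (rr_anti hLL n).trans (rr_le_UU b L' n)
    have a3 : F * lz L' ≤ B * lz L' := by gcongr; linarith
    have := rr_nonneg L n
    calc Λ n * rr L n ≤ (B * lz L') * UU b L' n := mul_le_mul (a1.trans a3) a2 this (by positivity)
      _ = _ := rfl
  · have a1 : ∑ n ∈ range (N / M + 1), Λ n * rr L n ≤ Chebyshev.psi ((N / M : ℕ) : ℝ) := by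
      rw [Chebyshev.psi_eq_sum_Icc, Nat.floor_natCast, ← Nat.range_succ_eq_Icc_zero]
      exact sum_le_sum fun n _ => mul_le_of_le_one_right (hl0 n) (rr_le_one L n)
    have a2 := Chebyshev.psi_le_const_mul_self (x := ((N / M : ℕ) : ℝ)) (by positivity)
    have a3 : Real.log 4 ≤ 2 := by
      rw [show (4:ℝ) = 2 ^ 2 by norm_num, Real.log_pow]; have := Real.log_two_lt_d9; push_cast; linarith
    have a4 : (((N / M : ℕ) : ℝ)) ≤ (N : ℝ) / M := Nat.cast_div_le
    calc _ ≤ _ := a1.trans a2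
      _ ≤ B * ((N : ℝ) / M) := mul_le_mul (by linarith) a4 (by positivity) (by linarith)

theorem minor1 (ε : ℝ) (hε : 0 < ε) (hε1 : ε ≤ 1) : ∃ (K : ℝ) (N0 : ℕ), 1 ≤ K ∧ 1 ≤ N0 ∧ ∀ N ≥ N0, ∀ α : ℝ,
    ‖∑ p ∈ range (N + 1) with p.Prime, (Real.log p : ℂ) * ec (p * α)‖ ≤ ε * N ∨
    ∃ q : ℕ, 0 < q ∧ (q : ℝ) ≤ K ∧ nn (q * α) ≤ K / N := by
  obtain ⟨b, hb⟩ := tau_small' (ε / 10000) (by positivity)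
  obtain ⟨E, hE⟩ : ∃ E : ℕ, E = 20 * (4 * b + 6) := ⟨_, rfl⟩
  have hE1 : 1 ≤ E := by omega
  have hE1' : (1:ℝ) ≤ E := by exact_mod_cast hE1
  obtain ⟨s, hs⟩ : ∃ s : ℕ, s = 16 * (4 * b + 6) := ⟨_, rfl⟩
  have hs2 : s < 2 ^ s := Nat.lt_two_pow_self
  set c : ℝ := ε / (40 * E) with hc
  have hcp : 0 < c := by positivity
  set c0 : ℝ := ε / (16 * E * 2 ^ s) with hc0
  have h2s : (1:ℝ) ≤ 2 ^ s := one_le_pow₀ (by norm_num)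
  have hES : (1:ℝ) ≤ E * 2 ^ s := one_le_mul_of_one_le_of_one_le hE1' h2s
  obtain ⟨K2, hK2, H2⟩ := scale c0 (2 * E * 2 ^ s + 6) (by positivity) ((div_le_one (by positivity)).2 (by linarith)) (by linarith)
  set K1 : ℝ := (6 * C1 / c) ^ 3
  set Z : ℝ := 88 * E / ε + 22 / c + 2 ^ s * (2 * K2) with hZ
  obtain ⟨L1, hL1⟩ := pow_unbounded_of_one_lt (2 * Z) (by norm_num : (1:ℝ) < 2)
  obtain ⟨N0, hN0, HN⟩ := params E (L1 + s + 1) hE1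
  refine ⟨max K1 K2, N0, le_max_of_le_right hK2, hN0, fun N hN α => ?_⟩
  obtain ⟨L, hL, hLa, hLb⟩ := HN N hN
  have hNp : 0 < N := by omega
  have hNp' : (0:ℝ) < N := by exact_mod_cast hNp
  by_cases hmaj : ∃ q : ℕ, 0 < q ∧ (q : ℝ) ≤ max K1 K2 ∧ nn (q * α) ≤ max K1 K2 / N
  · exact Or.inr hmaj
  left
  obtain ⟨L', rfl⟩ : ∃ L', L = L' + s := ⟨L - s, by omega⟩
  set L := L' + s with hLs
  have hlp := lz_pos L
  have hlp' := lz_pos L'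
  have hτb : ∀ L, tau b L ≤ 1 ∧ 12 * E * tau b L ≤ ε / 40 := by
    intro L
    have h := hb L
    have h0 := tau_nonneg b L
    have h1 : 6 * tau b L ≤ (4 * b + 6) * tau b L := by gcongr; linarith [(Nat.cast_nonneg b : (0:ℝ) ≤ b)]
    refine ⟨by linarith, ?_⟩
    rw [hE]; push_cast; linarith
  have hlzL : lz L = 2 ^ s * lz L' := by rw [lz_eq, lz_eq, hLs, pow_add]; ring
  have hlog2 := Real.log_two_gt_d9
  have hlogN : Real.log N ≤ 2 * E * lz L := by
    have h1 : N ≤ 2 ^ (2 * E * 2 ^ L) := (Nat.lt_pow_of_log_lt (by norm_num) hLb).le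
    have h2 : Real.log N ≤ Real.log ((2 ^ (2 * E * 2 ^ L) : ℕ) : ℝ) := Real.log_le_log hNp' (by exact_mod_cast h1)
    refine h2.trans (le_of_eq ?_)
    push_cast
    rw [Real.log_pow, lz_eq]; push_cast; ring
  have hlevN : lev b L ^ 20 ≤ N := by
    calc lev b L ^ 20 = 2 ^ (E * 2 ^ L) := by unfold lev; rw [← pow_mul, hE]; congr 1; ring
      _ ≤ 2 ^ Nat.log 2 N := Nat.pow_le_pow_right (by norm_num) hLa
      _ ≤ N := Nat.pow_log_le_self 2 hNp.ne'
  have hlev' : lev b L' ^ 16 ≤ 2 ^ 2 ^ (L' + s) := by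
    unfold lev
    rw [← pow_mul]
    refine Nat.pow_le_pow_right (by norm_num) ?_
    calc 2 ^ L' * (4 * b + 6) * 16 = 2 ^ L' * s := by rw [hs]; ring
      _ ≤ 2 ^ L' * 2 ^ s := Nat.mul_le_mul_left _ hs2.le
      _ = _ := by rw [pow_add]
  have hZ1 : Z ≤ lz L' := by
    have h1 : (2:ℝ) ^ L1 ≤ 2 ^ L' := pow_le_pow_right₀ (by norm_num) (by omega)
    rw [lz_eq]
    have h2 : (2:ℝ) ^ L' * (1 / 2) ≤ 2 ^ L' * Real.log 2 := by gcongr; linarith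
    linarith
  have hZ2 : lz L' ≤ lz L := by rw [hlzL]; exact le_mul_of_one_le_left hlp'.le h2s
  have hp1 : 0 < 88 * E / ε := by positivity
  have hp2 : 0 < 22 / c := by positivity
  have hp3 : 2 * K2 ≤ 2 ^ s * (2 * K2) := le_mul_of_one_le_left (by linarith) h2s
  set v : ℝ := (lev b L : ℝ) with hv
  have hv1 : 1 ≤ v := by rw [hv]; exact_mod_cast one_le_lev b L
  have hlv : lz L ≤ v := lz_le_lev b L
  have hvN : v ^ 20 ≤ N := by rw [hv]; exact_mod_cast hlevN
  have hvs : v ^ 10 ≤ √(N:ℝ) := Real.le_sqrt_of_sq_le (by rw [← pow_mul]; exact hvN)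
  have hv3 : v ^ 3 ≤ √(N:ℝ) := (pow_le_pow_right₀ hv1 (by norm_num)).trans hvs
  -- type I
  have hF : ‖FU Pf L (cE b L) 1 0 (N + 1) α‖ ≤ c * ((N + 1 : ℕ) : ℝ) / lz L := by
    by_contra! hcon
    obtain ⟨d, hd, hd1, hd2⟩ := big_FU b L (N + 1) (N + 1) c α hcp ((div_le_one (by positivity)).2 (by linarith)) (hτb L).1 le_rfl (by
      have a1 : 22 ≤ c * v := by
        have : 22 / c ≤ v := by linarith
        rwa [div_le_iff₀ hcp, mul_comm] at this
      have a2 : √(N:ℝ) ≤ √((N + 1 : ℕ) : ℝ) := Real.sqrt_le_sqrt (by push_cast; linarith)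
      calc 22 * v ^ 2 ≤ c * v * v ^ 2 := by gcongr
        _ = c * v ^ 3 := by ring
        _ ≤ _ := by gcongr; exact hv3.trans a2) hcon.le
    refine hmaj ⟨d, hd, hd1.trans (le_max_left _ _), hd2.trans ?_⟩
    have hK10 : 0 ≤ K1 := le_trans (Nat.cast_nonneg d) hd1
    push_cast
    gcongr
    · exact le_max_left _ _
    · linarith
  have hI := typeI b L N c α E hcp.le hE1' (hτb L).1 hlogN hvN hF
  have hII : ∀ j ∈ range (Nat.log 2 N + 1), _ ≤ c0 * N / lz L' := fun j _ => (H2 b L' s N (2 ^ j) α (2 * E * 2 ^ s) (by omega) (by positivity) (hτb L').1 (by positivity)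
      (by rw [mul_assoc, ← hlzL]; exact hlogN) le_rfl hlev' (le_trans (by linarith) (lz_le_lev b L'))).resolve_right (by
        rintro ⟨q, hq, hq1, hq2⟩
        exact hmaj ⟨q, hq, hq1.trans (le_max_right _ _), hq2.trans (by gcongr; exact le_max_right _ _)⟩)
  rw [decomp L N (Nat.log 2 N + 1) (by omega) (Nat.lt_pow_succ_log_self (by norm_num) N)] at hI
  have hIII := norm_sum_le_of_le _ hII
  rw [sum_const, card_range, nsmul_eq_mul] at hIII
  have hP := prime_approx L N (by omega) α
  set X := ∑ d ∈ range (N + 1), ((Λ d * rr L d : ℝ) : ℂ) * ec (d * α)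
  set S := ∑ p ∈ range (N + 1) with p.Prime, (Real.log p : ℂ) * ec (p * α)
  have hSn : ∀ (T : ℂ) (u w : ℝ), ‖X + T‖ ≤ u → ‖T‖ ≤ w → ‖S‖ ≤ ‖S - X‖ + u + w := by
    intro T u w hu hw
    refine le_trans ?_ (add_le_add (add_le_add le_rfl hu) hw)
    calc ‖S‖ = ‖(S - X) + (X + T) + (-T)‖ := by congr 1; ring
      _ ≤ _ := (norm_add₃_le).trans (by rw [norm_neg])
  refine (hSn _ _ _ hI hIII).trans ?_
  -- bounds
  have e1 : ((Nat.log 2 N + 1 : ℕ) : ℝ) * (c0 * N / lz L') ≤ ε / 4 * N := by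
    have a1 : ((Nat.log 2 N + 1 : ℕ) : ℝ) ≤ 2 * E * 2 ^ s * 2 ^ L' := by
      have : Nat.log 2 N + 1 ≤ 2 * E * 2 ^ L := hLb
      have a2 : ((Nat.log 2 N + 1 : ℕ) : ℝ) ≤ ((2 * E * 2 ^ L : ℕ) : ℝ) := by exact_mod_cast this
      refine a2.trans (le_of_eq ?_)
      rw [hLs, pow_add]; push_cast; ring
    calc _ ≤ 2 * E * 2 ^ s * 2 ^ L' * (c0 * N / lz L') := by gcongr
      _ = ε / 8 * N / Real.log 2 := by rw [hc0, lz_eq]; field_simp; norm_num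
      _ ≤ ε / 8 * N / (1 / 2) := by gcongr; linarith
      _ = _ := by ring
  have e2 : Chebyshev.psi N - Chebyshev.theta N + Chebyshev.theta ((2 ^ 2 ^ L : ℕ) : ℝ) ≤ 6 * E * N / lz L := by
    have hN1 : (1:ℝ) ≤ N := by exact_mod_cast hNp
    have a1 := Chebyshev.psi_sub_theta_le hN1
    have a2 := Chebyshev.theta_le_log4_mul_x (x := ((2 ^ 2 ^ L : ℕ) : ℝ)) (by positivity)
    have a3 : Real.log 4 ≤ 2 := by
      rw [show (4:ℝ) = 2 ^ 2 by norm_num, Real.log_pow]; have := Real.log_two_lt_d9; push_cast; linarith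
    have a4 : ((2 ^ 2 ^ L : ℕ) : ℝ) ≤ v := by
      rw [hv]; exact_mod_cast Nat.pow_le_pow_right (by norm_num) (Nat.le_mul_of_pos_right _ (by omega))
    have a5 : Real.log 4 * ((2 ^ 2 ^ L : ℕ) : ℝ) ≤ 2 * v := by gcongr
    have a6 : 2 * √(N:ℝ) * Real.log N ≤ 2 * √(N:ℝ) * (2 * E * v) := by gcongr; exact hlogN.trans (by gcongr)
    have a7 : √(N:ℝ) * v * lz L ≤ N := by
      calc √(N:ℝ) * v * lz L ≤ √(N:ℝ) * v * v := by gcongr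
        _ = √(N:ℝ) * v ^ 2 := by ring
        _ ≤ √(N:ℝ) * √(N:ℝ) := by gcongr; exact (pow_le_pow_right₀ hv1 (by norm_num)).trans hv3
        _ = N := Real.mul_self_sqrt hNp'.le
    have a8 : v * lz L ≤ √(N:ℝ) * v * lz L := by
      gcongr; exact le_mul_of_one_le_left (by linarith) (Real.one_le_sqrt.2 hN1)
    rw [le_div_iff₀ hlp]
    calc _ ≤ (2 * √(N:ℝ) * (2 * E * v) + 2 * v) * lz L := mul_le_mul_of_nonneg_right (by linarith) hlp.le
      _ = 4 * E * (√(N:ℝ) * v * lz L) + 2 * (v * lz L) := by ring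
      _ ≤ 4 * E * N + 2 * N := add_le_add (mul_le_mul_of_nonneg_left a7 (by positivity)) (by linarith)
      _ ≤ 6 * E * N := by
        have : 1 * (N:ℝ) ≤ E * N := by gcongr
        linarith
  have e3 : 22 * E / lz L ≤ ε / 4 := by
    rw [div_le_iff₀ hlp]
    have : 88 * E / ε ≤ lz L := by linarith
    rw [div_le_iff₀ hε] at this
    linarith
  have e4 : 4 * E * (c + 3 * tau b L) ≤ ε / 10 + ε / 40 := by
    have : 4 * E * c = ε / 10 := by rw [hc]; field_simp; norm_num
    linarith [(hτb L).2]
  have e5 : (N:ℝ) * (4 * E * (c + 3 * tau b L) + 16 * E / lz L) + 6 * E * N / lz L ≤ N * (ε / 10 + ε / 40 + ε / 4) := by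
    calc _ = (N:ℝ) * (4 * E * (c + 3 * tau b L) + 22 * E / lz L) := by ring
      _ ≤ _ := by gcongr
  have e6 : 0 < ε * N := by positivity
  linarith

theorem minor (ε : ℝ) (hε : 0 < ε) : ∃ (K : ℝ) (N0 : ℕ), 1 ≤ K ∧ 1 ≤ N0 ∧ ∀ N ≥ N0, ∀ α : ℝ,
    ‖∑ p ∈ range (N + 1) with p.Prime, (Real.log p : ℂ) * ec (p * α)‖ ≤ ε * N ∨
    ∃ q : ℕ, 0 < q ∧ (q : ℝ) ≤ K ∧ nn (q * α) ≤ K / N := by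
  obtain ⟨K, N0, hK, h0, H⟩ := minor1 (min ε 1) (by positivity) (min_le_right _ _)
  exact ⟨K, N0, hK, h0, fun N hN α => (H N hN α).imp_left fun h => h.trans (by gcongr; exact min_le_left _ _)⟩
end

section
open Finset

lemma sum_range_zmod {M : Type*} [AddCommMonoid M] (G : ℕ) [NeZero G] (F : ℕ → M) : ∑ n ∈ range G, F n = ∑ x : ZMod G, F x.val := by
  refine sum_bij' (fun n _ => (n : ZMod G)) (fun x _ => x.val) (fun _ _ => mem_univ _) (fun x _ => mem_range.2 x.val_lt)
    (fun n hn => ZMod.val_cast_of_lt (mem_range.1 hn)) (fun x _ => ZMod.natCast_zmod_val x) fun n hn => ?_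
  rw [ZMod.val_cast_of_lt (mem_range.1 hn)]

noncomputable abbrev ch {G : ℕ} [NeZero G] (x : ZMod G) : ℂ := ZMod.stdAddChar x

lemma ch_int {G : ℕ} [NeZero G] (n : ℕ) (k : ℤ) : ch ((n : ZMod G) * (k : ZMod G)) = ec (n * (k / G)) := by
  have := ZMod.stdAddChar_coe (N := G) (n * k)
  push_cast at this
  rw [ch, this, ec]
  congr 1; push_cast; ring

lemma ch_val {G : ℕ} [NeZero G] (x k : ZMod G) : ch (x * k) = ec (x.val * (k.val / G)) := by
  have := ch_int (G := G) x.val k.val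
  push_cast at this
  rwa [ZMod.natCast_zmod_val, ZMod.natCast_zmod_val] at this

lemma ch_norm {G : ℕ} [NeZero G] (x : ZMod G) : ‖ch x‖ = 1 := by simp [ch]

lemma ch_conj {G : ℕ} [NeZero G] (x : ZMod G) : (starRingEnd ℂ) (ch x) = ch (-x) := by
  rw [ch, ch, AddChar.map_neg_eq_conj]

lemma ch_sum {G : ℕ} [NeZero G] (b : ZMod G) : ∑ x : ZMod G, ch (x * b) = if b = 0 then (G : ℂ) else 0 := by
  have := AddChar.sum_mulShift b (ZMod.isPrimitive_stdAddChar G)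
  rw [ZMod.card] at this
  rw [this]; split_ifs <;> simp

noncomputable def hat {G : ℕ} [NeZero G] (f : ZMod G → ℝ) (k : ZMod G) : ℂ := ∑ x, (f x : ℂ) * ch (x * k)

lemma parseval {G : ℕ} [NeZero G] (f : ZMod G → ℝ) : ∑ k, ‖hat f k‖ ^ 2 = G * ∑ x, f x ^ 2 := by
  have e : ((∑ k, ‖hat f k‖ ^ 2 : ℝ) : ℂ) = ((G * ∑ x, f x ^ 2 : ℝ) : ℂ) := by
    have h1 : ∀ k, ((‖hat f k‖ ^ 2 : ℝ) : ℂ) = ∑ x, ∑ y, (f x : ℂ) * (f y : ℂ) * ch (k * (x - y)) := by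
      intro k
      rw [Complex.ofReal_pow, ← Complex.mul_conj']
      unfold hat
      rw [map_sum, sum_mul_sum]
      refine sum_congr rfl fun x _ => sum_congr rfl fun y _ => ?_
      rw [map_mul, Complex.conj_ofReal, ch_conj, show k * (x - y) = x * k + -(y * k) by ring, ch, ch, ch, AddChar.map_add_eq_mul]
      ring
    rw [Complex.ofReal_sum, sum_congr rfl fun k _ => h1 k, sum_comm, Complex.ofReal_mul, Complex.ofReal_sum, mul_sum]
    refine sum_congr rfl fun x _ => ?_
    rw [sum_comm, sum_eq_single x]
    · rw [← mul_sum, ch_sum]; simp; ring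
    · intro y _ hy
      rw [← mul_sum, ch_sum, if_neg (sub_ne_zero.2 hy.symm), mul_zero]
    · simp
  exact_mod_cast e

lemma triple {G : ℕ} [NeZero G] (f g h : ZMod G → ℝ) (x : ZMod G) :
    ((G * ∑ a, ∑ b, f a * g b * h (x - a - b) : ℝ) : ℂ) = ∑ k, hat f k * hat g k * hat h k * ch (-(x * k)) := by
  have h1 : ∀ k, hat f k * hat g k * hat h k * ch (-(x * k)) = ∑ a, ∑ b, ∑ c, ((f a * g b * h c : ℝ) : ℂ) * ch (k * (a + b + c - x)) := by
    intro k
    unfold hat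
    rw [sum_mul_sum, sum_mul, sum_mul]
    refine sum_congr rfl fun a _ => ?_
    rw [sum_mul, sum_mul]
    refine sum_congr rfl fun b _ => ?_
    rw [mul_sum, sum_mul]
    refine sum_congr rfl fun c _ => ?_
    rw [show k * (a + b + c - x) = a * k + b * k + c * k + -(x * k) by ring]
    simp only [ch, AddChar.map_add_eq_mul]
    push_cast; ring
  symm
  rw [sum_congr rfl fun k _ => h1 k, sum_comm, Complex.ofReal_mul, Complex.ofReal_sum, mul_sum]
  refine sum_congr rfl fun a _ => ?_
  rw [sum_comm, Complex.ofReal_sum, mul_sum]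
  refine sum_congr rfl fun b _ => ?_
  rw [sum_comm, sum_eq_single (x - a - b)]
  · rw [← mul_sum, ch_sum, if_pos (by ring)]
    simp only [Complex.ofReal_mul, Complex.ofReal_natCast]; ring
  · intro c _ hc
    rw [← mul_sum, ch_sum, if_neg (fun h0 => hc (by linear_combination h0)), mul_zero]
  · simp
end

section
open Finset

lemma large_sieve {G : ℕ} [NeZero G] (f U : ZMod G → ℝ) (B0 δ A D : ℝ) (hf : ∀ x, 0 ≤ f x) (hB : 0 ≤ B0) (hfU : ∀ x, f x ≤ B0 * U x)
    (S : Finset (ZMod G)) (hδ : 0 ≤ δ) (hS : ∀ k ∈ S, δ ≤ ‖hat f k‖) (hA : 0 ≤ A) (hUA : ∀ k, k ≠ 0 → ‖hat U k‖ ≤ A) (hD : ‖hat U 0‖ ≤ D) :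
    (δ * #S) ^ 2 ≤ (∑ x, f x) * (B0 * (#S * D + #S ^ 2 * A)) := by
  classical
  set c : ZMod G → ℂ := fun k => (starRingEnd ℂ) (hat f k) / ‖hat f k‖ with hc
  have hc1 : ∀ k, ‖c k‖ ≤ 1 := by
    intro k
    simp only [hc, norm_div, RCLike.norm_conj, Complex.norm_real, norm_norm]
    exact div_self_le_one _
  have hc2 : ∀ k, c k * hat f k = ‖hat f k‖ := by
    intro k
    simp only [hc]
    rcases eq_or_ne (hat f k) 0 with h | h
    · simp [h]
    · have h' : ((‖hat f k‖ : ℝ) : ℂ) ≠ 0 := by exact_mod_cast norm_ne_zero_iff.2 h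
      rw [div_mul_eq_mul_div, Complex.conj_mul', div_eq_iff h']; ring
  set T : ZMod G → ℂ := fun x => ∑ k ∈ S, c k * ch (x * k) with hT
  have h1 : δ * #S ≤ ∑ x, f x * ‖T x‖ := by
    have e : ((∑ k ∈ S, ‖hat f k‖ : ℝ) : ℂ) = ∑ x, (f x : ℂ) * T x := by
      rw [Complex.ofReal_sum, sum_congr rfl fun k _ => (hc2 k).symm]
      simp only [hat, hT, mul_sum]
      rw [sum_comm]
      exact sum_congr rfl fun x _ => sum_congr rfl fun k _ => by ring
    calc δ * #S = ∑ k ∈ S, δ := by rw [sum_const, nsmul_eq_mul]; ring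
      _ ≤ ∑ k ∈ S, ‖hat f k‖ := sum_le_sum hS
      _ ≤ ‖((∑ k ∈ S, ‖hat f k‖ : ℝ) : ℂ)‖ := by rw [Complex.norm_real]; exact le_abs_self _
      _ ≤ _ := by
        rw [e]
        refine norm_sum_le_of_le _ fun x _ => ?_
        rw [norm_mul, Complex.norm_real, Real.norm_of_nonneg (hf x)]
  have h2 : (∑ x, f x * ‖T x‖) ^ 2 ≤ (∑ x, f x) * ∑ x, f x * ‖T x‖ ^ 2 :=
    sum_sq_le_sum_mul_sum_of_sq_eq_mul _ (fun x _ => hf x) (fun x _ => mul_nonneg (hf x) (by positivity)) fun x _ => by ring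
  have h3 : ∑ x, f x * ‖T x‖ ^ 2 ≤ B0 * ∑ x, U x * ‖T x‖ ^ 2 := by
    rw [mul_sum]
    refine sum_le_sum fun x _ => ?_
    rw [← mul_assoc]
    exact mul_le_mul_of_nonneg_right (hfU x) (by positivity)
  have h4 : ∑ x, U x * ‖T x‖ ^ 2 ≤ #S * D + #S ^ 2 * A := by
    have e : ((∑ x, U x * ‖T x‖ ^ 2 : ℝ) : ℂ) = ∑ k ∈ S, ∑ l ∈ S, c k * (starRingEnd ℂ) (c l) * hat U (k - l) := by
      have : ∀ x, ((U x * ‖T x‖ ^ 2 : ℝ) : ℂ) = ∑ k ∈ S, ∑ l ∈ S, c k * (starRingEnd ℂ) (c l) * ((U x : ℂ) * ch (x * (k - l))) := by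
        intro x
        rw [Complex.ofReal_mul, Complex.ofReal_pow, ← Complex.mul_conj']
        simp only [hT]
        rw [map_sum, sum_mul_sum, mul_sum]
        refine sum_congr rfl fun k _ => ?_
        rw [mul_sum]
        refine sum_congr rfl fun l _ => ?_
        rw [map_mul, ch_conj, show x * (k - l) = x * k + -(x * l) by ring, ch, ch, ch, AddChar.map_add_eq_mul]
        ring
      rw [Complex.ofReal_sum, sum_congr rfl fun x _ => this x, sum_comm]
      refine sum_congr rfl fun k _ => ?_
      rw [sum_comm]
      refine sum_congr rfl fun l _ => ?_
      rw [← mul_sum, hat]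
    calc _ ≤ ‖((∑ x, U x * ‖T x‖ ^ 2 : ℝ) : ℂ)‖ := by rw [Complex.norm_real]; exact le_abs_self _
      _ ≤ ∑ k ∈ S, ∑ l ∈ S, ((if l = k then D else 0) + A) := by
        rw [e]
        refine norm_sum_le_of_le _ fun k _ => norm_sum_le_of_le _ fun l _ => ?_
        rw [norm_mul, norm_mul, RCLike.norm_conj]
        have a1 : ‖c k‖ * ‖c l‖ ≤ 1 := mul_le_one₀ (hc1 k) (norm_nonneg _) (hc1 l)
        refine (mul_le_of_le_one_left (norm_nonneg _) a1).trans ?_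
        split_ifs with h
        · rw [h, sub_self]; linarith
        · rw [zero_add]; exact hUA _ (sub_ne_zero.2 (Ne.symm h))
      _ = _ := by
        simp only [sum_add_distrib, sum_ite_eq', sum_const, nsmul_eq_mul]
        rw [sum_congr rfl (g := fun _ => D) fun k hk => if_pos hk, sum_const, nsmul_eq_mul]; ring
  have hF : 0 ≤ ∑ x, f x := sum_nonneg fun x _ => hf x
  calc (δ * #S) ^ 2 ≤ (∑ x, f x * ‖T x‖) ^ 2 := pow_le_pow_left₀ (by positivity) h1 2
    _ ≤ _ := h2
    _ ≤ _ := mul_le_mul_of_nonneg_left (h3.trans (mul_le_mul_of_nonneg_left h4 hB)) hF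

def Pw (W j i : ℕ) : Finset ℕ := if i < j then ∅ else (Pf i).filter fun p => ¬ p ∣ W

lemma Pw_blk (W j) : Blk (Pw W j) := by
  intro i p hp
  unfold Pw at hp
  split_ifs at hp
  · simp at hp
  · exact Pf_blk i p (mem_filter.1 hp).1

lemma Pw_mem (W j L p) : p ∈ PP (Pw W j) L ↔ p ∈ PP Pf L ∧ 2 ^ 2 ^ j ≤ p ∧ ¬ p ∣ W := by
  simp only [PP, Pw, mem_biUnion, mem_range]
  constructor
  · rintro ⟨i, hi, hp⟩
    split_ifs at hp with h
    · simp at hp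
    · rw [mem_filter] at hp
      exact ⟨⟨i, hi, hp.1⟩, le_trans (Nat.pow_le_pow_right (by norm_num) (Nat.pow_le_pow_right (by norm_num) (not_lt.1 h))) (Pf_blk i p hp.1).2.1, hp.2⟩
  · rintro ⟨⟨i, hi, hp⟩, h1, h2⟩
    refine ⟨i, hi, ?_⟩
    have h3 := (Pf_blk i p hp).2.2
    have : 2 ^ 2 ^ j < 2 ^ 2 ^ (i + 1) := h1.trans_lt h3
    have h4 := (Nat.pow_lt_pow_iff_right (by norm_num)).1 ((Nat.pow_lt_pow_iff_right (by norm_num)).1 this)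
    rw [if_neg (by omega), mem_filter]
    exact ⟨hp, h2⟩

lemma VV_anti {S T : Finset ℕ} (h : S ⊆ T) (hT : ∀ p ∈ T, p.Prime) : VV T ≤ VV S := by
  unfold VV
  rw [← prod_sdiff h]
  refine mul_le_of_le_one_left (VV_pos S fun p hp => hT p (h hp)).le (prod_le_one (fun p hp => ?_) fun p hp => ?_)
  · linarith [inv_le_half (hT p (mem_sdiff.1 hp).1)]
  · linarith [(by positivity : (0:ℝ) ≤ 1 / p)]

lemma VV_union {S T : Finset ℕ} (h : ∀ p ∈ S ∪ T, p.Prime) : VV S * VV T ≤ VV (S ∪ T) := by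
  have h1 : VV (S ∪ T) = VV S * VV (T \ S) := by
    unfold VV; rw [← union_sdiff_self_eq_union, prod_union disjoint_sdiff]
  rw [h1]
  refine mul_le_mul_of_nonneg_left (VV_anti sdiff_subset fun p hp => h p (mem_union_right _ hp)) (VV_pos S fun p hp => h p (mem_union_left _ hp)).le

lemma VV_Pw (W j L) (hW : 0 < W) : VV (PP (Pw W j) L) ≤ Real.exp (8 * j) * (W / W.totient) / lz L := by
  have hp := fun p hp => (Nat.mem_primesBelow.1 (by rw [← PP_Pf]; exact hp) : p < 2 ^ 2 ^ L ∧ p.Prime).2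
  have hs : PP (Pw W j) L ⊆ PP Pf L := fun p hp => ((Pw_mem W j L p).1 hp).1
  have hpj : ∀ p ∈ PP Pf j, p.Prime := PP_prime Pf_blk j
  have hpu : ∀ p ∈ PP Pf j ∪ W.primeFactors, p.Prime := fun p hp => (mem_union.1 hp).elim (hpj p) Nat.prime_of_mem_primeFactors
  have h1 : VV (PP Pf L) = VV (PP Pf L \ PP (Pw W j) L) * VV (PP (Pw W j) L) := by unfold VV; rw [prod_sdiff hs]
  have h2 : PP Pf L \ PP (Pw W j) L ⊆ PP Pf j ∪ W.primeFactors := by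
    intro p hq
    rw [mem_sdiff, Pw_mem] at hq
    rw [mem_union, mem_PPf, Nat.mem_primeFactors]
    have := hp p hq.1
    by_cases h : p < 2 ^ 2 ^ j
    · exact Or.inl ⟨h, this⟩
    · right
      by_contra hc
      exact hq.2 ⟨hq.1, not_lt.1 h, fun hd => hc ⟨this, hd, hW.ne'⟩⟩
  have h3 : Real.exp (-(8 * j)) ≤ VV (PP Pf j) := by
    rw [VV_PP Pf_blk]
    calc Real.exp (-(8 * j)) = ∏ i ∈ range j, Real.exp (-8) := by rw [prod_const, card_range, ← Real.exp_nat_mul]; congr 1; ring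
      _ ≤ _ := prod_le_prod (fun _ _ => (Real.exp_pos _).le) fun i _ => Pf_blk.V_ge i
  have h4 : VV W.primeFactors = W.totient / W := by
    have := Nat.totient_eq_mul_prod_factors W
    have h5 : (W.totient : ℝ) = W * VV W.primeFactors := by
      unfold VV
      have := congrArg (fun x : ℚ => (x : ℝ)) this
      push_cast at this
      simpa [one_div] using this
    rw [h5]; field_simp
  have hφ : (0:ℝ) < W.totient := by exact_mod_cast Nat.totient_pos.2 hW
  have h5 : Real.exp (-(8 * j)) * (W.totient / W) ≤ VV (PP Pf L \ PP (Pw W j) L) := by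
    calc _ ≤ VV (PP Pf j) * VV W.primeFactors := by rw [h4]; gcongr
      _ ≤ _ := (VV_union hpu).trans (VV_anti h2 hpu)
  have h6 := VV_Pf L
  have h7 := VVPP_pos (Pw_blk W j) L
  have h8 : Real.exp (-(8 * j)) * (W.totient / W) * VV (PP (Pw W j) L) ≤ 1 / lz L := by
    refine le_trans ?_ h6
    rw [h1]; gcongr
  have hl := lz_pos L
  calc VV (PP (Pw W j) L) = Real.exp (8 * j) * (W / W.totient) * (Real.exp (-(8 * j)) * (W.totient / W) * VV (PP (Pw W j) L)) := by
        rw [Real.exp_neg]; field_simp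
    _ ≤ Real.exp (8 * j) * (W / W.totient) * (1 / lz L) := by gcongr
    _ = _ := by ring

lemma hat_UF {G : ℕ} [NeZero G] (P L c W r) (k : ZMod G) : hat (fun x : ZMod G => UF P L c W r x.val) k = FU P L c W r G (k.val / G) := by
  unfold hat FU
  rw [sum_range_zmod]
  exact sum_congr rfl fun x _ => by rw [ch_val]

lemma SS_zero (G : ℕ) [NeZero G] (k : ℤ) (hk : ¬ (G : ℤ) ∣ k) : SS G (k / G) = 0 := by
  unfold SS
  rw [sum_range_zmod]
  have : ∀ x : ZMod G, ec (x.val * (k / G)) = ch (x * (k : ZMod G)) := fun x => by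
    rw [← ch_int, ZMod.natCast_zmod_val]
  rw [sum_congr rfl fun x _ => this x, ch_sum, if_neg]
  rwa [ZMod.intCast_zmod_eq_zero_iff_dvd]

lemma offdiag {G : ℕ} [NeZero G] (b L W r j Q : ℕ) (hj : 6 ≤ j) (hτ : tau b L ≤ 1) (hQ : 2 * lev b L ≤ Q) (k : ZMod G) (hk : k ≠ 0) :
    ‖hat (fun x : ZMod G => UF (Pw W j) L (cE b L) W r x.val) k‖ ≤ 3 * VV (PP (Pw W j) L) * G / √(2 ^ 2 ^ j) + lev b L * (Q + 7 * G / Q + 2) := by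
  rw [hat_UF]
  have hcop : ∀ p ∈ PP (Pw W j) L, Nat.Coprime p W := fun p hp =>
    ((PP_prime (Pw_blk W j) L p hp).coprime_iff_not_dvd).2 ((Pw_mem W j L p).1 hp).2.2
  obtain ⟨a, d, κ, hd, -, -, hκ0, -, hκ, hF⟩ := FU_bd (Pw_blk W j) b L W r hcop G Q (k.val / G) hQ
  have hV := VVPP_pos (Pw_blk W j) L
  have he : Real.exp (tau b L) ≤ 3 := (Real.exp_le_exp.2 hτ).trans (by linarith [Real.exp_one_lt_d9])
  refine hF.trans ?_
  gcongr
  by_cases h1 : d = 1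
  · subst h1
    have e : (k.val : ℝ) / G - a / (1 : ℕ) = (((k.val : ℤ) - a * G : ℤ) : ℝ) / G := by
      have : (G : ℝ) ≠ 0 := by exact_mod_cast NeZero.ne G
      push_cast; field_simp
    rw [e, SS_zero]
    · simp; positivity
    · intro h
      have h2 : (G : ℤ) ∣ k.val := by
        have := dvd_add h (Dvd.intro_left a rfl); simpa using this
      have h3 : G ∣ k.val := by exact_mod_cast h2
      have := Nat.eq_zero_of_dvd_of_lt h3 k.val_lt
      exact hk ((ZMod.val_eq_zero k).1 this)
  · have hY : Real.exp 13 ^ 2 ≤ (2:ℝ) ^ 2 ^ j := by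
      have a1 : Real.exp 13 = Real.exp 1 ^ 13 := by rw [← Real.exp_nat_mul]; norm_num
      have a2 : Real.exp 1 ^ 13 ≤ (3:ℝ) ^ 13 := pow_le_pow_left₀ (Real.exp_pos _).le (by linarith [Real.exp_one_lt_d9]) 13
      have a3 : (2:ℝ) ^ 2 ^ 6 ≤ (2:ℝ) ^ 2 ^ j := pow_le_pow_right₀ (by norm_num) (Nat.pow_le_pow_right (by norm_num) hj)
      rw [a1]
      calc _ ≤ ((3:ℝ) ^ 13) ^ 2 := by gcongr
        _ ≤ (2:ℝ) ^ 2 ^ 6 := by norm_num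
        _ ≤ _ := a3
    have hκ' := hκ _ hY (fun p hp => by exact_mod_cast ((Pw_mem W j L p).1 hp).2.1) h1
    calc _ ≤ VV (PP (Pw W j) L) * 3 * (1 / √(2 ^ 2 ^ j)) * G := by
          gcongr; exact SS_le _ _
      _ = _ := by ring
end

section
open Finset Filter

lemma jchoice (D : ℝ) (hD : 0 < D) : ∃ C : ℝ, 1 ≤ C ∧ ∀ t : ℝ, 0 < t → t ≤ 1 → ∃ j : ℕ, 6 ≤ j ∧ D * Real.exp (8 * j) / √(2 ^ 2 ^ j) ≤ t ^ 4 / 4 ∧ Real.exp (8 * j) * t ≤ C := by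
  set q : ℕ → ℝ := fun j => Real.exp (40 * j) / √(2 ^ 2 ^ j) with hq
  have hq0 : Tendsto q atTop (nhds 0) := by
    have h1 : Tendsto (fun n : ℕ => (n : ℝ) ^ 80 / (√2) ^ n) atTop (nhds 0) :=
      tendsto_pow_const_div_const_pow_of_one_lt 80 (by rw [Real.lt_sqrt]; norm_num; norm_num)
    have h2 := h1.comp (tendsto_pow_atTop_atTop_of_one_lt (by norm_num : 1 < 2))
    refine squeeze_zero (fun j => by positivity) (fun j => ?_) h2
    simp only [hq, Function.comp]
    have e : √((2:ℝ) ^ 2 ^ j) = √2 ^ 2 ^ j := by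
      rw [Real.sqrt_eq_iff_mul_self_eq (by positivity) (by positivity), ← mul_pow, Real.mul_self_sqrt (by norm_num)]
    rw [e]
    have h3 : Real.exp (40 * j) ≤ ((2 ^ j : ℕ) : ℝ) ^ 80 := by
      have : Real.exp (40 * j) = (Real.exp 1 ^ 40) ^ j := by rw [← Real.exp_nat_mul, ← Real.exp_nat_mul]; congr 1; push_cast; ring
      rw [this]
      calc (Real.exp 1 ^ 40) ^ j ≤ (4 ^ 40 : ℝ) ^ j := by gcongr; linarith [Real.exp_one_lt_d9]
        _ = _ := by push_cast; rw [← pow_mul, show (4:ℝ) = 2 ^ 2 by norm_num, ← pow_mul, ← pow_mul]; congr 1; ring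
    gcongr
  obtain ⟨M, hM⟩ := hq0.bddAbove_range
  have hM : ∀ j, q j ≤ M := fun j => hM ⟨j, rfl⟩
  have hM0 : 0 ≤ M := le_trans (by positivity) (hM 0)
  refine ⟨Real.exp 48 + 4 * D * Real.exp 32 * M, ?_, fun t ht ht1 => ?_⟩
  · have : 1 ≤ Real.exp 48 := Real.one_le_exp (by norm_num)
    have : 0 ≤ 4 * D * Real.exp 32 * M := by positivity
    linarith
  have hle : ∀ j : ℕ, D * Real.exp (8 * j) / √(2 ^ 2 ^ j) ≤ D * q j := by
    intro j
    simp only [hq]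
    rw [← mul_div_assoc]
    gcongr; norm_num
  have hex : ∃ i : ℕ, D * Real.exp (8 * (i + 6 : ℕ)) / √(2 ^ 2 ^ (i + 6)) ≤ t ^ 4 / 4 := by
    have h1 : Tendsto (fun j => D * q j) atTop (nhds 0) := by simpa using hq0.const_mul D
    have h2 := (h1.eventually (gt_mem_nhds (by positivity : 0 < t ^ 4 / 4))).exists_forall_of_atTop
    obtain ⟨n, hn⟩ := h2
    exact ⟨n, (hle _).trans (hn (n + 6) (by omega)).le⟩
  classical
  refine ⟨Nat.find hex + 6, by omega, Nat.find_spec hex, ?_⟩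
  set C := Real.exp 48 + 4 * D * Real.exp 32 * M with hC
  have hC2 : 0 ≤ 4 * D * Real.exp 32 * M := by positivity
  have hC3 : 1 ≤ Real.exp 48 := Real.one_le_exp (by norm_num)
  rcases hf : Nat.find hex with _ | i
  · have : Real.exp (8 * ((0 + 6 : ℕ) : ℝ)) * t ≤ Real.exp 48 * 1 := by
      gcongr; norm_num
    linarith
  · have hm := Nat.find_min hex (m := i) (by omega)
    rw [not_le] at hm
    set j := i + 6
    have h1 : (Real.exp (8 * ((i + 1 + 6 : ℕ) : ℝ)) * t) ^ 4 ≤ C ^ 4 := by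
      have e1 : (Real.exp (8 * ((i + 1 + 6 : ℕ) : ℝ)) * t) ^ 4 = Real.exp 32 * Real.exp (32 * j) * t ^ 4 := by
        rw [mul_pow, ← Real.exp_nat_mul, ← Real.exp_add]; congr 2; simp only [j]; push_cast; ring
      have e2 : Real.exp 32 * Real.exp (32 * j) * (4 * (D * Real.exp (8 * j) / √(2 ^ 2 ^ j))) = 4 * D * Real.exp 32 * q j := by
        simp only [hq]
        rw [show (40:ℝ) * j = 32 * j + 8 * j by ring, Real.exp_add]; ring
      rw [e1]
      calc _ ≤ Real.exp 32 * Real.exp (32 * j) * (4 * (D * Real.exp (8 * j) / √(2 ^ 2 ^ j))) := by gcongr; linarith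
        _ = _ := e2
        _ ≤ 4 * D * Real.exp 32 * M := by gcongr; exact hM j
        _ ≤ C := by linarith
        _ ≤ C ^ 4 := le_self_pow₀ (by linarith) (by norm_num)
    exact le_of_pow_le_pow_left₀ (by norm_num) (by linarith) h1

lemma dyad3 {ι : Type*} [Fintype ι] (a : ι → ℝ) (ha : ∀ k, 0 ≤ a k) (δ : ℝ) (hδ : 0 ≤ δ) (I : ℕ) :
    ∑ k with a k ≤ δ, a k ^ 3 ≤ ∑ i ∈ range I, (δ / 4 ^ i) ^ 3 * #{k | δ / 4 ^ (i + 1) ≤ a k} + ∑ k with a k ≤ δ / 4 ^ I, a k ^ 3 := by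
  induction I with
  | zero => simp
  | succ I ih =>
    refine ih.trans ?_
    rw [sum_range_succ, add_assoc]
    gcongr
    rw [← sum_filter_add_sum_filter_not (s := univ.filter fun k => a k ≤ δ / 4 ^ I) (fun k => δ / 4 ^ (I + 1) < a k)]
    refine add_le_add ?_ ?_
    · calc _ ≤ ∑ k with δ / 4 ^ (I + 1) ≤ a k, (δ / 4 ^ I) ^ 3 := by
            rw [filter_filter]
            refine (sum_le_sum fun k hk => ?_).trans (sum_le_sum_of_subset_of_nonneg (fun k hk => ?_) fun _ _ _ => by positivity)
            · rw [mem_filter] at hk; exact pow_le_pow_left₀ (ha k) hk.2.1 3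
            · rw [mem_filter] at hk ⊢; exact ⟨mem_univ _, hk.2.2.le⟩
        _ = _ := by rw [sum_const, nsmul_eq_mul]; ring
    · rw [filter_filter]
      refine sum_le_sum_of_subset_of_nonneg (fun k hk => ?_) fun k _ _ => pow_nonneg (ha k) 3
      rw [mem_filter] at hk ⊢
      exact ⟨mem_univ _, not_lt.1 hk.2.2⟩

lemma level (b E : ℕ) (hE : E = 20 * (4 * b + 6)) (hτ : ∀ L, tau b L ≤ 1) : ∃ C : ℝ, 1 ≤ C ∧ ∀ (L G : ℕ) [NeZero G] (W r : ℕ), 0 < W →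
    2288 * E ^ 2 ≤ L → E * 2 ^ L ≤ Nat.log 2 G → Nat.log 2 G < 2 * E * 2 ^ L → ∀ f : ZMod G → ℝ, (∀ x, 0 ≤ f x) →
    (∀ x, f x ≤ W.totient / W * (2 * Real.log G)) → (∀ x, f x ≠ 0 → (W * x.val + r).Prime ∧ G ≤ x.val ^ 2) →
    ∑ x, f x ≤ 13 * E * G ∧ 2 * Real.log G ≤ 4 * E * lz L ∧ ∀ t : ℝ, 0 < t → 1 ≤ t * lz L → t ≤ 1 →
      (#{k | t ^ 2 * G ≤ ‖hat f k‖} : ℝ) ≤ C / t ^ 5 := by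
  have hE1 : (1:ℝ) ≤ E := by exact_mod_cast (by omega : 1 ≤ E)
  obtain ⟨C3, hC3, HJ⟩ := jchoice (156 * E ^ 2) (by positivity)
  refine ⟨338 * E ^ 2 * C3, ?_, ?_⟩
  · have : (1:ℝ) ≤ E ^ 2 := one_le_pow₀ hE1
    have : 1 * 1 ≤ (E:ℝ) ^ 2 * C3 := mul_le_mul this hC3 (by norm_num) (by positivity)
    linarith
  intro L G _ W r hW hL hLa hLb f hf0 hfB hfp
  have hG0 : G ≠ 0 := NeZero.ne G
  have hGp : (0:ℝ) < G := by exact_mod_cast Nat.pos_of_ne_zero hG0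
  have hlp := lz_pos L
  have hlogG : 2 * Real.log G ≤ 4 * E * lz L := by
    have h1 : G ≤ 2 ^ (2 * E * 2 ^ L) := (Nat.lt_pow_of_log_lt (by norm_num) hLb).le
    have h2 : Real.log G ≤ Real.log ((2 ^ (2 * E * 2 ^ L) : ℕ) : ℝ) := Real.log_le_log hGp (by exact_mod_cast h1)
    have h3 : Real.log ((2 ^ (2 * E * 2 ^ L) : ℕ) : ℝ) = 2 * E * lz L := by
      push_cast
      rw [Real.log_pow, lz_eq]; push_cast; ring
    linarith
  have hlevN : lev b L ^ 20 ≤ G := by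
    calc lev b L ^ 20 = 2 ^ (E * 2 ^ L) := by unfold lev; rw [← pow_mul, hE]; congr 1; ring
      _ ≤ 2 ^ Nat.log 2 G := Nat.pow_le_pow_right (by norm_num) hLa
      _ ≤ G := Nat.pow_log_le_self 2 hG0
  set v : ℝ := (lev b L : ℝ) with hv
  have hv1n := one_le_lev b L
  have hv1 : 1 ≤ v := by rw [hv]; exact_mod_cast hv1n
  have hlv : lz L ≤ v := lz_le_lev b L
  have hvN : v ^ 20 ≤ G := by rw [hv]; exact_mod_cast hlevN
  have hvs : v ^ 10 ≤ √(G:ℝ) := Real.le_sqrt_of_sq_le (by rw [← pow_mul]; exact hvN)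
  have hvE : 2288 * (E:ℝ) ^ 2 ≤ v := le_trans (by exact_mod_cast hL) (L_le_lev b L)
  have hE2 : (E:ℝ) ≤ E ^ 2 := le_self_pow₀ hE1 (by norm_num)
  have hz : 2 ^ 2 ^ L ≤ lev b L := Nat.pow_le_pow_right (by norm_num) (Nat.le_mul_of_pos_right _ (by omega))
  set B0 : ℝ := W.totient / W * (2 * Real.log G) with hB0
  have hG1 : (1:ℝ) ≤ G := by exact_mod_cast Nat.pos_of_ne_zero hG0
  have hlg0 : 0 ≤ Real.log G := Real.log_nonneg hG1
  have hWp : (0:ℝ) < W := by exact_mod_cast hW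
  have hφ : (0:ℝ) < W.totient := by exact_mod_cast Nat.totient_pos.2 hW
  have hB00 : 0 ≤ B0 := by positivity
  have hφW : (W.totient : ℝ) / W ≤ 1 := (div_le_one hWp).2 (by exact_mod_cast Nat.totient_le W)
  have hB0v : B0 ≤ 4 * E * v := by
    calc B0 ≤ 1 * (2 * Real.log G) := mul_le_mul_of_nonneg_right hφW (by positivity)
      _ ≤ 4 * E * v := by rw [one_mul]; exact hlogG.trans (by gcongr)
  -- majorant
  have hmaj : ∀ j x, f x ≤ B0 * UF (Pw W j) L (cE b L) W r x.val := by
    intro j x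
    have h1 : ∏ p ∈ PP (Pw W j) L, (1 - xd W r x.val p) ≤ UF (Pw W j) L (cE b L) W r x.val := UE_ge (Pw_blk W j) b L _ (xd_mem W r x.val)
    by_cases hx : f x = 0
    · rw [hx]
      exact mul_nonneg hB00 (le_trans (prod_nonneg fun p _ => by linarith [(xd_mem W r x.val p).2]) h1)
    · obtain ⟨hp, hx2⟩ := hfp x hx
      rw [prod_eq_one] at h1
      · calc f x ≤ B0 * 1 := by rw [mul_one]; exact hfB x
          _ ≤ _ := by gcongr
      · intro p hpm
        have h2 := (mem_PPf L p).1 ((Pw_mem W j L p).1 hpm).1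
        have h3 : ¬ p ∣ W * x.val + r := by
          intro hd
          have h4 := (Nat.prime_dvd_prime_iff_eq h2.2 hp).1 hd
          have h5 : x.val ≤ W * x.val := Nat.le_mul_of_pos_left _ hW
          have h6 : x.val < lev b L := by omega
          have h7 : x.val ^ 2 < lev b L ^ 2 := Nat.pow_lt_pow_left h6 (by norm_num)
          have h8 : lev b L ^ 2 ≤ lev b L ^ 20 := Nat.pow_le_pow_right hv1n (by norm_num)
          omega
        simp [xd, h3]
  have hBV : ∀ j : ℕ, B0 * VV (PP (Pw W j) L) ≤ 4 * E * Real.exp (8 * j) := by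
    intro j
    calc B0 * VV (PP (Pw W j) L) ≤ B0 * (Real.exp (8 * j) * (W / W.totient) / lz L) := by gcongr; exact VV_Pw W j L hW
      _ = 2 * Real.log G * Real.exp (8 * j) / lz L := by rw [hB0]; field_simp
      _ ≤ (4 * E * lz L) * Real.exp (8 * j) / lz L := by gcongr
      _ = _ := by field_simp
  have hB2v : B0 * (2 * v) ≤ G := by
    calc B0 * (2 * v) ≤ (4 * E * v) * (2 * v) := by gcongr
      _ = 8 * E * v ^ 2 := by ring
      _ ≤ v * v ^ 2 := by gcongr; linarith
      _ = v ^ 3 := by ring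
      _ ≤ G := (pow_le_pow_right₀ hv1 (by norm_num)).trans hvN
  have hcnt : ∀ j, ∑ x : ZMod G, UF (Pw W j) L (cE b L) W r x.val ≤ 3 * VV (PP (Pw W j) L) * G + 2 * v := by
    intro j
    rw [← sum_range_zmod G (fun n => UF (Pw W j) L (cE b L) W r n)]
    refine (UF_count (Pw_blk W j) b L (cE b L) (cE_lv b L) (cE_abs b L) W r (fun p hp =>
      ((PP_prime (Pw_blk W j) L p hp).coprime_iff_not_dvd).2 ((Pw_mem W j L p).1 hp).2.2) G).trans ?_
    have he : Real.exp (tau b L) ≤ 3 := (Real.exp_le_exp.2 (hτ L)).trans (by linarith [Real.exp_one_lt_d9])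
    have hV := VVPP_pos (Pw_blk W j) L
    have : (G:ℝ) * Ug (Pw W j) L (cE b L) rc ≤ G * (VV (PP (Pw W j) L) * 3) := by
      gcongr; exact (UE_mean (Pw_blk W j) b L).trans (by gcongr)
    linarith
  have hBcnt : ∀ j : ℕ, B0 * (3 * VV (PP (Pw W j) L) * G + 2 * v) ≤ 13 * E * Real.exp (8 * j) * G := by
    intro j
    have h1 := hBV j
    have h2 : 3 * G * (B0 * VV (PP (Pw W j) L)) ≤ 3 * G * (4 * E * Real.exp (8 * j)) := by gcongr
    have h3 : 1 * 1 ≤ E * Real.exp (8 * j) := mul_le_mul hE1 (Real.one_le_exp (by positivity)) (by norm_num) (by positivity)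
    have h4 : 1 * (G:ℝ) ≤ E * Real.exp (8 * j) * G := by gcongr; linarith
    linarith
  have hF : ∑ x, f x ≤ 13 * E * G := by
    have := hBcnt 0
    simp only [Nat.cast_zero, mul_zero, Real.exp_zero, mul_one] at this
    refine le_trans ?_ this
    refine le_trans (sum_le_sum fun x _ => hmaj 0 x) ?_
    rw [← mul_sum]
    exact mul_le_mul_of_nonneg_left (hcnt 0) hB00
  refine ⟨hF, hlogG, fun t ht htl ht1 => ?_⟩
  obtain ⟨j, hj, hj1, hj2⟩ := HJ t ht ht1
  set Q : ℕ := Nat.sqrt G + 1 with hQ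
  have hQs : √(G:ℝ) ≤ Q := by
    rw [Real.sqrt_le_left (by positivity)]
    have := Nat.lt_succ_sqrt G
    exact_mod_cast (by rw [hQ, pow_two]; exact this.le)
  have hQs2 : (Q:ℝ) ≤ √(G:ℝ) + 1 := by
    rw [hQ]; push_cast
    have : ((Nat.sqrt G : ℕ) : ℝ) ≤ √(G:ℝ) := Real.nat_sqrt_le_real_sqrt
    linarith
  have hs1 : 1 ≤ √(G:ℝ) := Real.one_le_sqrt.2 hG1
  have hlevQ : 2 * lev b L ≤ Q := by
    have a1 : 2 * v ≤ v ^ 2 := by rw [pow_two]; gcongr; linarith [one_le_pow₀ hE1 (n := 2)]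
    have a2 : v ^ 2 ≤ v ^ 10 := pow_le_pow_right₀ hv1 (by norm_num)
    have : 2 * v ≤ Q := by linarith
    rw [hv] at this
    exact_mod_cast this
  have herr : v * (Q + 7 * G / Q + 2) ≤ 11 * v * √(G:ℝ) := by
    have a1 : 7 * G / Q ≤ 7 * √(G:ℝ) := by
      rw [div_le_iff₀ (by linarith)]
      have := Real.mul_self_sqrt hGp.le
      have a2 : √(G:ℝ) * √(G:ℝ) ≤ √(G:ℝ) * Q := by gcongr
      linarith
    have : v * (Q + 7 * G / Q + 2) ≤ v * (11 * √(G:ℝ)) := by gcongr; linarith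
    linarith
  have hBerr : 13 * E * (B0 * (11 * v * √(G:ℝ))) ≤ t ^ 4 / 4 * G := by
    have a1 : 1 ≤ t ^ 4 * v ^ 4 := by
      rw [← mul_pow]; exact one_le_pow₀ (htl.trans (by gcongr))
    have a2 : 2288 * (E:ℝ) ^ 2 * v ^ 2 ≤ t ^ 4 * √(G:ℝ) := by
      calc 2288 * (E:ℝ) ^ 2 * v ^ 2 ≤ v * v ^ 2 := by gcongr
        _ = 1 * v ^ 3 := by ring
        _ ≤ t ^ 4 * v ^ 4 * v ^ 3 := by gcongr
        _ = t ^ 4 * v ^ 7 := by ring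
        _ ≤ t ^ 4 * √(G:ℝ) := by gcongr; exact (pow_le_pow_right₀ hv1 (by norm_num)).trans hvs
    calc 13 * E * (B0 * (11 * v * √(G:ℝ))) ≤ 13 * E * ((4 * E * v) * (11 * v * √(G:ℝ))) := by gcongr
      _ = 2288 * (E:ℝ) ^ 2 * v ^ 2 * √(G:ℝ) / 4 := by ring
      _ ≤ t ^ 4 * √(G:ℝ) * √(G:ℝ) / 4 := by gcongr
      _ = t ^ 4 * (√(G:ℝ) * √(G:ℝ)) / 4 := by ring
      _ = _ := by rw [Real.mul_self_sqrt hGp.le]; ring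
  set S : Finset (ZMod G) := {k | t ^ 2 * G ≤ ‖hat f k‖} with hS
  set R : ℝ := ((#S : ℕ) : ℝ) with hR
  set V := VV (PP (Pw W j) L) with hV
  have hVp : 0 < V := VVPP_pos (Pw_blk W j) L
  set Y : ℝ := √(2 ^ 2 ^ j) with hY
  have hYp : 0 < Y := by positivity
  have hls := large_sieve f (fun x => UF (Pw W j) L (cE b L) W r x.val) B0 (t ^ 2 * G) (3 * V * G / Y + v * (Q + 7 * G / Q + 2)) (3 * V * G + 2 * v)
    hf0 hB00 (hmaj j) S (by positivity) (fun k hk => (mem_filter.1 hk).2) (by positivity) (fun k hk => offdiag b L W r j Q hj (hτ L) hlevQ k hk) (by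
      have : hat (fun x : ZMod G => UF (Pw W j) L (cE b L) W r x.val) 0 = ((∑ x : ZMod G, UF (Pw W j) L (cE b L) W r x.val : ℝ) : ℂ) := by
        unfold hat; push_cast; exact sum_congr rfl fun x _ => by simp [ch]
      rw [this, Complex.norm_real, Real.norm_of_nonneg]
      · exact hcnt j
      · exact sum_nonneg fun x _ => le_trans (prod_nonneg fun p _ => by linarith [(xd_mem W r x.val p).2]) (UE_ge (Pw_blk W j) b L _ (xd_mem W r x.val)))
  rw [← hR] at hls
  have hR0 : 0 ≤ R := Nat.cast_nonneg _
  have k1 : 13 * E * (B0 * (3 * V * G / Y)) ≤ t ^ 4 / 4 * G := by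
    calc 13 * E * (B0 * (3 * V * G / Y)) = 39 * E * G * (B0 * V) / Y := by ring
      _ ≤ 39 * E * G * (4 * E * Real.exp (8 * j)) / Y := div_le_div_of_nonneg_right (mul_le_mul_of_nonneg_left (hBV j) (by positivity)) hYp.le
      _ = (156 * E ^ 2 * Real.exp (8 * j) / Y) * G := by ring
      _ ≤ _ := mul_le_mul_of_nonneg_right hj1 hGp.le
  have k2 : 13 * E * (B0 * (3 * V * G / Y + v * (Q + 7 * G / Q + 2))) ≤ t ^ 4 / 2 * G := by
    have : 13 * E * (B0 * (v * (Q + 7 * G / Q + 2))) ≤ 13 * E * (B0 * (11 * v * √(G:ℝ))) :=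
      mul_le_mul_of_nonneg_left (mul_le_mul_of_nonneg_left herr hB00) (by positivity)
    linarith
  have k3 : (t ^ 2 * G * R) ^ 2 ≤ G * (R * (169 * E ^ 2 * Real.exp (8 * j) * G) + R ^ 2 * (t ^ 4 / 2 * G)) := by
    refine hls.trans ((mul_le_mul_of_nonneg_right hF (by positivity)).trans ?_)
    have a1 : 13 * E * (R * (B0 * (3 * V * G + 2 * v))) ≤ 13 * E * (R * (13 * E * Real.exp (8 * j) * G)) :=
      mul_le_mul_of_nonneg_left (mul_le_mul_of_nonneg_left (hBcnt j) hR0) (by positivity)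
    have a2 := mul_le_mul_of_nonneg_left k2 (by positivity : 0 ≤ R ^ 2)
    have a3 := mul_le_mul_of_nonneg_left (add_le_add a1 a2) hGp.le
    linarith
  rcases hR0.eq_or_lt with h0 | hRp
  · rw [← h0]; positivity
  have k4 : t ^ 4 * R ≤ 338 * E ^ 2 * Real.exp (8 * j) := by
    have a1 : (G ^ 2 * R) * (t ^ 4 * R) ≤ (G ^ 2 * R) * (169 * E ^ 2 * Real.exp (8 * j) + t ^ 4 * R / 2) := by linarith
    have := le_of_mul_le_mul_left a1 (by positivity)
    linarith
  rw [le_div_iff₀ (by positivity)]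
  calc R * t ^ 5 = (t ^ 4 * R) * t := by ring
    _ ≤ 338 * E ^ 2 * Real.exp (8 * j) * t := by gcongr
    _ = 338 * E ^ 2 * (Real.exp (8 * j) * t) := by ring
    _ ≤ _ := by gcongr

theorem restr : ∃ C : ℝ, 1 ≤ C ∧ ∀ t : ℝ, 0 < t → t ≤ 1 → ∃ G0, ∀ G ≥ G0, ∀ [NeZero G] (W r : ℕ), 0 < W → ∀ f : ZMod G → ℝ, (∀ x, 0 ≤ f x) →
    (∀ x, f x ≤ W.totient / W * (2 * Real.log G)) → (∀ x, f x ≠ 0 → (W * x.val + r).Prime ∧ G ≤ x.val ^ 2) →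
    ∑ x, f x ≤ C * G ∧ (#{k | t ^ 2 * G ≤ ‖hat f k‖} : ℝ) ≤ C / t ^ 5 ∧ ∑ k with ‖hat f k‖ ≤ t ^ 2 * G, ‖hat f k‖ ^ 3 ≤ C * t * G ^ 3 := by
  obtain ⟨b, hb⟩ := tau_small' 1 one_pos
  obtain ⟨E, hE⟩ : ∃ E : ℕ, E = 20 * (4 * b + 6) := ⟨_, rfl⟩
  have hτ : ∀ L, tau b L ≤ 1 := fun L => by
    have h0 := tau_nonneg b L
    have h1 : 1 * tau b L ≤ (4 * b + 6) * tau b L := by gcongr; linarith [(Nat.cast_nonneg b : (0:ℝ) ≤ b)]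
    linarith [hb L]
  obtain ⟨C, hC, H⟩ := level b E hE hτ
  have hE1 : (1:ℝ) ≤ E := by exact_mod_cast (by omega : 1 ≤ E)
  refine ⟨64 * C + 1 + 13 * E, by linarith, fun t ht ht1 => ?_⟩
  obtain ⟨L1, hL1⟩ := pow_unbounded_of_one_lt (2 * ((208 * E ^ 2 + 1) / t)) (by norm_num : (1:ℝ) < 2)
  obtain ⟨G0, -, HG⟩ := params E (max L1 (2288 * E ^ 2)) (by omega)
  refine ⟨G0, fun G hG _ W r hW f hf0 hfB hfp => ?_⟩
  obtain ⟨L, hL, hLa, hLb⟩ := HG G hG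
  obtain ⟨h1, h2, h3⟩ := H L G W r hW ((le_max_right _ _).trans hL) hLa hLb f hf0 hfB hfp
  have hlz : (208 * E ^ 2 + 1) / t ≤ lz L := by
    have a1 : (2:ℝ) ^ L1 ≤ 2 ^ L := pow_le_pow_right₀ (by norm_num) ((le_max_left _ _).trans hL)
    rw [lz_eq]
    have a2 : (2:ℝ) ^ L * (1 / 2) ≤ 2 ^ L * Real.log 2 := by gcongr; linarith [Real.log_two_gt_d9]
    linarith
  rw [div_le_iff₀ ht, mul_comm] at hlz
  have hE2 : 0 ≤ (E:ℝ) ^ 2 := by positivity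
  have hGp : (0:ℝ) < G := by exact_mod_cast Nat.pos_of_ne_zero (NeZero.ne G)
  have hlp := lz_pos L
  refine ⟨h1.trans (by gcongr; linarith), (h3 t ht (by linarith) ht1).trans (by gcongr; linarith), ?_⟩
  obtain ⟨I, hI1, hI2⟩ := exists_nat_pow_near (by linarith : 1 ≤ t * lz L) (by norm_num : (1:ℝ) < 2)
  refine (dyad3 (fun k => ‖hat f k‖) (fun k => norm_nonneg _) (t ^ 2 * G) (by positivity) I).trans ?_
  have e1 : ∑ i ∈ range I, (t ^ 2 * G / 4 ^ i) ^ 3 * (#{k | t ^ 2 * G / 4 ^ (i + 1) ≤ ‖hat f k‖} : ℝ) ≤ 64 * C * t * G ^ 3 := by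
    calc _ ≤ ∑ i ∈ range I, (32 * C * t * G ^ 3) * (1 / 2) ^ i := by
          refine sum_le_sum fun i hi => ?_
          have a0 : (2:ℝ) ^ (i + 1) ≤ 2 ^ I := pow_le_pow_right₀ (by norm_num) (mem_range.1 hi)
          have a1 := h3 (t / 2 ^ (i + 1)) (by positivity) (by
            rw [div_mul_eq_mul_div, one_le_div (by positivity)]; linarith)
            ((div_le_self ht.le (one_le_pow₀ (by norm_num))).trans ht1)
          have e : (t / 2 ^ (i + 1)) ^ 2 * G = t ^ 2 * G / 4 ^ (i + 1) := by
            rw [div_pow, ← pow_mul, mul_comm (i + 1) 2, pow_mul]; norm_num; ring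
          rw [e] at a1
          have e2 : (t ^ 2 * G / 4 ^ i) ^ 3 * (C / (t / 2 ^ (i + 1)) ^ 5) = (32 * C * t * G ^ 3) * (1 / 2) ^ i := by
            have : (4:ℝ) ^ i = 2 ^ i * 2 ^ i := by rw [← mul_pow]; norm_num
            rw [this, pow_succ, div_pow (1:ℝ), one_pow]; field_simp; ring
          rw [← e2]
          gcongr
      _ ≤ (32 * C * t * G ^ 3) * 2 := by
          rw [← mul_sum]
          gcongr
          have := summable_geometric_two.sum_le_tsum (range I) (fun i _ => by positivity)
          rwa [tsum_geometric_two] at this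
      _ = _ := by ring
  have e2 : ∑ k with ‖hat f k‖ ≤ t ^ 2 * G / 4 ^ I, ‖hat f k‖ ^ 3 ≤ t * G ^ 3 := by
    have a1 : ∑ k with ‖hat f k‖ ≤ t ^ 2 * G / 4 ^ I, ‖hat f k‖ ^ 3 ≤ (t ^ 2 * G / 4 ^ I) * ∑ k, ‖hat f k‖ ^ 2 := by
      rw [mul_sum]
      refine le_trans (sum_le_sum fun k hk => ?_) (sum_le_sum_of_subset_of_nonneg (filter_subset _ _) fun k _ _ => by positivity)
      rw [pow_succ, mul_comm]
      exact mul_le_mul_of_nonneg_right (mem_filter.1 hk).2 (by positivity)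
    have a2 : ∑ x, f x ^ 2 ≤ (4 * E * lz L) * (13 * E * G) := by
      have hφW : (W.totient : ℝ) / W ≤ 1 := (div_le_one (by exact_mod_cast hW)).2 (by exact_mod_cast Nat.totient_le W)
      have hlg : 0 ≤ Real.log G := Real.log_natCast_nonneg G
      calc ∑ x, f x ^ 2 ≤ ∑ x, (4 * E * lz L) * f x := sum_le_sum fun x _ => by
            rw [pow_two]
            refine mul_le_mul_of_nonneg_right ((hfB x).trans (le_trans (mul_le_of_le_one_left (by linarith) hφW) h2)) (hf0 x)
        _ ≤ _ := by rw [← mul_sum]; gcongr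
    rw [parseval] at a1
    have a3 : t ^ 2 / 4 ^ I ≤ 4 / lz L ^ 2 := by
      have b1 : t / 2 ^ I ≤ 2 / lz L := by
        rw [div_le_div_iff₀ (by positivity) hlp]; rw [pow_succ] at hI2; linarith
      have b2 := pow_le_pow_left₀ (by positivity) b1 2
      rw [div_pow, div_pow, ← pow_mul, mul_comm I 2, pow_mul] at b2
      norm_num at b2; exact b2
    calc _ ≤ (t ^ 2 * G / 4 ^ I) * (G * ∑ x, f x ^ 2) := a1
      _ = (t ^ 2 / 4 ^ I) * (G ^ 2 * ∑ x, f x ^ 2) := by ring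
      _ ≤ (4 / lz L ^ 2) * (G ^ 2 * ((4 * E * lz L) * (13 * E * G))) := by gcongr
      _ = (208 * E ^ 2 / lz L) * G ^ 3 := by field_simp; norm_num
      _ ≤ t * G ^ 3 := by
        gcongr
        rw [div_le_iff₀ hlp]; linarith
  have e3 : 0 ≤ 13 * E * (t * (G:ℝ) ^ 3) := by positivity
  linarith
end

section
open Finset

lemma bohr {P : ℕ} [NeZero P] (Λ : Finset (ZMod P)) (H : ℕ) (hH : 0 < H) : ∃ B : Finset (ZMod P), (P : ℝ) ≤ (H : ℝ) ^ #Λ * #B ∧ B.Nonempty ∧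
    ∀ k ∈ Λ, ∀ u ∈ B, ‖ch (u * k) - 1‖ ≤ 7 / H := by
  have hP : 0 < P := Nat.pos_of_ne_zero (NeZero.ne P)
  have hPr : (0:ℝ) < P := by exact_mod_cast hP
  have hHr : (0:ℝ) < H := by exact_mod_cast hH
  have : NeZero H := ⟨hH.ne'⟩
  let F : ZMod P → (Λ → Fin H) := fun n k => ⟨H * (n * k).val / P, by
    rw [Nat.div_lt_iff_lt_mul hP]; exact Nat.mul_lt_mul_of_pos_left (ZMod.val_lt _) hH⟩
  obtain ⟨y, -, hy⟩ := exists_le_card_fiber_of_nsmul_le_card_of_maps_to (s := (univ : Finset (ZMod P))) (t := univ) (f := F)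
    (b := (P : ℝ) / (H : ℝ) ^ #Λ) (fun _ _ => mem_univ _) univ_nonempty (by
      rw [card_univ, card_univ, ZMod.card, Fintype.card_fun, Fintype.card_fin, Fintype.card_coe, nsmul_eq_mul]
      push_cast
      rw [mul_div_cancel₀ _ (by positivity)])
  set S : Finset (ZMod P) := {x | F x = y} with hS
  have hne : S.Nonempty := by
    rw [← card_pos]
    have : (0:ℝ) < #S := lt_of_lt_of_le (by positivity) hy
    exact_mod_cast this
  obtain ⟨n0, hn0⟩ := hne
  refine ⟨S.image (· - n0), ?_, ⟨n0 - n0, mem_image_of_mem _ hn0⟩, ?_⟩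
  · rw [card_image_of_injective _ (sub_left_injective), mul_comm]
    exact (div_le_iff₀ (by positivity)).1 hy
  · intro k hk u hu
    obtain ⟨n, hn, rfl⟩ := mem_image.1 hu
    have e1 : ∀ x : ZMod P, ch x = ec (x.val / P) := fun x => by
      have := ch_int (G := P) x.val 1
      simp only [ZMod.natCast_zmod_val, Int.cast_one, mul_one] at this
      rw [this]; congr 1; ring
    have e2 : ‖ch ((n - n0) * k) - 1‖ = ‖ch (n * k) - ch (n0 * k)‖ := by
      have : ch (n * k) - ch (n0 * k) = ch (n0 * k) * (ch ((n - n0) * k) - 1) := by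
        rw [mul_sub, mul_one, ch, ch, ch, ← AddChar.map_add_eq_mul]; congr 2; ring
      rw [this, norm_mul, ch_norm, one_mul]
    rw [e2, e1, e1]
    refine (ec_sub_le _ _).trans ?_
    have h1 : ∀ z ∈ S, H * (z * k).val / P = (y ⟨k, hk⟩ : ℕ) := fun z hz => by
      have := congrFun (mem_filter.1 hz).2 ⟨k, hk⟩
      exact congrArg Fin.val this
    have h2 : ∀ z ∈ S, ((y ⟨k, hk⟩ : ℕ) : ℝ) / H ≤ (z * k).val / P ∧ ((z * k).val : ℝ) / P ≤ ((y ⟨k, hk⟩ : ℕ) : ℝ) / H + 1 / H := fun z hz => by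
      have a := h1 z hz
      rw [Nat.div_eq_iff hP] at a
      have a1 : ((y ⟨k, hk⟩ : ℕ) : ℝ) * P ≤ H * (z * k).val := by exact_mod_cast a.1
      have a2 : (H * (z * k).val : ℝ) ≤ (y ⟨k, hk⟩ : ℕ) * P + P := by
        have := a.2; exact_mod_cast (by omega : H * (z * k).val ≤ (y ⟨k, hk⟩ : ℕ) * P + P)
      constructor
      · rw [div_le_div_iff₀ hHr hPr]; linarith
      · rw [← add_div, div_le_div_iff₀ hPr hHr]; linarith
    have b1 := h2 n hn
    have b2 := h2 n0 hn0
    have b3 : |((n * k).val : ℝ) / P - (n0 * k).val / P| ≤ 1 / H := abs_le.2 ⟨by linarith, by linarith⟩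
    calc _ ≤ 7 * (1 / (H:ℝ)) := mul_le_mul (by linarith [Real.pi_lt_d2]) b3 (abs_nonneg _) (by norm_num)
      _ = _ := by ring

lemma hat_conv {G : ℕ} [NeZero G] (f g h : ZMod G → ℝ) (k : ZMod G) :
    hat (fun x => ∑ a, ∑ b, f a * g b * h (x - a - b)) k = hat f k * hat g k * hat h k := by
  have h1 : ∀ x, ((∑ a, ∑ b, f a * g b * h (x - a - b) : ℝ) : ℂ) * ch (x * k) =
      ∑ a, ∑ b, (f a : ℂ) * ch (a * k) * (g b * ch (b * k)) * (h (x - a - b) * ch ((x - a - b) * k)) := by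
    intro x
    push_cast
    rw [sum_mul]
    refine sum_congr rfl fun a _ => ?_
    rw [sum_mul]
    refine sum_congr rfl fun b _ => ?_
    rw [show x * k = a * k + b * k + (x - a - b) * k by ring]
    simp only [ch, AddChar.map_add_eq_mul]
    ring
  unfold hat
  rw [sum_congr rfl fun x _ => h1 x, sum_comm, sum_mul_sum, sum_mul]
  refine sum_congr rfl fun a _ => ?_
  rw [sum_comm, sum_mul]
  refine sum_congr rfl fun b _ => ?_
  rw [← mul_sum]
  congr 1
  exact Fintype.sum_equiv (Equiv.subRight (a + b)) _ _ fun x => by simp [sub_sub]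

lemma hat_zero {G : ℕ} [NeZero G] (f : ZMod G → ℝ) : hat f 0 = ((∑ x, f x : ℝ) : ℂ) := by simp [hat]

lemma hat_le {G : ℕ} [NeZero G] (f : ZMod G → ℝ) (hf : ∀ x, 0 ≤ f x) (k) : ‖hat f k‖ ≤ ∑ x, f x := by
  refine (norm_sum_le _ _).trans (le_of_eq (sum_congr rfl fun x _ => ?_))
  rw [norm_mul, ch_norm, mul_one, Complex.norm_real, Real.norm_of_nonneg (hf x)]

lemma pw6 (z : ℂ) (hz : ‖z‖ ≤ 1) : ‖1 - z ^ 6‖ ≤ 6 * ‖z - 1‖ := by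
  rw [← mul_neg_geom_sum, norm_mul, norm_sub_rev, mul_comm]
  refine mul_le_mul_of_nonneg_right ((norm_sum_le _ _).trans ?_) (norm_nonneg _)
  calc _ ≤ ∑ i ∈ range 6, (1:ℝ) := sum_le_sum fun i _ => by rw [norm_pow]; exact pow_le_one₀ (norm_nonneg _) hz
    _ = 6 := by simp

lemma amgm3 (a b c : ℝ) (ha : 0 ≤ a) (hb : 0 ≤ b) (hc : 0 ≤ c) : 3 * (a * b * c) ≤ a ^ 3 + b ^ 3 + c ^ 3 := by
  have h : a ^ 3 + b ^ 3 + c ^ 3 - 3 * (a * b * c) = (a + b + c) * ((a - b) ^ 2 + (b - c) ^ 2 + (c - a) ^ 2) / 2 := by ring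
  have : 0 ≤ (a + b + c) * ((a - b) ^ 2 + (b - c) ^ 2 + (c - a) ^ 2) / 2 := by positivity
  linarith

lemma smooth {P : ℕ} [NeZero P] (B : Finset (ZMod P)) (hB : B.Nonempty) :
    ∃ (β : ZMod P → ℂ) (S : (ZMod P → ℝ) → ZMod P → ℝ), (∀ k, ‖β k‖ ≤ 1) ∧ (∀ k δ, (∀ u ∈ B, ‖ch (u * k) - 1‖ ≤ δ) → ‖β k - 1‖ ≤ δ) ∧
    (∀ f k, hat (S f) k = β k ^ 2 * hat f k) ∧ (∀ f, (∀ x, 0 ≤ f x) → ∀ x, 0 ≤ S f x) ∧ (∀ f g, (∀ x, f x ≤ g x) → ∀ x, S f x ≤ S g x) ∧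
    (∀ f, ∑ x, S f x = ∑ x, f x) ∧ (∀ ν ε, 0 ≤ ε → (∀ k, k ≠ 0 → ‖hat ν k‖ ≤ ε * P) → ‖hat ν 0‖ ≤ (1 + ε) * P → ∀ x, S ν x ≤ 1 + ε + ε * (P / #B)) := by
  have hM : (0:ℝ) < #B := by exact_mod_cast card_pos.2 hB
  have hMc : (#B : ℂ) ≠ 0 := by exact_mod_cast hM.ne'
  have hPp : (0:ℝ) < P := by exact_mod_cast Nat.pos_of_ne_zero (NeZero.ne P)
  set s : ZMod P → ℝ := fun x => if x ∈ B then 1 else 0 with hs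
  have hs0 : ∀ x, 0 ≤ s x := fun x => by simp only [hs]; split_ifs <;> norm_num
  have hs1 : ∑ x, s x = #B := by simp [hs]
  have hs2 : ∑ x, s x ^ 2 = #B := by simp [hs]
  have hsh : ∀ k, hat s k = ∑ u ∈ B, ch (u * k) := fun k => by
    simp only [hat, hs]; rw [← sum_filter_add_sum_filter_not univ (· ∈ B)]
    rw [sum_congr rfl fun x hx => by rw [if_pos (mem_filter.1 hx).2], sum_congr (s₁ := filter (· ∉ B) univ) rfl fun x hx => by rw [if_neg (mem_filter.1 hx).2]]
    simp
  have hb2 : ∀ f k, hat (fun x => (∑ a, ∑ b, s a * s b * f (x - a - b)) / #B ^ 2) k = (hat s k / #B) ^ 2 * hat f k := by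
    intro f k
    have : hat (fun x => (∑ a, ∑ b, s a * s b * f (x - a - b)) / #B ^ 2) k = hat (fun x => (∑ a, ∑ b, s a * s b * f (x - a - b))) k / #B ^ 2 := by
      unfold hat; rw [sum_div]; refine sum_congr rfl fun x _ => ?_; push_cast; ring
    rw [this, hat_conv]; ring
  have h0 : hat s 0 = #B := by rw [hat_zero, hs1]; simp
  refine ⟨fun k => hat s k / #B, fun f x => (∑ a, ∑ b, s a * s b * f (x - a - b)) / #B ^ 2, fun k => ?_, fun k δ hk => ?_, hb2,
    fun f hf x => ?_, fun f g hfg x => ?_, fun f => ?_, fun ν ε hε h1 h2 x => ?_⟩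
  · rw [norm_div, Complex.norm_natCast, div_le_one hM, ← hs1]; exact hat_le s hs0 k
  · have : hat s k / #B - 1 = (∑ u ∈ B, (ch (u * k) - 1)) / #B := by
      rw [sum_sub_distrib, hsh, sub_div, sum_const, nsmul_eq_mul, mul_one, div_self hMc]
    rw [this, norm_div, Complex.norm_natCast, div_le_iff₀ hM]
    refine (norm_sum_le _ _).trans ((sum_le_sum hk).trans (le_of_eq ?_))
    rw [sum_const, nsmul_eq_mul, mul_comm]
  · exact div_nonneg (sum_nonneg fun a _ => sum_nonneg fun b _ => mul_nonneg (mul_nonneg (hs0 _) (hs0 _)) (hf _)) (by positivity)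
  · exact div_le_div_of_nonneg_right (sum_le_sum fun a _ => sum_le_sum fun b _ => mul_le_mul_of_nonneg_left (hfg _) (mul_nonneg (hs0 _) (hs0 _))) (by positivity)
  · have := hb2 f 0
    rw [hat_zero, h0, hat_zero, div_self hMc, one_pow, one_mul] at this
    exact_mod_cast this
  · have e := triple s s ν x
    have e2 : (P * ∑ a, ∑ b, s a * s b * ν (x - a - b) : ℝ) ≤ ∑ k, ‖hat s k‖ ^ 2 * ‖hat ν k‖ := by
      calc _ ≤ ‖((P * ∑ a, ∑ b, s a * s b * ν (x - a - b) : ℝ) : ℂ)‖ := by rw [Complex.norm_real]; exact le_abs_self _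
        _ ≤ _ := by
          rw [e]
          refine (norm_sum_le _ _).trans (le_of_eq (sum_congr rfl fun k _ => ?_))
          rw [norm_mul, norm_mul, norm_mul, ch_norm, mul_one, pow_two]
    have e3 : ∑ k, ‖hat s k‖ ^ 2 * ‖hat ν k‖ ≤ #B ^ 2 * ((1 + ε) * P) + ∑ k, ‖hat s k‖ ^ 2 * (ε * P) := by
      rw [← add_sum_erase univ _ (mem_univ 0)]
      refine add_le_add ?_ ?_
      · rw [h0, Complex.norm_natCast]; exact mul_le_mul_of_nonneg_left h2 (by positivity)
      · refine (sum_le_sum fun k hk => mul_le_mul_of_nonneg_left (h1 k (ne_of_mem_erase hk)) (by positivity)).trans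
          (sum_le_sum_of_subset_of_nonneg (erase_subset _ _) fun _ _ _ => by positivity)
    rw [← sum_mul, parseval, hs2] at e3
    rw [div_le_iff₀ (by positivity)]
    refine le_of_mul_le_mul_left ((e2.trans e3).trans (le_of_eq ?_)) hPp
    field_simp

theorem transfer (η : ℝ) (h0 : 0 < η) (h1 : η ≤ 1) : ∃ ε : ℝ, 0 < ε ∧ ∃ G0 : ℕ, ∀ P ≥ G0, ∀ [Fact P.Prime] (W : ℕ) (r : Fin 3 → ℕ) (ν f : Fin 3 → ZMod P → ℝ), 0 < W →
    (∀ i x, 0 ≤ f i x) → (∀ i x, f i x ≤ ν i x) → (∀ i x, f i x ≤ W.totient / W * (2 * Real.log P)) →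
    (∀ i x, f i x ≠ 0 → (W * x.val + r i).Prime ∧ P ≤ x.val ^ 2) →
    (∀ i k, k ≠ 0 → ‖hat (ν i) k‖ ≤ ε * P) → (∀ i, ‖hat (ν i) 0‖ ≤ (1 + ε) * P) → (∀ i, 3 * η * P ≤ ∑ x, f i x) →
    (1 + 8 * η) * P ≤ ∑ i, ∑ x, f i x → ∀ x, 0 < ∑ a, ∑ b, f 0 a * f 1 b * f 2 (x - a - b) := by
  obtain ⟨C, hC, HC⟩ := restr
  have hC0 : 0 < C := by linarith
  obtain ⟨t, ht⟩ : ∃ t, t = η ^ 5 / (16 * C) := ⟨_, rfl⟩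
  have ht0 : 0 < t := by rw [ht]; positivity
  have hη5 : η ^ 5 ≤ 1 := pow_le_one₀ h0.le h1
  have ht1 : t ≤ 1 := by rw [ht, div_le_one (by positivity)]; linarith
  obtain ⟨G0, HG⟩ := HC t ht0 ht1
  obtain ⟨H, hH⟩ := exists_nat_gt (1008 * C ^ 4 / (t ^ 5 * η ^ 5))
  have hH0 : (0:ℝ) < H := lt_of_le_of_lt (by positivity) hH
  have hHn : 0 < H := by exact_mod_cast hH0
  obtain ⟨M, hM⟩ := exists_nat_ge (3 * (C / t ^ 5))
  have hH1 : (1:ℝ) ≤ H := by exact_mod_cast hHn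
  refine ⟨η / (1 + H ^ M), by positivity, max G0 ⌈2 / η⌉₊, ?_⟩
  obtain ⟨ε, hε⟩ : ∃ ε, ε = η / (1 + (H:ℝ) ^ M) := ⟨_, rfl⟩
  rw [← hε]
  have hε0 : 0 < ε := by rw [hε]; positivity
  intro P hP _ W r ν f hW hf0 hfν hfB hfp hν hν0 hs hS x
  have hPp : (0:ℝ) < P := by exact_mod_cast Nat.pos_of_ne_zero (NeZero.ne P)
  have HR := fun i => HG P ((le_max_left _ _).trans hP) W (r i) hW (f i) (hf0 i) (hfB i) (hfp i)
  set Λ : Finset (ZMod P) := univ.biUnion fun i : Fin 3 => {k | t ^ 2 * P ≤ ‖hat (f i) k‖} with hΛ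
  have hΛc : (#Λ : ℝ) ≤ 3 * (C / t ^ 5) := by
    have : (#Λ : ℝ) ≤ ∑ i : Fin 3, (#{k | t ^ 2 * P ≤ ‖hat (f i) k‖} : ℝ) := by exact_mod_cast card_biUnion_le
    refine this.trans ((sum_le_sum fun i _ => (HR i).2.1).trans (by simp))
  have hΛM : #Λ ≤ M := by exact_mod_cast hΛc.trans hM
  obtain ⟨B, hBP, hBn, hBΛ⟩ := bohr Λ H hHn
  have hBc : (0:ℝ) < #B := by exact_mod_cast card_pos.2 hBn
  have hPB : (P:ℝ) / #B ≤ H ^ M := by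
    rw [div_le_iff₀ hBc]
    exact hBP.trans (mul_le_mul_of_nonneg_right (pow_le_pow_right₀ hH1 hΛM) hBc.le)
  obtain ⟨β, S, b1, b2, b3, b4, b5, b6, b7⟩ := smooth B hBn
  have hg1 : ∀ i a, S (f i) a ≤ 1 + η := fun i a => by
    refine (b5 _ _ (hfν i) a).trans ((b7 (ν i) ε hε0.le (hν i) (hν0 i) a).trans ?_)
    have : ε * (P / #B) ≤ ε * H ^ M := mul_le_mul_of_nonneg_left hPB hε0.le
    have e : ε * (1 + H ^ M) = η := by rw [hε]; field_simp
    linarith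
  have key := three_count (fun i => S (f i)) η h0 h1 (fun i => b4 _ (hf0 i)) hg1 (fun i => by rw [b6]; exact hs i) (by simpa only [b6] using hS)
    (by
      have : 2 / η ≤ P := (Nat.le_ceil _).trans (by exact_mod_cast (le_max_right _ _).trans hP)
      rw [div_le_iff₀ h0] at this; linarith) x
  have tr1 := triple (f 0) (f 1) (f 2) x
  have tr2 := triple (S (f 0)) (S (f 1)) (S (f 2)) x
  set Y : ℝ := ∑ a, ∑ b, f 0 a * f 1 b * f 2 (x - a - b) with hY
  set Z : ℝ := ∑ a, ∑ b, S (f 0) a * S (f 1) b * S (f 2) (x - a - b) with hZ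
  have diff : P * Z - P * Y ≤ ∑ k, ‖hat (f 0) k‖ * ‖hat (f 1) k‖ * ‖hat (f 2) k‖ * ‖1 - β k ^ 6‖ := by
    have : P * Y - P * Z ≥ - ‖((P * Y : ℝ) : ℂ) - ((P * Z : ℝ) : ℂ)‖ := by
      rw [← Complex.ofReal_sub, Complex.norm_real]; exact neg_abs_le _
    rw [tr1, tr2, ← sum_sub_distrib] at this
    have h2 := norm_sum_le univ (fun k => hat (f 0) k * hat (f 1) k * hat (f 2) k * ch (-(x * k)) - hat (S (f 0)) k * hat (S (f 1)) k * hat (S (f 2)) k * ch (-(x * k)))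
    have h3 : ∑ k, ‖hat (f 0) k * hat (f 1) k * hat (f 2) k * ch (-(x * k)) - hat (S (f 0)) k * hat (S (f 1)) k * hat (S (f 2)) k * ch (-(x * k))‖ =
        ∑ k, ‖hat (f 0) k‖ * ‖hat (f 1) k‖ * ‖hat (f 2) k‖ * ‖1 - β k ^ 6‖ := by
      refine sum_congr rfl fun k _ => ?_
      rw [b3, b3, b3, ← norm_mul, ← norm_mul, ← norm_mul, ← mul_one ‖hat (f 0) k * hat (f 1) k * hat (f 2) k * (1 - β k ^ 6)‖, ← ch_norm (-(x * k)), ← norm_mul]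
      congr 1; ring
    linarith
  have hC3 : ∀ i k, ‖hat (f i) k‖ ≤ C * P := fun i k => (hat_le _ (hf0 i) k).trans (HR i).1
  have s1 : ∑ k ∈ Λ, ‖hat (f 0) k‖ * ‖hat (f 1) k‖ * ‖hat (f 2) k‖ * ‖1 - β k ^ 6‖ ≤ η ^ 5 / 8 * P ^ 3 := by
    calc _ ≤ ∑ k ∈ Λ, (C * P) * (C * P) * (C * P) * (42 / H) := sum_le_sum fun k hk => by
          refine mul_le_mul (mul_le_mul (mul_le_mul (hC3 0 k) (hC3 1 k) (norm_nonneg _) (by positivity)) (hC3 2 k) (norm_nonneg _) (by positivity)) ?_ (norm_nonneg _) (by positivity)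
          refine (pw6 _ (b1 k)).trans ?_
          have := b2 k _ (hBΛ k hk)
          calc _ ≤ 6 * (7 / (H:ℝ)) := by linarith
            _ = _ := by ring
      _ = #Λ * ((C * P) * (C * P) * (C * P) * (42 / H)) := by rw [sum_const, nsmul_eq_mul]
      _ ≤ 3 * (C / t ^ 5) * ((C * P) * (C * P) * (C * P) * (42 / H)) := mul_le_mul_of_nonneg_right hΛc (by positivity)
      _ = (1008 * C ^ 4 / (t ^ 5 * η ^ 5)) * (η ^ 5 / 8 * P ^ 3 / H) := by field_simp; ring
      _ ≤ H * (η ^ 5 / 8 * P ^ 3 / H) := mul_le_mul_of_nonneg_right hH.le (by positivity)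
      _ = _ := by field_simp
  have s2 : ∑ k ∈ univ \ Λ, ‖hat (f 0) k‖ * ‖hat (f 1) k‖ * ‖hat (f 2) k‖ * ‖1 - β k ^ 6‖ ≤ η ^ 5 / 8 * P ^ 3 := by
    have q : ∀ i, ∑ k ∈ univ \ Λ, ‖hat (f i) k‖ ^ 3 ≤ C * t * P ^ 3 := fun i => by
      refine le_trans (sum_le_sum_of_subset_of_nonneg (fun k hk => ?_) fun _ _ _ => by positivity) (HR i).2.2
      rw [mem_filter]
      refine ⟨mem_univ _, ?_⟩
      by_contra hc
      exact (mem_sdiff.1 hk).2 (mem_biUnion.2 ⟨i, mem_univ _, mem_filter.2 ⟨mem_univ _, (not_le.1 hc).le⟩⟩)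
    calc _ ≤ ∑ k ∈ univ \ Λ, 2 / 3 * (‖hat (f 0) k‖ ^ 3 + ‖hat (f 1) k‖ ^ 3 + ‖hat (f 2) k‖ ^ 3) := sum_le_sum fun k _ => by
          have a1 : ‖1 - β k ^ 6‖ ≤ 2 := by
            refine (norm_sub_le _ _).trans ?_
            rw [norm_pow, norm_one]; linarith [pow_le_one₀ (norm_nonneg _) (b1 k) (n := 6)]
          have a2 := amgm3 _ _ _ (norm_nonneg (hat (f 0) k)) (norm_nonneg (hat (f 1) k)) (norm_nonneg (hat (f 2) k))
          have a3 := mul_le_mul_of_nonneg_left a1 (by positivity : 0 ≤ ‖hat (f 0) k‖ * ‖hat (f 1) k‖ * ‖hat (f 2) k‖)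
          linarith
      _ ≤ 2 / 3 * (C * t * P ^ 3 + C * t * P ^ 3 + C * t * P ^ 3) := by
          rw [← mul_sum, sum_add_distrib, sum_add_distrib]
          linarith [q 0, q 1, q 2]
      _ = 2 * (C * t) * P ^ 3 := by ring
      _ = η ^ 5 / 8 * P ^ 3 := by rw [ht]; field_simp; norm_num
  rw [← sum_sdiff (subset_univ Λ)] at diff
  have k2 : P * (η ^ 5 / 2 * P ^ 2) ≤ P * Z := mul_le_mul_of_nonneg_left key hPp.le
  have e : (P:ℝ) * (η ^ 5 / 2 * P ^ 2) = 4 * (η ^ 5 / 8 * P ^ 3) := by ring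
  have p3 : 0 < η ^ 5 / 8 * (P:ℝ) ^ 3 := by positivity
  have : 0 < P * Y := by linarith
  exact pos_of_mul_pos_right this hPp.le
end

section
open Finset Filter Topology

noncomputable def nu (W b n : ℕ) : ℝ := if (W * n + b).Prime then W.totient / W * Real.log (W * n + b : ℕ) else 0

lemma ap_bij {M : Type*} [AddCommMonoid M] (W q b x c : ℕ) (hW : 0 < W) (hb : b < W) (F : ℕ → M) :
    ∑ p ∈ range (W * x + b) with p.Prime ∧ p ≡ W * c + b [MOD W * q], F p = ∑ n ∈ range x with (W * n + b).Prime ∧ n ≡ c [MOD q], F (W * n + b) := by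
  symm
  refine sum_bij (fun n _ => W * n + b) (fun n hn => ?_) (fun n _ m _ h => ?_) (fun p hp => ?_) fun _ _ => rfl
  · simp only [mem_filter, mem_range] at hn ⊢
    exact ⟨by gcongr; exact hn.1, hn.2.1, (Nat.ModEq.mul_left' W hn.2.2).add_right b⟩
  · exact Nat.eq_of_mul_eq_mul_left hW (by omega)
  · simp only [mem_filter, mem_range] at hp
    obtain ⟨h1, h2, h3⟩ := hp
    have h4 : p % W = b := by
      have := h3.of_mul_right q
      rw [Nat.ModEq, Nat.mul_add_mod, Nat.mod_eq_of_lt hb] at this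
      exact this
    have h5 : W * (p / W) + b = p := by rw [← h4]; exact Nat.div_add_mod p W
    refine ⟨p / W, ?_, h5⟩
    simp only [mem_filter, mem_range, h5]
    refine ⟨lt_of_mul_lt_mul_left (a := W) (by omega) (by omega), h2, ?_⟩
    rw [← h5] at h3
    exact Nat.ModEq.mul_left_cancel' hW.ne' (h3.add_right_cancel' b)

lemma theta_lim (Q : ℕ) [NeZero Q] (a : ℕ) : Tendsto (fun n : ℕ => thetaAP Q a n / n) atTop (𝓝 (if a.Coprime Q then (Q.totient : ℝ)⁻¹ else 0)) := by
  split_ifs with h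
  · exact pnt_ap ((ZMod.isUnit_iff_coprime a Q).2 h)
  · refine squeeze_zero (fun n => div_nonneg (sum_nonneg fun p _ => Real.log_natCast_nonneg p) (Nat.cast_nonneg n)) (fun n => ?_)
      (tendsto_const_div_atTop_nhds_zero_nat (∑ p ∈ range (Q + 1), Real.log p))
    refine div_le_div_of_nonneg_right (sum_le_sum_of_subset_of_nonneg (fun p hp => ?_) fun p _ _ => Real.log_natCast_nonneg p) (Nat.cast_nonneg n)
    simp only [mem_filter] at hp
    have h2 : ¬ p.Coprime Q := fun hc => h ((ZMod.isUnit_iff_coprime a Q).1 (hp.2.2 ▸ (ZMod.isUnit_iff_coprime p Q).2 hc))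
    rw [hp.2.1.coprime_iff_not_dvd, not_not] at h2
    exact mem_range.2 (Nat.lt_succ_of_le (Nat.le_of_dvd (Nat.pos_of_ne_zero (NeZero.ne Q)) h2))

/-- density of a residue class -/
noncomputable def Dc (W b q c : ℕ) : ℝ := W.totient * if (W * c + b).Coprime (W * q) then ((W * q).totient : ℝ)⁻¹ else 0

lemma Dc_nonneg (W b q c) : 0 ≤ Dc W b q c := by unfold Dc; split_ifs <;> positivity

lemma nu_lim (W q b c : ℕ) (hW : 0 < W) (hq : 0 < q) (hb : b < W) :
    Tendsto (fun x : ℕ => (∑ n ∈ range x with n ≡ c [MOD q], nu W b n) / x) atTop (𝓝 (Dc W b q c)) := by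
  have : NeZero (W * q) := ⟨(Nat.mul_pos hW hq).ne'⟩
  have hWr : (0:ℝ) < W := by exact_mod_cast hW
  have hm : Tendsto (fun x : ℕ => W * x + b - 1) atTop atTop := by
    refine tendsto_atTop_mono (fun x => ?_) (tendsto_sub_atTop_nat 1)
    have : x ≤ W * x := Nat.le_mul_of_pos_left x hW
    omega
  have h1 := (theta_lim (W * q) (W * c + b)).comp hm
  have h2 : Tendsto (fun x : ℕ => ((W * x + b - 1 : ℕ) : ℝ) / x) atTop (𝓝 W) := by
    have : Tendsto (fun x : ℕ => (W : ℝ) + (b - 1) / x) atTop (𝓝 (W + 0)) := tendsto_const_nhds.add (tendsto_const_div_atTop_nhds_zero_nat _)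
    rw [add_zero] at this
    refine this.congr' ?_
    filter_upwards [eventually_ge_atTop 1] with x hx
    have hx0 : (0:ℝ) < x := by exact_mod_cast hx
    have : 1 ≤ W * x + b := by have := Nat.mul_pos hW hx; omega
    push_cast [Nat.cast_sub this]
    field_simp; ring
  have h3 := ((h1.mul h2).const_mul ((W.totient : ℝ) / W))
  have e : (W.totient : ℝ) / W * ((if (W * c + b).Coprime (W * q) then ((W * q).totient : ℝ)⁻¹ else 0) * W) = Dc W b q c := by
    unfold Dc; field_simp
  rw [e] at h3
  refine h3.congr' ?_
  filter_upwards [eventually_ge_atTop 2] with x hx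
  have hx1 : 2 ≤ W * x + b := by have := Nat.le_mul_of_pos_left x hW; omega
  have hx0 : (0:ℝ) < ((W * x + b - 1 : ℕ) : ℝ) := by exact_mod_cast (by omega : 0 < W * x + b - 1)
  have e2 : ∑ n ∈ range x with n ≡ c [MOD q], nu W b n = (W.totient : ℝ) / W * thetaAP (W * q) (W * c + b : ℕ) (W * x + b - 1) := by
    unfold thetaAP
    have := ap_bij W q b x c hW hb (fun p => Real.log p)
    simp only [ZMod.natCast_eq_natCast_iff]
    rw [show W * x + b - 1 + 1 = W * x + b by omega, this, mul_sum, sum_filter, sum_filter]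
    refine sum_congr rfl fun n _ => ?_
    unfold nu
    split_ifs <;> tauto
  rw [e2]
  simp only [Function.comp]
  field_simp

lemma Dc_one (W b : ℕ) (hW : 0 < W) (hc : b.Coprime W) (c : ℕ) : Dc W b 1 c = 1 := by
  unfold Dc
  rw [mul_one, if_pos (by simpa [Nat.Coprime] using hc), mul_inv_cancel₀]
  exact_mod_cast (Nat.totient_pos.2 hW).ne'

lemma zmod_filter {M : Type*} [AddCommMonoid M] (q x : ℕ) [NeZero q] (F : ℕ → M) : ∑ n ∈ range x, F n = ∑ c : ZMod q, ∑ n ∈ range x with n ≡ c.val [MOD q], F n := by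
  rw [← sum_fiberwise (range x) (fun n : ℕ => (n : ZMod q))]
  refine sum_congr rfl fun c _ => ?_
  congr 1
  refine filter_congr fun n _ => ?_
  rw [← ZMod.natCast_eq_natCast_iff, ZMod.natCast_zmod_val]

lemma Dc_sum (W b q : ℕ) [NeZero q] (hW : 0 < W) (hb : b < W) (hc : b.Coprime W) : ∑ c : ZMod q, Dc W b q c.val = 1 := by
  have h1 := tendsto_finsetSum (univ : Finset (ZMod q)) fun c _ => nu_lim W q b c.val hW (Nat.pos_of_ne_zero (NeZero.ne q)) hb
  have h2 := nu_lim W 1 b 0 hW one_pos hb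
  rw [Dc_one W b hW hc] at h2
  refine tendsto_nhds_unique h1 (h2.congr fun x => ?_)
  rw [← sum_div, ← zmod_filter, filter_true_of_mem fun n _ => Nat.modEq_one]

noncomputable def Dh (W b q : ℕ) [NeZero q] (a : ZMod q) : ℂ := ∑ c : ZMod q, (Dc W b q c.val : ℂ) * ch (c * a)

lemma nu_hat_lim (W q b : ℕ) [NeZero q] (hW : 0 < W) (hb : b < W) (a : ZMod q) :
    Tendsto (fun x : ℕ => (∑ n ∈ range x, ((nu W b n : ℂ) * ch ((n : ZMod q) * a) - Dh W b q a)) / x) atTop (𝓝 0) := by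
  have h1 := tendsto_finsetSum (univ : Finset (ZMod q)) fun c _ =>
    ((Complex.continuous_ofReal.tendsto _).comp (nu_lim W q b c.val hW (Nat.pos_of_ne_zero (NeZero.ne q)) hb)).mul_const (ch (c * a))
  have h2 := h1.sub_const (Dh W b q a)
  rw [Dh, sub_self] at h2
  refine h2.congr' ?_
  filter_upwards [eventually_ge_atTop 1] with x hx
  have hx0 : (x : ℂ) ≠ 0 := by exact_mod_cast (by omega : x ≠ 0)
  rw [sum_sub_distrib, sum_const, card_range, nsmul_eq_mul, sub_div, mul_div_cancel_left₀ _ hx0, Dh]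
  congr 1
  rw [zmod_filter q x, sum_div]
  refine sum_congr rfl fun c _ => ?_
  simp only [Function.comp]
  push_cast
  rw [div_mul_eq_mul_div, sum_mul]
  congr 1
  refine sum_congr rfl fun n hn => ?_
  have := (ZMod.natCast_eq_natCast_iff _ _ _).2 (mem_filter.1 hn).2
  rw [this, ZMod.natCast_zmod_val]

lemma shift (W b q l m c : ℕ) (hl : l.Prime) (hq : q = l * m) (h0 : 0 < q) : (∀ j < l, ¬ (W * (c + j * m) + b).Coprime q) ∨ (∀ j < l, (W * (c + j * m) + b).Coprime q) ∨
    (¬ l ∣ W ∧ ∃ j0 < l, ∀ j < l, ((W * (c + j * m) + b).Coprime q ↔ j ≠ j0)) := by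
  by_cases h1 : ∀ j < l, ¬ (W * (c + j * m) + b).Coprime q
  · exact Or.inl h1
  by_cases h2 : ∀ j < l, (W * (c + j * m) + b).Coprime q
  · exact Or.inr (Or.inl h2)
  refine Or.inr (Or.inr ?_)
  push Not at h1 h2
  obtain ⟨i, hi, hic⟩ := h1
  have key : ∀ j, ¬ (W * (c + j * m) + b).Coprime q → l ∣ W * (c + j * m) + b ∧ ¬ l ∣ W * m := by
    intro j hj
    obtain ⟨p, hp, hp1, hp2⟩ := Nat.Prime.not_coprime_iff_dvd.1 hj
    have h3 : ¬ p ∣ W * m := fun hd => by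
      have e1 : W * (c + j * m) + b = W * c + b + (W * m) * j := by ring
      have e2 : W * (c + i * m) + b = W * c + b + (W * m) * i := by ring
      rw [e1] at hp1
      have := (Nat.dvd_add_left (hd.mul_right j)).1 hp1
      refine Nat.Prime.not_coprime_iff_dvd.2 ⟨p, hp, ?_, hp2⟩ hic
      rw [e2]; exact dvd_add this (hd.mul_right i)
    have h4 : p = l := by
      rw [hq] at hp2
      rcases (Nat.Prime.dvd_mul hp).1 hp2 with h | h
      · exact (Nat.prime_dvd_prime_iff_eq hp hl).1 h
      · exact absurd (h.mul_left W) h3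
    exact h4 ▸ ⟨hp1, h3⟩
  obtain ⟨j0, hj0, hjc⟩ := h2
  have k0 := key j0 hjc
  refine ⟨fun h => k0.2 (h.mul_right m), j0, hj0, fun j hj => ⟨fun h e => hjc (e ▸ h), fun h => by_contra fun hc => ?_⟩⟩
  have k1 := key j hc
  have h5 : (l : ℤ) ∣ (W * m : ℕ) * ((j : ℤ) - j0) := by
    have a1 : (l : ℤ) ∣ ((W * (c + j * m) + b : ℕ) : ℤ) - ((W * (c + j0 * m) + b : ℕ) : ℤ) := dvd_sub (by exact_mod_cast k1.1) (by exact_mod_cast k0.1)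
    convert a1 using 1; push_cast; ring
  rcases (Nat.prime_iff_prime_int.1 hl).dvd_or_dvd h5 with h | h
  · exact k0.2 (by exact_mod_cast h)
  · have := Int.eq_zero_of_abs_lt_dvd h (by rw [abs_lt]; omega)
    omega

lemma Dh_le (W b q w : ℕ) [NeZero q] (hw : 0 < w) (hWw : ∀ l : ℕ, l.Prime → ¬ l ∣ W → w < l) (hW : 0 < W) (hb : b < W) (hc : b.Coprime W) (a : ZMod q) (ha : IsUnit a) (hq : q ≠ 1) :
    ‖Dh W b q a‖ ≤ 1 / w := by
  obtain ⟨l, hl, m, hm⟩ := Nat.exists_prime_and_dvd hq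
  have hq0 : 0 < q := Nat.pos_of_ne_zero (NeZero.ne q)
  have hwr : (0:ℝ) < w := by exact_mod_cast hw
  have hlr : (0:ℝ) < l := by exact_mod_cast hl.pos
  have hm0 : 0 < m := Nat.pos_of_ne_zero fun h => by rw [h] at hm; omega
  set D : ZMod q → ℝ := fun c => Dc W b q c.val with hD
  obtain ⟨ρ, hρ⟩ : ∃ ρ : ℝ, ρ = W.totient * ((W * q).totient : ℝ)⁻¹ := ⟨_, rfl⟩
  have hρ0 : 0 ≤ ρ := by rw [hρ]; positivity
  have hDv : ∀ n : ℕ, D n = if (W * n + b).Coprime q then ρ else 0 := by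
    intro n
    simp only [hD, Dc]
    have : (W * (n : ZMod q).val + b).Coprime (W * q) ↔ (W * n + b).Coprime q := by
      rw [Nat.coprime_mul_iff_right, ← ZMod.isUnit_iff_coprime _ q, ← ZMod.isUnit_iff_coprime _ q]
      push_cast
      rw [ZMod.natCast_zmod_val]
      refine and_iff_right ?_
      simpa [Nat.Coprime] using hc
    by_cases h : (W * n + b).Coprime q
    · rw [if_pos (this.2 h), if_pos h, hρ]
    · rw [if_neg fun h' => h (this.1 h'), if_neg h, mul_zero]
  have hma : ((m : ℕ) : ZMod q) * a ≠ 0 := by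
    rw [Ne, ha.mul_left_eq_zero, ZMod.natCast_eq_zero_iff]
    intro h
    have := Nat.le_of_dvd hm0 h
    have h2 := Nat.mul_le_mul_right m hl.two_le
    omega
  set ζ : ℂ := ch ((m : ZMod q) * a) with hζ
  have hζ1 : ζ ≠ 1 := fun h => hma (ZMod.injective_stdAddChar (N := q) (h.trans (AddChar.map_zero_eq_one _).symm))
  have hζp : ∀ j : ℕ, ch (((j * m : ℕ) : ZMod q) * a) = ζ ^ j := fun j => by
    rw [hζ, ch, ch, ← AddChar.map_nsmul_eq_pow]; congr 1; rw [nsmul_eq_mul]; push_cast; ring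
  have hζl : ∑ j ∈ range l, ζ ^ j = 0 := by
    have : ζ ^ l = 1 := by
      rw [← hζp, ← hm]; simp [ch]
    have h2 := mul_neg_geom_sum ζ l
    rw [this, sub_self, mul_eq_zero] at h2
    exact h2.resolve_left (sub_ne_zero.2 hζ1.symm)
  have step : ∀ c : ZMod q, ‖∑ j ∈ range l, (D (c + (j * m : ℕ)) : ℂ) * ζ ^ j‖ ≤ 1 / w * ∑ j ∈ range l, D (c + (j * m : ℕ)) := by
    intro c
    have e : ∀ j : ℕ, D (c + (j * m : ℕ)) = if (W * (c.val + j * m) + b).Coprime q then ρ else 0 := fun j => by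
      rw [← hDv]; push_cast; rw [ZMod.natCast_zmod_val]
    simp only [e]
    rcases shift W b q l m c.val hl hm hq0 with h | h | ⟨hlW, j0, hj0, h⟩
    · rw [sum_eq_zero fun j hj => by rw [if_neg (h j (mem_range.1 hj))]; simp, sum_eq_zero fun j hj => if_neg (h j (mem_range.1 hj))]; simp
    · rw [sum_congr rfl fun j hj => by rw [if_pos (h j (mem_range.1 hj))], ← mul_sum, hζl, mul_zero, norm_zero]
      exact mul_nonneg (by positivity) (sum_nonneg fun j _ => by split_ifs <;> linarith)
    · have e1 : ∀ j ∈ range l, ((if (W * (c.val + j * m) + b).Coprime q then ρ else 0 : ℝ)) = ρ - if j = j0 then ρ else 0 := fun j hj => by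
        have := h j (mem_range.1 hj)
        by_cases hj : j = j0
        · rw [if_neg (by tauto), if_pos hj, sub_self]
        · rw [if_pos (by tauto), if_neg hj, sub_zero]
      rw [sum_congr rfl e1, sum_congr rfl fun j hj => by rw [e1 j hj]]
      have e2 : ∑ j ∈ range l, ((ρ - if j = j0 then ρ else 0 : ℝ) : ℂ) * ζ ^ j = - (ρ * ζ ^ j0) := by
        have : ∀ j ∈ range l, ((ρ - if j = j0 then ρ else 0 : ℝ) : ℂ) * ζ ^ j = ρ * ζ ^ j - if j = j0 then (ρ : ℂ) * ζ ^ j else 0 := fun j _ => by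
          split_ifs <;> push_cast <;> ring
        rw [sum_congr rfl this, sum_sub_distrib, ← mul_sum, hζl, sum_ite_eq' (range l) j0, if_pos (mem_range.2 hj0)]; simp
      rw [e2, norm_neg, norm_mul, norm_pow, hζ, ch_norm, one_pow, mul_one, Complex.norm_real, Real.norm_of_nonneg hρ0, sum_sub_distrib, sum_ite_eq' (range l) j0,
        if_pos (mem_range.2 hj0), sum_const, card_range, nsmul_eq_mul, div_mul_eq_mul_div, one_mul, le_div_iff₀ hwr]
      have : (w : ℝ) + 1 ≤ l := by exact_mod_cast hWw l hl hlW
      have := mul_le_mul_of_nonneg_left this hρ0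
      linarith
  have e1 : (l : ℂ) * Dh W b q a = ∑ c : ZMod q, ch (c * a) * ∑ j ∈ range l, (D (c + (j * m : ℕ)) : ℂ) * ζ ^ j := by
    simp only [mul_sum]
    rw [sum_comm]
    have : ∀ j ∈ range l, ∑ c : ZMod q, ch (c * a) * ((D (c + (j * m : ℕ)) : ℂ) * ζ ^ j) = Dh W b q a := fun j _ => by
      rw [Dh]
      refine Fintype.sum_equiv (Equiv.addRight ((j * m : ℕ) : ZMod q)) _ _ fun c => ?_
      rw [Equiv.coe_addRight, ← hζp, add_mul, ch, ch, ch, AddChar.map_add_eq_mul]; ring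
    rw [sum_congr rfl this, sum_const, card_range, nsmul_eq_mul]
  have e2 : ∑ c : ZMod q, ∑ j ∈ range l, D (c + (j * m : ℕ)) = l := by
    rw [sum_comm]
    have : ∀ j ∈ range l, ∑ c : ZMod q, D (c + (j * m : ℕ)) = 1 := fun j _ => by
      rw [← Dc_sum W b q hW hb hc]
      exact Fintype.sum_equiv (Equiv.addRight ((j * m : ℕ) : ZMod q)) _ _ fun c => rfl
    rw [sum_congr rfl this]; simp
  have e3 : l * ‖Dh W b q a‖ ≤ 1 / w * l := by
    calc l * ‖Dh W b q a‖ = ‖(l : ℂ) * Dh W b q a‖ := by rw [norm_mul, Complex.norm_natCast]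
      _ ≤ ∑ c : ZMod q, 1 / w * ∑ j ∈ range l, D (c + (j * m : ℕ)) := by
          rw [e1]
          refine (norm_sum_le _ _).trans (sum_le_sum fun c _ => ?_)
          rw [norm_mul, ch_norm, one_mul]; exact step c
      _ = _ := by rw [← mul_sum, e2]
  exact le_of_mul_le_mul_left (by linarith) hlr
end

section
open Finset Filter Topology

lemma abel_le (u : ℕ → ℂ) (β δ : ℝ) (P : ℕ) (hu : ∀ x ≤ P, ‖∑ n ∈ range x, u n‖ ≤ δ) : ‖∑ n ∈ range P, u n * ec (n * β)‖ ≤ δ * (1 + 7 * (|β| * P)) := by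
  have e : ∀ Q : ℕ, ∑ n ∈ range Q, u n * ec (n * β) = (∑ n ∈ range Q, u n) * ec (Q * β) - ∑ n ∈ range Q, (∑ m ∈ range (n + 1), u m) * (ec ((n + 1 : ℕ) * β) - ec (n * β)) := by
    intro Q
    induction Q with
    | zero => simp
    | succ Q ih => rw [sum_range_succ, ih, sum_range_succ (fun n => (∑ m ∈ range (n + 1), u m) * (ec ((n + 1 : ℕ) * β) - ec (n * β))), sum_range_succ u Q]; ring
  have hδ : 0 ≤ δ := (norm_nonneg _).trans (hu 0 (Nat.zero_le _))
  rw [e]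
  refine (norm_sub_le _ _).trans ?_
  rw [norm_mul, ec_norm, mul_one]
  have h2 : ‖∑ n ∈ range P, (∑ m ∈ range (n + 1), u m) * (ec ((n + 1 : ℕ) * β) - ec (n * β))‖ ≤ ∑ n ∈ range P, δ * (7 * |β|) := by
    refine (norm_sum_le _ _).trans (sum_le_sum fun n hn => ?_)
    rw [norm_mul]
    refine mul_le_mul (hu _ (mem_range.1 hn)) ((ec_sub_le _ _).trans ?_) (norm_nonneg _) hδ
    rw [show ((n + 1 : ℕ) : ℝ) * β - n * β = β by push_cast; ring]
    exact mul_le_mul_of_nonneg_right (by linarith [Real.pi_lt_d2]) (abs_nonneg _)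
  rw [sum_const, card_range, nsmul_eq_mul] at h2
  have := hu P le_rfl
  linarith

lemma partial_ev (u : ℕ → ℂ) (hu : Tendsto (fun x : ℕ => (∑ n ∈ range x, u n) / x) atTop (𝓝 0)) (δ : ℝ) (hδ : 0 < δ) :
    ∀ᶠ P : ℕ in atTop, ∀ x ≤ P, ‖∑ n ∈ range x, u n‖ ≤ δ * P := by
  have h1 := (tendsto_zero_iff_norm_tendsto_zero.1 hu).eventually (ge_mem_nhds hδ)
  obtain ⟨X, hX⟩ := eventually_atTop.1 h1
  obtain ⟨M, hM⟩ := exists_nat_ge ((∑ n ∈ range X, ‖u n‖) / δ)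
  filter_upwards [eventually_ge_atTop M] with P hP x hx
  by_cases hxX : X ≤ x
  · rcases Nat.eq_zero_or_pos x with h0 | h0
    · rw [h0]; simp; positivity
    · have h0 : (0:ℝ) < x := by exact_mod_cast h0
      have := hX x hxX
      rw [norm_div, Complex.norm_natCast, div_le_iff₀ h0] at this
      exact this.trans (mul_le_mul_of_nonneg_left (by exact_mod_cast hx) hδ.le)
  · rw [div_le_iff₀ hδ, mul_comm] at hM
    refine ((norm_sum_le _ _).trans (sum_le_sum_of_subset_of_nonneg (range_subset_range.2 (by omega)) fun _ _ _ => norm_nonneg _)).trans (hM.trans ?_)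
    exact mul_le_mul_of_nonneg_left (by exact_mod_cast hP) hδ.le

lemma addchar (W b P : ℕ) (hW : 0 < W) (hb : b < W) (α B : ℝ) (hB : ∀ j < W, ‖∑ p ∈ range (W * P + b) with p.Prime, (Real.log p : ℂ) * ec (p * ((α + j) / W))‖ ≤ B) :
    ‖∑ n ∈ range P, (nu W b n : ℂ) * ec (n * α)‖ ≤ B := by
  have : NeZero W := ⟨hW.ne'⟩
  have hWr : (0:ℝ) < W := by exact_mod_cast hW
  have hB0 : 0 ≤ B := (norm_nonneg _).trans (hB 0 hW)
  have e1 : ∀ p : ℕ, ∑ j ∈ range W, ec ((p - b) * ((α + j) / W)) = if p ≡ W * 0 + b [MOD W * 1] then W * ec ((p - b) / W * α) else 0 := by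
    intro p
    have a1 : ∀ j : ℕ, ec ((p - b) * ((α + j) / W)) = ec ((p - b) / W * α) * ch ((j : ZMod W) * (((p : ℤ) - b : ℤ) : ZMod W)) := fun j => by
      rw [ch_int, ← ec_add]; congr 1; push_cast; ring
    rw [sum_congr rfl fun j _ => a1 j, ← mul_sum, sum_range_zmod W (fun j => ch ((j : ZMod W) * (((p : ℤ) - b : ℤ) : ZMod W)))]
    simp only [ZMod.natCast_zmod_val]
    rw [ch_sum]
    have : (((p : ℤ) - b : ℤ) : ZMod W) = 0 ↔ p ≡ W * 0 + b [MOD W * 1] := by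
      push_cast
      rw [sub_eq_zero, mul_zero, zero_add, mul_one, ZMod.natCast_eq_natCast_iff]
    rw [if_congr this rfl rfl]
    split_ifs <;> ring
  have e2 : ∑ j ∈ range W, ec (-(b * ((α + j) / W))) * ∑ p ∈ range (W * P + b) with p.Prime, (Real.log p : ℂ) * ec (p * ((α + j) / W)) =
      W * ∑ n ∈ range P with (W * n + b).Prime ∧ n ≡ 0 [MOD 1], (Real.log (W * n + b : ℕ) : ℂ) * ec (((W * n + b : ℕ) - b) / W * α) := by
    simp only [mul_sum]
    rw [sum_comm, ← ap_bij W 1 b P 0 hW hb (fun p => (W : ℂ) * ((Real.log p : ℂ) * ec ((p - b) / W * α))), sum_filter, sum_filter]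
    refine sum_congr rfl fun p _ => ?_
    have : ∀ j : ℕ, ec (-(b * ((α + j) / W))) * ((Real.log p : ℂ) * ec (p * ((α + j) / W))) = Real.log p * ec ((p - b) * ((α + j) / W)) := fun j => by
      rw [show (p - b) * ((α + j) / W) = -(b * ((α + j) / W)) + p * ((α + j) / W) by ring, ec_add]; ring
    rw [sum_congr rfl fun j _ => this j, ← mul_sum, e1]
    by_cases h1 : p.Prime
    · by_cases h2 : p ≡ W * 0 + b [MOD W * 1]
      · rw [if_pos h1, if_pos h2, if_pos ⟨h1, h2⟩]; ring
      · rw [if_pos h1, if_neg h2, if_neg (by tauto), mul_zero]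
    · rw [if_neg h1, if_neg (by tauto)]
  have e3 : ∑ n ∈ range P, (nu W b n : ℂ) * ec (n * α) = (W.totient / W : ℝ) * ∑ n ∈ range P with (W * n + b).Prime ∧ n ≡ 0 [MOD 1], (Real.log (W * n + b : ℕ) : ℂ) * ec (((W * n + b : ℕ) - b) / W * α) := by
    rw [mul_sum, sum_filter]
    refine sum_congr rfl fun n _ => ?_
    have e : (((W * n + b : ℕ) : ℝ) - b) / W * α = n * α := by push_cast; field_simp; ring
    rw [e, nu]
    by_cases h : (W * n + b).Prime
    · rw [if_pos h, if_pos ⟨h, Nat.modEq_one⟩]; push_cast; ring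
    · rw [if_neg h, if_neg (by tauto)]; simp
  have h4 : ‖(W : ℂ) * ∑ n ∈ range P with (W * n + b).Prime ∧ n ≡ 0 [MOD 1], (Real.log (W * n + b : ℕ) : ℂ) * ec (((W * n + b : ℕ) - b) / W * α)‖ ≤ W * B := by
    rw [← e2]
    refine (norm_sum_le _ _).trans ((sum_le_sum fun j hj => ?_).trans (le_of_eq (by rw [sum_const, card_range, nsmul_eq_mul])))
    rw [norm_mul, ec_norm, one_mul]
    exact hB j (mem_range.1 hj)
  rw [norm_mul, Complex.norm_natCast] at h4
  have h5 := le_of_mul_le_mul_left h4 hWr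
  rw [e3, norm_mul, Complex.norm_real, Real.norm_of_nonneg (by positivity)]
  have h6 : (W.totient : ℝ) / W ≤ 1 := (div_le_one hWr).2 (by exact_mod_cast Nat.totient_le W)
  calc _ ≤ 1 * B := mul_le_mul h6 h5 (norm_nonneg _) (by norm_num)
    _ = B := one_mul B

lemma unif_aux (W w b : ℕ) (hw : 0 < w) (hWw : ∀ l : ℕ, l.Prime → ¬ l ∣ W → w < l) (hW : 0 < W) (hb : b < W) (hc : b.Coprime W) (ε : ℝ) (hε : 0 < ε) (hwε : 1 / (w : ℝ) ≤ ε / 2) :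
    ∀ᶠ P : ℕ in atTop, ∀ [NeZero P], (∀ k : ZMod P, k ≠ 0 → ‖hat (fun x => nu W b x.val) k‖ ≤ ε * P) ∧ ‖hat (fun x : ZMod P => nu W b x.val) 0‖ ≤ (1 + ε) * P := by
  have hWr : (0:ℝ) < W := by exact_mod_cast hW
  obtain ⟨K, N0, hK, hN0, HK⟩ := minor (ε / (2 * W)) (by positivity)
  obtain ⟨M, hM⟩ := exists_nat_ge K
  have ev1 : ∀ᶠ P : ℕ in atTop, ∀ q ∈ range M, ∀ a : ZMod (q + 1), ∀ x ≤ P,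
      ‖∑ n ∈ range x, ((nu W b n : ℂ) * ch ((n : ZMod (q + 1)) * a) - Dh W b (q + 1) a)‖ ≤ (ε / (2 * (1 + 7 * (2 * K)))) * P :=
    (eventually_all_finset _).2 fun q _ => eventually_all.2 fun a => partial_ev _ (nu_hat_lim W (q + 1) b hW hb a) _ (by positivity)
  filter_upwards [ev1, eventually_ge_atTop (N0 + 2)] with P hP1 hP2 inst
  have hP2r : (2:ℝ) ≤ P := by exact_mod_cast (by omega : 2 ≤ P)
  have hat_eq : ∀ k : ZMod P, hat (fun x => nu W b x.val) k = ∑ n ∈ range P, (nu W b n : ℂ) * ec (n * (k.val / P)) := fun k => by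
    rw [sum_range_zmod P (fun n => (nu W b n : ℂ) * ec (n * (k.val / P))), hat]
    exact sum_congr rfl fun x _ => by rw [ch_val]
  have hMp : 0 < M := by
    have : (0:ℝ) < M := by linarith
    exact_mod_cast this
  have hD1 : ∀ (q : ℕ) (a : ZMod (q + 1)), q = 0 → Dh W b (q + 1) a = 1 := by
    intro q a hq
    subst hq
    have ha : a = 0 := Subsingleton.elim (α := ZMod 1) a 0
    rw [ha, Dh]
    simp only [mul_zero, ch, AddChar.map_zero_eq_one, mul_one]
    exact_mod_cast Dc_sum W b (0 + 1) hW hb hc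
  constructor
  · intro k hk
    rw [hat_eq]
    set α : ℝ := k.val / P with hα
    have hN : N0 ≤ W * P + b - 1 := by have := Nat.le_mul_of_pos_left P hW; omega
    have hN1 : W * P + b - 1 + 1 = W * P + b := by have := Nat.le_mul_of_pos_left P hW; omega
    have hNr : ((W * P + b - 1 : ℕ) : ℝ) = W * P + b - 1 := by
      rw [eq_sub_iff_add_eq]; exact_mod_cast hN1
    have hbr : (b:ℝ) ≤ W := by exact_mod_cast hb.le
    have hb0 : (0:ℝ) ≤ b := Nat.cast_nonneg b
    have hW1 : (1:ℝ) ≤ W := by exact_mod_cast hW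
    have hWP : (W:ℝ) * 2 ≤ W * P := mul_le_mul_of_nonneg_left hP2r hWr.le
    by_cases hmin : ∀ j < W, ‖∑ p ∈ range (W * P + b) with p.Prime, (Real.log p : ℂ) * ec (p * ((α + j) / W))‖ ≤ ε / (2 * W) * (W * P + b - 1 : ℕ)
    · refine (addchar W b P hW hb α _ hmin).trans ?_
      rw [hNr]
      calc _ ≤ ε / (2 * W) * (2 * W * P) := mul_le_mul_of_nonneg_left (by linarith) (by positivity)
        _ = _ := by field_simp
    push Not at hmin
    obtain ⟨j, hj, hjm⟩ := hmin
    have hq := HK _ hN ((α + j) / W)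
    rw [hN1] at hq
    obtain ⟨q, hq0, hqK, hqn⟩ := hq.resolve_left (not_le.2 hjm)
    have hq0r : (0:ℝ) < q := by exact_mod_cast hq0
    have hq1 : nn (q * α) ≤ 2 * K / P := by
      calc nn (q * α) = nn (W * (q * ((α + j) / W))) := by
            rw [← nn_add_int (q * α) (q * j)]; congr 1; push_cast; field_simp
        _ ≤ W * (K / (W * P + b - 1 : ℕ)) := (nn_mul _ _).trans (mul_le_mul_of_nonneg_left hqn hWr.le)
        _ ≤ 2 * K / P := by
            rw [hNr, ← mul_div_assoc, div_le_div_iff₀ (by linarith) (by linarith)]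
            have : K * (W * P) ≤ K * (2 * (W * P + b - 1)) := mul_le_mul_of_nonneg_left (by linarith) (by linarith)
            linarith
    set a := round (q * α) with ha
    set ρ : ℚ := (a : ℚ) / (q : ℤ) with hρ
    have hρd : ρ.den ≤ q := by
      refine Nat.le_of_dvd hq0 ?_
      have := Rat.den_dvd a q
      rw [Rat.divInt_eq_div, ← hρ] at this
      exact_mod_cast this
    have hρr : (ρ.num : ℝ) / ρ.den = a / q := by
      have := congrArg (fun z : ℚ => (z : ℝ)) (Rat.num_div_den ρ)
      push_cast at this
      rw [this, hρ]; push_cast; rfl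
    obtain ⟨d, hd⟩ : ∃ d, ρ.den = d + 1 := ⟨ρ.den - 1, (Nat.succ_pred_eq_of_pos ρ.den_pos).symm⟩
    have hdM : d ∈ range M := mem_range.2 (by
      have : (q:ℝ) ≤ M := hqK.trans hM
      have : q ≤ M := by exact_mod_cast this
      omega)
    set A : ZMod (d + 1) := (ρ.num : ZMod (d + 1)) with hA
    have hAu : IsUnit A := by
      rw [hA, ZMod.coe_int_isUnit_iff_isCoprime, ← hd, Int.isCoprime_iff_gcd_eq_one, Int.gcd_comm]
      exact ρ.reduced
    set β : ℝ := α - a / q with hβ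
    have hβP : |β| * P ≤ 2 * K := by
      have h1 : |β| ≤ 2 * K / P := by
        have e : |q * β| ≤ 2 * K / P := by
          rw [show q * β = q * α - a by rw [hβ]; field_simp]; exact hq1
        rw [abs_mul, abs_of_pos hq0r] at e
        have : 1 * |β| ≤ q * |β| := mul_le_mul_of_nonneg_right (by exact_mod_cast hq0) (abs_nonneg _)
        linarith
      rwa [le_div_iff₀ (by linarith)] at h1
    have hec : ∀ n : ℕ, ec (n * α) = ch ((n : ZMod (d + 1)) * A) * ec (n * β) := fun n => by
      rw [hA, ch_int, ← ec_add, ← hd, hρr, hβ]; congr 1; ring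
    have e1 : ∑ n ∈ range P, (nu W b n : ℂ) * ec (n * α) = ∑ n ∈ range P, ((nu W b n : ℂ) * ch ((n : ZMod (d + 1)) * A) - Dh W b (d + 1) A) * ec (n * β) +
        Dh W b (d + 1) A * ∑ n ∈ range P, ec (n * β) := by
      rw [mul_sum, ← sum_add_distrib]
      refine sum_congr rfl fun n _ => ?_
      rw [hec]; ring
    have h1 := abel_le _ β _ P (hP1 d hdM A)
    have h2 : ε / (2 * (1 + 7 * (2 * K))) * P * (1 + 7 * (|β| * P)) ≤ ε / 2 * P := by
      calc _ ≤ ε / (2 * (1 + 7 * (2 * K))) * P * (1 + 7 * (2 * K)) := mul_le_mul_of_nonneg_left (by linarith) (by positivity)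
        _ = _ := by field_simp
    have h3 : ‖Dh W b (d + 1) A * ∑ n ∈ range P, ec (n * β)‖ ≤ ε / 2 * P := by
      by_cases hd0 : d = 0
      · have : ∑ n ∈ range P, ec (n * β) = 0 := by
          have e : ∀ n : ℕ, ec (n * β) = ec (n * α) := fun n => by
            have := hρr
            rw [hd, hd0] at this
            rw [← ec_add_int (n * β) (n * ρ.num)]; congr 1
            rw [hβ, ← this]; push_cast; ring
          rw [sum_congr rfl fun n _ => e n, sum_range_zmod P (fun n => ec (n * α)), sum_congr rfl fun x _ => (ch_val x k).symm, ch_sum, if_neg hk]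
        rw [this, mul_zero, norm_zero]; positivity
      · rw [norm_mul]
        refine mul_le_mul ((Dh_le W b (d + 1) w hw hWw hW hb hc A hAu (by omega)).trans hwε) (SS_le P β) (norm_nonneg _) (by positivity)
    rw [e1]
    refine (norm_add_le _ _).trans ?_
    linarith
  · have h1 := hP1 0 (mem_range.2 hMp) 0 P le_rfl
    rw [hD1 0 0 rfl, sum_sub_distrib] at h1
    simp only [mul_zero, ch, AddChar.map_zero_eq_one, mul_one, sum_const, card_range, nsmul_eq_mul] at h1
    rw [hat_eq]
    simp only [ZMod.val_zero, Nat.cast_zero, zero_div, mul_zero, ec_zero, mul_one]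
    have h2 : ε / (2 * (1 + 7 * (2 * K))) ≤ ε := div_le_self hε.le (by linarith)
    have h3 := mul_le_mul_of_nonneg_right h2 (by linarith : (0:ℝ) ≤ P)
    have h4 := norm_le_norm_add_norm_sub (P : ℂ) (∑ n ∈ range P, (nu W b n : ℂ))
    rw [norm_sub_rev, Complex.norm_natCast] at h4
    linarith

theorem unif (ε : ℝ) (hε : 0 < ε) : ∃ w0 : ℕ, ∀ w ≥ w0, ∃ P0 : ℕ, ∀ P ≥ P0, ∀ [NeZero P], ∀ b < primorial w, b.Coprime (primorial w) →
    (∀ k : ZMod P, k ≠ 0 → ‖hat (fun x => nu (primorial w) b x.val) k‖ ≤ ε * P) ∧ ‖hat (fun x : ZMod P => nu (primorial w) b x.val) 0‖ ≤ (1 + ε) * P := by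
  obtain ⟨w0, hw0⟩ := exists_nat_ge (2 / ε)
  have hw0p : (0:ℝ) < w0 := lt_of_lt_of_le (by positivity) hw0
  refine ⟨w0, fun w hw => ?_⟩
  have hwr : (w0:ℝ) ≤ w := by exact_mod_cast hw
  have hw1 : (0:ℝ) < w := by linarith
  have hwε : 1 / (w : ℝ) ≤ ε / 2 := by
    rw [div_le_div_iff₀ hw1 (by norm_num)]
    have := hw0.trans hwr
    rw [div_le_iff₀ hε] at this; linarith
  have : ∀ᶠ P : ℕ in atTop, ∀ b ∈ range (primorial w), b.Coprime (primorial w) → ∀ [NeZero P], (∀ k : ZMod P, k ≠ 0 → ‖hat (fun x => nu (primorial w) b x.val) k‖ ≤ ε * P) ∧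
      ‖hat (fun x : ZMod P => nu (primorial w) b x.val) 0‖ ≤ (1 + ε) * P := by
    refine (eventually_all_finset _).2 fun b hb => ?_
    by_cases hc : b.Coprime (primorial w)
    · filter_upwards [unif_aux (primorial w) w b (by exact_mod_cast hw1) (fun l hl hd => by_contra fun h =>
          hd (dvd_prod_of_mem _ (mem_filter.2 ⟨mem_range.2 (by omega), hl⟩))) (primorial_pos w) (mem_range.1 hb) hc ε hε hwε] with P hP
      exact fun _ => hP
    · exact Eventually.of_forall fun P h => absurd h hc
  obtain ⟨P0, hP0⟩ := eventually_atTop.1 this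
  exact ⟨P0, fun P hP _ b hb hc => hP0 P hP b (mem_range.2 hb) hc⟩
end

section
open Finset Filter Topology

lemma theta_tend : Tendsto (fun n : ℕ => Chebyshev.theta n / n) atTop (𝓝 1) := by
  have := pnt_ap (q := 1) (a := 0) (isUnit_of_subsingleton _)
  rw [Nat.totient_one, Nat.cast_one, inv_one] at this
  refine this.congr fun n => ?_
  congr 1
  rw [thetaAP, Chebyshev.theta_eq_sum_Icc, Nat.floor_natCast]
  refine sum_congr ?_ fun _ _ => rfl
  ext p
  simp only [mem_filter, mem_range, mem_Icc]
  exact ⟨fun h => ⟨⟨Nat.zero_le _, by omega⟩, h.2.1⟩, fun h => ⟨by omega, h.2, Subsingleton.elim (α := ZMod 1) _ _⟩⟩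

lemma prime_gap (κ : ℝ) (h0 : 0 < κ) (h1 : κ ≤ 1) : ∀ᶠ y : ℕ in atTop, ∃ P : ℕ, P.Prime ∧ y < P ∧ (P : ℝ) ≤ (1 + κ) * y := by
  have e1 := theta_tend.eventually (Ioo_mem_nhds (by linarith : 1 - κ / 8 < 1) (by linarith : 1 < 1 + κ / 8))
  obtain ⟨Y, hY⟩ := eventually_atTop.1 e1
  obtain ⟨Z, hZ⟩ := exists_nat_gt (8 / (5 * κ))
  filter_upwards [eventually_ge_atTop (Y + Z + 1)] with y hy
  have hyr : (0:ℝ) < y := by exact_mod_cast (by omega : 0 < y)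
  have hyZ : (Z:ℝ) ≤ y := by exact_mod_cast (by omega : Z ≤ y)
  set m := ⌊(1 + κ) * y⌋₊ with hm
  have hm1 : (1 + κ) * y < m + 1 := Nat.lt_floor_add_one _
  have hm2 : (m : ℝ) ≤ (1 + κ) * y := Nat.floor_le (by positivity)
  have hκy : 0 < κ * y := by positivity
  have hym : y ≤ m := Nat.le_floor (by linarith)
  have hmr : (0:ℝ) < m := lt_of_lt_of_le hyr (by exact_mod_cast hym)
  by_contra hcon
  push Not at hcon
  have heq : Chebyshev.theta m = Chebyshev.theta y := by
    rw [Chebyshev.theta_eq_sum_Icc, Chebyshev.theta_eq_sum_Icc, Nat.floor_natCast, Nat.floor_natCast]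
    refine sum_congr ?_ fun _ _ => rfl
    ext p
    simp only [mem_filter, mem_Icc]
    refine ⟨fun h => ⟨⟨h.1.1, ?_⟩, h.2⟩, fun h => ⟨⟨h.1.1, h.1.2.trans hym⟩, h.2⟩⟩
    by_contra hc
    have := hcon p h.2 (by omega)
    have h3 : (p : ℝ) ≤ m := by exact_mod_cast h.1.2
    linarith
  have a1 := (hY m (by omega)).1
  have a2 := (hY y (by omega)).2
  rw [lt_div_iff₀ hmr, heq] at a1
  rw [div_lt_iff₀ hyr] at a2
  have a3 : 8 / (5 * κ) < y := hZ.trans_le hyZ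
  rw [div_lt_iff₀ (by positivity)] at a3
  have a4 : (1 - κ / 8) * ((1 + κ) * y - 1) ≤ (1 - κ / 8) * m := mul_le_mul_of_nonneg_left (by linarith) (by linarith)
  have a5 : κ * (κ * y) ≤ 1 * (κ * y) := mul_le_mul_of_nonneg_right h1 hκy.le
  have a6 : (1 - κ / 8) * ((1 + κ) * y - 1) = y + 7 / 8 * (κ * y) - κ * (κ * y) / 8 - 1 + κ / 8 := by ring
  have a7 : (1 + κ / 8) * y = y + κ * y / 8 := by ring
  linarith

lemma small_n (δ : ℝ) (hδ : 0 < δ) : ∀ᶠ P : ℕ in atTop, (√(P:ℝ) + 1) * (2 * Real.log P) ≤ δ * P := by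
  have h := ((isLittleO_log_rpow_atTop (by norm_num : (0:ℝ) < 1 / 2)).comp_tendsto tendsto_natCast_atTop_atTop).bound (by positivity : 0 < δ / 4)
  filter_upwards [h, eventually_ge_atTop 1] with P hP h1
  have h1r : (1:ℝ) ≤ P := by exact_mod_cast h1
  simp only [Function.comp, ← Real.sqrt_eq_rpow] at hP
  rw [Real.norm_of_nonneg (Real.log_nonneg h1r), Real.norm_of_nonneg (Real.sqrt_nonneg _)] at hP
  have hs : 1 ≤ √(P:ℝ) := Real.one_le_sqrt.2 h1r
  calc _ ≤ (2 * √(P:ℝ)) * (2 * (δ / 4 * √(P:ℝ))) := mul_le_mul (by linarith) (by linarith) (by linarith [Real.log_nonneg h1r]) (by linarith)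
    _ = δ * (√(P:ℝ) * √(P:ℝ)) := by ring
    _ = _ := by rw [Real.mul_self_sqrt (by linarith)]

noncomputable def LA (A : Set ℕ) (p : ℕ) : ℝ := A.indicator (fun p : ℕ => Real.log p) p

lemma LA_nonneg (A p) : 0 ≤ LA A p := Set.indicator_nonneg (fun p _ => Real.log_natCast_nonneg p) p
lemma LA_le (A p) : LA A p ≤ Real.log p := Set.indicator_le_self' (fun p _ => Real.log_natCast_nonneg p) p

lemma dens (A : Set ℕ) (hA : A ⊆ {p : ℕ | p.Prime}) (hd : lowerDensityInPrimes A > 5 / 8) :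
    ∃ η : ℝ, 0 < η ∧ η ≤ 1 / 4 ∧ ∀ᶠ X : ℕ in atTop, (5 / 8 + 4 * η) * X ≤ ∑ p ∈ range (X + 1), LA A p := by
  classical
  obtain ⟨c0, hc0, hc0d⟩ := exists_between hd
  set c := min c0 1 with hc
  have hc1 : c ≤ 1 := min_le_right _ _
  have hc58 : 5 / 8 < c := lt_min hc0 (by norm_num)
  have hev : ∀ᶠ N : ℕ in atTop, c * (({p : ℕ | p.Prime} ∩ Set.Icc 1 N).ncard : ℝ) ≤ ((A ∩ Set.Icc 1 N).ncard : ℝ) := by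
    have := eventually_lt_of_lt_liminf hc0d ⟨0, Filter.eventually_map.2 (Eventually.of_forall fun N => by positivity)⟩
    filter_upwards [this] with N hN
    rcases Nat.eq_zero_or_pos (({p : ℕ | p.Prime} ∩ Set.Icc 1 N).ncard) with h | h
    · rw [h]; simp
    · rw [lt_div_iff₀ (by exact_mod_cast h)] at hN
      exact (mul_le_mul_of_nonneg_right (min_le_left _ _) (Nat.cast_nonneg _)).trans hN.le
  obtain ⟨η, hη⟩ : ∃ η, η = (c - 5 / 8) / 6 := ⟨_, rfl⟩
  have hη0 : 0 < η := by rw [hη]; linarith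
  refine ⟨η, hη0, by rw [hη]; linarith, ?_⟩
  have e1 := theta_tend.eventually (lt_mem_nhds (by linarith : 1 - η < 1))
  have e2 := tendsto_natCast_atTop_atTop.eventually (Chebyshev.integral_theta_div_log_sq_isLittleO.bound hη0)
  filter_upwards [hev, e1, e2, eventually_ge_atTop 3] with X h1 h2 h3 hX
  have hXr : (3:ℝ) ≤ X := by exact_mod_cast hX
  have hlog : 0 < Real.log X := Real.log_pos (by linarith)
  rw [lt_div_iff₀ (by linarith)] at h2
  have hpi : (({p : ℕ | p.Prime} ∩ Set.Icc 1 X).ncard : ℝ) = Nat.primeCounting X := by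
    rw [← Nat.primesLE_card_eq_primeCounting, ← Set.ncard_coe_finset]
    congr 2; ext p
    simp only [Set.mem_inter_iff, Set.mem_setOf_eq, Set.mem_Icc, mem_coe, Nat.mem_primesLE]
    exact ⟨fun h => ⟨h.2.2, h.1⟩, fun h => ⟨h.2, h.2.one_le, h.1⟩⟩
  have hAc : ((A ∩ Set.Icc 1 X).ncard : ℝ) = #{p ∈ Nat.primesLE X | p ∈ A} := by
    rw [← Set.ncard_coe_finset]
    congr 2; ext p
    simp only [Set.mem_inter_iff, Set.mem_Icc, mem_coe, mem_filter, Nat.mem_primesLE]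
    exact ⟨fun h => ⟨⟨h.2.2, hA h.1⟩, h.1⟩, fun h => ⟨h.2, h.1.2.one_le, h.1.1⟩⟩
  have hpl : Nat.primeCounting X * Real.log X ≤ Chebyshev.theta X + η * X := by
    have a := Chebyshev.primeCounting_eq_theta_div_log_add_integral (x := X) (by linarith)
    rw [Nat.floor_natCast] at a
    rw [Real.norm_of_nonneg (by positivity : (0:ℝ) ≤ X / Real.log X)] at h3
    have h4 := (Real.le_norm_self _).trans h3
    rw [a, add_mul, div_mul_cancel₀ _ hlog.ne']
    have := mul_le_mul_of_nonneg_right h4 hlog.le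
    rw [mul_assoc, div_mul_cancel₀ _ hlog.ne'] at this
    linarith
  have hsplit : Chebyshev.theta X ≤ ∑ p ∈ range (X + 1), LA A p + (Nat.primeCounting X - (A ∩ Set.Icc 1 X).ncard) * Real.log X := by
    rw [Chebyshev.theta_eq_sum_primesLE_log, ← sum_filter_add_sum_filter_not _ (· ∈ A)]
    refine add_le_add ?_ ?_
    · calc _ = ∑ p ∈ Nat.primesLE X with p ∈ A, LA A p := sum_congr rfl fun p hp => (Set.indicator_of_mem (mem_filter.1 hp).2 _).symm
        _ ≤ _ := sum_le_sum_of_subset_of_nonneg (fun p hp => by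
            have := (Nat.mem_primesLE.1 (mem_filter.1 hp).1).1
            exact mem_range.2 (by omega)) fun p _ _ => LA_nonneg A p
    · have hcard : (Nat.primeCounting X : ℝ) - (A ∩ Set.Icc 1 X).ncard = #{p ∈ Nat.primesLE X | p ∉ A} := by
        rw [hAc, ← Nat.primesLE_card_eq_primeCounting, ← card_filter_add_card_filter_not (s := Nat.primesLE X) (· ∈ A)]
        push_cast; ring
      rw [hcard, ← nsmul_eq_mul]
      refine sum_le_card_nsmul _ _ _ fun p hp => ?_
      have hp := Nat.mem_primesLE.1 (mem_filter.1 hp).1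
      exact Real.log_le_log (by exact_mod_cast hp.2.pos) (by exact_mod_cast hp.1)
  rw [hpi] at h1
  have h5 : (Nat.primeCounting X - ((A ∩ Set.Icc 1 X).ncard : ℝ)) * Real.log X ≤ (1 - c) * (Chebyshev.theta X + η * X) := by
    calc _ ≤ ((1 - c) * Nat.primeCounting X) * Real.log X := mul_le_mul_of_nonneg_right (by linarith) hlog.le
      _ = (1 - c) * (Nat.primeCounting X * Real.log X) := by ring
      _ ≤ _ := mul_le_mul_of_nonneg_left hpl (by linarith)
  have h6 : c * ((1 - η) * X) ≤ c * Chebyshev.theta X := mul_le_mul_of_nonneg_left h2.le (by linarith)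
  have h7 : c = 5 / 8 + 6 * η := by rw [hη]; ring
  have h8 : c * (η * X) ≤ 1 * (η * X) := mul_le_mul_of_nonneg_right hc1 (by positivity)
  have h9 : (1 - c) * (η * X) ≤ 1 * (η * X) := mul_le_mul_of_nonneg_right (by linarith) (by positivity)
  have h10 : c * X = (5 / 8) * X + 6 * (η * X) := by rw [h7]; ring
  linarith
end

section
open Finset Filter Topology

noncomputable def SA (A : Set ℕ) (W : ℕ) (a : ZMod W) (X : ℕ) : ℝ := ∑ p ∈ range (X + 1) with ((p : ℕ) : ZMod W) = a, LA A p

lemma LA_ne {A p} (h : LA A p ≠ 0) : p ∈ A := Set.mem_of_indicator_ne_zero h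

lemma SA_low (A : Set ℕ) (hA : A ⊆ {p : ℕ | p.Prime}) (W X : ℕ) [NeZero W] :
    ∑ p ∈ range (X + 1), LA A p ≤ ∑ p ∈ range (W + 1), Real.log p + ∑ a : (ZMod W)ˣ, SA A W a X := by
  have h1 : ∑ a : (ZMod W)ˣ, SA A W a X = ∑ p ∈ range (X + 1), ∑ a : (ZMod W)ˣ, if ((p : ℕ) : ZMod W) = a then LA A p else 0 := by
    rw [sum_comm]
    exact sum_congr rfl fun a _ => sum_filter _ _
  have h2 : ∑ p ∈ range (X + 1), (if p ≤ W then Real.log p else 0) ≤ ∑ p ∈ range (W + 1), Real.log p := by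
    rw [← sum_filter]
    refine sum_le_sum_of_subset_of_nonneg (fun p hp => ?_) fun p _ _ => Real.log_natCast_nonneg p
    have := (mem_filter.1 hp).2
    exact mem_range.2 (by omega)
  refine le_trans ?_ (add_le_add_left h2 _)
  rw [h1, ← sum_add_distrib]
  refine sum_le_sum fun p _ => ?_
  have h3 : 0 ≤ ∑ a : (ZMod W)ˣ, if ((p : ℕ) : ZMod W) = a then LA A p else 0 :=
    sum_nonneg fun a _ => by split_ifs; exacts [LA_nonneg A p, le_rfl]
  by_cases hpA : LA A p = 0
  · have : 0 ≤ (if p ≤ W then Real.log p else 0) := by split_ifs; exacts [Real.log_natCast_nonneg p, le_rfl]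
    rw [hpA] at h3 ⊢; linarith
  have hp : p.Prime := hA (LA_ne hpA)
  split_ifs with hw
  · linarith [LA_le A p]
  have hc : p.Coprime W := (Nat.Prime.coprime_iff_not_dvd hp).2 fun h => hw (Nat.le_of_dvd (Nat.pos_of_ne_zero (NeZero.ne W)) h)
  rw [zero_add]
  have := single_le_sum (f := fun a : (ZMod W)ˣ => if ((p : ℕ) : ZMod W) = a then LA A p else 0) (fun a _ => by
    split_ifs; exacts [LA_nonneg A p, le_rfl]) (mem_univ (ZMod.unitOfCoprime p hc))
  rwa [if_pos (ZMod.coe_unitOfCoprime p hc).symm] at this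

lemma SA_up (A : Set ℕ) (hA : A ⊆ {p : ℕ | p.Prime}) (W X : ℕ) (a : ZMod W) : SA A W a X ≤ thetaAP W a X := by
  rw [SA, thetaAP, sum_filter, sum_filter]
  refine sum_le_sum fun p _ => ?_
  by_cases hpA : LA A p = 0
  · rw [hpA, ite_self]; split_ifs; exacts [Real.log_natCast_nonneg p, le_rfl]
  have hp : p.Prime := hA (LA_ne hpA)
  simp only [hp, true_and]
  split_ifs
  exacts [LA_le A p, le_rfl]

lemma SA_nonneg (A : Set ℕ) (W X : ℕ) (a : ZMod W) : 0 ≤ SA A W a X := sum_nonneg fun p _ => LA_nonneg A p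

lemma loc (A : Set ℕ) (hA : A ⊆ {p : ℕ | p.Prime}) (η : ℝ) (h0 : 0 < η)
    (hd : ∀ᶠ X : ℕ in atTop, (5 / 8 + 4 * η) * X ≤ ∑ p ∈ range (X + 1), LA A p) (w : ℕ) (hw : 5 ≤ w) [NeZero (primorial w)] :
    ∀ᶠ X : ℕ in atTop, ∀ N : ℕ, Odd N → ∃ a : Fin 3 → (ZMod (primorial w))ˣ, (a 0 : ZMod (primorial w)) + a 1 + a 2 = N ∧
      (∀ l, η * X < (primorial w).totient * SA A (primorial w) (a l) X) ∧
      (3 / 2 + 3 * η) * X < ∑ l, (primorial w).totient * SA A (primorial w) (a l) X := by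
  have key := local_main w hw
  generalize primorial w = W at *
  have hφ : (0:ℝ) < W.totient := by exact_mod_cast Nat.totient_pos.2 (Nat.pos_of_ne_zero (NeZero.ne W))
  have e2 : ∀ᶠ X : ℕ in atTop, ∀ a : (ZMod W)ˣ, thetaAP W a X / X < (W.totient : ℝ)⁻¹ * (1 + η) :=
    eventually_all.2 fun a => (pnt_ap a.isUnit).eventually_lt_const (by
      have : (0:ℝ) < (W.totient : ℝ)⁻¹ := inv_pos.2 hφ
      have := mul_pos this h0
      linarith)
  obtain ⟨C, hC⟩ : ∃ C, C = ∑ p ∈ range (W + 1), Real.log p := ⟨_, rfl⟩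
  have e3 : ∀ᶠ X : ℕ in atTop, C / η ≤ X := tendsto_natCast_atTop_atTop.eventually_ge_atTop _
  filter_upwards [hd, e2, e3, eventually_gt_atTop 0] with X hd e2 e3 hX N hN
  have hXr : (0:ℝ) < X := by exact_mod_cast hX
  have hlow := SA_low A hA W X
  rw [← hC] at hlow
  rw [div_le_iff₀ h0] at e3
  have hcard : (Fintype.card (ZMod W)ˣ : ℝ) = W.totient := by rw [ZMod.card_units_eq_totient]
  obtain ⟨a, ha, hpos, hs⟩ := key (fun a => max (W.totient * SA A W a X / X - η) 0) (fun a => ⟨le_max_right _ _, max_le (by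
      have h1 := e2 a
      have h2 := SA_up A hA W X a
      rw [div_lt_iff₀ hXr] at h1
      rw [sub_le_iff_le_add, div_le_iff₀ hXr]
      calc (W.totient : ℝ) * SA A W a X ≤ W.totient * ((W.totient : ℝ)⁻¹ * (1 + η) * X) := mul_le_mul_of_nonneg_left (by linarith) hφ.le
        _ = (1 + η) * X := by field_simp) zero_le_one⟩) (by
      rw [mu, hcard, lt_div_iff₀ hφ]
      have h1 : ∑ a : (ZMod W)ˣ, (W.totient * SA A W a X / X - η) ≤ ∑ a : (ZMod W)ˣ, max (W.totient * SA A W a X / X - η) 0 :=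
        sum_le_sum fun a _ => le_max_left _ _
      rw [sum_sub_distrib, sum_const, card_univ, nsmul_eq_mul, hcard, ← sum_div, ← mul_sum] at h1
      refine lt_of_lt_of_le ?_ h1
      have h2 : (5 / 8 + 3 * η) * X ≤ ∑ a : (ZMod W)ˣ, SA A W a X := by linarith
      have h3 : (W.totient : ℝ) * ((5 / 8 + 3 * η) * X) / X ≤ W.totient * (∑ a : (ZMod W)ˣ, SA A W a X) / X :=
        div_le_div_of_nonneg_right (mul_le_mul_of_nonneg_left h2 hφ.le) hXr.le
      rw [← mul_assoc, mul_div_cancel_right₀ _ hXr.ne'] at h3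
      have := mul_pos hφ h0
      linarith) N hN
  have hp : ∀ l, η < W.totient * SA A W (a l) X / X := fun l => by
    rcases lt_max_iff.1 (hpos l) with h | h
    · linarith
    · exact absurd h (lt_irrefl _)
  refine ⟨a, ha, fun l => (lt_div_iff₀ hXr).1 (hp l), ?_⟩
  rw [← lt_div_iff₀ hXr, sum_div]
  have : ∑ l, max (W.totient * SA A W (a l) X / X - η) 0 = ∑ l, W.totient * SA A W (a l) X / X - 3 * η := by
    rw [sum_congr rfl fun l _ => max_eq_left (sub_nonneg.2 (hp l).le), sum_sub_distrib, sum_const, card_univ, Fintype.card_fin, nsmul_eq_mul]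
    norm_num
  linarith

noncomputable def ff (A : Set ℕ) (W b X P n : ℕ) : ℝ := if W * n + b ≤ X ∧ P ≤ n ^ 2 then W.totient / W * LA A (W * n + b) else 0

lemma LA_bd (A : Set ℕ) (W b P n : ℕ) (hb : b < W) (hWP : W ≤ P) (hn : n < P) :
    W.totient / W * LA A (W * n + b) ≤ W.totient / W * (2 * Real.log P) := by
  refine mul_le_mul_of_nonneg_left ((LA_le _ _).trans ?_) (by positivity)
  rw [show 2 * Real.log (P:ℝ) = Real.log ((P ^ 2 : ℕ) : ℝ) by push_cast; rw [Real.log_pow]; norm_num]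
  have h1 : W * n + b ≤ P ^ 2 := by
    calc W * n + b ≤ W * (n + 1) := by rw [mul_add]; omega
      _ ≤ P * P := Nat.mul_le_mul hWP hn
      _ = P ^ 2 := (sq P).symm
  rcases Nat.eq_zero_or_pos (W * n + b) with h | h
  · rw [h, Nat.cast_zero, Real.log_zero]; exact Real.log_natCast_nonneg _
  · exact Real.log_le_log (by exact_mod_cast h) (by exact_mod_cast h1)

lemma ff_mass (A : Set ℕ) (W b X P : ℕ) [NeZero P] (hb : b < W) (hWP : W ≤ P) (hX : X < W * P) :
    W.totient / W * SA A W (b : ZMod W) X ≤ ∑ x : ZMod P, ff A W b X P x.val + (√(P:ℝ) + 1) * (2 * Real.log P) := by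
  have hW : 0 < W := by omega
  have hWr : (0:ℝ) < W := by exact_mod_cast hW
  have hφ1 : (W.totient : ℝ) / W ≤ 1 := div_le_one_of_le₀ (by exact_mod_cast Nat.totient_le W) hWr.le
  have hL : 0 ≤ 2 * Real.log P := mul_nonneg zero_le_two (Real.log_natCast_nonneg P)
  have h1 : SA A W (b : ZMod W) X = ∑ n ∈ range P with W * n + b ≤ X, LA A (W * n + b) := by
    have hm : ∀ p ∈ (range (X + 1)).filter (fun p : ℕ => (p : ZMod W) = b), W * (p / W) + b = p := fun p hp => by
      have := (ZMod.natCast_eq_natCast_iff _ _ _).1 (mem_filter.1 hp).2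
      rw [Nat.ModEq, Nat.mod_eq_of_lt hb] at this
      have h2 := Nat.div_add_mod p W
      omega
    refine sum_nbij' (fun p => p / W) (fun n => W * n + b) (fun p hp => ?_) (fun n hn => ?_) (fun p hp => hm p hp) (fun n hn => ?_)
      fun p hp => by rw [hm p hp]
    · have := mem_range.1 (mem_filter.1 hp).1
      refine mem_filter.2 ⟨mem_range.2 ?_, by rw [hm p hp]; omega⟩
      rw [Nat.div_lt_iff_lt_mul hW, mul_comm]; omega
    · have := (mem_filter.1 hn).2
      refine mem_filter.2 ⟨mem_range.2 (by omega), ?_⟩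
      push_cast
      rw [ZMod.natCast_self, zero_mul, zero_add]
    · rw [Nat.mul_add_div hW, Nat.div_eq_of_lt hb, add_zero]
  rw [h1, ← sum_range_zmod P (ff A W b X P), mul_sum, sum_filter]
  have h2 : ∑ n ∈ range P, (if n ^ 2 < P then 2 * Real.log P else 0) ≤ (√(P:ℝ) + 1) * (2 * Real.log P) := by
    rw [← sum_filter, sum_const, nsmul_eq_mul]
    refine mul_le_mul_of_nonneg_right ?_ hL
    have h3 : #((range P).filter fun n => n ^ 2 < P) ≤ #(range (Nat.sqrt P + 1)) := card_le_card fun n hn => by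
      have := (mem_filter.1 hn).2
      exact mem_range.2 (Nat.lt_succ_of_le (Nat.le_sqrt'.2 this.le))
    rw [card_range] at h3
    have h4 : ((#((range P).filter fun n => n ^ 2 < P) : ℕ) : ℝ) ≤ (Nat.sqrt P : ℝ) + 1 := by exact_mod_cast h3
    linarith [Real.nat_sqrt_le_real_sqrt (a := P)]
  refine le_trans ?_ (add_le_add_right h2 _)
  rw [← sum_add_distrib]
  refine sum_le_sum fun n hn => ?_
  have hb1 := LA_bd A W b P n hb hWP (mem_range.1 hn)
  have hb2 : (W.totient : ℝ) / W * (2 * Real.log P) ≤ 2 * Real.log P := mul_le_of_le_one_left hL hφ1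
  unfold ff
  by_cases c1 : W * n + b ≤ X <;> by_cases c2 : P ≤ n ^ 2
  · simp [c1, c2, not_lt.2 c2]
  · simp only [c1, c2, if_true, and_false, if_false, not_le.1 c2]; linarith
  · simp [c1, not_lt.2 c2]
  · simp only [c1, c2, if_false, and_false, not_le.1 c2, if_true]; linarith

/-- A density version of the Vinogradov three primes theorem: if `A` is a set of primes
with lower density greater than `5/8` in the primes, then every sufficiently large odd
positive integer is a sum of three elements of `A`. -/
theorem stmt0 (A : Set ℕ) (hA : A ⊆ {p : ℕ | p.Prime})
    (hd : lowerDensityInPrimes A > 5 / 8) :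
    ∃ N₀ : ℕ, ∀ N : ℕ, N₀ ≤ N → Odd N →
      ∃ a₁ ∈ A, ∃ a₂ ∈ A, ∃ a₃ ∈ A, N = a₁ + a₂ + a₃ := by
  obtain ⟨η, h0, h1, hdens⟩ := dens A hA hd
  obtain ⟨ε, hε, G0, htr⟩ := transfer (η / 16) (by linarith) (by linarith)
  obtain ⟨w0, hun⟩ := unif ε hε
  obtain ⟨P0, hun⟩ := hun (max w0 5) (le_max_left _ _)
  have : NeZero (primorial (max w0 5)) := ⟨(primorial_pos _).ne'⟩
  have hloc := loc A hA η h0 hdens (max w0 5) (le_max_right _ _)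
  generalize primorial (max w0 5) = W at *
  obtain ⟨X0, hloc⟩ := eventually_atTop.1 hloc
  obtain ⟨Y1, hgap⟩ := eventually_atTop.1 (prime_gap (η / 16) (by linarith) (by linarith))
  obtain ⟨Q, hQ⟩ := eventually_atTop.1 (small_n (η / 100) (by linarith))
  obtain ⟨K, hK⟩ := exists_nat_gt (16 / η)
  have hW : 0 < W := Nat.pos_of_ne_zero (NeZero.ne W)
  have hWr : (0:ℝ) < W := by exact_mod_cast hW
  refine ⟨2 * X0 + W * (Y1 + Q + W + G0 + P0) + 3 * W + K, fun N hN hodd => ?_⟩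
  obtain ⟨X, hX⟩ : ∃ X, X = 2 * N / 3 := ⟨_, rfl⟩
  obtain ⟨a, hsum, hpos, htot⟩ := hloc X (by omega) N hodd
  have hy : Y1 + Q + W + G0 + P0 ≤ N / W := (Nat.le_div_iff_mul_le hW).2 (by rw [mul_comm]; omega)
  obtain ⟨P, hP, hyP, hPy⟩ := hgap (N / W) (by omega)
  have hNP : N < W * P := by
    have := (Nat.div_lt_iff_lt_mul hW).1 hyP
    rwa [mul_comm]
  have hWPN : (W : ℝ) * P ≤ (1 + η / 16) * N := by
    have h2 : (W : ℝ) * ((N / W : ℕ) : ℝ) ≤ N := by exact_mod_cast Nat.mul_div_le N W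
    calc (W : ℝ) * P ≤ W * ((1 + η / 16) * ((N / W : ℕ) : ℝ)) := mul_le_mul_of_nonneg_left hPy hWr.le
      _ = (1 + η / 16) * (W * ((N / W : ℕ) : ℝ)) := by ring
      _ ≤ _ := mul_le_mul_of_nonneg_left h2 (by linarith)
  have : Fact P.Prime := ⟨hP⟩
  have hPr : (0:ℝ) < P := by exact_mod_cast hP.pos
  have hXlow : 2 / 3 * (1 - η / 8) * P ≤ X / W := by
    rw [le_div_iff₀ hWr]
    have h2 : (2 * N : ℝ) ≤ 3 * X + 2 := by exact_mod_cast (by omega : 2 * N ≤ 3 * X + 2)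
    have h3 : (K:ℝ) ≤ N := by exact_mod_cast (by omega : K ≤ N)
    rw [div_lt_iff₀ h0] at hK
    have h4 : (K:ℝ) * η ≤ N * η := mul_le_mul_of_nonneg_right h3 h0.le
    have h5 := mul_le_mul_of_nonneg_left hWPN (by linarith : (0:ℝ) ≤ 2 / 3 * (1 - η / 8))
    have h6 : 0 ≤ η * η * N := by positivity
    linarith
  have hsm := hQ P (by omega)
  obtain ⟨b, hb⟩ : ∃ b : Fin 3 → ℕ, b = fun i => (a i : ZMod W).val := ⟨_, rfl⟩
  have hbW : ∀ i, b i < W := fun i => by rw [hb]; exact ZMod.val_lt _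
  have hbc : ∀ i, (b i).Coprime W := fun i => by rw [hb]; exact ZMod.val_coe_unit_coprime _
  have hba : ∀ i, ((b i : ℕ) : ZMod W) = a i := fun i => by rw [hb]; exact ZMod.natCast_zmod_val _
  have hXN : 3 * X ≤ 2 * N := by omega
  have hmass : ∀ i, W.totient * SA A W (a i) X / W - η / 100 * P ≤ ∑ x : ZMod P, ff A W (b i) X P x.val := fun i => by
    have := ff_mass A W (b i) X P (hbW i) (by omega) (by omega)
    rw [hba, div_mul_eq_mul_div] at this
    linarith
  have hmod : (b 0 + b 1 + b 2) ≡ N [MOD W] := by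
    rw [← ZMod.natCast_eq_natCast_iff]
    push_cast
    rw [hba, hba, hba, hsum]
  have := hbW 0
  have := hbW 1
  have := hbW 2
  obtain ⟨T, hT⟩ := (Nat.modEq_iff_dvd' (by omega)).1 hmod
  have hffne : ∀ i n, ff A W (b i) X P n ≠ 0 → W * n + b i ∈ A ∧ W * n + b i ≤ X ∧ P ≤ n ^ 2 := fun i n h => by
    unfold ff at h
    split_ifs at h with hc
    · exact ⟨LA_ne (right_ne_zero_of_mul h), hc⟩
    · exact absurd rfl h
  have hη2 : η * η * P ≤ 1 / 4 * η * P := by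
    have := mul_le_mul_of_nonneg_right h1 (mul_nonneg h0.le hPr.le)
    linarith
  have hηP : 0 < η * P := by positivity
  have hfin := htr P (by omega) W b (fun i x => nu W (b i) x.val) (fun i x => ff A W (b i) X P x.val) hW
    (fun i x => by
      unfold ff; split_ifs
      exacts [mul_nonneg (by positivity) (LA_nonneg _ _), le_rfl])
    (fun i x => by
      by_cases h : ff A W (b i) X P x.val = 0
      · rw [h]; unfold nu; split_ifs
        exacts [mul_nonneg (by positivity) (Real.log_natCast_nonneg _), le_rfl]
      · obtain ⟨c1, c2⟩ := hffne i _ h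
        have hp : (W * x.val + b i).Prime := hA c1
        unfold ff nu
        rw [if_pos c2, if_pos hp]
        exact mul_le_mul_of_nonneg_left (LA_le _ _) (by positivity))
    (fun i x => by
      have h2 := LA_bd A W (b i) P x.val (hbW i) (by omega) (ZMod.val_lt x)
      unfold ff; split_ifs
      · exact h2
      · exact mul_nonneg (by positivity) (mul_nonneg zero_le_two (Real.log_natCast_nonneg _)))
    (fun i x h => ⟨hA (hffne i _ h).1, (hffne i _ h).2.2⟩)
    (fun i => (hun P (by omega) (b i) (hbW i) (hbc i)).1)
    (fun i => (hun P (by omega) (b i) (hbW i) (hbc i)).2)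
    (fun i => by
      refine le_trans ?_ (hmass i)
      have h2 := div_le_div_of_nonneg_right (hpos i).le hWr.le
      have h3 := mul_le_mul_of_nonneg_left hXlow h0.le
      rw [← mul_div_assoc] at h3
      linarith)
    (by
      refine le_trans ?_ (sum_le_sum fun i _ => hmass i)
      have h2 := div_le_div_of_nonneg_right htot.le hWr.le
      rw [sum_sub_distrib, ← sum_div, sum_const, card_univ, Fintype.card_fin, nsmul_eq_mul]
      have h3 := mul_le_mul_of_nonneg_left hXlow (by linarith : (0:ℝ) ≤ 3 / 2 + 3 * η)
      rw [← mul_div_assoc] at h3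
      push_cast
      linarith)
    (T : ZMod P)
  obtain ⟨x, -, hx⟩ := exists_ne_zero_of_sum_ne_zero hfin.ne'
  obtain ⟨y, -, hxy⟩ := exists_ne_zero_of_sum_ne_zero hx
  obtain ⟨z, hz⟩ : ∃ z : ZMod P, z = T - x - y := ⟨_, rfl⟩
  rw [← hz] at hxy
  obtain ⟨m0, l0, -⟩ := hffne 0 _ (left_ne_zero_of_mul (left_ne_zero_of_mul hxy))
  obtain ⟨m1, l1, -⟩ := hffne 1 _ (right_ne_zero_of_mul (left_ne_zero_of_mul hxy))
  obtain ⟨m2, l2, -⟩ := hffne 2 _ (right_ne_zero_of_mul hxy)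
  refine ⟨_, m0, _, m1, _, m2, ?_⟩
  have hcong : x.val + y.val + z.val ≡ T [MOD P] := by
    rw [← ZMod.natCast_eq_natCast_iff]
    push_cast
    rw [ZMod.natCast_zmod_val, ZMod.natCast_zmod_val, ZMod.natCast_zmod_val, hz]
    ring
  obtain ⟨s, hs⟩ : ∃ s, s = x.val + y.val + z.val := ⟨_, rfl⟩
  have hWs : W * s = W * x.val + W * y.val + W * z.val := by rw [hs]; ring
  rw [← hs] at hcong
  have hsT : s = T := by
    have hd1 := (Nat.modEq_iff_dvd).1 hcong
    obtain ⟨c, hc⟩ := hd1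
    rcases lt_trichotomy c 0 with h | h | h
    · exfalso
      have h2 : (T:ℤ) + P ≤ s := by
        have := mul_le_mul_of_nonneg_left (by omega : c ≤ -1) (by positivity : (0:ℤ) ≤ P)
        linarith
      have h3 : T + P ≤ s := by exact_mod_cast h2
      have h4 := Nat.mul_le_mul_left W h3
      rw [mul_add] at h4
      omega
    · rw [h, mul_zero] at hc; omega
    · exfalso
      have h2 : (s:ℤ) + P ≤ T := by
        have := mul_le_mul_of_nonneg_left (by omega : 1 ≤ c) (by positivity : (0:ℤ) ≤ P)
        linarith
      have h3 : s + P ≤ T := by exact_mod_cast h2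
      have h4 := Nat.mul_le_mul_left W h3
      rw [mul_add] at h4
      omega
  rw [hsT] at hWs
  omega
end
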